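/- Let (R, I) be a standard graded pair over an algebraically closed field k of characteristic 0, with R a two-dimensional domain, with a suitable spread (A, R_A, I_A) and reductions (R_s, I_s) mod p_s, and let f^∞_{R,I}(x) := lim_{p_s→∞} f_{R_s,I_s}(x) (which exists for every x ≥ 0). Then the limit lim_{p_s→∞} α(R_s, I_s) exists, is a rational number, and equals α^∞(R, I) := sup{x ≥ 0 : f^∞_{R,I}(x) ≠ 0}. -/

import Mathlib

/-! STATEMENT 9: `lim_{p_s→∞} α(R_s, I_s)` exists, is rational, and equals
`α^∞(R, I) = sup{x ≥ 0 : f^∞_{R,I}(x) ≠ 0}`. -/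

open Filter Topology TensorProduct

/-- The Frobenius power `I^{[q]}` of an ideal `I`. -/
def Ideal.frobPow {R : Type*} [CommRing R] (I : Ideal R) (q : ℕ) : Ideal R :=
  Ideal.span ((fun f => f ^ q) '' (I : Set R))

/-- `ν_I(J, q) = min { r ∈ ℕ | J^{r+1} ⊆ I^{[q]} }`. -/
noncomputable def nuF {R : Type*} [CommRing R] (J I : Ideal R) (q : ℕ) : ℕ :=
  sInf {r : ℕ | J ^ (r + 1) ≤ I.frobPow q}

/-- The graded maximal (irrelevant) ideal `𝔪 = ⊕_{m>0} R_m` of an `ℕ`-graded algebra. -/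
def irrelevantIdeal {k R : Type*} [CommSemiring k] [CommRing R] [Algebra k R]
    (𝒜 : ℕ → Submodule k R) : Ideal R :=
  Ideal.span (⋃ n ∈ Set.Ioi (0 : ℕ), (𝒜 n : Set R))

/-- The extension `I_A·(Ω ⊗_A R_A)` of an ideal `I_A ⊆ R_A` under base change. -/
noncomputable def redIdeal (A RA Ω : Type*) [CommRing A] [CommRing RA] [Algebra A RA]
    [CommRing Ω] [Algebra A Ω] (IA : Ideal RA) : Ideal (Ω ⊗[A] RA) :=
  Ideal.map (Algebra.TensorProduct.includeRight : RA →ₐ[A] Ω ⊗[A] RA).toRingHom IA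

/-- The grading on `Ω ⊗_A R_A` obtained by base change from a grading on `R_A`. -/
noncomputable def redGrading (A RA Ω : Type*) [CommRing A] [CommRing RA] [Algebra A RA]
    [CommRing Ω] [Algebra A Ω] (𝒜A : ℕ → Submodule A RA) (n : ℕ) :
    Submodule Ω (Ω ⊗[A] RA) :=
  Submodule.span Ω
    (⇑(Algebra.TensorProduct.includeRight : RA →ₐ[A] Ω ⊗[A] RA) '' (𝒜A n : Set RA))


/-- `dim_k (R/J)_m`: the `k`-dimension of the degree-`m` graded piece of `R/J`. -/
noncomputable def gradedPieceDim {k R : Type*} [Field k] [CommRing R] [Algebra k R]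
    (𝒜 : ℕ → Submodule k R) (J : Ideal R) (m : ℕ) : ℕ :=
  Module.finrank k ((𝒜 m) ⧸ (Submodule.comap (𝒜 m).subtype (J.restrictScalars k)))

section FilePA
open Polynomial
set_option linter.all false

section RB
variable {K V : Type*} [Field K] [AddCommGroup V] [Module K V] [Module K[X] V]
  [Module (RatFunc K) V] [IsScalarTower K K[X] V] [IsScalarTower K[X] (RatFunc K) V]
  [IsScalarTower K (RatFunc K) V]

/-- A good filtration on a `K(X)`-vector space. -/
structure GoodFilt (E : ℤ → Submodule K V) : Prop where
  mono : Monotone E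
  X_smul : ∀ l v, v ∈ E l → (X : K[X]) • v ∈ E (l + 1)
  cancel : ∀ l l' v, v ∈ E l' → (X : K[X]) • v ∈ E (l + 1) → v ∈ E l
  poly : ∀ v : V, ∃ P : K[X], P ≠ 0 ∧ ∃ l, P • v ∈ E l
  bdd : ∃ l₀, ∀ v ∈ E l₀, v = 0

namespace GoodFilt
variable {E : ℤ → Submodule K V}

lemma X_pow_smul (h : GoodFilt E) (n : ℕ) (l : ℤ) (v : V) (hv : v ∈ E l) :
    (X ^ n : K[X]) • v ∈ E (l + n) := by
  induction n with
  | zero => simpa using hv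
  | succ n ih =>
    rw [pow_succ', mul_smul]
    have := h.X_smul _ _ ih
    push_cast
    rwa [← add_assoc]

lemma smul_mem (h : GoodFilt E) (P : K[X]) (l m : ℤ) (v : V) (hv : v ∈ E l)
    (hm : P ≠ 0 → l + P.natDegree ≤ m) : P • v ∈ E m := by
  by_cases hP : P = 0
  · simp [hP]
  have hm := hm hP
  rw [P.as_sum_range_C_mul_X_pow, Finset.sum_smul]
  refine Submodule.sum_mem _ fun i hi => ?_
  rw [mul_smul, ← Polynomial.algebraMap_eq, algebraMap_smul]
  refine Submodule.smul_mem _ _ (h.mono ?_ (h.X_pow_smul i l v hv))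
  have : i ≤ P.natDegree := by simpa [Nat.lt_succ_iff] using hi
  omega

lemma cancel_pow (h : GoodFilt E) (n : ℕ) (l l' : ℤ) (v : V) (hv : v ∈ E l')
    (hX : (X ^ n : K[X]) • v ∈ E (l + n)) : v ∈ E l := by
  induction n generalizing l with
  | zero => simpa using hX
  | succ n ih =>
    refine ih l ?_
    refine h.cancel (l + n) (l' + n) _ (h.X_pow_smul n l' v hv) ?_
    rw [smul_smul, ← pow_succ']
    push_cast at hX
    rwa [add_assoc]

lemma cancel_poly (h : GoodFilt E) (P : K[X]) (hP : P ≠ 0) (l l' : ℤ) (v : V) (hv : v ∈ E l')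
    (hX : P • v ∈ E (l + P.natDegree)) : v ∈ E l := by
  have key : ∀ n : ℕ, v ∈ E (l + n) → v ∈ E l := by
    intro n
    induction n with
    | zero => intro h; simpa using h
    | succ n ih =>
      intro hn
      apply ih
      have h1 : P.eraseLead • v ∈ E (l + n + P.natDegree) := by
        by_cases h0 : P.eraseLead = 0
        · simp [h0]
        refine h.smul_mem _ _ _ v hn fun _ => ?_
        have := Polynomial.eraseLead_natDegree_lt_or_eraseLead_eq_zero P
        push_cast
        have : P.eraseLead.natDegree < P.natDegree := by tauto
        omega
      have h2 : P • v ∈ E (l + n + P.natDegree) := h.mono (by omega) hX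
      have h3 := Submodule.sub_mem _ h2 h1
      have h4 : P - P.eraseLead = C P.leadingCoeff * X ^ P.natDegree := by
        nth_rewrite 1 [← Polynomial.eraseLead_add_C_mul_X_pow P]
        ring
      rw [← sub_smul, h4, mul_smul,
        ← Polynomial.algebraMap_eq, algebraMap_smul] at h3
      rw [Submodule.smul_mem_iff _ (by simpa using hP)] at h3
      exact h.cancel_pow _ _ _ v hv h3
  obtain ⟨n, hn⟩ : ∃ n : ℕ, l' ≤ l + n := ⟨(l' - l).toNat, by omega⟩
  exact key n (h.mono hn hv)


/-- A reduced basis of a subspace `W` with respect to the filtration `E`. -/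
structure IsRed (E : ℤ → Submodule K V) (W : Submodule (RatFunc K) V) {ν : ℕ} (e : Fin ν → V)
    (b : Fin ν → ℤ) : Prop where
  li : LinearIndependent (RatFunc K) e
  span : Submodule.span (RatFunc K) (Set.range e) = W
  mem : ∀ j, e j ∈ E (b j)
  key : ∀ (a : Fin ν → RatFunc K) (l : ℤ), ∑ j, a j • e j ∈ E l →
    ∃ P : Fin ν → K[X], (∀ j, a j = algebraMap K[X] (RatFunc K) (P j)) ∧
      ∀ j, P j ≠ 0 → (P j).natDegree + b j ≤ l
  mono : Monotone b

lemma exists_isRed_aux (h : GoodFilt E) (W : Submodule (RatFunc K) V)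
    [FiniteDimensional (RatFunc K) W] :
    ∃ (e : Fin (Module.finrank (RatFunc K) W) → V)
      (b : Fin (Module.finrank (RatFunc K) W) → ℤ), LinearIndependent (RatFunc K) e ∧
      (∀ j, e j ∈ W) ∧ (∀ j, e j ∈ E (b j)) ∧
      ∀ (e' : Fin (Module.finrank (RatFunc K) W) → V)
        (b' : Fin (Module.finrank (RatFunc K) W) → ℤ), LinearIndependent (RatFunc K) e' →
        (∀ j, e' j ∈ W) → (∀ j, e' j ∈ E (b' j)) → ∑ j, b j ≤ ∑ j, b' j := by
  obtain ⟨l₀, hl₀⟩ := h.bdd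
  have := Int.exists_least_of_bdd (P := fun s => ∃ (e : Fin (Module.finrank (RatFunc K) W) → V)
      (b : Fin (Module.finrank (RatFunc K) W) → ℤ), LinearIndependent (RatFunc K) e ∧
      (∀ j, e j ∈ W) ∧ (∀ j, e j ∈ E (b j)) ∧ s = ∑ j, b j) ?_ ?_
  · obtain ⟨s, ⟨e, b, h1, h2, h3, h4⟩, hs⟩ := this
    refine ⟨e, b, h1, h2, h3, fun e' b' h1' h2' h3' => ?_⟩
    rw [← h4]
    exact hs _ ⟨e', b', h1', h2', h3', rfl⟩
  · refine ⟨∑ j : Fin (Module.finrank (RatFunc K) W), l₀, ?_⟩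
    rintro z ⟨e, b, h1, h2, h3, rfl⟩
    refine Finset.sum_le_sum fun j _ => ?_
    by_contra hlt
    exact h1.ne_zero j (hl₀ _ (h.mono (by omega) (h3 j)))
  · let B := Module.finBasis (RatFunc K) W
    choose P hP l hl using fun j => h.poly (B j : V)
    refine ⟨∑ j, l j, fun j => P j • (B j : V), l, ?_, ?_, hl, rfl⟩
    · have h1 : LinearIndependent (RatFunc K) (fun j => (B j : V)) :=
        B.linearIndependent.map' W.subtype (by simp)
      have h2 := h1.units_smul (fun j => Units.mk0 (algebraMap K[X] (RatFunc K) (P j))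
        (by simpa using hP j))
      convert h2 using 1
      ext j
      simp [Units.smul_def]
    · intro j
      show P j • (B j : V) ∈ W
      rw [← algebraMap_smul (RatFunc K) (P j) (B j : V)]
      exact W.smul_mem _ (B j).2

lemma exists_isRed_unsorted (h : GoodFilt E) (W : Submodule (RatFunc K) V)
    [FiniteDimensional (RatFunc K) W] :
    ∃ (e : Fin (Module.finrank (RatFunc K) W) → V)
      (b : Fin (Module.finrank (RatFunc K) W) → ℤ), LinearIndependent (RatFunc K) e ∧
      (∀ j, e j ∈ W) ∧ (∀ j, e j ∈ E (b j)) ∧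
      ∀ (a : Fin _ → RatFunc K) (l : ℤ), ∑ j, a j • e j ∈ E l →
      ∃ P : Fin _ → K[X], (∀ j, a j = algebraMap K[X] (RatFunc K) (P j)) ∧
        ∀ j, P j ≠ 0 → (P j).natDegree + b j ≤ l := by
  classical
  obtain ⟨e, b, h1, h2, h3, hmin⟩ := exists_isRed_aux h W
  refine ⟨e, b, h1, h2, h3, fun a l hal => ?_⟩
  -- replacement principle
  have repl : ∀ (j₀ : Fin (Module.finrank (RatFunc K) W)) (u : V) (Q : K[X])
      (A : Fin (Module.finrank (RatFunc K) W) → K[X]), Q ≠ 0 → A j₀ ≠ 0 →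
      Q • u = ∑ j, A j • e j → u ∈ E (b j₀ - 1) → False := by
    intro j₀ u Q A hQ hA hu hmem
    have huW : u ∈ W := by
      have : algebraMap K[X] (RatFunc K) Q • u ∈ W := by
        rw [algebraMap_smul, hu]
        refine W.sum_mem fun j _ => ?_
        rw [← algebraMap_smul (RatFunc K) (A j) (e j)]
        exact W.smul_mem _ (h2 j)
      rwa [W.smul_mem_iff (by simpa using hQ)] at this
    have := hmin (Function.update e j₀ u) (Function.update b j₀ (b j₀ - 1)) ?_ ?_ ?_
    · rw [Finset.sum_update_of_mem (Finset.mem_univ _),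
        ← Finset.add_sum_erase _ b (Finset.mem_univ j₀), Finset.sdiff_singleton_eq_erase] at this
      omega
    · refine h1.update j₀ u ⟨algebraMap K[X] (RatFunc K) Q, by simpa using hQ,
        Finsupp.equivFunOnFinite.symm (fun j => algebraMap K[X] (RatFunc K) (A j)), ?_, ?_⟩
      · simpa using hA
      · rw [algebraMap_smul, hu, Finsupp.linearCombination_apply, Finsupp.sum_fintype _ _ (by simp)]
        simp
    · intro j
      by_cases hj : j = j₀
      · subst hj; simpa using huW
      · simpa [hj] using h2 j
    · intro j
      by_cases hj : j = j₀
      · subst hj; simpa using hmem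
      · simpa [hj] using h3 j
  set v := ∑ j, a j • e j with hv
  -- polynomial parts
  have hpoly : ∃ P : Fin _ → K[X], ∀ j, a j = algebraMap K[X] (RatFunc K) (P j) := by
    obtain ⟨Q, hQ⟩ := IsLocalization.exist_integer_multiples_of_finite (nonZeroDivisors K[X]) a
    choose A hA using hQ
    have hQ0 : (Q : K[X]) ≠ 0 := nonZeroDivisors.coe_ne_zero Q
    have hA' : ∀ j, algebraMap K[X] (RatFunc K) (A j) = algebraMap K[X] (RatFunc K) Q * a j := by
      intro j; rw [hA, Algebra.smul_def]
    by_cases hmod : ∀ j, A j % (Q : K[X]) = 0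
    · refine ⟨fun j => A j / Q, fun j => ?_⟩
      have : (Q : K[X]) * (A j / Q) = A j := by
        have := EuclideanDomain.div_add_mod (A j) (Q : K[X])
        rw [hmod j, add_zero] at this
        exact this
      have h5 : algebraMap K[X] (RatFunc K) Q * algebraMap K[X] (RatFunc K) (A j / Q) =
          algebraMap K[X] (RatFunc K) Q * a j := by
        rw [← map_mul, this, hA']
      exact (mul_left_cancel₀ (by simpa using hQ0) h5).symm
    · exfalso
      push Not at hmod
      obtain ⟨j₁, hj₁⟩ := hmod
      obtain ⟨j₀, hj₀, hmax⟩ := Finset.exists_max_image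
        (Finset.univ.filter fun j => A j % (Q : K[X]) ≠ 0) b ⟨j₁, by simpa using hj₁⟩
      simp only [Finset.mem_filter, Finset.mem_univ, true_and] at hj₀ hmax
      have hu : (Q : K[X]) • (v - ∑ j, (A j / (Q : K[X])) • e j) = ∑ j, (A j % (Q : K[X])) • e j := by
        rw [smul_sub, hv, Finset.smul_sum, Finset.smul_sum, ← Finset.sum_sub_distrib]
        refine Finset.sum_congr rfl fun j _ => ?_
        rw [← algebraMap_smul (RatFunc K) (Q : K[X]) (a j • e j), smul_smul, ← hA', algebraMap_smul,
          smul_smul, ← sub_smul]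
        congr 1
        rw [sub_eq_iff_eq_add, add_comm]
        exact (EuclideanDomain.div_add_mod _ _).symm
      obtain ⟨l', hl'⟩ : ∃ l', v - ∑ j, (A j / (Q : K[X])) • e j ∈ E l' := by
        obtain ⟨M, hM⟩ := (Set.finite_range fun j => b j + ((A j / (Q : K[X])).natDegree : ℤ)).bddAbove
        refine ⟨max l M, Submodule.sub_mem _ (h.mono (le_max_left _ _) hal) ?_⟩
        refine Submodule.sum_mem _ fun j _ => h.smul_mem _ _ _ _ (h3 j) fun _ => ?_
        exact (hM ⟨j, rfl⟩).trans (le_max_right _ _)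
      refine repl j₀ _ Q _ hQ0 hj₀ hu (h.cancel_poly Q hQ0 _ l' _ hl' ?_)
      rw [hu]
      refine Submodule.sum_mem _ fun j _ => h.smul_mem _ _ _ _ (h3 j) fun hj => ?_
      have h6 := hmax j hj
      have h7 : (A j % (Q : K[X])).natDegree < (Q : K[X]).natDegree := by
        refine Polynomial.natDegree_lt_natDegree hj ?_
        exact Polynomial.degree_mod_lt _ hQ0
      omega
  obtain ⟨P, hP⟩ := hpoly
  refine ⟨P, hP, ?_⟩
  have hv' : v = ∑ j, P j • e j := by
    rw [hv]
    refine Finset.sum_congr rfl fun j _ => ?_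
    rw [hP, algebraMap_smul]
  by_contra hcon
  push Not at hcon
  obtain ⟨j₁, hj₁, hlt⟩ := hcon
  obtain ⟨j₂, hj₂, hmax⟩ := Finset.exists_max_image
    (Finset.univ.filter fun j => P j ≠ 0) (fun j => ((P j).natDegree : ℤ) + b j) ⟨j₁, by simpa using hj₁⟩
  simp only [Finset.mem_filter, Finset.mem_univ, true_and] at hj₂ hmax
  set M := ((P j₂).natDegree : ℤ) + b j₂ with hM
  have hlM : l < M := hlt.trans_le (hmax j₁ hj₁)
  obtain ⟨j₀, hj₀, hmax'⟩ := Finset.exists_max_image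
    (Finset.univ.filter fun j => P j ≠ 0 ∧ ((P j).natDegree : ℤ) + b j = M) b ⟨j₂, by simpa using ⟨hj₂, hM.symm⟩⟩
  simp only [Finset.mem_filter, Finset.mem_univ, true_and] at hj₀ hmax'
  let A : Fin (Module.finrank (RatFunc K) W) → K[X] := fun j =>
    if P j ≠ 0 ∧ ((P j).natDegree : ℤ) + b j = M then
      C (P j).leadingCoeff * X ^ ((P j).natDegree - (P j₀).natDegree) else 0
  have hA0 : A j₀ ≠ 0 := by
    simp only [A]
    rw [if_pos hj₀]
    simpa using hj₀.1
  set u := ∑ j, A j • e j with hu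
  refine repl j₀ u 1 A one_ne_zero hA0 (by rw [one_smul]) ?_
  have huE : u ∈ E (b j₀) := by
    refine Submodule.sum_mem _ fun j _ => h.smul_mem _ _ _ _ (h3 j) fun hj => ?_
    by_cases hc : P j ≠ 0 ∧ ((P j).natDegree : ℤ) + b j = M
    · simp only [A]
      rw [if_pos hc, Polynomial.natDegree_C_mul_X_pow _ _ (by simpa using hc.1)]
      have := hmax' j hc
      omega
    · simp only [A] at hj
      rw [if_neg hc] at hj
      exact absurd rfl hj
  refine h.cancel_pow (P j₀).natDegree _ _ _ huE ?_
  have heq : (X ^ (P j₀).natDegree : K[X]) • u = v - ∑ j, (P j - X ^ (P j₀).natDegree * A j) • e j := by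
    rw [hv', hu, Finset.smul_sum, ← Finset.sum_sub_distrib]
    refine Finset.sum_congr rfl fun j _ => ?_
    rw [smul_smul, ← sub_smul, sub_sub_cancel]
  rw [heq]
  refine Submodule.sub_mem _ (h.mono (by omega) hal) ?_
  refine Submodule.sum_mem _ fun j _ => h.smul_mem _ _ _ _ (h3 j) fun hj => ?_
  by_cases hc : P j ≠ 0 ∧ ((P j).natDegree : ℤ) + b j = M
  · simp only [A] at hj ⊢
    rw [if_pos hc] at hj ⊢
    have hle := hmax' j hc
    have h8 : P j - X ^ (P j₀).natDegree *
        (C (P j).leadingCoeff * X ^ ((P j).natDegree - (P j₀).natDegree)) = (P j).eraseLead := by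
      have h9 : (P j₀).natDegree ≤ (P j).natDegree := by omega
      have h10 : (X : K[X]) ^ (P j₀).natDegree *
        (C (P j).leadingCoeff * X ^ ((P j).natDegree - (P j₀).natDegree)) =
          C (P j).leadingCoeff * X ^ (P j).natDegree := by
        rw [mul_left_comm, ← pow_add, Nat.add_sub_cancel' h9]
      rw [h10]
      nth_rewrite 1 [← Polynomial.eraseLead_add_C_mul_X_pow (P j)]
      ring
    rw [h8] at hj ⊢
    have h11 := Polynomial.eraseLead_natDegree_lt_or_eraseLead_eq_zero (P j)
    have : (P j).eraseLead.natDegree < (P j).natDegree := by tauto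
    omega
  · simp only [A] at hj ⊢
    rw [if_neg hc, mul_zero, sub_zero] at hj ⊢
    have h12 := hmax j hj
    have h13 : ((P j).natDegree : ℤ) + b j ≠ M := fun h => hc ⟨hj, h⟩
    omega

theorem exists_isRed (h : GoodFilt E) (W : Submodule (RatFunc K) V)
    [FiniteDimensional (RatFunc K) W] :
    ∃ (e : Fin (Module.finrank (RatFunc K) W) → V)
      (b : Fin (Module.finrank (RatFunc K) W) → ℤ), IsRed E W e b := by
  obtain ⟨e, b, h1, h2, h3, h4⟩ := exists_isRed_unsorted h W
  let σ := Tuple.sort b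
  refine ⟨e ∘ σ, b ∘ σ, h1.comp _ σ.injective, ?_, fun j => h3 _, ?_, Tuple.monotone_sort b⟩
  · refine Submodule.eq_of_le_of_finrank_eq (Submodule.span_le.2 ?_) ?_
    · rintro _ ⟨j, rfl⟩; exact h2 _
    · rw [finrank_span_eq_card (h1.comp _ σ.injective), Fintype.card_fin]
  · intro a l hal
    obtain ⟨P, hP, hP'⟩ := h4 (a ∘ σ.symm) l (by
      rw [← Equiv.sum_comp σ]
      simpa using hal)
    exact ⟨P ∘ σ, fun j => by simpa using hP (σ j), fun j => hP' (σ j)⟩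

lemma IsRed.mem_E (h : GoodFilt E) {W : Submodule (RatFunc K) V} {ν : ℕ} {e : Fin ν → V}
    {b : Fin ν → ℤ} (hr : IsRed E W e b) (P : Fin ν → K[X]) (l : ℤ)
    (hP : ∀ j, P j ≠ 0 → (P j).natDegree + b j ≤ l) : ∑ j, P j • e j ∈ E l :=
  Submodule.sum_mem _ fun j _ => h.smul_mem _ _ _ _ (hr.mem j) fun hj => by
    have := hP j hj
    omega

lemma IsRed.exists_poly {W : Submodule (RatFunc K) V} {ν : ℕ} {e : Fin ν → V}
    {b : Fin ν → ℤ} (hr : IsRed E W e b) (l : ℤ) (v : V) (hv : v ∈ W) (hvl : v ∈ E l) :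
    ∃ P : Fin ν → K[X], v = ∑ j, P j • e j ∧ ∀ j, P j ≠ 0 → (P j).natDegree + b j ≤ l := by
  rw [← hr.span, Submodule.mem_span_range_iff_exists_fun] at hv
  obtain ⟨a, rfl⟩ := hv
  obtain ⟨P, hP, hP'⟩ := hr.key a l hvl
  refine ⟨P, Finset.sum_congr rfl fun j _ => ?_, hP'⟩
  rw [hP, algebraMap_smul]

lemma IsRed.mem_W {W : Submodule (RatFunc K) V} {ν : ℕ} {e : Fin ν → V}
    {b : Fin ν → ℤ} (hr : IsRed E W e b) (P : Fin ν → K[X]) : ∑ j, P j • e j ∈ W := by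
  refine W.sum_mem fun j _ => ?_
  rw [← algebraMap_smul (RatFunc K) (P j) (e j), ← hr.span]
  exact Submodule.smul_mem _ _ (Submodule.subset_span ⟨j, rfl⟩)

lemma IsRed.li_poly {W : Submodule (RatFunc K) V} {ν : ℕ} {e : Fin ν → V}
    {b : Fin ν → ℤ} (hr : IsRed E W e b) (P : Fin ν → K[X]) (hP : ∑ j, P j • e j = 0) (j : Fin ν) :
    P j = 0 := by
  have := Fintype.linearIndependent_iff.1 hr.li (fun j => algebraMap K[X] (RatFunc K) (P j))
    (by simpa using hP) j
  simpa using this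

theorem IsRed.finrank_eq (h : GoodFilt E) {W : Submodule (RatFunc K) V} {ν : ℕ} {e : Fin ν → V}
    {b : Fin ν → ℤ} (hr : IsRed E W e b) (l : ℤ) :
    Module.Finite K ↥(W.restrictScalars K ⊓ E l) ∧
    Module.finrank K ↥(W.restrictScalars K ⊓ E l) = ∑ j, (l - b j + 1).toNat := by
  have hdeg : ∀ (j : Fin ν) (P : K[X]), P ∈ Polynomial.degreeLT K (l - b j + 1).toNat ↔
      (P ≠ 0 → P.natDegree + b j ≤ l) := by
    intro j P
    by_cases hP : P = 0
    · simp [hP]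
    · rw [Polynomial.mem_degreeLT, Polynomial.degree_eq_natDegree hP]
      simp only [ne_eq, hP, not_false_eq_true, forall_const]
      rw [Nat.cast_lt]
      omega
  let φ₀ : ((j : Fin ν) → Polynomial.degreeLT K (l - b j + 1).toNat) →ₗ[K] V :=
    { toFun := fun P => ∑ j, (P j : K[X]) • e j
      map_add' := by
        intro P Q
        simp [add_smul, Finset.sum_add_distrib]
      map_smul' := by
        intro c P
        simp [Finset.smul_sum] }
  have hrange : LinearMap.range φ₀ = W.restrictScalars K ⊓ E l := by
    ext v
    constructor
    · rintro ⟨P, rfl⟩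
      exact ⟨hr.mem_W _, hr.mem_E h _ _ fun j => (hdeg j _).1 (P j).2⟩
    · rintro ⟨hv, hvl⟩
      obtain ⟨P, hP, hP'⟩ := hr.exists_poly l v hv hvl
      exact ⟨fun j => ⟨P j, (hdeg j _).2 (hP' j)⟩, hP.symm⟩
  have hinj : Function.Injective φ₀ := by
    rw [← LinearMap.ker_eq_bot, LinearMap.ker_eq_bot']
    intro P hP
    ext1 j
    exact Subtype.ext (hr.li_poly (fun j => (P j : K[X])) hP j)
  rw [← hrange]
  let eqv := fun j : Fin ν => Polynomial.degreeLTEquiv K (l - b j + 1).toNat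
  haveI : ∀ j : Fin ν, Module.Finite K (Polynomial.degreeLT K (l - b j + 1).toNat) := fun j =>
    Module.Finite.equiv (eqv j).symm
  constructor
  · infer_instance
  · rw [LinearMap.finrank_range_of_inj hinj, Module.finrank_pi_fintype]
    refine Finset.sum_congr rfl fun j _ => ?_
    rw [(eqv j).finrank_eq]
    simp

end GoodFilt
end RB
end FilePA

section FilePB
open Polynomial
set_option linter.all false

section Oinf
variable (K : Type*) [Field K]

/-- The local ring at infinity of `K(X)`. -/
noncomputable def Oinf : Subalgebra K (RatFunc K) where
  carrier := {r | r = 0 ∨ r.intDegree ≤ 0}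
  mul_mem' := by
    rintro a b ha hb
    by_cases h0 : a = 0
    · simp [h0]
    by_cases h1 : b = 0
    · simp [h1]
    right
    rw [RatFunc.intDegree_mul h0 h1]
    have := ha.resolve_left h0
    have := hb.resolve_left h1
    omega
  add_mem' := by
    rintro a b ha hb
    by_cases h0 : a = 0
    · simpa [h0] using hb
    by_cases h1 : b = 0
    · simpa [h1] using ha
    by_cases h2 : a + b = 0
    · left; exact h2
    right
    have := RatFunc.intDegree_add_le h1 h2
    have := ha.resolve_left h0
    have := hb.resolve_left h1
    omega
  algebraMap_mem' := by
    intro r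
    right
    rw [RatFunc.algebraMap_eq_C, RatFunc.intDegree_C]

variable {K}
lemma mem_Oinf {r : RatFunc K} : r ∈ Oinf K ↔ r = 0 ∨ r.intDegree ≤ 0 := Iff.rfl

lemma intDegree_X_zpow (n : ℤ) : (RatFunc.X ^ n : RatFunc K).intDegree = n := by
  have h : ∀ n : ℕ, (RatFunc.X ^ n : RatFunc K).intDegree = n := by
    intro n
    rw [← RatFunc.algebraMap_X, ← map_pow, RatFunc.intDegree_polynomial]
    simp
  obtain ⟨m, rfl | rfl⟩ := n.eq_nat_or_neg
  · rw [zpow_natCast, h]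
  · rw [zpow_neg, RatFunc.intDegree_inv, zpow_natCast, h]

lemma X_zpow_ne (n : ℤ) : (RatFunc.X ^ n : RatFunc K) ≠ 0 := zpow_ne_zero _ RatFunc.X_ne_zero

lemma X_zpow_mem (n : ℤ) (hn : n ≤ 0) : (RatFunc.X ^ n : RatFunc K) ∈ Oinf K :=
  Or.inr (by rwa [intDegree_X_zpow])

lemma X_zpow_mul_mem {r : RatFunc K} (n : ℤ) :
    RatFunc.X ^ (-n) * r ∈ Oinf K ↔ (r = 0 ∨ r.intDegree ≤ n) := by
  rw [mem_Oinf, mul_eq_zero_iff_left (X_zpow_ne _)]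
  by_cases hr : r = 0
  · simp [hr]
  · rw [RatFunc.intDegree_mul (X_zpow_ne _) hr, intDegree_X_zpow]
    simp only [hr, false_or]
    omega

instance : IsFractionRing (Oinf K) (RatFunc K) := by
  refine IsFractionRing.of_field _ _ fun z => ?_
  by_cases hz : z = 0
  · exact ⟨0, 0, by simp [hz]⟩
  by_cases hd : z.intDegree ≤ 0
  · exact ⟨⟨z, Or.inr hd⟩, 1, by simp⟩
  · refine ⟨1, ⟨z⁻¹, Or.inr ?_⟩, ?_⟩
    · rw [RatFunc.intDegree_inv]; omega
    · simp [Algebra.algebraMap_eq_smul_one, Subalgebra.smul_def]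

instance : IsDiscreteValuationRing (Oinf K) := by
  let ϖ : Oinf K := ⟨RatFunc.X ^ (-1 : ℤ), X_zpow_mem _ (by norm_num)⟩
  have hunit : ∀ x : Oinf K, IsUnit x ↔ (x : RatFunc K) ≠ 0 ∧ (x : RatFunc K).intDegree = 0 := by
    intro x
    constructor
    · rintro ⟨u, rfl⟩
      have h0 : ((u : Oinf K) : RatFunc K) ≠ 0 := by
        simpa using u.ne_zero
      have h1 : (((u⁻¹ : (Oinf K)ˣ) : Oinf K) : RatFunc K) ≠ 0 := by
        simpa using (u⁻¹).ne_zero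
      refine ⟨h0, ?_⟩
      have h2 : ((u : Oinf K) : RatFunc K) * (((u⁻¹ : (Oinf K)ˣ) : Oinf K) : RatFunc K) = 1 := by
        rw [← Subalgebra.coe_mul, Units.mul_inv, Subalgebra.coe_one]
      have h3 := congrArg RatFunc.intDegree h2
      rw [RatFunc.intDegree_mul h0 h1, RatFunc.intDegree_one] at h3
      have h4 := (u : Oinf K).2.resolve_left h0
      have h5 := ((u⁻¹ : (Oinf K)ˣ) : Oinf K).2.resolve_left h1
      omega
    · rintro ⟨h0, h1⟩
      refine IsUnit.of_mul_eq_one ⟨(x : RatFunc K)⁻¹, Or.inr ?_⟩ ?_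
      · rw [RatFunc.intDegree_inv]; omega
      · ext
        simp [h0]
  refine IsDiscreteValuationRing.ofHasUnitMulPowIrreducibleFactorization ⟨ϖ, ?_, ?_⟩
  · constructor
    · rw [hunit]
      rintro ⟨-, h⟩
      simp only [ϖ] at h
      rw [intDegree_X_zpow] at h
      omega
    · intro a b hab
      have hab' : (RatFunc.X ^ (-1 : ℤ) : RatFunc K) = a * b := congrArg Subtype.val hab
      have h0 : (a : RatFunc K) ≠ 0 := by
        intro h; rw [h, zero_mul] at hab'; exact X_zpow_ne _ hab'
      have h1 : (b : RatFunc K) ≠ 0 := by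
        intro h; rw [h, mul_zero] at hab'; exact X_zpow_ne _ hab'
      have h3 := congrArg RatFunc.intDegree hab'
      rw [RatFunc.intDegree_mul h0 h1, intDegree_X_zpow] at h3
      have h4 := a.2.resolve_left h0
      have h5 := b.2.resolve_left h1
      rw [hunit, hunit]
      have : (a : RatFunc K).intDegree = 0 ∨ (b : RatFunc K).intDegree = 0 := by omega
      tauto
  · intro x hx
    have h0 : (x : RatFunc K) ≠ 0 := by simpa using hx
    have h4 := x.2.resolve_left h0
    refine ⟨(-(x : RatFunc K).intDegree).toNat, ?_⟩
    have hy : RatFunc.X ^ (-(x : RatFunc K).intDegree) * (x : RatFunc K) ∈ Oinf K :=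
      (X_zpow_mul_mem _).2 (Or.inr le_rfl)
    have hu : IsUnit (⟨_, hy⟩ : Oinf K) := by
      rw [hunit]
      refine ⟨mul_ne_zero (X_zpow_ne _) h0, ?_⟩
      simp only
      rw [RatFunc.intDegree_mul (X_zpow_ne _) h0, intDegree_X_zpow]
      omega
    refine ⟨hu.unit, ?_⟩
    ext
    simp only [ϖ, IsUnit.unit_spec]
    push_cast
    rw [← zpow_natCast, ← zpow_mul, ← mul_assoc, ← zpow_add₀ RatFunc.X_ne_zero]
    rw [show -1 * ((-(x : RatFunc K).intDegree).toNat : ℤ) + -(x : RatFunc K).intDegree = 0 by omega]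
    simp
end Oinf

section EL
variable {K L : Type*} [Field K] [Field L] [Algebra K L] [Algebra K[X] L] [Algebra (RatFunc K) L]
  [IsScalarTower K K[X] L] [IsScalarTower K[X] (RatFunc K) L] [IsScalarTower K (RatFunc K) L]

instance : IsScalarTower K (Oinf K) L := ⟨fun a b c => by
  rw [Subalgebra.smul_def, Subalgebra.smul_def]
  simp⟩

variable (K L) in
/-- The filtration on `L` : elements integral over `K[X]` with poles at infinity bounded by `l`. -/
noncomputable def EL (l : ℤ) : Submodule K L where
  carrier := {x | IsIntegral K[X] x ∧ IsIntegral (Oinf K) ((RatFunc.X ^ (-l) : RatFunc K) • x)}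
  add_mem' := by
    rintro a b ⟨h1, h2⟩ ⟨h3, h4⟩
    exact ⟨h1.add h3, by rw [smul_add]; exact h2.add h4⟩
  zero_mem' := ⟨isIntegral_zero, by rw [smul_zero]; exact isIntegral_zero⟩
  smul_mem' := by
    rintro c x ⟨h1, h2⟩
    refine ⟨?_, ?_⟩
    · rw [← algebraMap_smul K[X] c x]; exact h1.smul _
    · rw [smul_comm, ← algebraMap_smul (Oinf K) c]; exact h2.smul _

lemma mem_EL {l : ℤ} {x : L} : x ∈ EL K L l ↔
    IsIntegral K[X] x ∧ IsIntegral (Oinf K) ((RatFunc.X ^ (-l) : RatFunc K) • x) := Iff.rfl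

lemma EL_mono : Monotone (EL K L) := by
  rintro l m hlm x ⟨h1, h2⟩
  refine ⟨h1, ?_⟩
  have h3 := h2.smul (⟨_, X_zpow_mem (l - m) (by omega)⟩ : Oinf K)
  rw [Subalgebra.smul_def, smul_smul, ← zpow_add₀ RatFunc.X_ne_zero] at h3
  rwa [show l - m + -l = -m by ring] at h3

lemma EL_mul {l m : ℤ} {x y : L} (hx : x ∈ EL K L l) (hy : y ∈ EL K L m) :
    x * y ∈ EL K L (l + m) := by
  refine ⟨hx.1.mul hy.1, ?_⟩
  have := hx.2.mul hy.2
  rw [smul_mul_smul_comm, ← zpow_add₀ RatFunc.X_ne_zero] at this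
  rwa [show -l + -m = -(l + m) by ring] at this

lemma EL_algebraMap (P : K[X]) (l : ℤ) (hl : P ≠ 0 → P.natDegree ≤ l) :
    algebraMap K[X] L P ∈ EL K L l := by
  refine ⟨isIntegral_algebraMap, ?_⟩
  have h1 : RatFunc.X ^ (-l) * algebraMap K[X] (RatFunc K) P ∈ Oinf K := by
    rw [X_zpow_mul_mem]
    by_cases h : P = 0
    · simp [h]
    · right
      rw [RatFunc.intDegree_polynomial]
      exact hl h
  have h2 := isIntegral_algebraMap (R := Oinf K) (A := L) (x := ⟨_, h1⟩)
  convert h2 using 1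
  rw [IsScalarTower.algebraMap_apply K[X] (RatFunc K) L, Algebra.smul_def, ← map_mul]
  rfl

lemma EL_smul (P : K[X]) {l m : ℤ} {x : L} (hx : x ∈ EL K L l) (hm : P ≠ 0 → l + P.natDegree ≤ m) :
    P • x ∈ EL K L m := by
  rw [Algebra.smul_def]
  by_cases hP : P = 0
  · simp [hP]
  · exact EL_mono (by have := hm hP; omega) (EL_mul (EL_algebraMap P P.natDegree (fun _ => le_rfl)) hx)

lemma EL_pow {l : ℤ} {x : L} (hx : x ∈ EL K L l) (q : ℕ) : x ^ q ∈ EL K L (q * l) := by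
  induction q with
  | zero =>
    simpa using EL_algebraMap (K := K) (L := L) 1 0 (by simp)
  | succ q ih =>
    rw [pow_succ]
    have := EL_mul ih hx
    convert this using 2
    push_cast; ring

lemma EL_of_pow {l : ℤ} {x : L} (q : ℕ) (hq : 0 < q) (hx : x ^ q ∈ EL K L (q * l)) :
    x ∈ EL K L l := by
  refine ⟨hx.1.of_pow hq, IsIntegral.of_pow hq ?_⟩
  have := hx.2
  rw [_root_.smul_pow, ← zpow_natCast, ← zpow_mul]
  rwa [show -(l : ℤ) * q = -(q * l) by ring]

lemma EL_X_smul {l : ℤ} {x : L} (hx : x ∈ EL K L l) : (X : K[X]) • x ∈ EL K L (l + 1) :=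
  EL_smul X hx (by simp)

lemma EL_cancel {l : ℤ} {x : L} (hx : IsIntegral K[X] x) (h : (X : K[X]) • x ∈ EL K L (l + 1)) :
    x ∈ EL K L l := by
  refine ⟨hx, ?_⟩
  have := h.2
  rw [← algebraMap_smul (RatFunc K) (X : K[X]) x, smul_smul, RatFunc.algebraMap_X] at this
  nth_rewrite 2 [← zpow_one RatFunc.X] at this
  rw [← zpow_add₀ RatFunc.X_ne_zero] at this
  rwa [show -(l + 1) + 1 = -l by ring] at this

lemma Oinf_factor (t : RatFunc K) (ht : t ≠ 0) : ∃ u ∈ Oinf K,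
    u * t = RatFunc.X ^ t.intDegree := by
  refine ⟨RatFunc.X ^ t.intDegree * t⁻¹, Or.inr ?_, ?_⟩
  · rw [RatFunc.intDegree_mul (X_zpow_ne _) (inv_ne_zero ht), RatFunc.intDegree_inv, intDegree_X_zpow]
    omega
  · field_simp

section fin
variable [FiniteDimensional (RatFunc K) L]

instance instAlgPoly : Algebra.IsAlgebraic K[X] L :=
  (IsFractionRing.comap_isAlgebraic_iff (A := K[X]) (K := RatFunc K) (C := L)).2 inferInstance

instance instAlgOinf : Algebra.IsAlgebraic (Oinf K) L :=
  (IsFractionRing.comap_isAlgebraic_iff (A := Oinf K) (K := RatFunc K) (C := L)).2 inferInstance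

lemma exists_EL {x : L} (hx : IsIntegral K[X] x) : ∃ l, x ∈ EL K L l := by
  obtain ⟨t, ht, h⟩ := IsAlgebraic.exists_integral_multiple ((instAlgOinf (K := K) (L := L)).isAlgebraic x)
  have ht' : (t : RatFunc K) ≠ 0 := by simpa using ht
  obtain ⟨u, hu, hut⟩ := Oinf_factor (t : RatFunc K) ht'
  have h2 := h.smul (⟨u, hu⟩ : Oinf K)
  rw [Subalgebra.smul_def, Subalgebra.smul_def, smul_smul, hut] at h2
  exact ⟨-(t : RatFunc K).intDegree, hx, by rwa [neg_neg]⟩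

lemma EL_neg {l : ℤ} (hl : l < 0) {x : L} (hx : x ∈ EL K L l) : x = 0 := by
  by_contra h0
  have hn : Algebra.norm (RatFunc K) x ≠ 0 := by
    rwa [Ne, Algebra.norm_eq_zero_iff]
  have h1 := Algebra.isIntegral_norm (RatFunc K) hx.1
  have h2 := Algebra.isIntegral_norm (RatFunc K) hx.2
  obtain ⟨P, hP⟩ := IsIntegrallyClosed.isIntegral_iff.1 h1
  obtain ⟨⟨r, hr⟩, hr'⟩ := IsIntegrallyClosed.isIntegral_iff.1 h2
  rw [Algebra.smul_def, map_mul, Algebra.norm_algebraMap, ← zpow_natCast, ← zpow_mul] at hr'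
  have hr1 : (RatFunc.X : RatFunc K) ^ (-l * (Module.finrank (RatFunc K) L : ℤ)) *
      Algebra.norm (RatFunc K) x ∈ Oinf K := by
    rw [← hr']; exact hr
  rw [show -l * (Module.finrank (RatFunc K) L : ℤ) = -(l * (Module.finrank (RatFunc K) L : ℤ)) by ring,
    X_zpow_mul_mem] at hr1
  have h3 := hr1.resolve_left hn
  rw [← hP, RatFunc.intDegree_polynomial] at h3
  have h4 : 0 < Module.finrank (RatFunc K) L := Module.finrank_pos
  have h5 : l * (Module.finrank (RatFunc K) L : ℤ) < 0 := mul_neg_of_neg_of_pos hl (by exact_mod_cast h4)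
  omega

variable {ι : Type*} [Finite ι]

variable (K L) in
/-- shifted filtration on `L^ι`. -/
noncomputable def ELn (d : ι → ℤ) (l : ℤ) : Submodule K (ι → L) :=
  Submodule.pi Set.univ (fun i => EL K L (l - d i))

lemma mem_ELn {d : ι → ℤ} {l : ℤ} {g : ι → L} : g ∈ ELn K L d l ↔ ∀ i, g i ∈ EL K L (l - d i) := by
  simp [ELn]

lemma ELn_mono (d : ι → ℤ) : Monotone (ELn K L d) := by
  intro l m hlm g hg
  rw [mem_ELn] at hg ⊢
  exact fun i => EL_mono (by omega) (hg i)

lemma exists_ELn (d : ι → ℤ) {g : ι → L} (hg : ∀ i, IsIntegral K[X] (g i)) : ∃ l, g ∈ ELn K L d l := by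
  choose l hl using fun i => exists_EL (hg i)
  obtain ⟨M, hM⟩ := (Set.finite_range fun i => l i + d i).bddAbove
  refine ⟨M, mem_ELn.2 fun i => EL_mono ?_ (hl i)⟩
  have := hM ⟨i, rfl⟩
  simp only at this
  omega

lemma exists_poly_integral {ι : Type*} [Finite ι] (g : ι → L) : ∃ P : K[X], P ≠ 0 ∧ ∀ i, IsIntegral K[X] (P • g i) := by
  classical
  cases nonempty_fintype ι
  choose Q hQ hi using fun i => IsAlgebraic.exists_integral_multiple ((instAlgPoly (K := K) (L := L)).isAlgebraic (g i))
  refine ⟨∏ i, Q i, Finset.prod_ne_zero_iff.2 fun i _ => hQ i, fun i => ?_⟩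
  rw [← Finset.prod_erase_mul _ _ (Finset.mem_univ i), mul_smul]
  exact (hi i).smul _

lemma goodELn (d : ι → ℤ) : GoodFilt (ELn K L d) where
  mono := ELn_mono d
  X_smul l v hv := by
    rw [mem_ELn] at hv ⊢
    intro i
    have := EL_X_smul (hv i)
    rwa [show l - d i + 1 = l + 1 - d i by ring] at this
  cancel l l' v hv hX := by
    rw [mem_ELn] at hv hX ⊢
    intro i
    refine EL_cancel (hv i).1 ?_
    have := hX i
    rwa [show l + 1 - d i = l - d i + 1 by ring] at this
  poly v := by
    obtain ⟨P, hP, h⟩ := exists_poly_integral (K := K) v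
    exact ⟨P, hP, exists_ELn d h⟩
  bdd := by
    obtain ⟨M, hM⟩ := (Set.finite_range d).bddBelow
    refine ⟨M - 1, fun v hv => ?_⟩
    ext i
    refine EL_neg ?_ (mem_ELn.1 hv i)
    have := hM ⟨i, rfl⟩
    omega

lemma goodEL : GoodFilt (EL K L) where
  mono := EL_mono
  X_smul l v hv := EL_X_smul hv
  cancel l l' v hv hX := EL_cancel hv.1 hX
  poly v := by
    obtain ⟨P, hP, h⟩ := IsAlgebraic.exists_integral_multiple ((instAlgPoly (K := K) (L := L)).isAlgebraic v)
    exact ⟨P, hP, exists_EL h⟩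
  bdd := ⟨-1, fun v hv => EL_neg (by norm_num) hv⟩

end fin
end EL
end FilePB

section FilePC
open Polynomial
set_option linter.all false

section PidDual
variable {B L ι ρ : Type*} [CommRing B] [IsDomain B] [IsPrincipalIdealRing B] [Field L] [Algebra B L]
  [IsFractionRing B L] [Fintype ι] [Fintype ρ] [DecidableEq ρ]

lemma pid_dual (g : ρ → ι → L) (hg : LinearIndependent L g) :
    ∃ (u f : ρ → ι → B) (X Y : Matrix ρ ρ L),
      (∀ l m, ∑ i, f l i * u m i = if l = m then 1 else 0) ∧
      (∀ l i, algebraMap B L (u l i) = ∑ m, X m l * g m i) ∧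
      (∀ l i, g l i = ∑ m, Y m l * algebraMap B L (u m i)) := by
  classical
  set U : Submodule L (ι → L) := Submodule.span L (Set.range g) with hU
  let c : (ι → B) →ₗ[B] (ι → L) := (Algebra.linearMap B L).compLeft ι
  have hc : ∀ x i, c x i = algebraMap B L (x i) := fun x i => rfl
  set M : Submodule B (ι → B) := (U.restrictScalars B).comap c with hM
  have hMm : ∀ x, x ∈ M ↔ c x ∈ U := fun x => Iff.rfl
  obtain ⟨n, snf⟩ := Submodule.smithNormalForm (Pi.basisFun B ι) M
  have hinj := IsFractionRing.injective B L
  have ha0 : ∀ i, snf.a i ≠ 0 := by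
    intro i h
    have := snf.snf i
    rw [h, zero_smul] at this
    exact snf.bN.ne_zero i (Subtype.ext this)
  let u : Fin n → ι → B := fun l => snf.bM (snf.f l)
  have huM : ∀ l, u l ∈ M := by
    intro l
    have h1 : snf.a l • u l ∈ M := by
      have := (snf.bN l).2
      rwa [snf.snf l] at this
    rw [hMm] at h1 ⊢
    rw [map_smul, ← algebraMap_smul L] at h1
    exact (U.smul_mem_iff ((map_ne_zero_iff _ hinj).2 (ha0 l))).1 h1
  -- span
  have hspan : ∀ x ∈ U, x ∈ Submodule.span L (Set.range fun l => c (u l)) := by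
    intro x hx
    obtain ⟨b, hb⟩ := IsLocalization.exist_integer_multiples_of_finite (nonZeroDivisors B) x
    choose y hy using hb
    have hcy : c y = (b : B) • x := by
      ext i
      rw [hc, hy i]; rfl
    have hyM : y ∈ M := by
      rw [hMm, hcy, ← algebraMap_smul L]
      exact U.smul_mem _ hx
    have h2 : c y ∈ Submodule.span L (Set.range fun l => c (u l)) := by
      have h3 := snf.bN.sum_repr ⟨y, hyM⟩
      have h4 := congrArg (fun z : M => c (z : ι → B)) h3
      simp only [Submodule.coe_sum, Submodule.coe_smul, map_sum, map_smul, snf.snf] at h4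
      rw [← h4]
      refine Submodule.sum_mem _ fun i _ => ?_
      rw [← algebraMap_smul L, ← algebraMap_smul L (snf.a i)]
      exact Submodule.smul_mem _ _ (Submodule.smul_mem _ _ (Submodule.subset_span ⟨i, rfl⟩))
    rw [hcy, ← algebraMap_smul L] at h2
    exact (Submodule.smul_mem_iff _ ((map_ne_zero_iff _ hinj).2 (nonZeroDivisors.coe_ne_zero b))).1 h2
  have hspanEq : Submodule.span L (Set.range fun l => c (u l)) = U := by
    apply le_antisymm
    · rw [Submodule.span_le]; rintro _ ⟨l, rfl⟩; exact huM l
    · exact hspan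
  let f : Fin n → ι → B := fun l i => snf.bM.coord (snf.f l) (Pi.single i 1)
  have hf : ∀ l m, ∑ i, f l i * u m i = if l = m then 1 else 0 := by
    intro l m
    have h1 : snf.bM.coord (snf.f l) (u m) = ∑ i, u m i * f l i := by
      conv_lhs => rw [pi_eq_sum_univ' (u m)]
      rw [map_sum]
      refine Finset.sum_congr rfl fun i _ => ?_
      rw [map_smul, smul_eq_mul]
    simp_rw [mul_comm (f l _)]
    rw [← h1]
    simp [u, Module.Basis.coord_apply, Finsupp.single_apply, eq_comm]
  have hli : LinearIndependent L (fun l => c (u l)) := by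
    rw [Fintype.linearIndependent_iff]
    intro a ha l
    have h1 : ∑ i, algebraMap B L (f l i) * (∑ m, a m • c (u m)) i = a l := by
      simp only [Finset.sum_apply, Pi.smul_apply, smul_eq_mul, hc, Finset.mul_sum]
      rw [Finset.sum_comm]
      have : ∀ m, ∑ i, algebraMap B L (f l i) * (a m * algebraMap B L (u m i)) =
          if l = m then a m else 0 := by
        intro m
        have := congrArg (algebraMap B L) (hf l m)
        rw [map_sum] at this
        simp only [map_mul] at this
        calc _ = a m * ∑ i, algebraMap B L (f l i) * algebraMap B L (u m i) := by
              rw [Finset.mul_sum]; refine Finset.sum_congr rfl fun i _ => by ring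
          _ = _ := by rw [this]; split_ifs <;> simp
      simp [this]
    rw [ha] at h1
    simpa using h1.symm
  have hcard : n = Fintype.card ρ := by
    have h1 := finrank_span_eq_card hli
    have h2 := finrank_span_eq_card hg
    rw [hspanEq] at h1
    rw [← hU, h1] at h2
    simpa using h2
  let ε : ρ ≃ Fin n := Fintype.equivFinOfCardEq hcard.symm
  have hX : ∀ l : ρ, ∃ a : ρ → L, ∑ m, a m • g m = c (u (ε l)) := by
    intro l
    have : c (u (ε l)) ∈ Submodule.span L (Set.range g) := huM (ε l)
    rwa [Submodule.mem_span_range_iff_exists_fun] at this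
  have hY : ∀ l : ρ, ∃ a : Fin n → L, ∑ m, a m • c (u m) = g l := by
    intro l
    have := hspan (g l) (Submodule.subset_span ⟨l, rfl⟩)
    rwa [Submodule.mem_span_range_iff_exists_fun] at this
  choose X hX using hX
  choose Y hY using hY
  refine ⟨fun l => u (ε l), fun l => f (ε l), fun m l => X l m, fun m l => Y l (ε m), ?_, ?_, ?_⟩
  · intro l m; rw [hf]; simp
  · intro l i
    rw [← hc, ← hX]; simp [Finset.sum_apply]
  · intro l i
    rw [← hY, ← ε.sum_comp]; simp [Finset.sum_apply, hc]
end PidDual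

section LocalIndex
variable {O k0 L : Type*} [CommRing O] [IsDomain O] [IsDiscreteValuationRing O] [Field k0] [Field L]
  [Algebra O k0] [IsFractionRing O k0] [Algebra k0 L] [Algebra O L] [IsScalarTower O k0 L]
  [FiniteDimensional k0 L] [Algebra.IsSeparable k0 L]

lemma integralClosure_pid (O k0 L : Type*) [CommRing O] [IsDomain O] [IsDiscreteValuationRing O]
    [Field k0] [Field L] [Algebra O k0] [IsFractionRing O k0] [Algebra k0 L] [Algebra O L]
    [IsScalarTower O k0 L] [FiniteDimensional k0 L] [Algebra.IsSeparable k0 L] :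
    IsPrincipalIdealRing (integralClosure O L) := by
  haveI : IsDedekindDomain (integralClosure O L) := integralClosure.isDedekindDomain O k0 L
  apply IsPrincipalIdealRing.of_finite_maximals
  haveI : Algebra.IsIntegral O (integralClosure O L) := inferInstance
  haveI : Module.IsTorsionFree O (integralClosure O L) := by
    haveI : FaithfulSMul O L := by
      rw [faithfulSMul_iff_algebraMap_injective, IsScalarTower.algebraMap_eq O k0 L]
      exact (algebraMap k0 L).injective.comp (IsFractionRing.injective O k0)
    infer_instance
  refine (IsDedekindDomain.primesOver_finite (IsLocalRing.maximalIdeal O) (integralClosure O L)).subset ?_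
  intro P hP
  haveI : P.IsMaximal := hP
  refine ⟨inferInstance, ⟨?_⟩⟩
  have : (P.comap (algebraMap O (integralClosure O L))).IsMaximal :=
    Ideal.isMaximal_comap_of_isIntegral_of_isMaximal P
  exact (IsLocalRing.eq_maximalIdeal this).symm

variable {ι ρ κ : Type*} [Fintype ι] [Fintype ρ] [DecidableEq ρ] [Fintype κ] [DecidableEq κ]

theorem local_index (φ : L →+* L) (hφ : ∀ x, IsIntegral O x → IsIntegral O (φ x))
    (g : ρ → ι → L) (hg : LinearIndependent L g) (τ : Module.Basis κ k0 L)
    (hτ : ∀ a, IsIntegral O (τ a))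
    (hτ' : ∀ x, IsIntegral O x → ∀ a, ∃ r : O, τ.repr x a = algebraMap O k0 r)
    (e : ρ × κ → ι → L) (M : Matrix (ρ × κ) (ρ × κ) k0)
    (heM : ∀ j i, e j i = ∑ c, M c j • (τ c.2 * φ (g c.1 i)))
    (he : ∀ j i, IsIntegral O (e j i))
    (he' : ∀ x : ρ → L, (∀ i, IsIntegral O (∑ l, x l * φ (g l i))) →
      ∃ a : ρ × κ → O, ∀ i, ∑ l, x l * φ (g l i) = ∑ j, algebraMap O L (a j) * e j i) :
    ∃ (u : Oˣ) (δ : L), δ ≠ 0 ∧ M.det = algebraMap O k0 u * Algebra.norm k0 (φ δ) := by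
  classical
  haveI := integralClosure_pid O k0 L
  haveI : IsFractionRing (integralClosure O L) L :=
    IsIntegralClosure.isFractionRing_of_finite_extension O k0 L (integralClosure O L)
  obtain ⟨u, f, X, Y, hfu, hX, hY⟩ := pid_dual (B := integralClosure O L) g hg
  have hX' : ∀ l i, ((u l i : integralClosure O L) : L) = ∑ m, X m l * g m i := hX
  have hY' : ∀ l i, g l i = ∑ m, Y m l * ((u m i : integralClosure O L) : L) := hY
  have hfu' : ∀ l m, ∑ i, ((f l i : integralClosure O L) : L) * (u m i : L) = if l = m then 1 else 0 := by
    intro l m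
    have := congrArg (fun z : integralClosure O L => (z : L)) (hfu l m)
    simp only [AddSubmonoidClass.coe_finsetSum, MulMemClass.coe_mul] at this
    rw [this]; split_ifs <;> rfl
  -- X * Y = 1
  have hXY : X * Y = 1 := by
    ext m l
    have h1 : ∑ m, ((X * Y) m l - (1 : Matrix ρ ρ L) m l) • g m = 0 := by
      ext i
      simp only [Finset.sum_apply, Pi.smul_apply, smul_eq_mul, sub_mul, Finset.sum_sub_distrib,
        Matrix.mul_apply, Matrix.one_apply, ite_mul, one_mul, zero_mul, Finset.sum_ite_eq',
        Finset.mem_univ, if_true, Pi.zero_apply]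
      rw [sub_eq_zero, hY' l i]
      simp_rw [hX', Finset.mul_sum, Finset.sum_mul]
      rw [Finset.sum_comm]
      exact Finset.sum_congr rfl fun _ _ => Finset.sum_congr rfl fun _ _ => by ring
    exact sub_eq_zero.1 (Fintype.linearIndependent_iff.1 hg _ h1 m)
  have hdX : X.det ≠ 0 := by
    have := congrArg Matrix.det hXY
    rw [Matrix.det_mul, Matrix.det_one] at this
    exact left_ne_zero_of_mul_eq_one this
  -- coordinates wrt φ u
  have hcoord : ∀ (x : ρ → L) l, ∑ i, φ (f l i) * ∑ m, x m * φ (u m i) = x l := by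
    intro x l
    simp_rw [Finset.mul_sum]
    rw [Finset.sum_comm]
    have : ∀ m, ∑ i, φ (f l i) * (x m * φ (u m i)) = if l = m then x m else 0 := by
      intro m
      have := congrArg φ (hfu' l m)
      rw [map_sum] at this
      simp only [map_mul] at this
      calc _ = x m * ∑ i, φ (f l i) * φ (u m i) := by
            rw [Finset.mul_sum]; refine Finset.sum_congr rfl fun i _ => by ring
        _ = _ := by rw [this]; split_ifs <;> simp
    simp [this]
  have hφu : ∀ l i, φ (u l i) = ∑ m, φ (X m l) * φ (g m i) := by
    intro l i; rw [hX', map_sum]; simp only [map_mul]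
  have hφg : ∀ l i, φ (g l i) = ∑ m, φ (Y m l) * φ (u m i) := by
    intro l i; rw [hY', map_sum]; simp only [map_mul]
  have hmix : ∀ (x : ρ → L) i, ∑ l, x l * φ (g l i) = ∑ m, (∑ l, x l * φ (Y m l)) * φ (u m i) := by
    intro x i
    simp_rw [hφg, Finset.mul_sum, Finset.sum_mul]
    rw [Finset.sum_comm]
    exact Finset.sum_congr rfl fun _ _ => Finset.sum_congr rfl fun _ _ => by ring
  have hmix' : ∀ (x : ρ → L) i, ∑ l, x l * φ (u l i) = ∑ m, (∑ l, x l * φ (X m l)) * φ (g m i) := by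
    intro x i
    simp_rw [hφu, Finset.mul_sum, Finset.sum_mul]
    rw [Finset.sum_comm]
    exact Finset.sum_congr rfl fun _ _ => Finset.sum_congr rfl fun _ _ => by ring
  -- independence of φ g
  have hig : ∀ x : ρ → L, (∀ i, ∑ l, x l * φ (g l i) = 0) → x = 0 := by
    intro x hx
    have h1 : ∀ m, ∑ l, x l * φ (Y m l) = 0 := by
      intro m
      rw [← hcoord (fun m => ∑ l, x l * φ (Y m l)) m]
      simp_rw [← hmix, hx]; simp
    have hYX : Y * X = 1 := mul_eq_one_comm.1 hXY
    ext l
    have h2 : ∑ m, (∑ l', x l' * φ (Y m l')) * φ (X l m) = x l := by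
      simp_rw [Finset.sum_mul]
      rw [Finset.sum_comm]
      have : ∀ l', ∑ m, x l' * φ (Y m l') * φ (X l m) = if l = l' then x l' else 0 := by
        intro l'
        have := congrArg φ (congrFun (congrFun hXY l) l')
        rw [Matrix.mul_apply, map_sum, Matrix.one_apply] at this
        simp only [map_mul] at this
        calc _ = x l' * ∑ m, φ (X l m) * φ (Y m l') := by
              rw [Finset.mul_sum]; refine Finset.sum_congr rfl fun i _ => by ring
          _ = _ := by rw [this]; split_ifs <;> simp
      simp [this]
    rw [← h2]; simp [h1]
  -- independence of τ φ g over k0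
  have higk : ∀ y : ρ × κ → k0, (∀ i, ∑ c, y c • (τ c.2 * φ (g c.1 i)) = 0) → y = 0 := by
    intro y hy
    have h1 : (fun l => ∑ a, y (l, a) • τ a) = 0 := by
      apply hig
      intro i
      rw [← hy i, Fintype.sum_prod_type]
      refine Finset.sum_congr rfl fun l _ => ?_
      rw [Finset.sum_mul]
      refine Finset.sum_congr rfl fun a _ => by rw [smul_mul_assoc]
    ext ⟨l, a⟩
    exact Fintype.linearIndependent_iff.1 τ.linearIndependent (fun a => y (l, a)) (congrFun h1 l) a
  -- N
  let Ψ : L →+* Matrix κ κ k0 := (Algebra.leftMulMatrix τ).toRingHom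
  let N : Matrix (ρ × κ) (ρ × κ) k0 := ((X.map φ).map Ψ).comp ρ ρ κ κ k0
  have hNdet : N.det = Algebra.norm k0 (φ X.det) := by
    rw [Algebra.norm_eq_matrix_det τ]
    have := Matrix.det_det (X.map φ) Ψ
    rw [← this, RingHom.map_det]; rfl
  have hN0 : N.det ≠ 0 := by
    rw [hNdet]; simpa [Algebra.norm_ne_zero_iff] using hdX
  have hNapp : ∀ m b l a, N (m, b) (l, a) = τ.repr (φ (X m l) * τ a) b := by
    intro m b l a
    show (Algebra.leftMulMatrix τ (φ (X m l))) b a = _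
    rw [Algebra.leftMulMatrix_eq_repr_mul]
  have ht : ∀ l a i, τ a * φ (u l i) = ∑ c, N c (l, a) • (τ c.2 * φ (g c.1 i)) := by
    intro l a i
    rw [Fintype.sum_prod_type, hφu, Finset.mul_sum]
    refine Finset.sum_congr rfl fun m _ => ?_
    calc _ = (φ (X m l) * τ a) * φ (g m i) := by ring
      _ = (∑ b, N (m, b) (l, a) • τ b) * φ (g m i) := by
        congr 1
        simp_rw [hNapp]
        exact (τ.sum_repr _).symm
      _ = _ := by
        rw [Finset.sum_mul]
        refine Finset.sum_congr rfl fun b _ => by rw [smul_mul_assoc]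
  have hui : ∀ l i, IsIntegral O (φ (u l i)) := fun l i => hφ _ (u l i).2
  -- P
  have hP : ∀ c : ρ × κ, ∃ a : ρ × κ → O, ∀ i, τ c.2 * φ (u c.1 i) = ∑ j, algebraMap O L (a j) * e j i := by
    rintro ⟨l, a⟩
    have h1 : ∀ i, τ a * φ (u l i) = ∑ m, (τ a * φ (X m l)) * φ (g m i) := by
      intro i; rw [hφu, Finset.mul_sum]; exact Finset.sum_congr rfl fun _ _ => by ring
    obtain ⟨b, hb⟩ := he' (fun m => τ a * φ (X m l)) (fun i => by
      rw [← h1]; exact (hτ a).mul (hui l i))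
    exact ⟨b, fun i => by rw [← hb i]; exact h1 i⟩
  choose P hP using hP
  -- Q
  have hQ : ∀ j : ρ × κ, ∃ a : ρ × κ → O, ∀ i, e j i = ∑ c, algebraMap O L (a c) * (τ c.2 * φ (u c.1 i)) := by
    intro j
    let x : ρ → L := fun l => ∑ a, M (l, a) j • τ a
    have h1 : ∀ i, e j i = ∑ l, x l * φ (g l i) := by
      intro i
      rw [heM, Fintype.sum_prod_type]
      refine Finset.sum_congr rfl fun l _ => ?_
      rw [Finset.sum_mul]
      refine Finset.sum_congr rfl fun a _ => by rw [smul_mul_assoc]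
    let y : ρ → L := fun m => ∑ l, x l * φ (Y m l)
    have h2 : ∀ i, e j i = ∑ m, y m * φ (u m i) := fun i => by rw [h1, hmix]
    have h3 : ∀ l, IsIntegral O (y l) := by
      intro l
      rw [← hcoord y l]
      refine IsIntegral.sum _ fun i _ => (hφ _ (f l i).2).mul ?_
      rw [← h2]; exact he j i
    choose r hr using fun l => hτ' (y l) (h3 l)
    refine ⟨fun c => r c.1 c.2, fun i => ?_⟩
    rw [h2, Fintype.sum_prod_type]
    refine Finset.sum_congr rfl fun l _ => ?_
    conv_lhs => rw [← τ.sum_repr (y l)]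
    rw [Finset.sum_mul]
    refine Finset.sum_congr rfl fun a _ => ?_
    rw [hr, Algebra.smul_def, ← IsScalarTower.algebraMap_apply]; ring
  choose Q hQ using hQ
  let Pm : Matrix (ρ × κ) (ρ × κ) O := Matrix.of fun j c => P c j
  let Qm : Matrix (ρ × κ) (ρ × κ) O := Matrix.of fun c j => Q j c
  have hPm : ∀ j c, Pm.map (algebraMap O k0) j c = algebraMap O k0 (P c j) := fun _ _ => rfl
  have hQm : ∀ c j, Qm.map (algebraMap O k0) c j = algebraMap O k0 (Q j c) := fun _ _ => rfl
  have hMP : M * Pm.map (algebraMap O k0) = N := by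
    ext c0 c1
    have := higk (fun c => (M * Pm.map (algebraMap O k0)) c c1 - N c c1) (fun i => by
      simp_rw [sub_smul, Finset.sum_sub_distrib]
      rw [sub_eq_zero, ← ht c1.1 c1.2, hP c1 i]
      simp_rw [heM, Finset.mul_sum, Matrix.mul_apply, Finset.sum_smul]
      rw [Finset.sum_comm]
      refine Finset.sum_congr rfl fun _ _ => Finset.sum_congr rfl fun _ _ => ?_
      simp only [hPm, Algebra.smul_def, map_mul, ← IsScalarTower.algebraMap_apply]
      ring)
    exact sub_eq_zero.1 (congrFun this c0)
  have hNQ : N * Qm.map (algebraMap O k0) = M := by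
    ext c0 c1
    have := higk (fun c => (N * Qm.map (algebraMap O k0)) c c1 - M c c1) (fun i => by
      simp_rw [sub_smul, Finset.sum_sub_distrib]
      rw [sub_eq_zero, ← heM, hQ c1 i]
      simp_rw [ht, Finset.mul_sum, Matrix.mul_apply, Finset.sum_smul]
      rw [Finset.sum_comm]
      refine Finset.sum_congr rfl fun _ _ => Finset.sum_congr rfl fun _ _ => ?_
      simp only [hQm, Algebra.smul_def, map_mul, ← IsScalarTower.algebraMap_apply]
      ring)
    exact sub_eq_zero.1 (congrFun this c0)
  have hPQ : Qm.det * Pm.det = 1 := by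
    apply IsFractionRing.injective O k0
    have h1 := congrArg Matrix.det hMP
    rw [← hNQ] at h1
    simp only [Matrix.det_mul] at h1
    have h2 : ∀ T : Matrix (ρ × κ) (ρ × κ) O, (T.map (algebraMap O k0)).det = algebraMap O k0 T.det :=
      fun T => ((algebraMap O k0).map_det T).symm
    rw [h2, h2] at h1
    rw [map_mul, map_one]
    apply mul_left_cancel₀ hN0
    rw [mul_one, ← mul_assoc]; exact h1
  refine ⟨⟨Qm.det, Pm.det, hPQ, by rw [mul_comm, hPQ]⟩, X.det, hdX, ?_⟩
  rw [← hNQ, Matrix.det_mul, hNdet, mul_comm]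
  congr 1
  exact ((algebraMap O k0).map_det Qm).symm
end LocalIndex
end FilePC

section FilePD
open Polynomial
set_option linter.all false

section Index

lemma li_map_ringHom {L ι ρ : Type*} [Field L] [Fintype ι] [Fintype ρ] (φ : L →+* L)
    (g : ρ → ι → L) (hg : LinearIndependent L g) :
    LinearIndependent L (fun l i => φ (g l i)) := by
  classical
  obtain ⟨u, f, X, Y, h1, h2, h3⟩ := pid_dual (B := L) g hg
  have hY : LinearIndependent L g := hg
  -- a left inverse: functionals F l with F l (g m) = δ
  have : ∃ F : ρ → ι → L, ∀ l m, ∑ i, F l i * g m i = if l = m then 1 else 0 := by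
    let G : (ρ → L) →ₗ[L] (ι → L) := Fintype.linearCombination L g
    have hG : LinearMap.ker G = ⊥ := by
      rw [LinearMap.ker_eq_bot']
      intro m hm
      funext l
      exact Fintype.linearIndependent_iff.1 hg m (by simpa [G, Fintype.linearCombination_apply] using hm) l
    obtain ⟨H, hH⟩ := LinearMap.exists_leftInverse_of_injective G hG
    refine ⟨fun l i => H (Pi.single i 1) l, fun l m => ?_⟩
    have h4 : H (g m) l = ∑ i, g m i * H (Pi.single i 1) l := by
      conv_lhs => rw [pi_eq_sum_univ' (g m)]
      rw [map_sum, Finset.sum_apply]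
      refine Finset.sum_congr rfl fun i _ => ?_
      rw [map_smul]; rfl
    simp_rw [mul_comm (H _ l)]
    rw [← h4]
    have h5 := LinearMap.congr_fun hH (Pi.single m 1)
    have h6 : G (Pi.single m 1) = g m := by
      simp [G, Fintype.linearCombination_apply, Pi.single_apply]
    rw [LinearMap.comp_apply, h6] at h5
    rw [h5]; simp [Pi.single_apply]
  obtain ⟨F, hF⟩ := this
  rw [Fintype.linearIndependent_iff]
  intro a ha l
  have h4 : ∑ i, φ (F l i) * (∑ m, a m • (fun i => φ (g m i))) i = a l := by
    simp only [Finset.sum_apply, Pi.smul_apply, smul_eq_mul, Finset.mul_sum]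
    rw [Finset.sum_comm]
    have : ∀ m, ∑ i, φ (F l i) * (a m * φ (g m i)) = if l = m then a m else 0 := by
      intro m
      have := congrArg φ (hF l m)
      rw [map_sum] at this
      simp only [map_mul] at this
      calc _ = a m * ∑ i, φ (F l i) * φ (g m i) := by
            rw [Finset.mul_sum]; refine Finset.sum_congr rfl fun i _ => by ring
        _ = _ := by rw [this]; split_ifs <;> simp
    simp [this]
  rw [ha] at h4
  simpa using h4.symm

variable {K L : Type*} [Field K] [Field L] [Algebra K L] [Algebra K[X] L] [Algebra (RatFunc K) L]
  [IsScalarTower K K[X] L] [IsScalarTower K[X] (RatFunc K) L] [IsScalarTower K (RatFunc K) L]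
  [FiniteDimensional (RatFunc K) L]

/-- valuation parity at a finite point. -/
def LocPow (q : ℕ) (a : K) (r : RatFunc K) : Prop :=
  ∃ s t m n : K[X], s.eval a ≠ 0 ∧ t.eval a ≠ 0 ∧ m ≠ 0 ∧ n ≠ 0 ∧
    r * algebraMap K[X] (RatFunc K) (s * m ^ q) = algebraMap K[X] (RatFunc K) (t * n ^ q)

lemma LocPow.dvd_intDegree [IsAlgClosed K] (q : ℕ) (r : RatFunc K) (hr : r ≠ 0)
    (h : ∀ a, LocPow q a r) : (q : ℤ) ∣ r.intDegree := by
  classical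
  have hn : r.num ≠ 0 := RatFunc.num_ne_zero hr
  have hd : r.denom ≠ 0 := r.denom_ne_zero
  have hrm : ∀ a, (q : ℤ) ∣ (r.num.rootMultiplicity a : ℤ) - r.denom.rootMultiplicity a := by
    intro a
    obtain ⟨s, t, m, n, hs, ht, hm, hn', h⟩ := h a
    have h1 : r.num * (s * m ^ q) = r.denom * (t * n ^ q) := by
      apply IsFractionRing.injective K[X] (RatFunc K)
      rw [map_mul, map_mul _ r.denom, ← h, ← mul_assoc]
      congr 1
      have : algebraMap K[X] (RatFunc K) r.denom ≠ 0 := by simpa using hd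
      have h0 := r.num_div_denom
      rw [div_eq_iff this] at h0
      rw [h0, mul_comm]
    have hs0 : s ≠ 0 := by rintro rfl; simp at hs
    have ht0 : t ≠ 0 := by rintro rfl; simp at ht
    have h2 := congrArg (rootMultiplicity a) h1
    have hmq : m ^ q ≠ 0 := pow_ne_zero _ hm
    have hnq : n ^ q ≠ 0 := pow_ne_zero _ hn'
    have hsa : s.rootMultiplicity a = 0 := rootMultiplicity_eq_zero hs
    have hta : t.rootMultiplicity a = 0 := rootMultiplicity_eq_zero ht
    rw [rootMultiplicity_mul (mul_ne_zero hn (mul_ne_zero hs0 hmq)),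
      rootMultiplicity_mul (mul_ne_zero hs0 hmq),
      rootMultiplicity_mul (mul_ne_zero hd (mul_ne_zero ht0 hnq)),
      rootMultiplicity_mul (mul_ne_zero ht0 hnq), hsa, hta] at h2
    have h3 : ∀ P : K[X], P ≠ 0 → (P ^ q).rootMultiplicity a = q * P.rootMultiplicity a := by
      intro P hP
      rw [← count_roots, ← count_roots, roots_pow, Multiset.count_nsmul]
    rw [h3 m hm, h3 n hn'] at h2
    refine ⟨(n.rootMultiplicity a : ℤ) - m.rootMultiplicity a, ?_⟩
    push_cast [mul_sub]
    have : (r.num.rootMultiplicity a : ℤ) + (0 + q * m.rootMultiplicity a) =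
      r.denom.rootMultiplicity a + (0 + q * n.rootMultiplicity a) := by exact_mod_cast h2
    linarith
  have hsum : ∀ P : K[X], P ≠ 0 → ∀ S : Finset K, P.roots.toFinset ⊆ S →
      (P.natDegree : ℤ) = ∑ a ∈ S, (P.rootMultiplicity a : ℤ) := by
    intro P hP S hS
    have h1 := (IsAlgClosed.splits P).natDegree_eq_card_roots
    rw [h1, ← Multiset.toFinset_sum_count_eq]
    push_cast
    simp_rw [count_roots]
    apply Finset.sum_subset hS
    intro a _ ha
    have : a ∉ P.roots := by simpa using ha
    rw [← count_roots, Multiset.count_eq_zero_of_notMem this]; rfl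
  rw [RatFunc.intDegree, hsum r.num hn (r.num.roots.toFinset ∪ r.denom.roots.toFinset) Finset.subset_union_left,
    hsum r.denom hd (r.num.roots.toFinset ∪ r.denom.roots.toFinset) Finset.subset_union_right,
    ← Finset.sum_sub_distrib]
  exact Finset.dvd_sum fun a _ => hrm a

variable [Algebra.IsSeparable (RatFunc K) L]
variable {ι : Type*} [Fintype ι]

/-- The comparison of a reduced basis with a product basis, local conditions at a finite point. -/
lemma index_finite (q : ℕ) (φ : L →+* L) (hφ : ∀ x, φ x = x ^ q) (a0 : K) (d : ι → ℤ)
    {ρ n0 : ℕ} (g : Fin ρ → ι → L) (hg : LinearIndependent L g)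
    (W : Submodule (RatFunc K) (ι → L))
    (hW : ∀ x : Fin ρ → L, (fun i => ∑ l, x l * φ (g l i)) ∈ W)
    {ν : ℕ} (e : Fin ν → ι → L) (b : Fin ν → ℤ) (hr : GoodFilt.IsRed (ELn K L d) W e b)
    (τ : Fin n0 → L) (c : Fin n0 → ℤ) (hτ : GoodFilt.IsRed (EL K L) ⊤ τ c)
    (τb : Module.Basis (Fin n0) (RatFunc K) L) (hτb : ∀ a, τb a = τ a)
    (ε : Fin ρ × Fin n0 ≃ Fin ν) (M : Matrix (Fin ρ × Fin n0) (Fin ρ × Fin n0) (RatFunc K))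
    (heM : ∀ j i, e (ε j) i = ∑ c, M c j • (τ c.2 * φ (g c.1 i))) :
    LocPow q a0 M.det ∧ M.det ≠ 0 := by
  classical
  let P : Ideal K[X] := Ideal.span {X - C a0}
  haveI hPm : P.IsMaximal := by
    apply PrincipalIdealRing.isMaximal_of_irreducible
    exact irreducible_X_sub_C a0
  have hmemP : ∀ s : K[X], s ∈ P ↔ s.eval a0 = 0 := by
    intro s; rw [Ideal.mem_span_singleton, dvd_iff_isRoot]; rfl
  have hS : P.primeCompl ≤ nonZeroDivisors K[X] := P.primeCompl_le_nonZeroDivisors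
  let O := Localization.subalgebra.ofField (RatFunc K) P.primeCompl hS
  haveI : IsLocalization P.primeCompl O := inferInstance
  haveI : IsLocalization.AtPrime O P := this
  haveI : IsFractionRing O (RatFunc K) := inferInstance
  haveI : IsDiscreteValuationRing O :=
    IsLocalization.AtPrime.isDiscreteValuationRing_of_dedekind_domain K[X] (P := P)
      (by
        intro h
        have : (X - C a0 : K[X]) ∈ (⊥ : Ideal K[X]) := h ▸ Ideal.mem_span_singleton_self _
        exact X_sub_C_ne_zero a0 (by simpa using this)) O
  haveI : IsScalarTower K[X] O L := IsScalarTower.of_algebraMap_eq fun x => by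
    rw [IsScalarTower.algebraMap_apply K[X] (RatFunc K) L]; rfl
  have hint : ∀ x : L, IsIntegral K[X] x → IsIntegral O x := fun x hx => hx.tower_top
  have hmul : ∀ (v : ι ⊕ Unit → L), (∀ i, IsIntegral O (v i)) →
      ∃ s : K[X], s.eval a0 ≠ 0 ∧ ∀ i, IsIntegral K[X] (s • v i) := by
    intro v hv
    choose m hm using fun i => IsIntegral.exists_multiple_integral_of_isLocalization P.primeCompl (v i) (hv i)
    refine ⟨∏ i, (m i : K[X]), ?_, fun i => ?_⟩
    · rw [eval_prod]
      exact Finset.prod_ne_zero_iff.2 fun i _ h => (m i).2 ((hmemP _).2 h)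
    · rw [← Finset.prod_erase_mul _ _ (Finset.mem_univ i), mul_smul]
      exact (hm i).smul _
  have hOmem : ∀ (s p : K[X]), s.eval a0 ≠ 0 →
      ∃ r : O, algebraMap O (RatFunc K) r = algebraMap K[X] (RatFunc K) p / algebraMap K[X] (RatFunc K) s := by
    intro s p hs
    have hsP : s ∈ P.primeCompl := fun h => hs ((hmemP s).1 h)
    refine ⟨IsLocalization.mk' O p ⟨s, hsP⟩, ?_⟩
    have hs0 : algebraMap K[X] (RatFunc K) s ≠ 0 := by
      have : s ≠ 0 := by rintro rfl; simp at hs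
      simpa using this
    rw [eq_div_iff hs0]
    have := IsLocalization.mk'_spec O p (⟨s, hsP⟩ : P.primeCompl)
    have h2 := congrArg (algebraMap O (RatFunc K)) this
    rw [map_mul] at h2
    exact h2
  have hsmul : ∀ (s : K[X]) (x : L), s • x = algebraMap K[X] L s * x := fun s x => Algebra.smul_def _ _
  have hax : ∀ s : K[X], algebraMap K[X] L s = algebraMap (RatFunc K) L (algebraMap K[X] (RatFunc K) s) :=
    fun s => IsScalarTower.algebraMap_apply _ _ _ _
  obtain ⟨u, δ, hδ, hdet⟩ := local_index (O := O) (k0 := RatFunc K) φ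
    (fun x hx => by rw [hφ]; exact hx.pow q) g hg τb
    (fun a => by rw [hτb]; exact hint _ (hτ.mem a).1)
    (fun x hx a => by
      obtain ⟨s, hs, hsx⟩ := hmul (fun _ => x) (fun _ => hx)
      obtain ⟨l, hl⟩ := exists_EL (hsx (Sum.inr ()))
      obtain ⟨p, hp, -⟩ := hτ.exists_poly l _ trivial hl
      have hs0 : algebraMap K[X] (RatFunc K) s ≠ 0 := by
        have : s ≠ 0 := by rintro rfl; simp at hs
        simpa using this
      obtain ⟨r, hr⟩ := hOmem s (p a) hs
      refine ⟨r, ?_⟩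
      rw [hr, eq_div_iff hs0]
      have h1 : τb.repr (s • x) a = algebraMap K[X] (RatFunc K) (p a) := by
        rw [hp]
        have : ∀ j, p j • τ j = algebraMap K[X] (RatFunc K) (p j) • τb j := fun j => by
          rw [hτb, algebraMap_smul]
        simp_rw [this]
        rw [τb.repr_sum_self]
      rw [← h1, ← algebraMap_smul (RatFunc K) s x, map_smul, Finsupp.smul_apply, smul_eq_mul, mul_comm])
    (fun j => e (ε j)) M
    (fun j i => by simp_rw [hτb]; exact heM j i)
    (fun j i => hint _ (mem_ELn.1 (hr.mem (ε j)) i).1)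
    (fun x hx => by
      let v : ι → L := fun i => ∑ l, x l * φ (g l i)
      obtain ⟨s, hs, hsx⟩ := hmul (Sum.elim v 0) (by
        rintro (i | i)
        · exact hx i
        · exact isIntegral_zero)
      replace hsx := fun i => hsx (Sum.inl i)
      obtain ⟨l, hl⟩ := exists_ELn d hsx
      obtain ⟨p, hp, -⟩ := hr.exists_poly l (s • v) (by
        rw [← algebraMap_smul (RatFunc K) s v]
        exact W.smul_mem _ (hW x)) hl
      have hs0 : algebraMap K[X] (RatFunc K) s ≠ 0 := by
        have : s ≠ 0 := by rintro rfl; simp at hs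
        simpa using this
      choose r hr' using fun j => hOmem s (p j) hs
      refine ⟨fun j => r (ε j), fun i => ?_⟩
      have hsL : algebraMap K[X] L s ≠ 0 := by rw [hax]; simpa using hs0
      apply mul_left_cancel₀ hsL
      have h1 := congrFun hp i
      rw [Pi.smul_apply, hsmul, Finset.sum_apply] at h1
      rw [h1, ε.sum_comp (fun j => algebraMap O L (r j) * e j i), Finset.mul_sum]
      refine Finset.sum_congr rfl fun j _ => ?_
      rw [Pi.smul_apply, hsmul, ← mul_assoc]
      congr 1
      have h2 := hr' j
      rw [eq_div_iff hs0] at h2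
      have h3 : algebraMap O L (r j) = algebraMap (RatFunc K) L (algebraMap O (RatFunc K) (r j)) :=
        IsScalarTower.algebraMap_apply _ _ _ _
      rw [h3, hax, hax, ← h2, map_mul, mul_comm])
  have hnd : Algebra.norm (RatFunc K) δ ≠ 0 := by rwa [Ne, Algebra.norm_eq_zero_iff]
  rw [hφ, map_pow] at hdet
  refine ⟨?_, ?_⟩
  · set y := Algebra.norm (RatFunc K) δ with hy
    obtain ⟨⟨t, s⟩, hts⟩ := IsLocalization.surj P.primeCompl (u : O)
    have htP : t ∈ P.primeCompl := by
      have h1 : IsUnit (algebraMap K[X] O t) := by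
        rw [← hts]; exact u.isUnit.mul (IsLocalization.map_units O s)
      exact (IsLocalization.AtPrime.isUnit_to_map_iff O P t).1 h1
    refine ⟨s, t, y.denom, y.num, fun h => s.2 ((hmemP _).2 h), fun h => htP ((hmemP _).2 h),
      y.denom_ne_zero, RatFunc.num_ne_zero hnd, ?_⟩
    have h2 := congrArg (algebraMap O (RatFunc K)) hts
    rw [map_mul] at h2
    have h2' : algebraMap O (RatFunc K) (u : O) * algebraMap K[X] (RatFunc K) s = algebraMap K[X] (RatFunc K) t := h2
    have : algebraMap K[X] (RatFunc K) y.denom ≠ 0 := by simpa using y.denom_ne_zero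
    have h0 := y.num_div_denom
    rw [div_eq_iff this] at h0
    rw [hdet, map_mul, map_mul, map_pow, map_pow, h0, ← h2']
    ring
  · rw [hdet]
    exact mul_ne_zero (by simpa using u.ne_zero) (pow_ne_zero _ hnd)

/-- The comparison at infinity. -/
lemma index_infinite (q : ℕ) (hq : 0 < q) (φ : L →+* L) (hφ : ∀ x, φ x = x ^ q) (d : ι → ℤ)
    {ρ n0 : ℕ} (g : Fin ρ → ι → L) (hg : LinearIndependent L g)
    (W : Submodule (RatFunc K) (ι → L))
    (hW : ∀ x : Fin ρ → L, (fun i => ∑ l, x l * φ (g l i)) ∈ W)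
    {ν : ℕ} (e : Fin ν → ι → L) (b : Fin ν → ℤ)
    (hr : GoodFilt.IsRed (ELn K L (fun i => q * d i)) W e b)
    (τ : Fin n0 → L) (c : Fin n0 → ℤ) (hτ : GoodFilt.IsRed (EL K L) ⊤ τ c)
    (τb : Module.Basis (Fin n0) (RatFunc K) L) (hτb : ∀ a, τb a = τ a)
    (ε : Fin ρ × Fin n0 ≃ Fin ν) (M : Matrix (Fin ρ × Fin n0) (Fin ρ × Fin n0) (RatFunc K))
    (heM : ∀ j i, e (ε j) i = ∑ c, M c j • (τ c.2 * φ (g c.1 i))) :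
    (q : ℤ) ∣ M.det.intDegree + (ρ * ∑ a, c a - ∑ j, b j) := by
  classical
  let x0 : RatFunc K := RatFunc.X
  have hx0 : x0 ≠ 0 := RatFunc.X_ne_zero
  have hX0 : ∀ m : ℤ, algebraMap (RatFunc K) L (x0 ^ m) ≠ 0 := fun m => by
    rw [Ne, map_eq_zero]; exact zpow_ne_zero m hx0
  have hφX : ∀ m : ℤ, φ (algebraMap (RatFunc K) L (x0 ^ m)) = algebraMap (RatFunc K) L (x0 ^ (q * m)) := by
    intro m
    rw [hφ, ← map_pow, mul_comm, zpow_mul, zpow_natCast]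
  let u : Fin n0 → (RatFunc K)ˣ := fun a => Units.mk0 (x0 ^ (- c a)) (zpow_ne_zero _ hx0)
  let τ' : Module.Basis (Fin n0) (RatFunc K) L := τb.unitsSMul u
  have hτ'a : ∀ a, τ' a = (x0 ^ (-c a)) • τ a := fun a => by
    rw [Module.Basis.unitsSMul_apply, hτb]; rfl
  let g' : Fin ρ → ι → L := fun l i => algebraMap (RatFunc K) L (x0 ^ (d i)) * g l i
  have hg' : LinearIndependent L g' := by
    rw [Fintype.linearIndependent_iff] at hg ⊢
    intro a ha
    apply hg a
    ext i
    have := congrFun ha i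
    simp only [Finset.sum_apply, Pi.smul_apply, smul_eq_mul, g', Pi.zero_apply] at this ⊢
    apply mul_left_cancel₀ (hX0 (d i))
    rw [mul_zero, ← this, Finset.mul_sum]
    exact Finset.sum_congr rfl fun _ _ => by ring
  let M' : Matrix (Fin ρ × Fin n0) (Fin ρ × Fin n0) (RatFunc K) :=
    Matrix.of fun c' j => x0 ^ (c c'.2) * M c' j * x0 ^ (- b (ε j))
  let e' : Fin ρ × Fin n0 → ι → L := fun j i =>
    algebraMap (RatFunc K) L (x0 ^ (q * d i)) * (algebraMap (RatFunc K) L (x0 ^ (- b (ε j))) * e (ε j) i)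
  have hdetM' : M'.det = x0 ^ (ρ * ∑ a, c a - ∑ j, b j) * M.det := by
    have h1 : M' = Matrix.diagonal (fun c' : Fin ρ × Fin n0 => x0 ^ (c c'.2)) * M *
        Matrix.diagonal (fun j => x0 ^ (- b (ε j))) := by
      ext c' j
      rw [Matrix.mul_diagonal, Matrix.diagonal_mul]; rfl
    rw [h1, Matrix.det_mul, Matrix.det_mul, Matrix.det_diagonal, Matrix.det_diagonal]
    have h2 : ∀ {κ : Type} (S : Finset κ) (f : κ → ℤ), ∏ j ∈ S, x0 ^ (f j) = x0 ^ (∑ j ∈ S, f j) := by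
      intro κ S f
      induction S using Finset.induction_on with
      | empty => simp
      | insert a S ha ih => rw [Finset.prod_insert ha, Finset.sum_insert ha, ih, zpow_add₀ hx0]
    rw [h2, h2, mul_right_comm, ← zpow_add₀ hx0]
    congr 2
    rw [Finset.sum_neg_distrib, ε.sum_comp (fun j => b j), Fintype.sum_prod_type, sub_eq_add_neg]
    simp
  have hmem : ∀ (l : ℤ) (y : L), y ∈ EL K L l → IsIntegral (Oinf K) (algebraMap (RatFunc K) L (x0 ^ (-l)) * y) := by
    intro l y hy
    have := hy.2
    rwa [Algebra.smul_def] at this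
  have hpoly : ∀ (p : K[X]) (hp : p ≠ 0) (y : L) (m : ℤ), IsIntegral K[X] (p • y) →
      IsIntegral (Oinf K) (algebraMap (RatFunc K) L (x0 ^ m) * y) → p • y ∈ EL K L (p.natDegree - m) := by
    intro p hp y m h1 h2
    refine ⟨h1, ?_⟩
    have h3 : x0 ^ (-(p.natDegree : ℤ)) * algebraMap K[X] (RatFunc K) p ∈ Oinf K := by
      rw [X_zpow_mul_mem, RatFunc.intDegree_polynomial]; simp
    have h4 := h2.smul (⟨_, h3⟩ : Oinf K)
    rw [Subalgebra.smul_def] at h4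
    convert h4 using 1
    rw [Algebra.smul_def, Algebra.smul_def, Algebra.smul_def, map_mul,
      IsScalarTower.algebraMap_apply K[X] (RatFunc K) L,
      show -((p.natDegree : ℤ) - m) = -(p.natDegree : ℤ) + m by ring, zpow_add₀ hx0, map_mul]
    ring
  have hdeg : ∀ (p r : K[X]) (n : ℤ), p ≠ 0 → (r ≠ 0 → r.natDegree + n ≤ p.natDegree) →
      x0 ^ n * (algebraMap K[X] (RatFunc K) r / algebraMap K[X] (RatFunc K) p) ∈ Oinf K := by
    intro p r n hp hr
    by_cases hr0 : r = 0
    · simp [hr0, (Oinf K).zero_mem]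
    have hp' : algebraMap K[X] (RatFunc K) p ≠ 0 := by simpa using hp
    have hr' : algebraMap K[X] (RatFunc K) r ≠ 0 := by simpa using hr0
    rw [← neg_neg n, X_zpow_mul_mem]
    right
    rw [div_eq_mul_inv, RatFunc.intDegree_mul hr' (inv_ne_zero hp'), RatFunc.intDegree_inv,
      RatFunc.intDegree_polynomial, RatFunc.intDegree_polynomial]
    have := hr hr0
    omega
  have hax : ∀ s : K[X], algebraMap K[X] L s = algebraMap (RatFunc K) L (algebraMap K[X] (RatFunc K) s) :=
    fun s => IsScalarTower.algebraMap_apply _ _ _ _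
  obtain ⟨w, δ, hδ, hdet⟩ := local_index (O := Oinf K) (k0 := RatFunc K) φ
    (fun x hx => by rw [hφ]; exact hx.pow q) g' hg' τ'
    (fun a => by rw [hτ'a, Algebra.smul_def]; exact hmem _ _ (hτ.mem a))
    (fun x hx a => by
      obtain ⟨p, hp, hpx⟩ := exists_poly_integral (K := K) (fun _ : Unit => x)
      have h1 := hpoly p hp x 0 (hpx ()) (by simpa using hx)
      obtain ⟨P, hP, hPd⟩ := hτ.exists_poly _ _ trivial h1
      have hp' : algebraMap K[X] (RatFunc K) p ≠ 0 := by simpa using hp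
      refine ⟨⟨_, hdeg p (P a) (c a) hp (by simpa using hPd a)⟩, ?_⟩
      have h2 : τb.repr (p • x) a = algebraMap K[X] (RatFunc K) (P a) := by
        rw [hP]
        have : ∀ j, P j • τ j = algebraMap K[X] (RatFunc K) (P j) • τb j := fun j => by
          rw [hτb, algebraMap_smul]
        simp_rw [this]
        rw [τb.repr_sum_self]
      rw [← algebraMap_smul (RatFunc K) p x, map_smul] at h2
      have h2' : algebraMap K[X] (RatFunc K) p * τb.repr x a = algebraMap K[X] (RatFunc K) (P a) := h2
      rw [Module.Basis.repr_unitsSMul]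
      show _ = x0 ^ c a * (algebraMap K[X] (RatFunc K) (P a) / algebraMap K[X] (RatFunc K) p)
      rw [← h2', mul_div_cancel_left₀ _ hp', Units.smul_def, smul_eq_mul]
      congr 1
      simp [u])
    e' M'
    (fun j i => by
      simp only [e', heM, Finset.mul_sum]
      refine Finset.sum_congr rfl fun c' _ => ?_
      rw [hτ'a]
      simp only [g', M', Matrix.of_apply, map_mul, hφX, Algebra.smul_def]
      have h1 : algebraMap (RatFunc K) L (x0 ^ (c c'.2)) * algebraMap (RatFunc K) L (x0 ^ (- c c'.2)) = 1 := by
        rw [← map_mul, ← zpow_add₀ hx0]; simp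
      calc _ = (algebraMap (RatFunc K) L (x0 ^ (c c'.2)) * algebraMap (RatFunc K) L (x0 ^ (- c c'.2))) *
            (algebraMap (RatFunc K) L (x0 ^ (↑q * d i)) * (algebraMap (RatFunc K) L (x0 ^ (-b (ε j))) *
            (algebraMap (RatFunc K) L (M c' j) * (τ c'.2 * φ (g c'.1 i))))) := by rw [h1, one_mul]
        _ = _ := by ring)
    (fun j i => by
      have h1 := hmem _ _ (mem_ELn.1 (hr.mem (ε j)) i)
      convert h1 using 1
      simp only [e']
      rw [← mul_assoc, ← map_mul, ← zpow_add₀ hx0]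
      congr 3; ring)
    (fun x hx => by
      let v : ι → L := fun i => ∑ l, x l * φ (g l i)
      have hv : ∀ i, ∑ l, x l * φ (g' l i) = algebraMap (RatFunc K) L (x0 ^ (q * d i)) * v i := by
        intro i
        simp only [v, g', map_mul, hφX, Finset.mul_sum]
        exact Finset.sum_congr rfl fun _ _ => by ring
      obtain ⟨p, hp, hpx⟩ := exists_poly_integral (K := K) v
      have hvE : p • v ∈ ELn K L (fun i => q * d i) p.natDegree := by
        rw [mem_ELn]
        intro i
        exact hpoly p hp (v i) _ (hpx i) (by rw [← hv]; exact hx i)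
      obtain ⟨P, hP, hPd⟩ := hr.exists_poly _ (p • v) (by
        rw [← algebraMap_smul (RatFunc K) p v]
        exact W.smul_mem _ (hW x)) hvE
      have hp' : algebraMap K[X] (RatFunc K) p ≠ 0 := by simpa using hp
      refine ⟨fun j => ⟨_, hdeg p (P (ε j)) (b (ε j)) hp (by simpa using hPd (ε j))⟩, fun i => ?_⟩
      rw [hv]
      have hpL : algebraMap K[X] L p ≠ 0 := by rw [hax]; simpa using hp'
      have h1 := congrFun hP i
      rw [Pi.smul_apply, Algebra.smul_def, Finset.sum_apply] at h1
      apply mul_left_cancel₀ hpL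
      rw [mul_left_comm, h1, ← ε.sum_comp, Finset.mul_sum, Finset.mul_sum]
      refine Finset.sum_congr rfl fun j _ => ?_
      have h3 : ∀ r : Oinf K, algebraMap (Oinf K) L r = algebraMap (RatFunc K) L (r : RatFunc K) := fun r => rfl
      rw [h3]
      simp only [e']
      rw [Pi.smul_apply, Algebra.smul_def, map_mul, map_div₀, ← hax, ← hax]
      have h4 : algebraMap (RatFunc K) L (x0 ^ (b (ε j))) * algebraMap (RatFunc K) L (x0 ^ (- b (ε j))) = 1 := by
        rw [← map_mul, ← zpow_add₀ hx0]; simp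
      field_simp
      linear_combination (- (algebraMap (RatFunc K) L) (x0 ^ (↑q * d i)) * (algebraMap K[X] L (P (ε j))) * e (ε j) i) * h4)
  have hnd : Algebra.norm (RatFunc K) δ ≠ 0 := by rwa [Ne, Algebra.norm_eq_zero_iff]
  rw [hφ, map_pow, hdetM'] at hdet
  have hM0 : M.det ≠ 0 := by
    intro h0
    rw [h0, mul_zero] at hdet
    exact mul_ne_zero (by simpa using w.ne_zero) (pow_ne_zero _ hnd) hdet.symm
  have hwdeg : ((w : Oinf K) : RatFunc K).intDegree = 0 := by
    have h1 : ((w : Oinf K) : RatFunc K) ≠ 0 := by simpa using w.ne_zero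
    have h1' : ((w⁻¹ : (Oinf K)ˣ) : Oinf K) ≠ 0 := Units.ne_zero _
    have h1'' : (((w⁻¹ : (Oinf K)ˣ) : Oinf K) : RatFunc K) ≠ 0 := by simpa using h1'
    have h2 := (mem_Oinf.1 (w : Oinf K).2).resolve_left h1
    have h3 := (mem_Oinf.1 ((w⁻¹ : (Oinf K)ˣ) : Oinf K).2).resolve_left h1''
    have h4 : ((w : Oinf K) : RatFunc K) * (((w⁻¹ : (Oinf K)ˣ) : Oinf K) : RatFunc K) = 1 := by
      exact congrArg (fun z : Oinf K => (z : RatFunc K)) (Units.mul_inv w)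
    have h5 := congrArg RatFunc.intDegree h4
    rw [RatFunc.intDegree_mul h1 h1'', RatFunc.intDegree_one] at h5
    omega
  have hpowdeg : ∀ (y : RatFunc K), y ≠ 0 → ∀ n : ℕ, (y ^ n).intDegree = n * y.intDegree := by
    intro y hy n
    induction n with
    | zero => simp
    | succ n ih => rw [pow_succ, RatFunc.intDegree_mul (pow_ne_zero _ hy) hy, ih]; push_cast; ring
  have h6 := congrArg RatFunc.intDegree hdet
  have hw0 : algebraMap (Oinf K) (RatFunc K) (w : Oinf K) ≠ 0 := by simpa using w.ne_zero
  rw [RatFunc.intDegree_mul (X_zpow_ne _) hM0, intDegree_X_zpow,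
    RatFunc.intDegree_mul hw0 (pow_ne_zero _ hnd), hpowdeg _ hnd] at h6
  refine ⟨(Algebra.norm (RatFunc K) δ).intDegree, ?_⟩
  have hwdeg' : (algebraMap (Oinf K) (RatFunc K) (w : Oinf K)).intDegree = 0 := hwdeg
  rw [hwdeg'] at h6
  linarith

theorem index_thm [IsAlgClosed K] (q : ℕ) (hq : 0 < q) (φ : L →+* L) (hφ : ∀ x, φ x = x ^ q) (d : ι → ℤ)
    {ρ n0 : ℕ} (g : Fin ρ → ι → L) (hg : LinearIndependent L g)
    (W : Submodule (RatFunc K) (ι → L))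
    (hW : ∀ v, v ∈ W ↔ ∃ x : Fin ρ → L, v = fun i => ∑ l, x l * φ (g l i))
    {ν : ℕ} (e : Fin ν → ι → L) (b : Fin ν → ℤ)
    (hr : GoodFilt.IsRed (ELn K L (fun i => q * d i)) W e b)
    (τ : Fin n0 → L) (c : Fin n0 → ℤ) (hτ : GoodFilt.IsRed (EL K L) ⊤ τ c) :
    (q : ℤ) ∣ ∑ j, b j - ρ * ∑ a, c a ∧ ν = ρ * n0 := by
  classical
  let τb : Module.Basis (Fin n0) (RatFunc K) L := Module.Basis.mk hτ.li (by rw [hτ.span])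
  have hτb : ∀ a, τb a = τ a := fun a => Module.Basis.mk_apply _ _ a
  have hφg := li_map_ringHom φ g hg
  let t : Fin ρ × Fin n0 → ι → L := fun c i => τ c.2 * φ (g c.1 i)
  have hcomb : ∀ y : Fin ρ × Fin n0 → RatFunc K, ∑ c, y c • t c =
      ∑ l, (∑ a, y (l, a) • τ a) • (fun i => φ (g l i)) := by
    intro y
    ext i
    simp only [Finset.sum_apply, Pi.smul_apply, smul_eq_mul, Fintype.sum_prod_type, t, Finset.sum_mul,
      smul_mul_assoc]
  have hcoeff : ∀ x : Fin ρ → L, (fun i => ∑ l, x l * φ (g l i)) = ∑ c : Fin ρ × Fin n0, τb.repr (x c.1) c.2 • t c := by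
    intro x
    rw [hcomb]
    ext i
    simp only [Finset.sum_apply, Pi.smul_apply, smul_eq_mul]
    refine Finset.sum_congr rfl fun l _ => ?_
    congr 1
    conv_lhs => rw [← τb.sum_repr (x l)]
    simp_rw [hτb]
  have htli : LinearIndependent (RatFunc K) t := by
    rw [Fintype.linearIndependent_iff]
    intro y hy ⟨l, a⟩
    rw [hcomb] at hy
    have h1 := Fintype.linearIndependent_iff.1 hφg _ hy l
    exact Fintype.linearIndependent_iff.1 hτ.li (fun a => y (l, a)) h1 a
  have htspan : Submodule.span (RatFunc K) (Set.range t) = W := by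
    apply le_antisymm
    · rw [Submodule.span_le]
      rintro _ ⟨⟨l, a⟩, rfl⟩
      rw [SetLike.mem_coe, hW]
      refine ⟨Pi.single l (τ a), ?_⟩
      ext i
      simp [t, Pi.single_apply]
    · intro v hv
      obtain ⟨x, rfl⟩ := (hW v).1 hv
      rw [hcoeff]
      exact Submodule.sum_mem _ fun c _ => Submodule.smul_mem _ _ (Submodule.subset_span ⟨c, rfl⟩)
  have hcard : ν = ρ * n0 := by
    have h1 := finrank_span_eq_card htli
    have h2 := finrank_span_eq_card hr.li
    rw [htspan] at h1
    rw [hr.span, h1] at h2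
    simpa using h2.symm
  refine ⟨?_, hcard⟩
  let ε : Fin ρ × Fin n0 ≃ Fin ν := finProdFinEquiv.trans (finCongr hcard.symm)
  have hex : ∀ j, ∃ x : Fin ρ → L, e j = fun i => ∑ l, x l * φ (g l i) := fun j => by
    rw [← hW, ← hr.span]; exact Submodule.subset_span ⟨j, rfl⟩
  choose x hx using hex
  let M : Matrix (Fin ρ × Fin n0) (Fin ρ × Fin n0) (RatFunc K) :=
    Matrix.of fun c j => τb.repr (x (ε j) c.1) c.2
  have heM : ∀ j i, e (ε j) i = ∑ c, M c j • (τ c.2 * φ (g c.1 i)) := by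
    intro j i
    rw [hx, hcoeff, Finset.sum_apply]
    rfl
  have hWx : ∀ x : Fin ρ → L, (fun i => ∑ l, x l * φ (g l i)) ∈ W := fun x => (hW _).2 ⟨x, rfl⟩
  have h1 := fun a0 => index_finite q φ hφ a0 _ g hg W hWx e b hr τ c hτ τb hτb ε M heM
  have h2 := index_infinite q hq φ hφ d g hg W hWx e b hr τ c hτ τb hτb ε M heM
  have h3 := LocPow.dvd_intDegree q M.det (h1 0).2 fun a => (h1 a).1
  have h4 := (dvd_sub h3 h2)
  have h5 : ∑ j, b j - ρ * ∑ a, c a = M.det.intDegree - (M.det.intDegree + (ρ * ∑ a, c a - ∑ j, b j)) := by ring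
  rw [h5]; exact h4
end Index
end FilePD

section FilePE
open Polynomial
set_option linter.all false

section DiscGeneral
variable {O k0 L : Type*} [CommRing O] [IsDomain O] [IsIntegrallyClosed O] [Field k0] [Field L] [Algebra O k0]
  [IsFractionRing O k0] [Algebra k0 L] [Algebra O L] [IsScalarTower O k0 L]
  [FiniteDimensional k0 L] [Algebra.IsSeparable k0 L]

lemma discr_coord {ι : Type*} [Fintype ι] [DecidableEq ι] (b : Module.Basis ι k0 L)
    (hb : ∀ i, IsIntegral O (b i)) (x : L) (hx : IsIntegral O x) (i : ι) :
    ∃ r : O, algebraMap O k0 r = Algebra.discr k0 b * b.repr x i := by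
  have hdet : (Algebra.traceMatrix k0 b).det * b.repr x i =
      Matrix.cramer (Algebra.traceMatrix k0 b) (fun j => Algebra.trace k0 L (x * b j)) i := by
    have h1 : (Algebra.traceMatrix k0 b).mulVec (b.equivFun x) = fun j => Algebra.trace k0 L (x * b j) :=
      Algebra.traceMatrix_of_basis_mulVec _ _
    rw [← h1, Matrix.cramer_eq_adjugate_mulVec, Matrix.mulVec_mulVec, Matrix.adjugate_mul]
    simp [Matrix.smul_mulVec]
  rw [Algebra.discr_def, hdet, Matrix.cramer_apply]
  have key : IsIntegral O ((Algebra.traceMatrix k0 ⇑b).updateCol i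
      fun j => Algebra.trace k0 L (x * b j)).det := by
    refine IsIntegral.det fun j l => ?_
    by_cases hl : l = i
    · simp only [Matrix.updateCol_apply, hl, if_true]
      exact Algebra.isIntegral_trace (hx.mul (hb _))
    · simp only [Matrix.updateCol_apply, hl, if_false]
      exact Algebra.isIntegral_trace ((hb _).mul (hb _))
  exact IsIntegrallyClosed.isIntegral_iff.1 key

lemma norm_div_integral (z : L) (hz : IsIntegral O z) (h0 : z ≠ 0) :
    IsIntegral O (algebraMap k0 L (Algebra.norm k0 z) / z) := by
  classical
  let E := AlgebraicClosure L
  have h1 := Algebra.norm_eq_prod_embeddings k0 E z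
  have hinj : Function.Injective (algebraMap L E) := (algebraMap L E).injective
  have : IsIntegral O (algebraMap L E (algebraMap k0 L (Algebra.norm k0 z) / z)) := by
    rw [map_div₀, ← IsScalarTower.algebraMap_apply k0 L E, h1,
      ← Finset.mul_prod_erase Finset.univ _ (Finset.mem_univ (IsScalarTower.toAlgHom k0 L E))]
    have h2 : (IsScalarTower.toAlgHom k0 L E) z = algebraMap L E z := rfl
    rw [h2, mul_div_cancel_left₀ _ (by simpa using h0)]
    refine IsIntegral.prod _ fun σ _ => ?_
    exact hz.map (σ.restrictScalars O)
  exact (isIntegral_algebraMap_iff hinj).1 this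

lemma discr_scale {ι : Type*} [Fintype ι] [DecidableEq ι] (b : ι → L) (c : ι → k0) :
    Algebra.discr k0 (fun i => c i • b i) = (∏ i, c i) ^ 2 * Algebra.discr k0 b := by
  have := Algebra.discr_of_matrix_vecMul (A := k0) b (Matrix.diagonal c)
  rw [Matrix.det_diagonal] at this
  rw [← this]
  congr 1
  ext i
  rw [Matrix.diagonal_map (by simp), Matrix.vecMul_diagonal, Algebra.smul_def, mul_comm]

lemma discr_pow {ι : Type*} [Fintype ι] [DecidableEq ι] (p : ℕ) [Fact p.Prime] [CharP L p]
    (b : ι → L) (hcard : Fintype.card ι = Module.finrank k0 L) :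
    Algebra.discr k0 (fun i => b i ^ p) = Algebra.discr k0 b ^ p := by
  let E := AlgebraicClosure L
  haveI : CharP E p := charP_of_injective_algebraMap (algebraMap L E).injective p
  have e : ι ≃ (L →ₐ[k0] E) := Fintype.equivOfCardEq (by rw [hcard, AlgHom.card])
  apply (algebraMap k0 E).injective
  rw [map_pow, Algebra.discr_eq_det_embeddingsMatrixReindex_pow_two k0 E b e,
    Algebra.discr_eq_det_embeddingsMatrixReindex_pow_two k0 E _ e, ← pow_mul, mul_comm 2 p, pow_mul]
  congr 1
  have := (frobenius E p).map_det (Algebra.embeddingsMatrixReindex k0 E b e)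
  rw [frobenius_def] at this
  rw [this]
  congr 1
  ext i j
  simp [Algebra.embeddingsMatrixReindex, Algebra.embeddingsMatrix, frobenius_def]
end DiscGeneral

lemma prod_X_zpow {K : Type*} [Field K] {ι : Type*} [Fintype ι] (w : ι → ℤ) :
    (∏ i, (RatFunc.X ^ (-(w i)) : RatFunc K)) = RatFunc.X ^ (-(∑ i, w i)) := by
  classical
  induction (Finset.univ : Finset ι) using Finset.induction_on with
  | empty => simp
  | insert a s ha ih => rw [Finset.prod_insert ha, Finset.sum_insert ha, ih, ← zpow_add₀ RatFunc.X_ne_zero]; congr 1; ring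

section DiscGraded
variable {K L : Type*} [Field K] [Field L] [Algebra K L] [Algebra K[X] L] [Algebra (RatFunc K) L]
  [IsScalarTower K K[X] L] [IsScalarTower K[X] (RatFunc K) L] [IsScalarTower K (RatFunc K) L]
  [FiniteDimensional (RatFunc K) L] [Algebra.IsSeparable (RatFunc K) L]
  {ι : Type*} [Fintype ι] [DecidableEq ι]

lemma discr_poly (b : Module.Basis ι (RatFunc K) L) (w : ι → ℤ) (hb : ∀ i, b i ∈ EL K L (w i)) :
    ∃ δ : K[X], δ ≠ 0 ∧ algebraMap K[X] (RatFunc K) δ = Algebra.discr (RatFunc K) b ∧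
      (δ.natDegree : ℤ) ≤ 2 * ∑ i, w i := by
  have h1 : IsIntegral K[X] (Algebra.discr (RatFunc K) b) :=
    Algebra.discr_isIntegral _ fun i => (mem_EL.1 (hb i)).1
  obtain ⟨δ, hδ⟩ := IsIntegrallyClosed.isIntegral_iff.1 h1
  have h0 : δ ≠ 0 := by
    rintro rfl
    rw [map_zero] at hδ
    exact Algebra.discr_not_zero_of_basis (RatFunc K) b hδ.symm
  refine ⟨δ, h0, hδ, ?_⟩
  have h2 : IsIntegral (Oinf K) (Algebra.discr (RatFunc K) (fun i => (RatFunc.X ^ (-(w i)) : RatFunc K) • b i)) :=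
    Algebra.discr_isIntegral _ fun i => (mem_EL.1 (hb i)).2
  rw [discr_scale, ← hδ] at h2
  obtain ⟨r, hr⟩ := IsIntegrallyClosed.isIntegral_iff.1 h2
  have h3 : (RatFunc.X ^ (-(2 * ∑ i, w i)) : RatFunc K) * algebraMap K[X] (RatFunc K) δ ∈ Oinf K := by
    have : (RatFunc.X ^ (-(2 * ∑ i, w i)) : RatFunc K) = (∏ i, (RatFunc.X ^ (-(w i)) : RatFunc K)) ^ 2 := by
      rw [prod_X_zpow, pow_two, ← zpow_add₀ RatFunc.X_ne_zero]; congr 1; ring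
    rw [this, ← hr]
    exact r.2
  rw [X_zpow_mul_mem] at h3
  rcases h3 with h3 | h3
  · simp [h0] at h3
  · rwa [RatFunc.intDegree_polynomial] at h3

lemma discr_coord_graded (b : Module.Basis ι (RatFunc K) L) (w : ι → ℤ) (hb : ∀ i, b i ∈ EL K L (w i))
    (l : ℤ) (x : L) (hx : x ∈ EL K L l) :
    ∃ P : ι → K[X], Algebra.discr (RatFunc K) b • x = ∑ i, P i • b i ∧
      ∀ i, P i ≠ 0 → ((P i).natDegree : ℤ) + w i ≤ l + 2 * ∑ i, w i := by
  have h1 := discr_coord b (fun i => (mem_EL.1 (hb i)).1) x (mem_EL.1 hx).1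
  choose P hP using h1
  refine ⟨P, ?_, ?_⟩
  · conv_lhs => rw [← b.sum_repr x, Finset.smul_sum]
    refine Finset.sum_congr rfl fun i _ => ?_
    rw [smul_smul, ← hP, algebraMap_smul]
  intro i hi
  let b' : Module.Basis ι (RatFunc K) L :=
    Module.Basis.isUnitSMul b (w := fun i => (RatFunc.X ^ (-(w i)) : RatFunc K))
    (fun i => (X_zpow_ne _).isUnit)
  have hb' : ∀ i, b' i = (RatFunc.X ^ (-(w i)) : RatFunc K) • b i := fun i => b.isUnitSMul_apply _ i
  obtain ⟨r, hr⟩ := discr_coord (O := Oinf K) b' (fun i => by rw [hb']; exact (mem_EL.1 (hb i)).2) _ (mem_EL.1 hx).2 i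
  have h2 : Algebra.discr (RatFunc K) b' = (∏ i, (RatFunc.X ^ (-(w i)) : RatFunc K)) ^ 2 * Algebra.discr (RatFunc K) b := by
    rw [← discr_scale]; congr 1; ext i; exact hb' i
  have h3 : b'.repr x i = RatFunc.X ^ (w i) * b.repr x i := by
    simp only [b', Module.Basis.repr_isUnitSMul]
    rw [Units.smul_def]
    simp
  have h4 : (RatFunc.X ^ (-(l + 2 * (∑ i, w i) - w i)) : RatFunc K) * algebraMap K[X] (RatFunc K) (P i) ∈ Oinf K := by
    have : (RatFunc.X ^ (-(l + 2 * (∑ i, w i) - w i)) : RatFunc K) =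
      (∏ i, (RatFunc.X ^ (-(w i)) : RatFunc K)) ^ 2 * (RatFunc.X ^ (w i) * RatFunc.X ^ (-l)) := by
      rw [prod_X_zpow, pow_two, ← zpow_add₀ RatFunc.X_ne_zero, ← zpow_add₀ RatFunc.X_ne_zero,
        ← zpow_add₀ RatFunc.X_ne_zero]; congr 1; ring
    rw [map_smul, Finsupp.smul_apply, h3, h2] at hr
    rw [this, hP]
    convert! r.2 using 1
    change _ = algebraMap (Oinf K) (RatFunc K) r
    rw [hr, smul_eq_mul]; ring
  rw [X_zpow_mul_mem] at h4
  rcases h4 with h4 | h4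
  · simp [hi] at h4
  · rw [RatFunc.intDegree_polynomial] at h4
    omega
end DiscGraded
end FilePE

section FilePE2
open Polynomial
set_option linter.all false

lemma poly_pdecomp {K : Type*} [Field K] (p : ℕ) [Fact p.Prime] [CharP K p] [PerfectRing K p] (P : K[X]) :
    ∃ Q : Fin p → K[X], P = ∑ i : Fin p, X ^ (i : ℕ) * Q i ^ p ∧
      ∀ i, Q i ≠ 0 → P ≠ 0 ∧ p * (Q i).natDegree ≤ P.natDegree := by
  have hp : p.Prime := Fact.out
  by_cases hP : P = 0
  · refine ⟨0, ?_, by simp⟩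
    simp [hP, hp.ne_zero]
  have hroot : ∀ a : K, ∃ r : K, r ^ p = a := fun a => by
    obtain ⟨r, hr⟩ := (PerfectRing.bijective_frobenius (R := K) (p := p)).surjective a
    exact ⟨r, hr⟩
  choose ρ hρ using hroot
  refine ⟨fun i => ∑ m ∈ Finset.range (P.natDegree + 1), if m % p = i then C (ρ (P.coeff m)) * X ^ (m / p) else 0,
    ?_, fun i hi => ⟨hP, ?_⟩⟩
  · have : ∀ i : Fin p, X ^ (i : ℕ) * (∑ m ∈ Finset.range (P.natDegree + 1),
        if m % p = i then C (ρ (P.coeff m)) * X ^ (m / p) else 0) ^ p =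
        ∑ m ∈ Finset.range (P.natDegree + 1), if m % p = i then C (P.coeff m) * X ^ m else 0 := by
      intro i
      rw [sum_pow_char, Finset.mul_sum]
      refine Finset.sum_congr rfl fun m _ => ?_
      split_ifs with h
      · rw [mul_pow, ← C_pow, hρ, ← pow_mul, mul_left_comm, ← pow_add]
        congr 2
        rw [← h, mul_comm]; exact Nat.mod_add_div m p
      · simp [hp.ne_zero]
    simp_rw [this]
    rw [Finset.sum_comm]
    conv_lhs => rw [P.as_sum_range_C_mul_X_pow]
    refine Finset.sum_congr rfl fun m _ => ?_
    rw [Finset.sum_eq_single (⟨m % p, Nat.mod_lt _ hp.pos⟩ : Fin p)]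
    · simp
    · intro j _ hj
      rw [if_neg]
      intro h; exact hj (Fin.ext h.symm)
    · simp
  · have : (∑ m ∈ Finset.range (P.natDegree + 1), if m % p = i then C (ρ (P.coeff m)) * X ^ (m / p) else 0).natDegree ≤ P.natDegree / p := by
      refine natDegree_sum_le_of_forall_le _ _ fun m hm => ?_
      split_ifs
      · refine (natDegree_C_mul_X_pow_le _ _).trans (Nat.div_le_div_right ?_)
        simpa [Nat.lt_succ_iff] using hm
      · simp
    calc _ ≤ p * (P.natDegree / p) := Nat.mul_le_mul_left _ this
      _ ≤ _ := Nat.mul_div_le _ _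

section PDec
variable {K L : Type*} [Field K] [Field L] [Algebra K L] [Algebra K[X] L] [Algebra (RatFunc K) L]
  [IsScalarTower K K[X] L] [IsScalarTower K[X] (RatFunc K) L] [IsScalarTower K (RatFunc K) L]
  [FiniteDimensional (RatFunc K) L] [Algebra.IsSeparable (RatFunc K) L]
  (pb : PowerBasis (RatFunc K) L) (N : ℕ) (hθ : pb.gen ∈ EL K L N)
  (δ : K[X]) (hδ0 : δ ≠ 0) (hδ : algebraMap K[X] (RatFunc K) δ = Algebra.discr (RatFunc K) pb.basis)

lemma two_mul_sum_fin (N e : ℕ) : 2 * ∑ k : Fin e, ((N * (k : ℕ) : ℕ) : ℤ) = ((N * e * (e - 1) : ℕ) : ℤ) := by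
  rw [Fin.sum_univ_eq_sum_range (fun k => ((N * k : ℕ) : ℤ))]
  rw [← Nat.cast_sum, ← Finset.mul_sum]
  have := Finset.sum_range_id_mul_two e
  rw [mul_assoc N, ← this]; push_cast; ring

include hθ in
lemma pb_basis_mem (k : Fin pb.dim) : pb.basis k ∈ EL K L ((N * (k : ℕ) : ℕ) : ℤ) := by
  rw [pb.basis_eq_pow]
  have := EL_pow hθ (k : ℕ)
  rwa [show ((N * (k : ℕ) : ℕ) : ℤ) = (k : ℕ) * (N : ℤ) by push_cast; ring]

include hθ in
lemma exists_disc : ∃ δ : K[X], δ ≠ 0 ∧ algebraMap K[X] (RatFunc K) δ = Algebra.discr (RatFunc K) pb.basis ∧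
    (δ.natDegree : ℤ) ≤ ((N * pb.dim * (pb.dim - 1) : ℕ) : ℤ) := by
  obtain ⟨δ, h⟩ := discr_poly pb.basis _ (pb_basis_mem pb N hθ)
  rw [two_mul_sum_fin] at h
  exact ⟨δ, h⟩

include hθ hδ in
lemma disc_coord (l : ℤ) (x : L) (hx : x ∈ EL K L l) :
    ∃ P : Fin pb.dim → K[X], δ • x = ∑ k : Fin pb.dim, P k • pb.gen ^ (k : ℕ) ∧
      ∀ k, P k ≠ 0 → ((P k).natDegree : ℤ) + (N * (k : ℕ) : ℕ) ≤ l + ((N * pb.dim * (pb.dim - 1) : ℕ) : ℤ) := by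
  obtain ⟨P, h, h'⟩ := discr_coord_graded pb.basis _ (pb_basis_mem pb N hθ) l x hx
  rw [two_mul_sum_fin] at h'
  refine ⟨P, ?_, h'⟩
  rw [← hδ, algebraMap_smul] at h
  simpa using h

include hθ hδ0 hδ in
lemma disc_pdecomp (p : ℕ) [Fact p.Prime] [CharP K p] [PerfectRing K p] (l : ℤ) (x : L) (hx : x ∈ EL K L l) :
    ∃ a : Fin p → L, x = ∑ i : Fin p, (X : K[X]) ^ (i : ℕ) • a i ^ p ∧
      ∀ i, δ • a i ∈ EL K L (l / p + ((N * pb.dim * (pb.dim - 1) : ℕ) : ℤ)) := by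
  have hp : p.Prime := Fact.out
  haveI : CharP L p := charP_of_injective_algebraMap (algebraMap K L).injective p
  set c0 := N * pb.dim * (pb.dim - 1) with hc0
  have hcard : Fintype.card (Fin pb.dim) = Module.finrank (RatFunc K) L := by
    rw [pb.finrank]; simp
  have hd := discr_pow (k0 := RatFunc K) p pb.basis hcard
  have hli : LinearIndependent (RatFunc K) (fun k => pb.basis k ^ p) := by
    by_contra h
    rw [Algebra.discr_zero_of_not_linearIndependent (RatFunc K) h] at hd
    exact pow_ne_zero p (Algebra.discr_not_zero_of_basis (RatFunc K) pb.basis) hd.symm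
  haveI : Nonempty (Fin pb.dim) := ⟨⟨0, pb.dim_pos⟩⟩
  let b' := basisOfLinearIndependentOfCardEqFinrank hli hcard
  have hb' : ⇑b' = fun k => pb.basis k ^ p := coe_basisOfLinearIndependentOfCardEqFinrank _ _
  have hmem : ∀ k : Fin pb.dim, b' k ∈ EL K L (((p * N) * (k : ℕ) : ℕ) : ℤ) := by
    intro k
    rw [hb']
    have := EL_pow (pb_basis_mem pb N hθ k) p
    rwa [show (((p * N) * (k : ℕ) : ℕ) : ℤ) = p * ((N * (k : ℕ) : ℕ) : ℤ) by push_cast; ring]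
  obtain ⟨P, h, h'⟩ := discr_coord_graded b' _ hmem l x hx
  rw [two_mul_sum_fin] at h'
  rw [hb', hd, ← hδ, ← map_pow, algebraMap_smul] at h
  choose Q hQ hQ' using fun k => poly_pdecomp p (P k)
  set u : Fin p → L := fun i => ∑ k : Fin pb.dim, Q k i • pb.gen ^ (k : ℕ) with hu
  have hδL : algebraMap K[X] L δ ≠ 0 := by
    rw [IsScalarTower.algebraMap_apply K[X] (RatFunc K) L]
    simpa using hδ0
  have hua : ∀ i, δ • (u i / algebraMap K[X] L δ) = u i := fun i => by
    rw [Algebra.smul_def, mul_div_cancel₀ _ hδL]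
  refine ⟨fun i => u i / algebraMap K[X] L δ, ?_, fun i => ?_⟩
  · have h2 : δ ^ p • x = ∑ i : Fin p, (X : K[X]) ^ (i : ℕ) • u i ^ p := by
      rw [h]
      simp_rw [hu, sum_pow_char]
      simp_rw [_root_.smul_pow, Finset.smul_sum]
      rw [Finset.sum_comm]
      refine Finset.sum_congr rfl fun k _ => ?_
      conv_lhs => rw [hQ k, Finset.sum_smul]
      refine Finset.sum_congr rfl fun i _ => ?_
      rw [smul_smul, pb.basis_eq_pow]
    have h3 : algebraMap K[X] L δ ^ p * x = algebraMap K[X] L δ ^ p * ∑ i : Fin p, (X : K[X]) ^ (i : ℕ) • (u i / algebraMap K[X] L δ) ^ p := by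
      rw [← map_pow, ← Algebra.smul_def, h2, Finset.mul_sum]
      refine Finset.sum_congr rfl fun i _ => ?_
      rw [mul_smul_comm, div_pow, map_pow, mul_div_cancel₀ _ (pow_ne_zero _ hδL)]
    exact mul_left_cancel₀ (pow_ne_zero _ hδL) h3
  · rw [hua]
    refine Submodule.sum_mem _ fun k _ => ?_
    have h4 := pb_basis_mem pb N hθ k
    rw [pb.basis_eq_pow] at h4
    refine EL_smul _ h4 fun hne => ?_
    obtain ⟨h5, h6⟩ := hQ' k i hne
    have h7 := h' k h5
    have h8 : ((p : ℤ) * (Q k i).natDegree) ≤ (P k).natDegree := by exact_mod_cast h6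
    have h9 : (((N * (k : ℕ) : ℕ) : ℤ) + (Q k i).natDegree - c0) * p ≤ l := by
      push_cast [hc0] at h7 h8 ⊢
      have : (((p * N * pb.dim * (pb.dim - 1) : ℕ)) : ℤ) = p * ((N * pb.dim * (pb.dim - 1) : ℕ) : ℤ) := by push_cast; ring
      push_cast at this
      nlinarith
    have := (Int.le_ediv_iff_mul_le (by exact_mod_cast hp.pos)).2 h9
    omega
end PDec
end FilePE2

section FilePE3
open Polynomial
set_option linter.all false

section Der
variable {K L : Type*} [Field K] [Field L] [Algebra K L] [Algebra K[X] L] [Algebra (RatFunc K) L]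
  [IsScalarTower K K[X] L] [IsScalarTower K[X] (RatFunc K) L] [IsScalarTower K (RatFunc K) L]
  [FiniteDimensional (RatFunc K) L] [Algebra.IsSeparable (RatFunc K) L]

variable (K L) in
lemma exists_der : ∃ D : Derivation K L L, ∀ P : K[X], D (algebraMap K[X] L P) = algebraMap K[X] L (derivative P) := by
  haveI h1 : Algebra.FormallyEtale K[X] (RatFunc K) :=
    Algebra.FormallyEtale.of_isLocalization (nonZeroDivisors K[X])
  haveI h2 : Algebra.FormallyEtale (RatFunc K) L := Algebra.FormallyEtale.of_isSeparable _ _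
  haveI h3 : Algebra.FormallyEtale K[X] L := Algebra.FormallyEtale.comp K[X] (RatFunc K) L
  let l : KaehlerDifferential K K[X] →ₗ[K[X]] L :=
    (Algebra.linearMap K[X] L).comp (KaehlerDifferential.polynomialEquiv K).toLinearMap
  let g : KaehlerDifferential K L →ₗ[L] L :=
    (l.liftBaseChange L).comp (KaehlerDifferential.tensorKaehlerEquivOfFormallyEtale K K[X] L).symm.toLinearMap
  refine ⟨g.compDer (KaehlerDifferential.D K L), fun P => ?_⟩
  change g (KaehlerDifferential.D K L (algebraMap K[X] L P)) = _
  simp only [g, LinearMap.comp_apply, LinearEquiv.coe_coe]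
  rw [KaehlerDifferential.tensorKaehlerEquivOfFormallyEtale_symm_D_algebraMap]
  simp [l]

lemma der_pow_char (D : Derivation K L L) (p : ℕ) [CharP K p] (a : L) : D (a ^ p) = 0 := by
  haveI : CharP L p := charP_of_injective_algebraMap (algebraMap K L).injective p
  rw [Derivation.leibniz_pow]
  simp [CharP.cast_eq_zero]

lemma der_smul (D : Derivation K L L) (hD : ∀ P : K[X], D (algebraMap K[X] L P) = algebraMap K[X] L (derivative P))
    (P : K[X]) (x : L) : D (P • x) = P • D x + (derivative P) • x := by
  rw [Algebra.smul_def P x, D.leibniz, hD, Algebra.smul_def P, Algebra.smul_def (derivative P), smul_eq_mul, smul_eq_mul]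
  ring

variable (pb : PowerBasis (RatFunc K) L) (N : ℕ) (hθ : pb.gen ∈ EL K L N)
  (δ : K[X]) (hδ0 : δ ≠ 0) (hδ : algebraMap K[X] (RatFunc K) δ = Algebra.discr (RatFunc K) pb.basis)


lemma minpoly_coeff (l : ℤ) (x : L) (hx : x ∈ EL K L l) (i : ℕ) (hin : i ≤ (minpoly K[X] x).natDegree)
    (hi : (minpoly K[X] x).coeff i ≠ 0) :
    (((minpoly K[X] x).coeff i).natDegree : ℤ) ≤ l * ((minpoly K[X] x).natDegree - i : ℤ) := by
  have h1 := minpoly.isIntegrallyClosed_eq_field_fractions' (RatFunc K) (mem_EL.1 hx).1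
  have h2 := minpoly.isIntegrallyClosed_eq_field_fractions' (RatFunc K) (mem_EL.1 hx).2
  have h3 := IsIntegrallyClosed.minpoly_smul (R := RatFunc K) (X_zpow_ne (-l)) (Algebra.IsIntegral.isIntegral (R := RatFunc K) x)
  rw [h2, h1] at h3
  have h4 := congrArg (fun P : (RatFunc K)[X] => P.coeff i) h3
  have hinj : Function.Injective (algebraMap K[X] (RatFunc K)) := IsFractionRing.injective _ _
  simp only [coeff_map, coeff_scaleRoots, natDegree_map_eq_of_injective hinj] at h4
  have h5 : (RatFunc.X ^ (-(l * ((minpoly K[X] x).natDegree - i : ℤ))) : RatFunc K) *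
      algebraMap K[X] (RatFunc K) ((minpoly K[X] x).coeff i) ∈ Oinf K := by
    rw [mul_comm, show (RatFunc.X ^ (-(l * ((minpoly K[X] x).natDegree - i : ℤ))) : RatFunc K) =
      (RatFunc.X ^ (-l)) ^ ((minpoly K[X] x).natDegree - i) by
        rw [← zpow_natCast, ← zpow_mul]; congr 1; push_cast [hin]; ring, ← h4]
    exact Subtype.prop _
  rw [X_zpow_mul_mem] at h5
  rcases h5 with h5 | h5
  · simp [hi] at h5
  · rwa [RatFunc.intDegree_polynomial] at h5

include hδ in
lemma der_gen (D : Derivation K L L) (hθ : pb.gen ∈ EL K L N)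
    (hD : ∀ P : K[X], D (algebraMap K[X] L P) = algebraMap K[X] L (derivative P)) :
    δ • D pb.gen ∈ EL K L ((N * (pb.dim - 1) ^ 2 + N * pb.dim : ℕ) : ℤ) := by
  have hint := (mem_EL.1 hθ).1
  set P := minpoly K[X] pb.gen with hP
  have h1 := minpoly.isIntegrallyClosed_eq_field_fractions' (RatFunc K) hint
  have hinj : Function.Injective (algebraMap K[X] (RatFunc K)) := IsFractionRing.injective _ _
  have hdeg : P.natDegree = pb.dim := by
    rw [← pb.natDegree_minpoly, h1, natDegree_map_eq_of_injective hinj]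
  have hpos := pb.dim_pos
  have hco : ∀ i, i ≤ pb.dim → P.coeff i ≠ 0 → ((P.coeff i).natDegree : ℤ) ≤ N * (pb.dim - i : ℤ) := by
    intro i hi h
    have := minpoly_coeff N pb.gen hθ i (by rw [← hP, hdeg]; exact hi) h
    rwa [← hP, hdeg] at this
  have hpow : ∀ i : ℕ, pb.gen ^ i ∈ EL K L (i * N) := fun i => EL_pow hθ i
  -- z
  set z := aeval pb.gen (derivative P) with hz
  set y := ∑ i ∈ Finset.range (pb.dim + 1), derivative (P.coeff i) • pb.gen ^ i with hy
  have hzs : z = ∑ i ∈ Finset.range (pb.dim + 1), P.coeff i • ((i : K[X]) • pb.gen ^ (i - 1)) := by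
    rw [hz, derivative_apply, P.sum_over_range' (by simp) (pb.dim + 1) (by omega), map_sum]
    refine Finset.sum_congr rfl fun i _ => ?_
    simp [Algebra.smul_def, mul_assoc]
  have hzE : z ∈ EL K L (N * (pb.dim - 1 : ℕ)) := by
    rw [hzs]
    refine Submodule.sum_mem _ fun i hi => ?_
    have hi' : i ≤ pb.dim := by simpa [Nat.lt_succ_iff] using hi
    rcases Nat.eq_zero_or_pos i with rfl | hi0
    · simp
    have h6 : (i : K[X]) • pb.gen ^ (i - 1) ∈ EL K L ((i - 1 : ℕ) * N) :=
      EL_smul _ (hpow _) (by simp)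
    refine EL_smul _ h6 fun hne => ?_
    have := hco i hi' hne
    push_cast [hi0, hpos]
    nlinarith
  have hyE : y ∈ EL K L (N * pb.dim) := by
    refine Submodule.sum_mem _ fun i hi => ?_
    have hi' : i ≤ pb.dim := by simpa [Nat.lt_succ_iff] using hi
    refine EL_smul _ (hpow _) fun hne => ?_
    have hne' : P.coeff i ≠ 0 := by rintro h; simp [h] at hne
    have := hco i hi' hne'
    have h7 : ((derivative (P.coeff i)).natDegree : ℤ) ≤ (P.coeff i).natDegree := by
      exact_mod_cast (natDegree_derivative_le _).trans (Nat.sub_le _ _)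
    nlinarith
  have hzy : y + z * D pb.gen = 0 := by
    have h8 : aeval pb.gen P = 0 := minpoly.aeval _ _
    have h9 : D (aeval pb.gen P) = 0 := by rw [h8, map_zero]
    rw [aeval_eq_sum_range' (n := pb.dim + 1) (by omega), map_sum] at h9
    rw [← h9, hy, hzs, Finset.sum_mul, ← Finset.sum_add_distrib]
    refine Finset.sum_congr rfl fun i _ => ?_
    rw [der_smul D hD, D.leibniz_pow, add_comm]
    congr 1
    simp [Algebra.smul_def, mul_assoc]
  have hnorm : Algebra.norm (RatFunc K) z = (-1) ^ (pb.dim * (pb.dim - 1) / 2) * algebraMap K[X] (RatFunc K) δ := by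
    have := Algebra.discr_powerBasis_eq_norm (RatFunc K) pb
    rw [hδ, this, pb.finrank, ← mul_assoc, ← pow_add, ← two_mul, pow_mul]
    simp only [even_two, Even.neg_pow, one_pow, one_mul]
    rw [h1, derivative_map, aeval_map_algebraMap]
  have hδL : algebraMap K[X] L δ ≠ 0 := by
    rw [IsScalarTower.algebraMap_apply K[X] (RatFunc K) L, hδ]
    simpa using Algebra.discr_not_zero_of_basis (RatFunc K) pb.basis
  have hz0 : z ≠ 0 := by
    intro h
    rw [h, Algebra.norm_zero] at hnorm
    have := congrArg (algebraMap (RatFunc K) L) hnorm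
    rw [map_zero, map_mul, ← IsScalarTower.algebraMap_apply] at this
    simp [hδL] at this
  have hwE : algebraMap (RatFunc K) L (Algebra.norm (RatFunc K) z) / z ∈ EL K L (N * ((pb.dim - 1 : ℕ) : ℤ) ^ 2) := by
    rw [mem_EL]
    refine ⟨norm_div_integral (k0 := RatFunc K) z (mem_EL.1 hzE).1 hz0, ?_⟩
    have h10 := norm_div_integral (O := Oinf K) (k0 := RatFunc K) _ (mem_EL.1 hzE).2 (smul_ne_zero (X_zpow_ne _) hz0)
    convert! h10 using 1
    simp only [Algebra.smul_def]
    rw [map_mul, Algebra.norm_algebraMap, pb.finrank, map_mul]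
    rw [mul_div_mul_comm, ← map_div₀]
    congr 2
    rw [← zpow_natCast, ← zpow_mul, ← zpow_sub₀ RatFunc.X_ne_zero]
    congr 1
    push_cast [hpos]; ring
  have hfin : δ • D pb.gen = - ((-1) ^ (pb.dim * (pb.dim - 1) / 2) * (algebraMap (RatFunc K) L (Algebra.norm (RatFunc K) z) / z) * y) := by
    have h11 : D pb.gen = - (y / z) := by
      field_simp; linear_combination hzy
    have h12 : ((-1 : L) ^ (pb.dim * (pb.dim - 1) / 2)) * (-1 : L) ^ (pb.dim * (pb.dim - 1) / 2) = 1 := by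
      rw [← mul_pow]; simp
    rw [hnorm, map_mul, map_pow, map_neg, map_one, ← IsScalarTower.algebraMap_apply, h11, Algebra.smul_def]
    field_simp
    linear_combination y * h12
  rw [hfin, mul_assoc]
  refine Submodule.neg_mem _ ?_
  have h13 := EL_mul hwE hyE
  rcases neg_one_pow_eq_or L (pb.dim * (pb.dim - 1) / 2) with h | h
  · rw [h, one_mul]; exact_mod_cast h13
  · rw [h, neg_one_mul]; exact Submodule.neg_mem _ (by exact_mod_cast h13)

include hδ in
lemma der_bound (D : Derivation K L L) (hθ : pb.gen ∈ EL K L N)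
    (hD : ∀ P : K[X], D (algebraMap K[X] L P) = algebraMap K[X] L (derivative P))
    (hδd : δ.natDegree ≤ N * pb.dim * (pb.dim - 1)) (l : ℤ) (x : L) (hx : x ∈ EL K L l) :
    (δ ^ 2) • D x ∈ EL K L (l + (4 * N * pb.dim ^ 2 : ℕ)) := by
  obtain ⟨P, hP, hPd⟩ := disc_coord pb N hθ δ hδ l x hx
  have hg := der_gen pb N δ hδ D hθ hD
  obtain ⟨e', he'⟩ : ∃ e', pb.dim = e' + 1 := ⟨pb.dim - 1, by have := pb.dim_pos; omega⟩
  have hδd' : (δ.natDegree : ℤ) ≤ N * (e' + 1) * e' := by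
    rw [he', Nat.add_sub_cancel] at hδd; exact_mod_cast hδd
  have hN : (0 : ℤ) ≤ N := by positivity
  have he0 : (0 : ℤ) ≤ e' := by positivity
  have hNe : (0 : ℤ) ≤ N * e' := by positivity
  have hNee : (0 : ℤ) ≤ N * e' * e' := by positivity
  have hdd : ((derivative δ).natDegree : ℤ) ≤ δ.natDegree := by
    exact_mod_cast (natDegree_derivative_le _).trans (Nat.sub_le _ _)
  have e1 : (δ ^ 2) • D x = δ • D (δ • x) - δ • (derivative δ • x) := by
    rw [der_smul D hD, smul_add, add_sub_cancel_right, smul_smul, pow_two]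
  rw [e1]
  have hc : ((4 * N * pb.dim ^ 2 : ℕ) : ℤ) = 4 * N * (e' + 1) ^ 2 := by rw [he']; push_cast; ring
  rw [hc]
  refine Submodule.sub_mem _ ?_ ?_
  · rw [hP, map_sum, Finset.smul_sum]
    refine Submodule.sum_mem _ fun k _ => ?_
    by_cases hPk : P k = 0
    · simp [hPk]
    have h1 := hPd k hPk
    have he'' : ((N * pb.dim * (pb.dim - 1) : ℕ) : ℤ) = N * (e' + 1) * e' := by
      rw [he', Nat.add_sub_cancel]; push_cast; ring
    rw [he''] at h1
    push_cast at h1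
    have hk : ((k : ℕ) : ℤ) ≤ e' := by have := k.2; omega
    have hgp : ∀ i : ℕ, pb.gen ^ i ∈ EL K L (i * N) := fun i => EL_pow hθ i
    rw [der_smul D hD, smul_add]
    refine Submodule.add_mem _ ?_ ?_
    · have e2 : δ • P k • D (pb.gen ^ (k : ℕ)) = P k • (((k : ℕ) : K[X]) • pb.gen ^ ((k : ℕ) - 1) * δ • D pb.gen) := by
        rw [D.leibniz_pow]
        simp only [Algebra.smul_def, nsmul_eq_mul, smul_eq_mul, map_natCast]
        simp
        ring
      rw [e2]
      rcases Nat.eq_zero_or_pos (k : ℕ) with h0 | h0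
      · simp [h0]
      have h6 : ((k : ℕ) : K[X]) • pb.gen ^ ((k : ℕ) - 1) ∈ EL K L (((k : ℕ) - 1 : ℕ) * N) :=
        EL_smul _ (hgp _) (by simp)
      refine EL_smul _ (EL_mul h6 hg) fun _ => ?_
      have he3 : ((N * (pb.dim - 1) ^ 2 + N * pb.dim : ℕ) : ℤ) = N * e' ^ 2 + N * (e' + 1) := by
        rw [he', Nat.add_sub_cancel]; push_cast; ring
      rw [he3]
      push_cast [h0]
      nlinarith
    · rw [smul_smul]
      refine EL_smul _ (hgp _) fun hne => ?_
      have h2 : ((δ * derivative (P k)).natDegree : ℤ) ≤ δ.natDegree + (P k).natDegree := by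
        have := natDegree_mul_le (p := δ) (q := derivative (P k))
        have := (natDegree_derivative_le (P k)).trans (Nat.sub_le _ _)
        omega
      nlinarith
  · rw [smul_smul]
    refine EL_smul _ hx fun hne => ?_
    have h2 : ((δ * derivative δ).natDegree : ℤ) ≤ δ.natDegree + δ.natDegree := by
      have := natDegree_mul_le (p := δ) (q := derivative δ)
      omega
    nlinarith

end Der
end FilePE3

section FilePF
open Polynomial
set_option linter.all false

lemma eigen_split {K V σ : Type*} [Field K] [AddCommGroup V] [Module K V] (T : V →ₗ[K] V) (U : Submodule K V)
    (hU : ∀ v ∈ U, T v ∈ U) (μ : σ → K) (hμ : Function.Injective μ) (s : Finset σ) :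
    ∀ v : σ → V, (∀ i, T (v i) = μ i • v i) → ∑ i ∈ s, v i ∈ U → ∀ i ∈ s, v i ∈ U := by
  classical
  induction s using Finset.induction_on with
  | empty => simp
  | insert a s ha ih =>
    intro v hv hs
    have h1 : ∑ i ∈ s, (μ i - μ a) • v i ∈ U := by
      have : ∑ i ∈ s, (μ i - μ a) • v i = T (∑ i ∈ insert a s, v i) - μ a • ∑ i ∈ insert a s, v i := by
        rw [map_sum, Finset.smul_sum, ← Finset.sum_sub_distrib, Finset.sum_insert ha]
        simp_rw [hv, sub_smul]
        simp
      rw [this]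
      exact U.sub_mem (hU _ hs) (U.smul_mem _ hs)
    have h2 := ih (fun i => (μ i - μ a) • v i) (fun i => by rw [map_smul, hv, smul_comm]) h1
    have h3 : ∀ i ∈ s, v i ∈ U := by
      intro i hi
      have hne : μ i - μ a ≠ 0 := sub_ne_zero.2 fun h => ha (hμ h ▸ hi)
      exact (U.smul_mem_iff hne).1 (h2 i hi)
    intro i hi
    rcases Finset.mem_insert.1 hi with rfl | hi
    · rw [Finset.sum_insert ha] at hs
      exact (U.add_mem_iff_left (U.sum_mem h3)).1 hs
    · exact h3 i hi

lemma span_frob {L ι : Type*} [Field L] (p : ℕ) [Fact p.Prime] [CharP L p] (S : Set (ι → L)) (a : ι → L)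
    (ha : a ∈ Submodule.span L S) : a ^ p ∈ Submodule.span L ((fun z => z ^ p) '' S) := by
  induction ha using Submodule.span_induction with
  | mem x hx => exact Submodule.subset_span ⟨x, hx, rfl⟩
  | zero => rw [zero_pow (Fact.out : p.Prime).ne_zero]; exact Submodule.zero_mem _
  | add x y _ _ hx hy =>
    have : (x + y) ^ p = x ^ p + y ^ p := by ext i; simp [add_pow_char]
    rw [this]; exact Submodule.add_mem _ hx hy
  | smul c x _ hx =>
    have : (c • x) ^ p = c ^ p • x ^ p := by ext i; simp [mul_pow]
    rw [this]; exact Submodule.smul_mem _ _ hx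

lemma mem_of_frob_mem {L ι : Type*} [Field L] [Fintype ι] (p : ℕ) [Fact p.Prime] [CharP L p]
    (W : Submodule L (ι → L)) (z : ι → L)
    (h : z ^ p ∈ Submodule.span L ((fun z => z ^ p) '' (W : Set (ι → L)))) : z ∈ W := by
  classical
  by_contra hz
  obtain ⟨f, hf, hfz⟩ := Submodule.exists_le_ker_of_notMem hz
  have hfs : ∀ v, f v = ∑ i, v i * f (Pi.single i 1) := fun v => by
    conv_lhs => rw [pi_eq_sum_univ' v, map_sum]
    refine Finset.sum_congr rfl fun i _ => ?_
    rw [map_smul, smul_eq_mul]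
  have hk : ∀ v ∈ Submodule.span L ((fun z => z ^ p) '' (W : Set (ι → L))), ∑ i, v i * f (Pi.single i 1) ^ p = 0 := by
    intro v hv
    induction hv using Submodule.span_induction with
    | mem x hx =>
      obtain ⟨w, hw, rfl⟩ := hx
      have h1 : f w = 0 := hfz hw
      have : (∑ i, w i * f (Pi.single i 1)) ^ p = 0 := by
        rw [← hfs, h1, zero_pow (Fact.out : p.Prime).ne_zero]
      rw [sum_pow_char] at this
      simpa [mul_pow] using this
    | zero => simp
    | add x y _ _ hx hy => simp [add_mul, Finset.sum_add_distrib, hx, hy]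
    | smul c x _ hx => simp [mul_assoc, ← Finset.mul_sum, hx]
  have := hk _ h
  apply hf
  have h2 : (f z) ^ p = 0 := by
    rw [hfs z, sum_pow_char]; simpa [mul_pow] using this
  exact pow_eq_zero_iff (Fact.out : p.Prime).ne_zero |>.1 h2

/-- syzygies of the `q`-th powers -/
def Kq {L ι : Type*} [Field L] [Fintype ι] (h : ι → L) (q : ℕ) : Submodule L (ι → L) where
  carrier := {g | ∑ i, g i * h i ^ q = 0}
  add_mem' := by
    intro a b ha hb
    simp only [Set.mem_setOf_eq] at *
    simp [add_mul, Finset.sum_add_distrib, ha, hb]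
  zero_mem' := by simp
  smul_mem' := by
    intro c x hx
    simp only [Set.mem_setOf_eq] at *
    simp [mul_assoc, ← Finset.mul_sum, hx]

lemma mem_Kq {L ι : Type*} [Field L] [Fintype ι] {h : ι → L} {q : ℕ} {g : ι → L} :
    g ∈ Kq h q ↔ ∑ i, g i * h i ^ q = 0 := Iff.rfl

lemma Kq_frob {L ι : Type*} [Field L] [Fintype ι] (p : ℕ) [Fact p.Prime] [CharP L p] {h : ι → L} {q : ℕ} {g : ι → L}
    (hg : g ∈ Kq h q) : g ^ p ∈ Kq h (p * q) := by
  rw [mem_Kq] at *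
  have := congrArg (· ^ p) hg
  simp only [sum_pow_char, zero_pow (Fact.out : p.Prime).ne_zero] at this
  rw [← this]
  refine Finset.sum_congr rfl fun i _ => ?_
  rw [mul_pow, ← pow_mul, mul_comm q p]; rfl

section Descent
variable {K L : Type*} [Field K] [Field L] [Algebra K L] [Algebra K[X] L] [Algebra (RatFunc K) L]
  [IsScalarTower K K[X] L] [IsScalarTower K[X] (RatFunc K) L] [IsScalarTower K (RatFunc K) L]
  [FiniteDimensional (RatFunc K) L] [Algebra.IsSeparable (RatFunc K) L]
  (pb : PowerBasis (RatFunc K) L) (N : ℕ) (hθ : pb.gen ∈ EL K L N)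
  (δ : K[X]) (hδ0 : δ ≠ 0) (hδ : algebraMap K[X] (RatFunc K) δ = Algebra.discr (RatFunc K) pb.basis)
  (hδd : δ.natDegree ≤ N * pb.dim * (pb.dim - 1))
  (p : ℕ) [Fact p.Prime] [CharP K p] [PerfectRing K p]
  {ι : Type*} [Fintype ι] (h : ι → L) (d : ι → ℤ)

/-- eigenvector splitting for vectors over `L` -/
lemma pdec_split (D : Derivation K L L)
    (hD : ∀ P : K[X], D (algebraMap K[X] L P) = algebraMap K[X] L (derivative P))
    (U : Submodule L (ι → L)) (hU : ∀ v ∈ U, (fun i => D (v i)) ∈ U) (a : Fin p → ι → L)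
    (ha : ∑ i : Fin p, (X : K[X]) ^ (i : ℕ) • a i ^ p ∈ U) (i : Fin p) : a i ^ p ∈ U := by
  let T : (ι → L) →ₗ[K] (ι → L) :=
    { toFun := fun v j => algebraMap K[X] L X * D (v j)
      map_add' := fun x y => by ext j; simp [mul_add]
      map_smul' := fun c x => by ext j; simp }
  have hXL : algebraMap K[X] L X ≠ 0 := by
    rw [IsScalarTower.algebraMap_apply K[X] (RatFunc K) L]; simp [RatFunc.X_ne_zero]
  have := eigen_split T (U.restrictScalars K) (fun v hv => by
      have := U.smul_mem (algebraMap K[X] L X) (hU v hv)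
      exact this) (fun i : Fin p => ((i : ℕ) : K)) (fun i j hij => by
        have := (CharP.cast_eq_iff_mod_eq K p).1 hij
        rw [Nat.mod_eq_of_lt i.2, Nat.mod_eq_of_lt j.2] at this
        exact Fin.ext this) Finset.univ
      (fun i => (X : K[X]) ^ (i : ℕ) • a i ^ p) (fun i => by
        ext j
        simp only [T, LinearMap.coe_mk, AddHom.coe_mk, Pi.smul_apply, Pi.pow_apply]
        rw [der_smul D hD, der_pow_char D p, smul_zero, zero_add, ← Algebra.smul_def, smul_smul,
          derivative_X_pow, ← smul_assoc]
        congr 1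
        rcases Nat.eq_zero_or_pos (i : ℕ) with h0 | h0
        · simp [h0]
        · obtain ⟨r, hr⟩ : ∃ r, (i : ℕ) = r + 1 := ⟨(i : ℕ) - 1, by omega⟩
          rw [hr, Nat.add_sub_cancel, Polynomial.smul_eq_C_mul]; ring) ha i (Finset.mem_univ _)
  have h2 : (algebraMap K[X] L X) ^ (i : ℕ) • a i ^ p ∈ U := by
    have e : (algebraMap K[X] L X) ^ (i : ℕ) • a i ^ p = (X : K[X]) ^ (i : ℕ) • a i ^ p := by
      rw [← map_pow, algebraMap_smul]
    rw [e]; exact this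
  exact (U.smul_mem_iff (pow_ne_zero _ hXL)).1 h2

include hθ hδ0 hδ in
lemma pdec_vec (q m : ℤ) (v : ι → L) (hv : v ∈ ELn K L (fun i => (p : ℤ) * q * d i) m) :
    ∃ a : Fin p → ι → L, v = ∑ i : Fin p, (X : K[X]) ^ (i : ℕ) • a i ^ p ∧
      ∀ i, δ • a i ∈ ELn K L (fun i => q * d i) (m / p + ((N * pb.dim * (pb.dim - 1) : ℕ) : ℤ)) := by
  have hp : p.Prime := Fact.out
  rw [mem_ELn] at hv
  choose a ha ha' using fun j => disc_pdecomp pb N hθ δ hδ0 hδ p _ _ (hv j)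
  refine ⟨fun i j => a j i, ?_, fun i => ?_⟩
  · ext j
    rw [ha j]
    simp
  · rw [mem_ELn]
    intro j
    have := ha' j i
    rw [mul_assoc, Int.sub_mul_ediv_left _ _ (by exact_mod_cast hp.ne_zero)] at this
    convert! this using 2
    ring

lemma pdec_unique (u : Fin p → L) (hu : ∑ i : Fin p, (X : K[X]) ^ (i : ℕ) • u i ^ p = 0) (i : Fin p) : u i = 0 := by
  obtain ⟨D, hD⟩ := exists_der K L
  have := pdec_split (ι := Unit) p D hD ⊥ (fun v hv => by
    rw [Submodule.mem_bot] at hv ⊢; ext; simp [hv]) (fun i _ => u i) (by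
      rw [Submodule.mem_bot]; ext j; simpa using hu) i
  rw [Submodule.mem_bot] at this
  have := congrFun this ()
  simpa [(Fact.out : p.Prime).ne_zero] using this

variable (K) in
/-- bounded syzygies -/
def SS (q : ℕ) (m : ℤ) : Set (ι → L) := {v | v ∈ Kq h q ∧ v ∈ ELn K L (fun i => (q : ℤ) * d i) m}

include hθ hδ hδd in
lemma descent_D (m G : ℤ) (hG : ((4 * N * pb.dim ^ 2 : ℕ) : ℤ) ≤ G) (hδ0 : δ ≠ 0)
    (hgap : SS K h d p (m + G) ⊆ Submodule.span L (SS K h d p m)) (D : Derivation K L L)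
    (hD : ∀ P : K[X], D (algebraMap K[X] L P) = algebraMap K[X] L (derivative P)) :
    ∀ v ∈ Submodule.span L (SS K h d p m), (fun i => D (v i)) ∈ Submodule.span L (SS K h d p m) := by
  have hδL : algebraMap K[X] L δ ≠ 0 := by
    rw [IsScalarTower.algebraMap_apply K[X] (RatFunc K) L]
    simpa using hδ0
  intro v hv
  induction hv using Submodule.span_induction with
  | mem v hv =>
    obtain ⟨h1, h2⟩ := hv
    have h3 : (δ ^ 2) • (fun i => D (v i)) ∈ SS K h d p (m + G) := by
      constructor
      · rw [mem_Kq] at h1 ⊢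
        have h4 := congrArg D h1
        rw [map_sum, map_zero] at h4
        simp only [Pi.smul_apply, smul_mul_assoc, ← Finset.smul_sum]
        rw [← smul_zero (δ ^ 2), ← h4]
        congr 1
        refine Finset.sum_congr rfl fun i _ => ?_
        rw [D.leibniz, der_pow_char, smul_zero, zero_add, smul_eq_mul, mul_comm]
      · rw [mem_ELn] at h2 ⊢
        intro i
        have := der_bound pb N δ hδ D hθ hD hδd _ _ (h2 i)
        exact EL_mono (by omega) this
    have h5 := hgap h3
    have e : (δ ^ 2) • (fun i => D (v i)) = (algebraMap K[X] L δ ^ 2) • (fun i => D (v i)) := by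
      rw [← map_pow, algebraMap_smul]
    rw [e] at h5
    exact (Submodule.smul_mem_iff _ (pow_ne_zero _ hδL)).1 h5
  | zero =>
    have : (fun i : ι => D ((0 : ι → L) i)) = 0 := by ext; simp
    rw [this]; exact Submodule.zero_mem _
  | add x y _ _ hx hy =>
    have : (fun i : ι => D ((x + y) i)) = (fun i => D (x i)) + (fun i => D (y i)) := by ext; simp
    rw [this]; exact Submodule.add_mem _ hx hy
  | smul c x hx' hx =>
    have : (fun i : ι => D ((c • x) i)) = c • (fun i => D (x i)) + D c • x := by ext; simp [mul_comm]
    rw [this]; exact Submodule.add_mem _ (Submodule.smul_mem _ _ hx) (Submodule.smul_mem _ _ hx')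

include hθ hδ0 hδ hδd in
theorem descent (k : ℕ) : ∀ (m G : ℤ),
    (p : ℤ) ^ k * ((4 * N * pb.dim ^ 2 : ℕ) + 2 * (N * pb.dim * (pb.dim - 1) : ℕ)) - 2 * (N * pb.dim * (pb.dim - 1) : ℕ) ≤ G →
    SS K h d (p ^ (k + 1)) (m + G) ⊆ Submodule.span L (SS K h d (p ^ (k + 1)) m) →
    SS K h d (p ^ (k + 1)) m ⊆ Submodule.span L ((fun z => z ^ (p ^ (k + 1))) '' {z | z ^ (p ^ (k + 1)) ∈
        Submodule.span L (SS K h d (p ^ (k + 1)) m)}) := by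
  have hp : p.Prime := Fact.out
  haveI : CharP L p := charP_of_injective_algebraMap (algebraMap K L).injective p
  have hδL : algebraMap K[X] L δ ≠ 0 := by
    rw [IsScalarTower.algebraMap_apply K[X] (RatFunc K) L]
    simpa using hδ0
  have hsmul : ∀ (P : K[X]) (a : ι → L), P • a = algebraMap K[X] L P • a := fun P a => by rw [algebraMap_smul]
  induction k with
  | zero =>
    intro m G hG hgap v hv
    obtain ⟨D, hD⟩ := exists_der K L
    simp only [zero_add, pow_one, pow_zero, one_mul] at *
    have hst := descent_D pb N hθ δ hδ hδd p h d m G (by omega) hδ0 hgap D hD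
    obtain ⟨a, ha, -⟩ := pdec_vec pb N hθ δ hδ0 hδ p d 1 m v (by simpa using hv.2)
    have h1 := pdec_split p D hD _ hst a (ha ▸ Submodule.subset_span hv)
    rw [ha]
    refine Submodule.sum_mem _ fun i _ => ?_
    rw [hsmul]
    exact Submodule.smul_mem _ _ (Submodule.subset_span ⟨a i, h1 i, rfl⟩)
  | succ k ih =>
    intro m G hG hgap v hv
    set c0 : ℤ := ((N * pb.dim * (pb.dim - 1) : ℕ) : ℤ) with hc0
    set c : ℤ := ((4 * N * pb.dim ^ 2 : ℕ) : ℤ) with hc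
    set m1 := m / p + c0 with hm1
    set H := (p : ℤ) ^ k * (c + 2 * c0) - 2 * c0 with hH
    have hp2 : (2 : ℤ) ≤ p := by exact_mod_cast hp.two_le
    have hc0' : 0 ≤ c0 := by positivity
    have hH0 : 0 ≤ H := by
      have h1 : (1 : ℤ) ≤ (p : ℤ) ^ k := one_le_pow₀ (by omega)
      have h2 : 0 ≤ c := by positivity
      nlinarith
    have hmp : (p : ℤ) * m1 ≤ m + p * c0 := by
      have := Int.mul_ediv_self_le (x := m) (k := (p : ℤ)) (by omega)
      rw [hm1]; linarith
    have hG' : p * c0 + p * H ≤ G := by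
      refine le_trans ?_ hG
      rw [hH, pow_succ]
      nlinarith
    have hqq : p ^ (k + 1 + 1) = p * p ^ (k + 1) := by rw [pow_succ]; ring
    set q' := p ^ (k + 1) with hq'
    set W := Submodule.span L (SS K h d (p ^ (k + 1 + 1)) m) with hW
    set W1 := Submodule.span L (SS K h d q' m1) with hW1
    -- Frobenius of bounded elements
    have hfrob : ∀ (l : ℤ) (z : ι → L), z ∈ SS K h d q' l → z ^ p ∈ SS K h d (p ^ (k + 1 + 1)) (p * l) := by
      intro l z hz
      refine ⟨by rw [hqq]; exact Kq_frob p hz.1, ?_⟩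
      rw [mem_ELn]
      intro i
      have := EL_pow ((mem_ELn.1 hz.2) i) p
      convert! this using 2
      rw [hqq]; push_cast; ring
    have hmonoSS : ∀ (q : ℕ) (l l' : ℤ), l ≤ l' → SS K h d q l ⊆ SS K h d q l' := fun q l l' hl z hz =>
      ⟨hz.1, ELn_mono _ hl hz.2⟩
    have hFW : ∀ z ∈ W1, z ^ p ∈ W := by
      intro z hz
      refine Submodule.span_le.2 ?_ (span_frob p _ z hz)
      rintro _ ⟨z, hz, rfl⟩
      refine hgap (hmonoSS _ _ _ ?_ (hfrob _ z hz))
      nlinarith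
    have hdec : ∀ v ∈ SS K h d (p ^ (k + 1 + 1)) m, ∃ a : Fin p → ι → L, v = ∑ i : Fin p, (X : K[X]) ^ (i : ℕ) • a i ^ p ∧
        ∀ i, a i ∈ W1 := by
      intro v hv
      obtain ⟨a, ha, ha'⟩ := pdec_vec pb N hθ δ hδ0 hδ p d (q' : ℤ) m v (by
        have := hv.2
        rw [hqq] at this; push_cast at this; exact_mod_cast this)
      refine ⟨a, ha, fun i => ?_⟩
      have h1 : a i ∈ Kq h q' := by
        rw [mem_Kq]
        refine pdec_unique (K := K) p (fun i => ∑ j, a i j * h j ^ q') ?_ i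
        have h2 := mem_Kq.1 hv.1
        rw [← h2, ha]
        simp only [sum_pow_char, Finset.sum_apply, Pi.smul_apply, Pi.pow_apply, Finset.smul_sum, Finset.sum_mul]
        rw [Finset.sum_comm]
        refine Finset.sum_congr rfl fun j _ => Finset.sum_congr rfl fun i _ => ?_
        rw [mul_pow, smul_mul_assoc, ← pow_mul, hqq, mul_comm q' p]
      have h3 : δ • a i ∈ W1 := by
        refine Submodule.subset_span ⟨?_, ha' i⟩
        rw [hsmul]; exact Submodule.smul_mem _ _ h1
      rw [hsmul] at h3
      exact (Submodule.smul_mem_iff _ hδL).1 h3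
    have hWF : W ≤ Submodule.span L ((fun z => z ^ p) '' (W1 : Set (ι → L))) := by
      refine Submodule.span_le.2 fun v hv => ?_
      obtain ⟨a, ha, ha'⟩ := hdec v hv
      rw [ha]
      refine Submodule.sum_mem _ fun i _ => ?_
      rw [hsmul]
      exact Submodule.smul_mem _ _ (Submodule.subset_span ⟨a i, ha' i, rfl⟩)
    have hgap1 : SS K h d q' (m1 + H) ⊆ W1 := by
      intro z hz
      apply mem_of_frob_mem p W1 z
      apply hWF
      refine hgap (hmonoSS _ _ _ ?_ (hfrob _ z hz))
      nlinarith
    have hih := ih m1 H le_rfl hgap1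
    have hW1Z : W1 ≤ Submodule.span L ((fun z => z ^ q') '' {z | z ^ q' ∈ W1}) := Submodule.span_le.2 hih
    obtain ⟨a, ha, ha'⟩ := hdec v hv
    rw [ha]
    refine Submodule.sum_mem _ fun i _ => ?_
    rw [hsmul]
    refine Submodule.smul_mem _ _ ?_
    refine Submodule.span_mono ?_ (span_frob p _ _ (hW1Z (ha' i)))
    rintro _ ⟨_, ⟨z, hz, rfl⟩, rfl⟩
    have e : (z ^ q') ^ p = z ^ p ^ (k + 1 + 1) := by rw [← pow_mul, hqq, mul_comm]
    refine ⟨z, ?_, e.symm⟩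
    show z ^ p ^ (k + 1 + 1) ∈ W
    rw [← e]
    exact hFW _ hz
end Descent
end FilePF

section FilePF2
set_option linter.all false
open Polynomial

lemma GoodFilt.IsRed.restrict {K V : Type*} [Field K] [AddCommGroup V] [Module K V] [Module K[X] V] [Module (RatFunc K) V]
    [IsScalarTower K K[X] V] [IsScalarTower K[X] (RatFunc K) V] [IsScalarTower K (RatFunc K) V]
    {E : ℤ → Submodule K V} {W : Submodule (RatFunc K) V} {t r : ℕ} {e : Fin (t + r) → V} {b : Fin (t + r) → ℤ}
    (hr : GoodFilt.IsRed E W e b) :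
    GoodFilt.IsRed E (Submodule.span (RatFunc K) (Set.range (fun i => e (Fin.castAdd r i))))
      (fun i => e (Fin.castAdd r i)) (fun i => b (Fin.castAdd r i)) where
  li := hr.li.comp _ (Fin.castAdd_injective t r)
  span := rfl
  mem := fun j => hr.mem _
  key := by
    intro a l hl
    let a' : Fin (t + r) → RatFunc K := Fin.append a (fun _ => 0)
    have h1 : ∑ j, a' j • e j = ∑ j, a j • e (Fin.castAdd r j) := by
      rw [Fin.sum_univ_add]; simp [a']
    obtain ⟨P, hP, hP2⟩ := hr.key a' l (by rw [h1]; exact hl)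
    refine ⟨fun j => P (Fin.castAdd r j), fun j => ?_, fun j hj => hP2 _ hj⟩
    have := hP (Fin.castAdd r j)
    simpa [a'] using this
  mono := fun i j hij => hr.mono (show (Fin.castAdd r i : ℕ) ≤ (Fin.castAdd r j : ℕ) from hij)

lemma index_of_span {K L : Type*} [Field K] [Field L] [Algebra K L] [Algebra K[X] L] [Algebra (RatFunc K) L]
    [IsScalarTower K K[X] L] [IsScalarTower K[X] (RatFunc K) L] [IsScalarTower K (RatFunc K) L]
    [FiniteDimensional (RatFunc K) L] [Algebra.IsSeparable (RatFunc K) L] {ι : Type*} [Fintype ι] [DecidableEq ι]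
    [IsAlgClosed K] (q : ℕ) (hq : 0 < q) (φ : L →+* L) (hφ : ∀ x, φ x = x ^ q) (d : ι → ℤ)
    (W : Submodule L (ι → L)) (hW : W ≤ Submodule.span L ((fun z => z ^ q) '' {z | z ^ q ∈ W}))
    {ν n0 : ℕ} (e : Fin ν → ι → L) (b : Fin ν → ℤ)
    (hr : GoodFilt.IsRed (ELn K L (fun i => q * d i)) (W.restrictScalars (RatFunc K)) e b)
    (τ : Fin n0 → L) (c : Fin n0 → ℤ) (hτ : GoodFilt.IsRed (EL K L) ⊤ τ c) :
    (q : ℤ) ∣ ∑ j, b j - (Module.finrank L W : ℤ) * ∑ a, c a ∧ ν = Module.finrank L W * n0 := by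
  classical
  set T : Set (ι → L) := (fun z => z ^ q) '' {z | z ^ q ∈ W} with hT
  obtain ⟨B, hBT, hBs, hBli⟩ := exists_linearIndependent L T
  have hspan : Submodule.span L B = W := by
    rw [hBs]
    refine le_antisymm (Submodule.span_le.2 ?_) hW
    rintro _ ⟨z, hz, rfl⟩
    exact hz
  haveI : Finite B := hBli.finite
  haveI : Fintype B := Fintype.ofFinite B
  have hcard : Fintype.card B = Module.finrank L W := by
    rw [← hspan]
    have := finrank_span_eq_card hBli
    rw [Subtype.range_coe] at this
    exact this.symm
  let σ : Fin (Module.finrank L W) ≃ B := (finCongr hcard.symm).trans (Fintype.equivFin B).symm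
  have hg' : ∀ l : Fin (Module.finrank L W), ∃ z : ι → L, z ^ q = (σ l : ι → L) := fun l => by
    obtain ⟨z, -, hz⟩ := hBT (σ l).2
    exact ⟨z, hz⟩
  choose g hg using hg'
  have hg2 : ∀ l i, φ (g l i) = (σ l : ι → L) i := fun l i => by rw [hφ, ← hg]; rfl
  have hli2 : LinearIndependent L (fun l => ((σ l : B) : ι → L)) := hBli.comp _ σ.injective
  have hgli : LinearIndependent L g := by
    rw [Fintype.linearIndependent_iff] at hli2 ⊢
    intro x hx l
    have h1 := hli2 (fun l => φ (x l)) (by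
      ext i
      have h2 := congrArg φ (congrFun hx i)
      simp only [Finset.sum_apply, Pi.smul_apply, smul_eq_mul, map_sum, map_mul, hg2, Pi.zero_apply, map_zero] at h2 ⊢
      exact h2) l
    exact (map_eq_zero φ).1 h1
  refine index_thm q hq φ hφ d g hgli (W.restrictScalars (RatFunc K)) ?_ e b hr τ c hτ
  intro v
  have h3 : Set.range (fun l => ((σ l : B) : ι → L)) = B := by
    ext x; constructor
    · rintro ⟨l, rfl⟩; exact (σ l).2
    · intro hx; exact ⟨σ.symm ⟨x, hx⟩, by simp⟩
  rw [Submodule.restrictScalars_mem]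
  conv_lhs => rw [← hspan, ← h3]
  rw [Submodule.mem_span_range_iff_exists_fun]
  refine exists_congr fun x => ?_
  have h4 : (fun i => ∑ l, x l * φ (g l i)) = ∑ l, x l • ((σ l : B) : ι → L) := by
    ext i; simp [hg2]
  rw [h4]
  exact eq_comm

section Cluster
variable {K L : Type*} [Field K] [Field L] [Algebra K L] [Algebra K[X] L] [Algebra (RatFunc K) L]
  [IsScalarTower K K[X] L] [IsScalarTower K[X] (RatFunc K) L] [IsScalarTower K (RatFunc K) L]
  [FiniteDimensional (RatFunc K) L] [Algebra.IsSeparable (RatFunc K) L] [IsAlgClosed K]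
  (pb : PowerBasis (RatFunc K) L) (N : ℕ) (hθ : pb.gen ∈ EL K L N)
  (p : ℕ) [Fact p.Prime] [CharP K p]
  {ι : Type*} [Fintype ι] [DecidableEq ι] (h : ι → L) (d : ι → ℤ)

include hθ in
lemma cluster_low (k : ℕ) {t r n0 : ℕ} (ht : 0 < t) (hr0 : 0 < r) {e : Fin (t + r) → ι → L} {b : Fin (t + r) → ℤ}
    (hr : GoodFilt.IsRed (ELn K L (fun i => (p ^ (k + 1) : ℕ) * d i))
      ((Kq h (p ^ (k + 1))).restrictScalars (RatFunc K)) e b)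
    (hgap : b ⟨t - 1, by omega⟩ + ((p : ℤ) ^ k * ((4 * N * pb.dim ^ 2 : ℕ) + 2 * (N * pb.dim * (pb.dim - 1) : ℕ))
        - 2 * (N * pb.dim * (pb.dim - 1) : ℕ)) < b ⟨t, by omega⟩)
    (τ : Fin n0 → L) (c : Fin n0 → ℤ) (hτ : GoodFilt.IsRed (EL K L) ⊤ τ c) :
    ∃ ρ : ℕ, ((p ^ (k + 1) : ℕ) : ℤ) ∣ ∑ j : Fin t, b (Fin.castAdd r j) - ρ * ∑ a, c a ∧ t = ρ * n0 := by
  classical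
  obtain ⟨δ, hδ0, hδ, hδd⟩ := exists_disc pb N hθ
  have hp : p.Prime := Fact.out
  haveI : CharP L p := charP_of_injective_algebraMap (algebraMap K L).injective p
  set H : ℤ := (p : ℤ) ^ k * ((4 * N * pb.dim ^ 2 : ℕ) + 2 * (N * pb.dim * (pb.dim - 1) : ℕ))
        - 2 * (N * pb.dim * (pb.dim - 1) : ℕ) with hH
  set m : ℤ := b ⟨t - 1, by omega⟩ with hm
  set q : ℕ := p ^ (k + 1) with hq
  have hq0 : 0 < q := pow_pos hp.pos _
  have hdim : 1 ≤ pb.dim := pb.dim_pos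
  have hNH : (N : ℤ) ≤ H := by
    have h1 : (1 : ℤ) ≤ (p : ℤ) ^ k := by exact_mod_cast Nat.one_le_pow _ _ hp.pos
    have h2 : (N : ℤ) ≤ (4 * N * pb.dim ^ 2 : ℕ) := by
      have : N * 1 ≤ N * (4 * pb.dim ^ 2) := Nat.mul_le_mul_left _ (by nlinarith)
      exact_mod_cast (by nlinarith)
    have h3 : (0 : ℤ) ≤ (4 * N * pb.dim ^ 2 : ℕ) + 2 * (N * pb.dim * (pb.dim - 1) : ℕ) := by positivity
    nlinarith
  set W' := Submodule.span (RatFunc K) (Set.range (fun i => e (Fin.castAdd r i))) with hW'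
  have ha : ∀ m' : ℤ, m' < b ⟨t, by omega⟩ → SS K h d q m' ⊆ W' := by
    rintro m' hm' v ⟨hv1, hv2⟩
    obtain ⟨P, rfl, hP⟩ := hr.exists_poly m' v hv1 hv2
    refine Submodule.sum_mem _ fun j _ => ?_
    by_cases hPj : P j = 0
    · simp [hPj]
    · have h1 := hP j hPj
      have hjt : (j : ℕ) < t := by
        by_contra hcon
        have h2 : b ⟨t, by omega⟩ ≤ b j := hr.mono (show t ≤ (j : ℕ) by omega)
        omega
      rw [← algebraMap_smul (RatFunc K)]
      refine Submodule.smul_mem _ _ (Submodule.subset_span ⟨⟨j, hjt⟩, ?_⟩)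
      rfl
  have hb : ∀ v ∈ W', pb.gen • v ∈ W' := by
    intro v hv
    induction hv using Submodule.span_induction with
    | mem v hv =>
      obtain ⟨j, rfl⟩ := hv
      refine ha (m + N) (by omega) ⟨?_, ?_⟩
      · refine Submodule.smul_mem _ _ ?_
        have : e (Fin.castAdd r j) ∈ (Kq h q).restrictScalars (RatFunc K) := by
          rw [← hr.span]; exact Submodule.subset_span ⟨_, rfl⟩
        exact this
      · rw [mem_ELn]
        intro i
        have h1 := mem_ELn.1 (hr.mem (Fin.castAdd r j)) i
        have h2 : b (Fin.castAdd r j) ≤ m := hr.mono (show (j : ℕ) ≤ t - 1 by have := j.2; omega)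
        exact EL_mono (by omega) (EL_mul hθ h1)
    | zero => simp
    | add x y _ _ hx hy => rw [smul_add]; exact W'.add_mem hx hy
    | smul a x _ hx => rw [smul_comm]; exact W'.smul_mem _ hx
  have hc : ∀ (x : L), ∀ v ∈ W', x • v ∈ W' := by
    intro x
    have hx : x ∈ Algebra.adjoin (RatFunc K) {pb.gen} := by rw [pb.adjoin_gen_eq_top]; trivial
    induction hx using Algebra.adjoin_induction with
    | mem x hx => rw [Set.mem_singleton_iff] at hx; subst hx; exact hb
    | algebraMap a => intro v hv; rw [algebraMap_smul]; exact W'.smul_mem _ hv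
    | add x y _ _ hx hy => intro v hv; rw [add_smul]; exact W'.add_mem (hx v hv) (hy v hv)
    | mul x y _ _ hx hy => intro v hv; rw [mul_smul]; exact hx _ (hy v hv)
  have hmH : m + H < b ⟨t, by omega⟩ := hgap
  have hWL : (Submodule.span L (SS K h d q m)).restrictScalars (RatFunc K) = W' := by
    apply le_antisymm
    · intro v hv
      rw [Submodule.restrictScalars_mem] at hv
      induction hv using Submodule.span_induction with
      | mem v hv => exact ha m (by omega) hv
      | zero => simp
      | add x y _ _ hx hy => exact W'.add_mem hx hy
      | smul a x _ hx => exact hc _ _ hx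
    · rw [hW', Submodule.span_le]
      rintro _ ⟨j, rfl⟩
      refine Submodule.subset_span ⟨?_, ?_⟩
      · have : e (Fin.castAdd r j) ∈ (Kq h q).restrictScalars (RatFunc K) := by
          rw [← hr.span]; exact Submodule.subset_span ⟨_, rfl⟩
        exact this
      · exact ELn_mono _ (hr.mono (show (j : ℕ) ≤ t - 1 by have := j.2; omega)) (hr.mem (Fin.castAdd r j))
  have hdesc := descent pb N hθ δ hδ0 hδ (by exact_mod_cast hδd) p h d k m H le_rfl (by
    intro v hv
    have := ha (m + H) hmH hv
    rw [← hWL] at this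
    exact this)
  have hr' := hr.restrict (t := t) (r := r)
  rw [← hW', ← hWL] at hr'
  obtain ⟨h1, h2⟩ := index_of_span q hq0 (iterateFrobenius L p (k + 1)) (fun x => by rw [iterateFrobenius_def]) d
    (Submodule.span L (SS K h d q m)) (Submodule.span_le.2 hdesc) _ _ hr' τ c hτ
  exact ⟨_, h1, h2⟩

lemma Kq_span {L ι : Type*} [Field L] [Fintype ι] [DecidableEq ι] (p : ℕ) [Fact p.Prime] [CharP L p] (h : ι → L)
    (i0 : ι) (hi0 : h i0 ≠ 0) (k : ℕ) :
    Kq h (p ^ k) ≤ Submodule.span L ((fun z => z ^ (p ^ k)) '' {z | z ^ (p ^ k) ∈ Kq h (p ^ k)}) := by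
  have hp : p.Prime := Fact.out
  set q := p ^ k with hq
  have hq0 : q ≠ 0 := (pow_pos hp.pos _).ne'
  intro v hv
  rw [mem_Kq] at hv
  let z : ι → ι → L := fun j => h i0 • Pi.single j 1 - h j • Pi.single i0 1
  have hz : ∀ j i, (z j ^ q) i = h i0 ^ q * (if i = j then 1 else 0) - h j ^ q * (if i = i0 then 1 else 0) := by
    intro j i
    have : (z j ^ q) i = (h i0 * (Pi.single j 1 : ι → L) i - h j * (Pi.single i0 1 : ι → L) i) ^ q := rfl
    rw [this, hq, sub_pow_char_pow, mul_pow, mul_pow, ← hq, Pi.single_apply, Pi.single_apply]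
    congr 2 <;> split_ifs <;> simp [hq0]
  have hzK : ∀ j, z j ^ q ∈ Kq h q := by
    intro j
    rw [mem_Kq]
    simp only [hz, sub_mul, Finset.sum_sub_distrib, mul_ite, mul_one, mul_zero, ite_mul, zero_mul]
    simp [mul_comm]
  have hv2 : v = ∑ j, (v j / h i0 ^ q) • z j ^ q := by
    ext i
    simp only [Finset.sum_apply, Pi.smul_apply, hz, smul_eq_mul, mul_sub, Finset.sum_sub_distrib]
    have hne : h i0 ^ q ≠ 0 := pow_ne_zero _ hi0
    have e1 : ∑ j, v j / h i0 ^ q * (h i0 ^ q * if i = j then 1 else 0) = v i := by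
      rw [Finset.sum_eq_single i (fun j _ hj => by simp [hj.symm]) (by simp)]
      field_simp; simp
    have e2 : ∑ j, v j / h i0 ^ q * (h j ^ q * if i = i0 then 1 else 0) = 0 := by
      have : ∀ j, v j / h i0 ^ q * (h j ^ q * if i = i0 then 1 else 0) = (v j * h j ^ q) * ((if i = i0 then 1 else 0) / h i0 ^ q) :=
        fun j => by ring
      simp only [this, ← Finset.sum_mul, hv, zero_mul]
    rw [e1, e2, sub_zero]
  rw [hv2]
  exact Submodule.sum_mem _ fun j _ => Submodule.smul_mem _ _ (Submodule.subset_span ⟨_, hzK j, rfl⟩)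

lemma Kq_finrank {L ι : Type*} [Field L] [Fintype ι] [DecidableEq ι] (h : ι → L)
    (i0 : ι) (hi0 : h i0 ≠ 0) (q : ℕ) : Module.finrank L (Kq h q) + 1 = Fintype.card ι := by
  let f : Module.Dual L (ι → L) := ∑ i, (h i ^ q) • LinearMap.proj (R := L) (φ := fun _ : ι => L) i
  have hf : ∀ v, f v = ∑ i, v i * h i ^ q := by
    intro v; simp [f, mul_comm]
  have h1 : Kq h q = LinearMap.ker f := by
    ext v; rw [mem_Kq, LinearMap.mem_ker, hf]
  have h2 : f ≠ 0 := by
    intro h0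
    have := congrArg (fun g => g (Pi.single i0 1)) h0
    simp only [hf, LinearMap.zero_apply] at this
    rw [Finset.sum_eq_single i0 (fun j _ hj => by simp [hj]) (by simp)] at this
    simp [hi0] at this
  rw [h1, Module.Dual.finrank_ker_add_one_of_ne_zero h2, Module.finrank_fintype_fun_eq_card]

/-- combinatorial: top cluster of a finite monotone integer sequence -/
lemma top_cluster {ν : ℕ} (hν : 0 < ν) (b : Fin ν → ℤ) (H : ℤ) :
    ∃ t : ℕ, ∃ ht : t < ν, (∀ _ : 0 < t, b ⟨t - 1, by omega⟩ + H < b ⟨t, ht⟩) ∧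
      b ⟨ν - 1, by omega⟩ - b ⟨t, ht⟩ ≤ (ν - 1 - t : ℤ) * H := by
  classical
  have hex : ∃ t : ℕ, ∃ ht : t < ν, b ⟨ν - 1, by omega⟩ - b ⟨t, ht⟩ ≤ (ν - 1 - t : ℤ) * H := by
    refine ⟨ν - 1, by omega, ?_⟩
    have : ((ν - 1 : ℕ) : ℤ) = ν - 1 := by omega
    rw [this]; simp
  obtain ⟨ht, h1⟩ := Nat.find_spec hex
  refine ⟨Nat.find hex, ht, fun h0 => ?_, h1⟩
  have h2 := Nat.find_min hex (m := Nat.find hex - 1) (by omega)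
  push Not at h2
  have h3 := h2 (by omega)
  have h4 : ((Nat.find hex - 1 : ℕ) : ℤ) = (Nat.find hex : ℤ) - 1 := by omega
  rw [h4] at h3
  nlinarith

include hθ in
/-- The main numerical outcome for the curve data. -/
theorem cluster_main (i0 : ι) (hi0 : h i0 ≠ 0) (k : ℕ) {ν n0 : ℕ} {e : Fin ν → ι → L} {b : Fin ν → ℤ}
    (hr : GoodFilt.IsRed (ELn K L (fun i => (p ^ (k + 1) : ℕ) * d i))
      ((Kq h (p ^ (k + 1))).restrictScalars (RatFunc K)) e b)
    (τ : Fin n0 → L) (c : Fin n0 → ℤ) (hτ : GoodFilt.IsRed (EL K L) ⊤ τ c) :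
    ν = (Fintype.card ι - 1) * n0 ∧
    ((p ^ (k + 1) : ℕ) : ℤ) ∣ ∑ j, b j - (Fintype.card ι - 1 : ℕ) * ∑ a, c a ∧
    ∀ hν : 0 < ν, ∃ (z : ℤ) (r : ℕ), 1 ≤ r ∧ r ≤ ν ∧
      |(r : ℤ) * b ⟨ν - 1, by omega⟩ - (p ^ (k + 1) : ℕ) * z| ≤
        (ν : ℤ) ^ 2 * ((p : ℤ) ^ k * ((4 * N * pb.dim ^ 2 : ℕ) + 2 * (N * pb.dim * (pb.dim - 1) : ℕ)))
          + ν * |∑ a, c a| := by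
  classical
  have hp : p.Prime := Fact.out
  haveI : CharP L p := charP_of_injective_algebraMap (algebraMap K L).injective p
  have hfr := Kq_finrank h i0 hi0 (p ^ (k + 1))
  have hfr' : Module.finrank L (Kq h (p ^ (k + 1))) = Fintype.card ι - 1 := by omega
  obtain ⟨hA, hB⟩ := index_of_span (p ^ (k + 1)) (pow_pos hp.pos _) (iterateFrobenius L p (k + 1))
    (fun x => by rw [iterateFrobenius_def]) d _ (Kq_span p h i0 hi0 (k + 1)) e b hr τ c hτ
  rw [hfr'] at hA hB
  refine ⟨hB, hA, fun hν => ?_⟩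
  set H : ℤ := (p : ℤ) ^ k * ((4 * N * pb.dim ^ 2 : ℕ) + 2 * (N * pb.dim * (pb.dim - 1) : ℕ))
        - 2 * (N * pb.dim * (pb.dim - 1) : ℕ) with hH
  set H' : ℤ := (p : ℤ) ^ k * ((4 * N * pb.dim ^ 2 : ℕ) + 2 * (N * pb.dim * (pb.dim - 1) : ℕ)) with hH'
  have hH'0 : 0 ≤ H' := by positivity
  have hHH' : H ≤ H' := by
    rw [hH]; have : (0 : ℤ) ≤ (N * pb.dim * (pb.dim - 1) : ℕ) := by positivity
    linarith
  obtain ⟨t, ht, hgap, htop⟩ := top_cluster hν b H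
  obtain ⟨r, rfl⟩ : ∃ r, ν = t + r := ⟨ν - t, by omega⟩
  have hr0 : 0 < r := by omega
  have hn0 : 0 < n0 := by
    rcases Nat.eq_zero_or_pos n0 with h0 | h0
    · subst h0; simp at hB; omega
    · exact h0
  set last : Fin (t + r) := ⟨t + r - 1, by omega⟩ with hlast
  obtain ⟨ρ, hρ, hρt⟩ : ∃ ρ : ℕ, ((p ^ (k + 1) : ℕ) : ℤ) ∣ ∑ j : Fin t, b (Fin.castAdd r j) - ρ * ∑ a, c a ∧ t = ρ * n0 := by
    rcases Nat.eq_zero_or_pos t with h0 | h0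
    · refine ⟨0, ?_, by simpa using h0⟩
      subst h0; simp
    · exact cluster_low pb N hθ p h d k h0 hr0 hr (hgap h0) τ c hτ
  obtain ⟨z1, hz1⟩ := hA
  obtain ⟨z2, hz2⟩ := hρ
  refine ⟨z1 - z2, r, hr0, by omega, ?_⟩
  rw [Fin.sum_univ_add] at hz1
  set q : ℤ := ((p ^ (k + 1) : ℕ) : ℤ)
  set C := ∑ a, c a
  set ρ0 := Fintype.card ι - 1
  have hle : ρ ≤ ρ0 := by
    by_contra hcon
    have : ρ0 * n0 < ρ * n0 := Nat.mul_lt_mul_of_pos_right (by omega) hn0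
    omega
  have hle2 : ρ0 ≤ t + r := by rw [hB]; exact Nat.le_mul_of_pos_right _ hn0
  have hsum : (r : ℤ) * b last = ∑ j : Fin r, b (Fin.natAdd t j) + ∑ j : Fin r, (b last - b (Fin.natAdd t j)) := by
    rw [← Finset.sum_add_distrib]; simp
  have hb1 : ∀ j : Fin r, 0 ≤ b last - b (Fin.natAdd t j) ∧ b last - b (Fin.natAdd t j) ≤ (t + r : ℕ) * H' := by
    intro j
    have h1 : b (Fin.natAdd t j) ≤ b last := hr.mono (show t + (j : ℕ) ≤ t + r - 1 by have := j.2; omega)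
    have h2 : b ⟨t, ht⟩ ≤ b (Fin.natAdd t j) := hr.mono (show t ≤ t + (j : ℕ) by omega)
    refine ⟨by linarith, ?_⟩
    have h3 : (((t + r : ℕ) : ℤ) - 1 - t) * H ≤ (t + r : ℕ) * H' := by
      have h5 : (0 : ℤ) ≤ ((t + r : ℕ) : ℤ) - 1 - t := by omega
      have h6 : ((t + r : ℕ) : ℤ) - 1 - t ≤ (t + r : ℕ) := by omega
      calc _ ≤ (((t + r : ℕ) : ℤ) - 1 - t) * H' := mul_le_mul_of_nonneg_left hHH' h5
        _ ≤ _ := mul_le_mul_of_nonneg_right h6 hH'0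
    linarith
  have hs1 : 0 ≤ ∑ j : Fin r, (b last - b (Fin.natAdd t j)) := Finset.sum_nonneg fun j _ => (hb1 j).1
  have hs2 : ∑ j : Fin r, (b last - b (Fin.natAdd t j)) ≤ r * ((t + r : ℕ) * H') := by
    refine (Finset.sum_le_sum fun j _ => (hb1 j).2).trans ?_
    simp
  have heq : (r : ℤ) * b last - q * (z1 - z2) = ((ρ0 : ℤ) - ρ) * C + ∑ j : Fin r, (b last - b (Fin.natAdd t j)) := by
    rw [hsum]; linear_combination hz1 - hz2
  rw [heq]
  refine (abs_add_le _ _).trans ?_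
  rw [abs_mul, abs_of_nonneg hs1]
  have h7 : |((ρ0 : ℤ) - ρ)| ≤ (t + r : ℕ) := by rw [abs_le]; constructor <;> omega
  have h8 := mul_le_mul_of_nonneg_right h7 (abs_nonneg C)
  have h9 : (r : ℤ) * ((t + r : ℕ) * H') ≤ ((t + r : ℕ) : ℤ) ^ 2 * H' := by
    have : (r : ℤ) ≤ (t + r : ℕ) := by omega
    have := mul_le_mul_of_nonneg_right this (show 0 ≤ ((t + r : ℕ) : ℤ) * H' by positivity)
    nlinarith
  linarith

end Cluster
end FilePF2

section FilePG1
set_option linter.all false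
open Polynomial

/-- dehomogenization data -/
structure CM {K L S : Type*} [Field K] [Field L] [Algebra K L] [Algebra K[X] L] [Algebra (RatFunc K) L]
  [IsScalarTower K K[X] L] [IsScalarTower K[X] (RatFunc K) L] [IsScalarTower K (RatFunc K) L]
  [CommRing S] [Algebra K S] (𝒮 : ℕ → Submodule K S) (ψ : S →ₐ[K] L) (N : ℕ) (w y : S) : Prop where
  hN : 0 < N
  hw : w ∈ 𝒮 1
  hy : y ∈ 𝒮 N
  ψw : ψ w = 1
  ψy : ψ y = algebraMap K[X] L X
  inj : ∀ j, ∀ s ∈ 𝒮 j, ψ s = 0 → s = 0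
  mem : ∀ j : ℕ, ∀ s ∈ 𝒮 (N * j), ψ s ∈ EL K L j
  frac : ∀ x : L, ∃ a b : S, ψ b ≠ 0 ∧ x = ψ a / ψ b

section EL
variable {K L : Type*} [Field K] [Field L] [Algebra K L] [Algebra K[X] L] [Algebra (RatFunc K) L]
  [IsScalarTower K K[X] L] [IsScalarTower K[X] (RatFunc K) L] [IsScalarTower K (RatFunc K) L]
  [FiniteDimensional (RatFunc K) L]

lemma EL_dim {n0 : ℕ} {τ : Fin n0 → L} {c : Fin n0 → ℤ} (hτ : GoodFilt.IsRed (EL K L) ⊤ τ c) (l : ℤ) :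
    Module.Finite K (EL K L l) ∧ (Module.finrank K (EL K L l)) = ∑ j, (l - c j + 1).toNat := by
  have h := hτ.finrank_eq goodEL l
  have e : (⊤ : Submodule (RatFunc K) L).restrictScalars K ⊓ EL K L l = EL K L l := by simp
  rw [e] at h
  exact h

lemma isRed_card {n0 : ℕ} {τ : Fin n0 → L} {c : Fin n0 → ℤ} (hτ : GoodFilt.IsRed (EL K L) ⊤ τ c) :
    n0 = Module.finrank (RatFunc K) L := by
  have h := finrank_span_eq_card hτ.li
  rw [hτ.span] at h
  simpa using h.symm

lemma exists_red : ∃ (τ : Fin (Module.finrank (RatFunc K) L) → L) (c : Fin (Module.finrank (RatFunc K) L) → ℤ), GoodFilt.IsRed (EL K L) ⊤ τ c := by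
  have h := (goodEL (K := K) (L := L)).exists_isRed ⊤
  rwa [finrank_top] at h

variable (K L) in
lemma EL_dim_bound : ∃ C : ℤ, ∀ l : ℤ, 0 ≤ l → |(Module.finrank K (EL K L l) : ℤ) - Module.finrank (RatFunc K) L * l| ≤ C := by
  obtain ⟨τ, c, hτ⟩ := exists_red (K := K) (L := L)
  refine ⟨∑ j, (|c j| + 1), fun l hl => ?_⟩
  rw [(EL_dim hτ l).2]
  have : (Module.finrank (RatFunc K) L : ℤ) * l = ∑ j : Fin (Module.finrank (RatFunc K) L), l := by simp
  rw [this]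
  push_cast
  rw [← Finset.sum_sub_distrib]
  refine (Finset.abs_sum_le_sum_abs _ _).trans (Finset.sum_le_sum fun j _ => ?_)
  rcases abs_cases (c j) with ⟨h1, h2⟩ | ⟨h1, h2⟩ <;> rw [h1, abs_le] <;> constructor <;> omega

lemma EL_finite (l : ℤ) : Module.Finite K (EL K L l) := by
  obtain ⟨τ, c, hτ⟩ := exists_red (K := K) (L := L)
  exact (EL_dim hτ l).1
end EL

section CM
variable {K L S : Type*} [Field K] [Field L] [Algebra K L] [Algebra K[X] L] [Algebra (RatFunc K) L]
  [IsScalarTower K K[X] L] [IsScalarTower K[X] (RatFunc K) L] [IsScalarTower K (RatFunc K) L]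
  [FiniteDimensional (RatFunc K) L]
  [CommRing S] [Algebra K S] {𝒮 : ℕ → Submodule K S} [GradedAlgebra 𝒮] {ψ : S →ₐ[K] L} {N : ℕ} {w y : S}

lemma CM.wpow (h : CM 𝒮 ψ N w y) (r : ℕ) : w ^ r ∈ 𝒮 r := by
  have := SetLike.pow_mem_graded r h.hw
  simpa using this

lemma CM.mulw (h : CM 𝒮 ψ N w y) {l l' : ℕ} (hl : l ≤ l') {s : S} (hs : s ∈ 𝒮 l) :
    w ^ (l' - l) * s ∈ 𝒮 l' ∧ ψ (w ^ (l' - l) * s) = ψ s := by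
  constructor
  · have := SetLike.mul_mem_graded (h.wpow (l' - l)) hs
    rwa [Nat.sub_add_cancel hl] at this
  · simp [h.ψw]

/-- `ψ` restricted to a graded piece. -/
noncomputable def psiR (𝒮 : ℕ → Submodule K S) (ψ : S →ₐ[K] L) (l : ℕ) : 𝒮 l →ₗ[K] L := ψ.toLinearMap.comp (𝒮 l).subtype

lemma CM.psiR_inj (h : CM 𝒮 ψ N w y) (l : ℕ) : Function.Injective (psiR 𝒮 ψ l) := by
  rw [← LinearMap.ker_eq_bot, LinearMap.ker_eq_bot']
  intro s hs
  exact Subtype.ext (h.inj l s s.2 hs)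

lemma CM.mem' (h : CM 𝒮 ψ N w y) {l : ℕ} {j : ℤ} (hl : (l : ℤ) ≤ N * j) {s : S} (hs : s ∈ 𝒮 l) : ψ s ∈ EL K L j := by
  have hj : 0 ≤ j := by
    by_contra hcon
    have := h.hN
    nlinarith
  lift j to ℕ using hj
  have h1 := h.mulw (l' := N * j) (by exact_mod_cast hl) hs
  rw [← h1.2]
  exact h.mem j _ h1.1

lemma CM.finite (h : CM 𝒮 ψ N w y) (l : ℕ) : Module.Finite K (𝒮 l) := by
  haveI := EL_finite (K := K) (L := L) (l : ℤ)
  let f : 𝒮 l →ₗ[K] EL K L (l : ℤ) := (psiR 𝒮 ψ l).codRestrict _ (fun s => h.mem' (by have := h.hN; nlinarith) s.2)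
  refine Module.Finite.of_injective f ?_
  intro a b hab
  exact h.psiR_inj l (congrArg Subtype.val hab)

lemma CM.finrank_le (h : CM 𝒮 ψ N w y) (l : ℕ) (j : ℤ) (hl : (l : ℤ) ≤ N * j) :
    Module.finrank K (𝒮 l) ≤ Module.finrank K (EL K L j) := by
  haveI := EL_finite (K := K) (L := L) j
  let f : 𝒮 l →ₗ[K] EL K L j := (psiR 𝒮 ψ l).codRestrict _ (fun s => h.mem' hl s.2)
  refine LinearMap.finrank_le_finrank_of_injective (f := f) ?_
  intro a b hab
  exact h.psiR_inj l (congrArg Subtype.val hab)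

lemma CM.mono (h : CM 𝒮 ψ N w y) {l l' : ℕ} (hl : l ≤ l') : Module.finrank K (𝒮 l) ≤ Module.finrank K (𝒮 l') := by
  haveI := h.finite l'
  let f : 𝒮 l →ₗ[K] 𝒮 l' := ((LinearMap.mulLeft K (w ^ (l' - l))).comp (𝒮 l).subtype).codRestrict _ (fun s => (h.mulw hl s.2).1)
  refine LinearMap.finrank_le_finrank_of_injective (f := f) ?_
  intro a b hab
  have h1 : w ^ (l' - l) * (a : S) = w ^ (l' - l) * (b : S) := congrArg Subtype.val hab
  apply h.psiR_inj l
  show ψ a = ψ b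
  rw [← (h.mulw hl a.2).2, h1, (h.mulw hl b.2).2]

lemma CM.exists_deg (h : CM 𝒮 ψ N w y) (s : S) : ∃ t0 : ℕ, ∀ t, t0 ≤ t → ∃ s' ∈ 𝒮 t, ψ s' = ψ s := by
  classical
  induction s using DirectSum.Decomposition.inductionOn 𝒮 with
  | zero => exact ⟨0, fun t _ => ⟨0, Submodule.zero_mem _, rfl⟩⟩
  | homogeneous m =>
    rename_i i
    exact ⟨i, fun t ht => ⟨_, h.mulw ht m.2⟩⟩
  | add a b ha hb =>
    obtain ⟨t1, h1⟩ := ha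
    obtain ⟨t2, h2⟩ := hb
    refine ⟨max t1 t2, fun t ht => ?_⟩
    obtain ⟨a', ha', ea⟩ := h1 t (le_trans (le_max_left _ _) ht)
    obtain ⟨b', hb', eb⟩ := h2 t (le_trans (le_max_right _ _) ht)
    exact ⟨a' + b', Submodule.add_mem _ ha' hb', by simp [ea, eb]⟩

lemma CM.span_top (h : CM 𝒮 ψ N w y) : Submodule.span (RatFunc K) (Set.range ψ) = ⊤ := by
  have h1 : Subalgebra.toSubmodule (Algebra.adjoin (RatFunc K) (Set.range ψ)) = Submodule.span (RatFunc K) (Set.range ψ) := by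
    rw [Algebra.adjoin_eq_span]
    congr 1
    have : Set.range ψ = (MonoidHom.mrange (ψ : S →* L) : Set L) := by ext; simp
    rw [this, Submonoid.closure_eq]
  rw [← h1, eq_top_iff]
  intro x _
  obtain ⟨a, b, hb, rfl⟩ := h.frac x
  rw [div_eq_mul_inv]
  refine Subalgebra.mul_mem _ (Algebra.subset_adjoin ⟨a, rfl⟩) ?_
  exact Subalgebra.inv_mem_of_algebraic (A := Algebra.adjoin (RatFunc K) (Set.range ψ)) (x := ⟨ψ b, Algebra.subset_adjoin ⟨b, rfl⟩⟩) (Algebra.IsAlgebraic.isAlgebraic _)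

lemma CM.lower (h : CM 𝒮 ψ N w y) : ∃ t : ℕ, ∀ j : ℕ, Module.finrank (RatFunc K) L * j ≤
    Module.finrank K (𝒮 (N * (t + j))) := by
  classical
  obtain ⟨B, hBT, hBs, hBli⟩ := exists_linearIndependent (RatFunc K) (Set.range ψ)
  haveI : Finite B := hBli.finite
  haveI : Fintype B := Fintype.ofFinite B
  have hcard : Fintype.card B = Module.finrank (RatFunc K) L := by
    have := finrank_span_eq_card hBli
    rw [Subtype.range_coe, hBs, h.span_top, finrank_top] at this
    exact this.symm
  have hs : ∀ b : B, ∃ t0 : ℕ, ∀ t, t0 ≤ t → ∃ s' ∈ 𝒮 t, ψ s' = b := fun b => by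
    obtain ⟨s, hs⟩ := hBT b.2
    rw [← hs]; exact h.exists_deg s
  choose t0 ht0 using hs
  let t := ∑ b, t0 b
  have ht : ∀ b, t0 b ≤ N * t := fun b => (Finset.single_le_sum (fun _ _ => Nat.zero_le _) (Finset.mem_univ b)).trans
    (Nat.le_mul_of_pos_left _ h.hN)
  choose s' hs' hs'' using fun b => ht0 b (N * t) (ht b)
  refine ⟨t, fun j => ?_⟩
  haveI := h.finite (N * (t + j))
  have hmem : ∀ (c : B × Fin j), y ^ (c.2 : ℕ) * (w ^ (N * (j - c.2)) * s' c.1) ∈ 𝒮 (N * (t + j)) := by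
    intro c
    have h1 := SetLike.mul_mem_graded (SetLike.pow_mem_graded (c.2 : ℕ) h.hy) (SetLike.mul_mem_graded (h.wpow (N * (j - c.2))) (hs' c.1))
    convert h1 using 2
    have := c.2.2
    obtain ⟨u, hu⟩ : ∃ u, j = c.2 + u := ⟨j - c.2, by omega⟩
    simp only [smul_eq_mul]
    rw [show j - (c.2 : ℕ) = u by omega]
    nth_rewrite 1 [hu]
    ring
  let v : B × Fin j → 𝒮 (N * (t + j)) := fun c => ⟨_, hmem c⟩
  have hv : ∀ c, ψ (v c) = (X : K[X]) ^ (c.2 : ℕ) • (c.1 : L) := by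
    intro c
    show ψ (y ^ (c.2 : ℕ) * (w ^ (N * (j - c.2)) * s' c.1)) = _
    rw [map_mul, map_mul, map_pow, map_pow, h.ψw, h.ψy, one_pow, one_mul, hs'', ← map_pow, Algebra.smul_def]
  have hli : LinearIndependent K v := by
    rw [Fintype.linearIndependent_iff]
    intro a ha
    have h1 : ∑ b : B, (algebraMap K[X] (RatFunc K) (∑ i : Fin j, C (a (b, i)) * X ^ (i : ℕ))) • (b : L) = 0 := by
      have h2 := congrArg (psiR 𝒮 ψ _) ha
      rw [map_sum, map_zero, Fintype.sum_prod_type] at h2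
      rw [← h2]
      refine Finset.sum_congr rfl fun b _ => ?_
      rw [algebraMap_smul, Finset.sum_smul]
      refine Finset.sum_congr rfl fun i _ => ?_
      have h3 : psiR 𝒮 ψ _ (v (b, i)) = ψ (v (b, i)) := rfl
      rw [map_smul, h3, hv, mul_smul, ← Polynomial.algebraMap_eq, algebraMap_smul]
    rw [Fintype.linearIndependent_iff] at hBli
    rintro ⟨b, i⟩
    have h4 := hBli _ h1 b
    rw [map_eq_zero_iff _ (RatFunc.algebraMap_injective K)] at h4
    have h5 := congrArg (fun P => P.coeff (i : ℕ)) h4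
    simp only [finset_sum_coeff, coeff_C_mul_X_pow, coeff_zero] at h5
    rw [Finset.sum_eq_single i (fun k _ hk => if_neg (fun h => hk (Fin.ext h.symm))) (by simp)] at h5
    simpa using h5
  have := hli.fintype_card_le_finrank
  rw [Fintype.card_prod, hcard, Fintype.card_fin] at this
  exact this

lemma CM.dim_bound (h : CM 𝒮 ψ N w y) : ∃ C : ℤ, ∀ l : ℕ,
    |(Module.finrank K (𝒮 l) : ℤ) - Module.finrank (RatFunc K) L * (l / N : ℕ)| ≤ C := by
  obtain ⟨C, hC⟩ := EL_dim_bound K L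
  obtain ⟨t, ht⟩ := h.lower
  set e := Module.finrank (RatFunc K) L
  refine ⟨|C| + e + e * t, fun l => ?_⟩
  have hN := h.hN
  have hdm := Nat.div_add_mod l N
  have hml := Nat.mod_lt l hN
  have h1 := h.finrank_le l (l / N + 1 : ℕ) (by push_cast; exact_mod_cast (by nlinarith))
  have h2 := hC (l / N + 1 : ℕ) (by positivity)
  have h3 : (Module.finrank K (𝒮 l) : ℤ) ≤ Module.finrank K (EL K L ((l / N + 1 : ℕ) : ℤ)) := by exact_mod_cast h1
  have h4 : (e : ℤ) * (l / N : ℕ) - e * t ≤ Module.finrank K (𝒮 l) := by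
    rcases le_total t (l / N) with hc | hc
    · have h5 := ht (l / N - t)
      have h6 := h.mono (l := N * (t + (l / N - t))) (l' := l) (by rw [Nat.add_sub_cancel' hc]; exact Nat.mul_div_le l N)
      have h7 : (e * (l / N - t : ℕ) : ℤ) ≤ Module.finrank K (𝒮 l) := by exact_mod_cast h5.trans h6
      rw [Nat.cast_sub hc] at h7
      linarith
    · have : (e : ℤ) * (l / N : ℕ) ≤ e * t := by exact_mod_cast Nat.mul_le_mul_left _ hc
      have : (0 : ℤ) ≤ Module.finrank K (𝒮 l) := by positivity
      linarith
  have h8 := (abs_le.1 h2).2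
  have h9 := le_abs_self C
  have h10 : (0 : ℤ) ≤ e := by positivity
  have h11 : (0 : ℤ) ≤ e * t := by positivity
  push_cast at h8 h3 h4 ⊢
  rw [abs_le]
  constructor <;> nlinarith [abs_nonneg C]
end CM
end FilePG1

section FilePG2
set_option linter.all false
open Polynomial

section piece
variable {K S : Type*} [Field K] [CommRing S] [Algebra K S] {𝒮 : ℕ → Submodule K S} [GradedAlgebra 𝒮]

lemma piece_mem {ι : Type*} [Fintype ι] (H : ι → S) (D : ι → ℕ) (hH : ∀ i, H i ∈ 𝒮 (D i)) (m : ℕ) (x : S) (hx : x ∈ 𝒮 m)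
    (hxJ : x ∈ Ideal.span (Set.range H)) :
    ∃ c : ι → S, (∀ i, D i ≤ m → c i ∈ 𝒮 (m - D i)) ∧ (∀ i, ¬ D i ≤ m → c i = 0) ∧ x = ∑ i, c i * H i := by
  classical
  rw [Ideal.mem_span_range_iff_exists_fun] at hxJ
  obtain ⟨a, ha⟩ := hxJ
  refine ⟨fun i => if D i ≤ m then (DirectSum.decompose 𝒮 (a i) (m - D i) : S) else 0, fun i hi => ?_, fun i hi => ?_, ?_⟩
  · simp only [hi, if_true]; exact SetLike.coe_mem _
  · simp [hi]
  · have h1 : x = (DirectSum.decompose 𝒮 x m : S) := by rw [DirectSum.decompose_of_mem_same 𝒮 hx]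
    rw [h1, ← ha, DirectSum.decompose_sum, DFinsupp.finset_sum_apply, AddSubmonoidClass.coe_finset_sum]
    refine Finset.sum_congr rfl fun i _ => ?_
    dsimp only
    split_ifs with hi
    · rw [DirectSum.coe_decompose_mul_of_right_mem_of_le 𝒮 (hH i) hi]
    · rw [DirectSum.coe_decompose_mul_of_right_mem_of_not_le 𝒮 (hH i) hi, zero_mul]

lemma gpd_eq (𝒮 : ℕ → Submodule K S) (J : Ideal S) (m : ℕ) [Module.Finite K (𝒮 m)] :
    gradedPieceDim 𝒮 J m + Module.finrank K (Submodule.comap (𝒮 m).subtype (J.restrictScalars K)) = Module.finrank K (𝒮 m) :=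
  Submodule.finrank_quotient_add_finrank _

/-- only generators of small degree matter -/
lemma gpd_subtype {ι : Type*} [Fintype ι] (H : ι → S) (D : ι → ℕ) (hH : ∀ i, H i ∈ 𝒮 (D i)) (m : ℕ) (P : ι → Prop)
    (hP : ∀ i, ¬ P i → m < D i) :
    gradedPieceDim 𝒮 (Ideal.span (Set.range H)) m =
      gradedPieceDim 𝒮 (Ideal.span (Set.range (fun i : {i // P i} => H i))) m := by
  classical
  have : Submodule.comap (𝒮 m).subtype ((Ideal.span (Set.range H)).restrictScalars K) =
      Submodule.comap (𝒮 m).subtype ((Ideal.span (Set.range (fun i : {i // P i} => H i))).restrictScalars K) := by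
    ext ⟨x, hx⟩
    simp only [Submodule.mem_comap, Submodule.subtype_apply, Submodule.restrictScalars_mem]
    constructor
    · intro h
      obtain ⟨c, h1, h2, h3⟩ := piece_mem H D hH m x hx h
      rw [h3]
      refine Ideal.sum_mem _ fun i _ => ?_
      by_cases hi : P i
      · exact Ideal.mul_mem_left _ _ (Ideal.subset_span ⟨⟨i, hi⟩, rfl⟩)
      · rw [h2 i (by have := hP i hi; omega), zero_mul]; exact Ideal.zero_mem _
    · intro h
      refine Ideal.span_mono ?_ h
      rintro _ ⟨i, rfl⟩
      exact ⟨i, rfl⟩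
  rw [gradedPieceDim, gradedPieceDim, this]

lemma gpd_anti {J J' : Ideal S} (h : J ≤ J') (m : ℕ) [Module.Finite K (𝒮 m)] : gradedPieceDim 𝒮 J' m ≤ gradedPieceDim 𝒮 J m := by
  have h1 := gpd_eq 𝒮 J m
  have h2 := gpd_eq 𝒮 J' m
  have h3 := Submodule.finrank_mono (Submodule.comap_mono (f := (𝒮 m).subtype)
    (show J.restrictScalars K ≤ J'.restrictScalars K from h))
  omega

/-- rank-nullity for the syzygy map. -/
noncomputable def syzMap (𝒮 : ℕ → Submodule K S) {ι : Type*} [Fintype ι] (H : ι → S) (m : ι → ℕ) : (∀ i, 𝒮 (m i)) →ₗ[K] S :=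
  ∑ i, (LinearMap.mulRight K (H i)).comp ((𝒮 (m i)).subtype.comp (LinearMap.proj i))

lemma syzMap_apply {ι : Type*} [Fintype ι] (H : ι → S) (m : ι → ℕ) (c : ∀ i, 𝒮 (m i)) :
    syzMap 𝒮 H m c = ∑ i, (c i : S) * H i := by
  simp [syzMap]

lemma gpd_formula {ι : Type*} [Fintype ι] (H : ι → S) (D : ι → ℕ) (hH : ∀ i, H i ∈ 𝒮 (D i)) (m : ℕ) (hm : ∀ i, D i ≤ m)
    [∀ l, Module.Finite K (𝒮 l)] :
    (gradedPieceDim 𝒮 (Ideal.span (Set.range H)) m : ℤ) = Module.finrank K (𝒮 m) - ∑ i, (Module.finrank K (𝒮 (m - D i)) : ℤ)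
      + Module.finrank K (LinearMap.ker (syzMap 𝒮 H (fun i => m - D i))) := by
  classical
  have h1 := gpd_eq 𝒮 (Ideal.span (Set.range H)) m
  have h2 := LinearMap.finrank_range_add_finrank_ker (syzMap 𝒮 H (fun i => m - D i))
  rw [Module.finrank_pi_fintype] at h2
  have h3 : Submodule.map (𝒮 m).subtype (Submodule.comap (𝒮 m).subtype ((Ideal.span (Set.range H)).restrictScalars K)) =
      LinearMap.range (syzMap 𝒮 H (fun i => m - D i)) := by
    ext x
    rw [Submodule.map_comap_subtype]
    constructor
    · rintro ⟨hx, hxJ⟩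
      obtain ⟨c, hc, -, hx2⟩ := piece_mem H D hH m x hx hxJ
      exact ⟨fun i => ⟨c i, hc i (hm i)⟩, by rw [syzMap_apply, hx2]⟩
    · rintro ⟨c, rfl⟩
      rw [syzMap_apply]
      refine ⟨Submodule.sum_mem _ fun i _ => ?_, Ideal.sum_mem _ fun i _ => Ideal.mul_mem_left _ _ (Ideal.subset_span ⟨i, rfl⟩)⟩
      have := SetLike.mul_mem_graded (c i).2 (hH i)
      rwa [Nat.sub_add_cancel (hm i)] at this
  have h4 : Module.finrank K (Submodule.comap (𝒮 m).subtype ((Ideal.span (Set.range H)).restrictScalars K)) =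
      Module.finrank K (LinearMap.range (syzMap 𝒮 H (fun i => m - D i))) := by
    rw [← h3]
    exact (Submodule.equivMapOfInjective _ (Submodule.injective_subtype _) _).finrank_eq
  rw [h4] at h1
  zify at h1 h2
  linarith
end piece

section CM
variable {K L S : Type*} [Field K] [Field L] [Algebra K L] [Algebra K[X] L] [Algebra (RatFunc K) L]
  [IsScalarTower K K[X] L] [IsScalarTower K[X] (RatFunc K) L] [IsScalarTower K (RatFunc K) L]
  [FiniteDimensional (RatFunc K) L]
  [CommRing S] [Algebra K S] {𝒮 : ℕ → Submodule K S} [GradedAlgebra 𝒮] {ψ : S →ₐ[K] L} {N : ℕ} {w y : S}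

lemma CM.ker_bound (hc : CM 𝒮 ψ N w y) {ι : Type*} [Fintype ι] [DecidableEq ι] (h : ι → S) (d : ι → ℕ) (q m : ℕ)
    (hh : ∀ i, h i ∈ 𝒮 (d i)) (hm : ∀ i, q * d i ≤ N * m) (V : Submodule K (ι → L))
    (hV : V = ((Kq (fun i => ψ (h i)) q).restrictScalars (RatFunc K)).restrictScalars K ⊓
      ELn K L (fun i => ((q * d i / N : ℕ) : ℤ)) m) :
    Module.finrank K (LinearMap.ker (syzMap 𝒮 (fun i => h i ^ q) (fun i => N * m - q * d i))) ≤ Module.finrank K V ∧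
    Module.finrank K V + ∑ i, Module.finrank K (𝒮 (N * m - q * d i)) ≤
      Module.finrank K (LinearMap.ker (syzMap 𝒮 (fun i => h i ^ q) (fun i => N * m - q * d i))) +
      ∑ i, Module.finrank K (EL K L ((m : ℤ) - ((q * d i / N : ℕ) : ℤ))) := by
  classical
  haveI := fun l => hc.finite l
  haveI := fun l => EL_finite (K := K) (L := L) l
  set δ : ι → ℤ := fun i => ((q * d i / N : ℕ) : ℤ) with hδ
  set E := ELn K L δ m with hE
  let T : (∀ i, 𝒮 (N * m - q * d i)) →ₗ[K] (ι → L) := LinearMap.pi fun i => (psiR 𝒮 ψ _).comp (LinearMap.proj i)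
  have hT : ∀ c i, T c i = ψ (c i) := fun c i => rfl
  have hTinj : Function.Injective T := by
    intro a b hab
    ext i
    have := congrFun hab i
    exact congrArg Subtype.val (hc.psiR_inj _ this)
  have hEfin : Module.Finite K E ∧ Module.finrank K E ≤ ∑ i, Module.finrank K (EL K L ((m : ℤ) - δ i)) := by
    let f : E →ₗ[K] (∀ i, EL K L ((m : ℤ) - δ i)) :=
      LinearMap.pi fun i => ((LinearMap.proj i).comp E.subtype).codRestrict _ (fun v => mem_ELn.1 v.2 i)
    have hf : Function.Injective f := by
      intro a b hab
      ext i
      exact congrArg Subtype.val (congrFun hab i)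
    refine ⟨Module.Finite.of_injective f hf, ?_⟩
    have := LinearMap.finrank_le_finrank_of_injective hf
    rwa [Module.finrank_pi_fintype] at this
  haveI := hEfin.1
  have hTE : LinearMap.range T ≤ E := by
    rintro _ ⟨c, rfl⟩
    rw [hE, mem_ELn]
    intro i
    refine hc.mem' ?_ (c i).2
    have h1 := hm i
    have h2 := Nat.div_mul_le_self (q * d i) N
    rw [Nat.cast_sub h1]
    simp only [hδ]
    have h3 : (((q * d i / N * N : ℕ)) : ℤ) ≤ (q * d i : ℕ) := by exact_mod_cast h2
    push_cast at h3 ⊢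
    nlinarith
  have hVE : V ≤ E := by rw [hV]; exact inf_le_right
  have hmap : Submodule.map T (LinearMap.ker (syzMap 𝒮 (fun i => h i ^ q) (fun i => N * m - q * d i))) = V ⊓ LinearMap.range T := by
    have key : ∀ c, c ∈ LinearMap.ker (syzMap 𝒮 (fun i => h i ^ q) (fun i => N * m - q * d i)) ↔ T c ∈ Kq (fun i => ψ (h i)) q := by
      intro c
      rw [LinearMap.mem_ker, syzMap_apply, mem_Kq]
      have e1 : ∑ i, T c i * ψ (h i) ^ q = ψ (∑ i, (c i : S) * h i ^ q) := by
        simp [hT]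
      rw [e1]
      constructor
      · intro h0; rw [h0, map_zero]
      · intro h0
        refine hc.inj (N * m) _ (Submodule.sum_mem _ fun i _ => ?_) h0
        have := SetLike.mul_mem_graded (c i).2 (SetLike.pow_mem_graded q (hh i))
        rwa [smul_eq_mul, Nat.sub_add_cancel (hm i)] at this
    ext v
    constructor
    · rintro ⟨c, hcc, rfl⟩
      refine ⟨?_, ⟨c, rfl⟩⟩
      rw [hV]
      exact ⟨(key c).1 hcc, hTE ⟨c, rfl⟩⟩
    · rintro ⟨hv, ⟨c, rfl⟩⟩
      rw [hV] at hv
      exact ⟨c, (key c).2 hv.1, rfl⟩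
  haveI hVf : Module.Finite K V := Submodule.finiteDimensional_of_le hVE
  have hk : Module.finrank K (LinearMap.ker (syzMap 𝒮 (fun i => h i ^ q) (fun i => N * m - q * d i))) = Module.finrank K (V ⊓ LinearMap.range T : Submodule K (ι → L)) := by
    rw [← hmap]
    exact (Submodule.equivMapOfInjective _ hTinj _).finrank_eq
  haveI hTf : Module.Finite K (LinearMap.range T) := inferInstance
  have hrank : Module.finrank K (LinearMap.range T) = ∑ i, Module.finrank K (𝒮 (N * m - q * d i)) := by
    rw [LinearMap.finrank_range_of_inj hTinj, Module.finrank_pi_fintype]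
  refine ⟨?_, ?_⟩
  · rw [hk]; exact Submodule.finrank_mono inf_le_left
  · rw [hk, ← hrank, ← Submodule.finrank_sup_add_finrank_inf_eq V (LinearMap.range T)]
    have := (Submodule.finrank_mono (sup_le hVE hTE)).trans hEfin.2
    rw [add_comm]
    exact Nat.add_le_add_left this _

lemma Kq_isRed_card {ι : Type*} [Fintype ι] [DecidableEq ι] (h : ι → L) (i0 : ι) (hi0 : h i0 ≠ 0) (q : ℕ)
    {E : ℤ → Submodule K (ι → L)} {ν : ℕ} {e : Fin ν → ι → L} {b : Fin ν → ℤ}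
    (hr : GoodFilt.IsRed E ((Kq h q).restrictScalars (RatFunc K)) e b) :
    (ν : ℤ) = (Fintype.card ι - 1) * Module.finrank (RatFunc K) L := by
  have h1 := finrank_span_eq_card hr.li
  rw [hr.span, Fintype.card_fin] at h1
  have h2 := Kq_finrank h i0 hi0 q
  have h3 : Module.finrank (RatFunc K) L * Module.finrank L (Kq h q) = Module.finrank (RatFunc K) (Kq h q) :=
    Module.finrank_mul_finrank _ _ _
  have h4 : Module.finrank (RatFunc K) ((Kq h q).restrictScalars (RatFunc K)) = Module.finrank (RatFunc K) (Kq h q) := rfl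
  rw [← h1, h4, ← h3, ← h2]
  push_cast; ring

theorem CM.formula (hc : CM 𝒮 ψ N w y) (ι : Type*) [Fintype ι] [DecidableEq ι] :
    ∃ C : ℤ, ∀ (h : ι → S) (d : ι → ℕ) (hh : ∀ i, h i ∈ 𝒮 (d i)) (i0 : ι) (hi0 : h i0 ≠ 0) (q : ℕ)
      {ν : ℕ} (e : Fin ν → ι → L) (b : Fin ν → ℤ)
      (hr : GoodFilt.IsRed (ELn K L (fun i => ((q * d i / N : ℕ) : ℤ)))
        ((Kq (fun i => ψ (h i)) q).restrictScalars (RatFunc K)) e b), ∃ κ : ℤ, ∀ m : ℕ, (∀ i, q * d i ≤ N * m) →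
      |(gradedPieceDim 𝒮 (Ideal.span (Set.range fun i => h i ^ q)) (N * m) : ℤ) - ∑ j, max (b j - m) 0 - κ| ≤ C := by
  classical
  haveI := fun l => hc.finite l
  obtain ⟨C1, hC1⟩ := hc.dim_bound
  obtain ⟨C2, hC2⟩ := EL_dim_bound K L
  set e0 : ℕ := Module.finrank (RatFunc K) L with he0
  set n := Fintype.card ι with hn
  refine ⟨C1 + n * (C1 + C2 + e0) + n * (C1 + C2 + e0) + n * e0, ?_⟩
  intro h d hh i0 hi0 q ν e b hr
  have hψi0 : ψ (h i0) ≠ 0 := fun h0 => hi0 (hc.inj _ _ (hh i0) h0)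
  have hν := Kq_isRed_card (fun i => ψ (h i)) i0 hψi0 q hr
  set δ : ι → ℕ := fun i => q * d i / N with hδ
  refine ⟨e0 * ∑ i, (δ i : ℤ) - ∑ j, b j, fun m hm => ?_⟩
  have hN := hc.hN
  have hG := gpd_formula (𝒮 := 𝒮) (fun i => h i ^ q) (fun i => q * d i) (fun i => by
    simpa using SetLike.pow_mem_graded q (hh i)) (N * m) hm
  obtain ⟨hk1, hk2⟩ := hc.ker_bound h d q m hh hm _ rfl
  have hV := (hr.finrank_eq (goodELn _) (m : ℤ)).2
  rw [hV] at hk1 hk2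
  set ke := Module.finrank K (LinearMap.ker (syzMap 𝒮 (fun i => h i ^ q) (fun i => N * m - q * d i)))
  have hδm : ∀ i, δ i ≤ m := fun i => by
    have : δ i ≤ N * m / N := Nat.div_le_div_right (hm i)
    rwa [Nat.mul_div_cancel_left _ hN] at this
  -- dimension of the pieces
  have hA : |(Module.finrank K (𝒮 (N * m)) : ℤ) - e0 * m| ≤ C1 := by
    have := hC1 (N * m)
    rwa [Nat.mul_div_cancel_left _ hN] at this
  have hB : ∀ i, |(Module.finrank K (𝒮 (N * m - q * d i)) : ℤ) - e0 * (m - δ i)| ≤ C1 + e0 := by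
    intro i
    have h1 := hC1 (N * m - q * d i)
    have h2 : ((N * m - q * d i) / N : ℕ) ≤ m - δ i ∧ m - δ i ≤ (N * m - q * d i) / N + 1 := by
      have hdm := Nat.div_add_mod (q * d i) N
      have hml := Nat.mod_lt (q * d i) hN
      have hmi := hm i
      have hle := hδm i
      obtain ⟨u, hu⟩ : ∃ u, m = δ i + u := ⟨m - δ i, by omega⟩
      have hδi : q * d i / N = δ i := rfl
      rw [hδi] at hdm
      have e1 : m - δ i = u := by omega
      rw [e1]
      have e2 : N * m - q * d i + q * d i % N = N * u := by
        have : N * m = N * δ i + N * u := by rw [hu]; ring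
        omega
      constructor
      · have : (N * m - q * d i) ≤ N * u := by omega
        have := Nat.div_le_div_right (c := N) this
        rwa [Nat.mul_div_cancel_left _ hN] at this
      · have : N * u ≤ (N * m - q * d i) + N := by omega
        have := Nat.div_le_div_right (c := N) this
        rwa [Nat.mul_div_cancel_left _ hN, Nat.add_div_right _ hN] at this
    have h3 : (((N * m - q * d i) / N : ℕ) : ℤ) ≤ m - δ i := by have := hδm i; omega
    have h4 : (m : ℤ) - δ i ≤ ((N * m - q * d i) / N : ℕ) + 1 := by have := hδm i; omega
    have h5 : (0 : ℤ) ≤ e0 := by positivity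
    have h6 := mul_le_mul_of_nonneg_left h3 h5
    have h7 := mul_le_mul_of_nonneg_left h4 h5
    rw [abs_le] at h1 ⊢
    constructor <;> linarith [h1.1, h1.2]
  have hD : ∀ i, |(Module.finrank K (EL K L ((m : ℤ) - ((q * d i / N : ℕ) : ℤ))) : ℤ) - e0 * (m - δ i)| ≤ C2 := by
    intro i
    have h1 := hδm i
    exact hC2 ((m : ℤ) - δ i) (by omega)
  have sB : |∑ i, (Module.finrank K (𝒮 (N * m - q * d i)) : ℤ) - ∑ i, (e0 : ℤ) * (m - δ i)| ≤ n * (C1 + e0) := by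
    rw [← Finset.sum_sub_distrib]
    refine (Finset.abs_sum_le_sum_abs _ _).trans ((Finset.sum_le_sum fun i _ => hB i).trans ?_)
    simp [hn]
  have sD : |∑ i, (Module.finrank K (EL K L ((m : ℤ) - ((q * d i / N : ℕ) : ℤ))) : ℤ) - ∑ i, (e0 : ℤ) * (m - δ i)| ≤ n * C2 := by
    rw [← Finset.sum_sub_distrib]
    refine (Finset.abs_sum_le_sum_abs _ _).trans ((Finset.sum_le_sum fun i _ => hD i).trans ?_)
    simp [hn]
  have sE : ∑ i, (e0 : ℤ) * (m - δ i) = n * e0 * m - e0 * ∑ i, (δ i : ℤ) := by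
    rw [← Finset.mul_sum, Finset.sum_sub_distrib]; simp [hn]; ring
  have sF : |∑ j, (((m : ℤ) - b j + 1).toNat : ℤ) - (ν * m - ∑ j, b j + ∑ j, max (b j - m) 0)| ≤ ν := by
    have : (ν * m - ∑ j, b j + ∑ j, max (b j - m) 0) = ∑ j, ((m : ℤ) - b j + max (b j - m) 0) := by
      rw [Finset.sum_add_distrib, Finset.sum_sub_distrib]; simp
    rw [this, ← Finset.sum_sub_distrib]
    refine (Finset.abs_sum_le_sum_abs _ _).trans ((Finset.sum_le_sum (g := fun _ => (1 : ℤ)) fun j _ => ?_).trans (by simp))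
    rw [abs_le]
    rcases max_cases (b j - m) 0 with ⟨h1, h2⟩ | ⟨h1, h2⟩ <;> rw [h1] <;> constructor <;> omega
  have hk1' : (ke : ℤ) ≤ ∑ j, (((m : ℤ) - b j + 1).toNat : ℤ) := by exact_mod_cast hk1
  have hk2' : ∑ j, (((m : ℤ) - b j + 1).toNat : ℤ) + ∑ i, (Module.finrank K (𝒮 (N * m - q * d i)) : ℤ) ≤
      ke + ∑ i, (Module.finrank K (EL K L ((m : ℤ) - ((q * d i / N : ℕ) : ℤ))) : ℤ) := by exact_mod_cast hk2
  have hC20 : 0 ≤ C2 := (abs_nonneg _).trans (hC2 0 le_rfl)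
  have hC10 : 0 ≤ C1 := (abs_nonneg _).trans hA
  have hn0 : (0 : ℤ) ≤ n := by positivity
  have hnν : (ν : ℤ) ≤ n * e0 := by
    rw [hν]; have : (0 : ℤ) ≤ e0 := by positivity
    nlinarith
  have hνm : (ν : ℤ) * m = n * e0 * m - e0 * m := by rw [hν]; ring
  have hp1 : (0 : ℤ) ≤ n * C2 := by positivity
  have hp2 : (0 : ℤ) ≤ n * C1 := by positivity
  have hp3 : (0 : ℤ) ≤ n * e0 := by positivity
  rw [hG, abs_le]
  rw [abs_le] at hA sB sD sF
  obtain ⟨hA1, hA2⟩ := hA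
  obtain ⟨sB1, sB2⟩ := sB
  obtain ⟨sD1, sD2⟩ := sD
  obtain ⟨sF1, sF2⟩ := sF
  simp only [mul_add] at *
  constructor <;> linarith

lemma CM.gpd_step (hc : CM 𝒮 ψ N w y) : ∃ C : ℤ, 0 ≤ C ∧ ∀ (J : Ideal S) (m k : ℕ), k ≤ N →
    (gradedPieceDim 𝒮 J (m + k) : ℤ) ≤ gradedPieceDim 𝒮 J m + C := by
  haveI := fun l => hc.finite l
  obtain ⟨C1, hC1⟩ := hc.dim_bound
  set e0 : ℕ := Module.finrank (RatFunc K) L with he0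
  have hC10 : 0 ≤ C1 := (abs_nonneg _).trans (hC1 0)
  refine ⟨2 * C1 + e0, by positivity, fun J m k hk => ?_⟩
  have h1 := gpd_eq 𝒮 J m
  have h2 := gpd_eq 𝒮 J (m + k)
  have h3 : Module.finrank K (Submodule.comap (𝒮 m).subtype (J.restrictScalars K)) ≤
      Module.finrank K (Submodule.comap (𝒮 (m + k)).subtype (J.restrictScalars K)) := by
    let f : Submodule.comap (𝒮 m).subtype (J.restrictScalars K) →ₗ[K] Submodule.comap (𝒮 (m + k)).subtype (J.restrictScalars K) :=
      { toFun := fun x => ⟨⟨w ^ (m + k - m) * (x : 𝒮 m), (hc.mulw (by omega) (x : 𝒮 m).2).1⟩, J.mul_mem_left _ x.2⟩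
        map_add' := fun a b => by ext; simp [mul_add]
        map_smul' := fun a b => by ext; simp }
    refine LinearMap.finrank_le_finrank_of_injective (f := f) ?_
    intro a b hab
    have h1 : w ^ (m + k - m) * ((a : 𝒮 m) : S) = w ^ (m + k - m) * ((b : 𝒮 m) : S) := congrArg Subtype.val (congrArg Subtype.val hab)
    apply Subtype.ext
    apply hc.psiR_inj m
    show ψ ((a : 𝒮 m) : S) = ψ ((b : 𝒮 m) : S)
    rw [← (hc.mulw (l' := m + k) (by omega) (a : 𝒮 m).2).2, h1, (hc.mulw (by omega) (b : 𝒮 m).2).2]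
  have h4 := hC1 m
  have h5 := hC1 (m + k)
  have h6 : (m + k) / N ≤ m / N + 1 := by
    rw [← Nat.add_div_right _ hc.hN]; exact Nat.div_le_div_right (by omega)
  have h7 : (e0 : ℤ) * ((m + k) / N : ℕ) ≤ e0 * ((m / N : ℕ) + 1) := by exact_mod_cast Nat.mul_le_mul_left _ h6
  rw [abs_le] at h4 h5
  obtain ⟨h41, h42⟩ := h4
  obtain ⟨h51, h52⟩ := h5
  zify at h1 h2 h3
  linarith

/-- Formula in all degrees. -/
theorem CM.formula' (hc : CM 𝒮 ψ N w y) (ι : Type*) [Fintype ι] [DecidableEq ι] :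
    ∃ C : ℤ, 0 ≤ C ∧ ∀ (h : ι → S) (d : ι → ℕ) (hh : ∀ i, h i ∈ 𝒮 (d i)) (i0 : ι) (hi0 : h i0 ≠ 0) (q : ℕ)
      {ν : ℕ} (e : Fin ν → ι → L) (b : Fin ν → ℤ)
      (hr : GoodFilt.IsRed (ELn K L (fun i => ((q * d i / N : ℕ) : ℤ)))
        ((Kq (fun i => ψ (h i)) q).restrictScalars (RatFunc K)) e b), ∃ κ : ℤ, ∀ m : ℕ, (∀ i, q * d i + N ≤ m) →
      |(gradedPieceDim 𝒮 (Ideal.span (Set.range fun i => h i ^ q)) m : ℤ) - ∑ j, max (b j - (m / N : ℕ)) 0 - κ| ≤ C := by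
  obtain ⟨C, hC⟩ := hc.formula ι
  obtain ⟨C1, hC10, hC1⟩ := hc.gpd_step
  set e0 : ℕ := Module.finrank (RatFunc K) L with he0
  refine ⟨|C| + C1 + Fintype.card ι * e0, by positivity, fun h d hh i0 hi0 q ν e b hr => ?_⟩
  obtain ⟨κ, hκ⟩ := hC h d hh i0 hi0 q e b hr
  have hψi0 : ψ (h i0) ≠ 0 := fun h0 => hi0 (hc.inj _ _ (hh i0) h0)
  have hν := Kq_isRed_card (fun i => ψ (h i)) i0 hψi0 q hr
  refine ⟨κ, fun m hm => ?_⟩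
  have hN := hc.hN
  set u := m / N with hu
  have hdm := Nat.div_add_mod m N
  have hml := Nat.mod_lt m hN
  rw [← hu] at hdm
  have h1 := hκ u (fun i => by have := hm i; omega)
  have h2 := hκ (u + 1) (fun i => by have := hm i; rw [mul_add]; omega)
  set J := Ideal.span (Set.range fun i => h i ^ q)
  have h3 := hC1 J (N * u) (m % N) hml.le
  rw [hdm] at h3
  have h4 := hC1 J m (N - m % N) (by omega)
  rw [show m + (N - m % N) = N * (u + 1) by rw [mul_add]; omega] at h4
  have h5 : ∑ j, max (b j - (u : ℤ)) 0 ≤ ∑ j, max (b j - ((u + 1 : ℕ) : ℤ)) 0 + ν := by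
    have : (ν : ℤ) = ∑ j : Fin ν, (1 : ℤ) := by simp
    rw [this, ← Finset.sum_add_distrib]
    refine Finset.sum_le_sum fun j _ => ?_
    push_cast
    omega
  have hnν : (ν : ℤ) ≤ Fintype.card ι * e0 := by
    rw [hν]; have : (0 : ℤ) ≤ e0 := by positivity
    nlinarith
  have hn0 : (0 : ℤ) ≤ (Fintype.card ι : ℤ) * e0 := by positivity
  rw [abs_le] at h1 h2 ⊢
  have h6 := le_abs_self C
  obtain ⟨h11, h12⟩ := h1
  obtain ⟨h21, h22⟩ := h2
  constructor <;> linarith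
end CM
end FilePG2

section FilePG3
set_option linter.all false
open Polynomial

/-- graded domain data -/
structure GS {K S ι : Type*} [Field K] [CommRing S] [Algebra K S] (𝒮 : ℕ → Submodule K S)
    (g : ι → S) (a : ι → ℕ) (N : ℕ) : Prop where
  h0 : ∀ x ∈ 𝒮 0, ∃ c : K, x = algebraMap K S c
  hg : ∀ i, g i ∈ 𝒮 (a i)
  ha : ∀ i, 0 < a i
  hN : 0 < N
  hd : ∀ i, a i ∣ N
  gen : Algebra.adjoin K (Set.range g) = ⊤
  dim : ringKrullDim S = 2

section GS
variable {K S ι : Type*} [Field K] [CommRing S] [Algebra K S] {𝒮 : ℕ → Submodule K S} [GradedAlgebra 𝒮]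
  [Fintype ι] {g : ι → S} {a : ι → ℕ} {N : ℕ}

/-- monomials -/
def gmon (g : ι → S) (e : ι → ℕ) : S := ∏ i, g i ^ e i

lemma gmon_mem (hg : ∀ i, g i ∈ 𝒮 (a i)) (e : ι → ℕ) : gmon g e ∈ 𝒮 (∑ i, e i * a i) := by
  apply SetLike.prod_mem_graded
  intro i _
  have := SetLike.pow_mem_graded (e i) (hg i)
  simpa using this

lemma proj_same {x : S} {n : ℕ} (hx : x ∈ 𝒮 n) : (DirectSum.decompose 𝒮 x n : S) = x :=
  DirectSum.decompose_of_mem_same 𝒮 hx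

lemma gmon_span (hg : ∀ i, g i ∈ 𝒮 (a i)) (gen : Algebra.adjoin K (Set.range g) = ⊤) (n : ℕ) (x : S) (hx : x ∈ 𝒮 n) :
    x ∈ Submodule.span K {z | ∃ e : ι → ℕ, ∑ i, e i * a i = n ∧ z = gmon g e} := by
  have h1 : x ∈ Algebra.adjoin K (Set.range g) := by rw [gen]; trivial
  rw [Algebra.adjoin_range_eq_range_aeval] at h1
  obtain ⟨P, rfl⟩ := h1
  have h2 : (MvPolynomial.aeval g) P = ∑ d ∈ P.support, P.coeff d • gmon g d := by
    change (MvPolynomial.aeval g) P = _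
    rw [MvPolynomial.aeval_def, MvPolynomial.eval₂_eq']
    refine Finset.sum_congr rfl fun d _ => ?_
    rw [Algebra.smul_def]; rfl
  have h3 := proj_same hx
  change ((DirectSum.decompose 𝒮 ((MvPolynomial.aeval g) P) n : 𝒮 n) : S) = (MvPolynomial.aeval g) P at h3
  change (MvPolynomial.aeval g) P ∈ _
  rw [← h3, h2, DirectSum.decompose_sum, DFinsupp.finset_sum_apply, AddSubmonoidClass.coe_finset_sum]
  refine Submodule.sum_mem _ fun d _ => ?_
  rw [DirectSum.decompose_smul]
  change ((P.coeff d • (DirectSum.decompose 𝒮 (gmon g d) n) : 𝒮 n) : S) ∈ _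
  rw [Submodule.coe_smul]
  apply Submodule.smul_mem
  by_cases h : ∑ i, d i * a i = n
  · subst h
    rw [proj_same (gmon_mem hg d)]
    exact Submodule.subset_span ⟨d, rfl, rfl⟩
  · rw [DirectSum.decompose_of_mem_ne 𝒮 (gmon_mem hg d) h]
    exact zero_mem _

/-- span of `w^i y^j τ` in degree `n` -/
def TT (K : Type*) {S ι : Type*} [Field K] [CommRing S] [Algebra K S] [Fintype ι] (g : ι → S) (a : ι → ℕ) (N : ℕ) (w y : S) (E n : ℕ) : Submodule K S :=
  Submodule.span K {x | ∃ (i j : ℕ) (e : ι → Fin E), i + N * j + ∑ l, (e l : ℕ) * a l = n ∧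
    x = w ^ i * y ^ j * gmon g (fun l => e l)}

lemma TT_mul_w {w y : S} {E n : ℕ} (i0 j0 : ℕ) {x : S} (hx : x ∈ TT K g a N w y E n) : w ^ i0 * y ^ j0 * x ∈ TT K g a N w y E (n + i0 + N * j0) := by
  have : TT K g a N w y E n ≤ (TT K g a N w y E (n + i0 + N * j0)).comap (LinearMap.mulLeft K (w ^ i0 * y ^ j0)) := by
    refine Submodule.span_le.2 ?_
    rintro _ ⟨i, j, e, rfl, rfl⟩
    refine Submodule.subset_span ⟨i + i0, j + j0, e, by ring, ?_⟩
    simp only [LinearMap.mulLeft_apply]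
    ring
  exact this hx

theorem TT_main (hg : ∀ i, g i ∈ 𝒮 (a i)) (gen : Algebra.adjoin K (Set.range g) = ⊤) (hN : 0 < N) {w y : S}
    (hw : w ∈ 𝒮 1) (hy : y ∈ 𝒮 N) {E : ℕ} (hE : ∀ i, g i ^ E ∈ Ideal.span {w, y}) (n : ℕ) :
    𝒮 n ≤ TT K g a N w y E n := by
  classical
  induction n using Nat.strong_induction_on with
  | _ n ih =>
  intro x hx
  refine (Submodule.span_le.2 ?_) (gmon_span hg gen n x hx)
  rintro _ ⟨e, he, rfl⟩
  by_cases h : ∀ i, e i < E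
  · exact Submodule.subset_span ⟨0, 0, fun l => ⟨e l, h l⟩, by simpa using he, by simp⟩
  push Not at h
  obtain ⟨i, hi⟩ := h
  obtain ⟨u, v, huv⟩ := Ideal.mem_span_pair.1 (hE i)
  have h1 : gmon g e = g i ^ E * gmon g (Function.update e i (e i - E)) := by
    unfold gmon
    rw [Finset.prod_eq_mul_prod_sdiff_singleton_of_mem (Finset.mem_univ i), Finset.prod_eq_mul_prod_sdiff_singleton_of_mem (Finset.mem_univ i) (fun l => g l ^ Function.update e i (e i - E) l), ← mul_assoc]
    congr 1
    · rw [Function.update_self, ← pow_add]; congr 1; omega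
    · refine Finset.prod_congr rfl fun l hl => ?_
      rw [Function.update_of_ne]
      simpa using hl
  set r := gmon g (Function.update e i (e i - E)) with hr
  have h2 : gmon g e = w * (u * r) + y * (v * r) := by rw [h1, ← huv]; ring
  have h3 := proj_same (𝒮 := 𝒮) (n := n) (by rw [← he]; exact gmon_mem hg e : gmon g e ∈ 𝒮 n)
  rw [← h3, h2, DirectSum.decompose_add]
  change ((DirectSum.decompose 𝒮 (w * (u * r)) n : 𝒮 n) : S) + (DirectSum.decompose 𝒮 (y * (v * r)) n : 𝒮 n) ∈ TT K g a N w y E n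
  apply Submodule.add_mem
  · by_cases h4 : 1 ≤ n
    · rw [DirectSum.coe_decompose_mul_of_left_mem_of_le 𝒮 hw h4]
      have := TT_mul_w 1 0 (ih (n - 1) (by omega) (DirectSum.decompose 𝒮 (u * r) (n - 1)).2)
      have e : n - 1 + 1 + N * 0 = n := by omega
      rw [e] at this
      simpa using this
    · rw [DirectSum.coe_decompose_mul_of_left_mem_of_not_le 𝒮 hw h4]; exact zero_mem _
  · by_cases h4 : N ≤ n
    · rw [DirectSum.coe_decompose_mul_of_left_mem_of_le 𝒮 hy h4]
      have := TT_mul_w 0 1 (ih (n - N) (by omega) (DirectSum.decompose 𝒮 (v * r) (n - N)).2)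
      have e : n - N + 0 + N * 1 = n := by omega
      rw [e] at this
      simpa using this
    · rw [DirectSum.coe_decompose_mul_of_left_mem_of_not_le 𝒮 hy h4]; exact zero_mem _

/-- If `y` is a multiple of `w^N` the dimension is at most one. -/
theorem dim_le_one (hg : ∀ i, g i ∈ 𝒮 (a i)) (gen : Algebra.adjoin K (Set.range g) = ⊤) (hN : 0 < N) {w y : S}
    (hw : w ∈ 𝒮 1) (hy : y ∈ 𝒮 N) {E : ℕ} (hE : ∀ i, g i ^ E ∈ Ideal.span {w, y}) (c : K) (hc : y = algebraMap K S c * w ^ N) :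
    ringKrullDim S ≤ 1 := by
  classical
  letI : Algebra K[X] S := (Polynomial.aeval w).toAlgebra
  have hX : ∀ P : K[X], algebraMap K[X] S P = Polynomial.aeval w P := fun P => rfl
  haveI : IsScalarTower K K[X] S := IsScalarTower.of_algebraMap_eq fun r => by rw [hX]; simp
  have hfin : Module.Finite K[X] S := by
    refine ⟨⟨Finset.univ.image (fun e : ι → Fin E => gmon g (fun l => e l)), ?_⟩⟩
    rw [eq_top_iff]
    intro x _
    have h1 : ∀ n, 𝒮 n ≤ (Submodule.span K[X] ((Finset.univ.image (fun e : ι → Fin E => gmon g (fun l => e l)) : Finset S) : Set S)).restrictScalars K := by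
      intro n
      refine (TT_main hg gen hN hw hy hE n).trans (Submodule.span_le.2 ?_)
      rintro _ ⟨i, j, e, -, rfl⟩
      have : w ^ i * y ^ j * gmon g (fun l => e l) = (X ^ i * (C c * X ^ N) ^ j : K[X]) • gmon g (fun l => (e l : ℕ)) := by
        rw [Algebra.smul_def, hX]; simp [hc]
      rw [this]
      exact Submodule.smul_mem _ _ (Submodule.subset_span (by simp))
    rw [← DirectSum.sum_support_decompose 𝒮 x]
    exact Submodule.sum_mem _ fun n _ => h1 n (DirectSum.decompose 𝒮 x n).2
  have hint : Algebra.IsIntegral K[X] S := Algebra.IsIntegral.of_finite _ _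
  have h1 : ringKrullDim S ≤ ringKrullDim K[X] := by
    refine Order.krullDim_le_of_strictMono (PrimeSpectrum.comap (algebraMap K[X] S)) ?_
    intro P Q h
    exact Ideal.IsIntegral.comap_lt_comap (R := K[X]) (I := P.asIdeal) (J := Q.asIdeal) h
  refine h1.trans ?_
  rw [IsPrincipalIdealRing.ringKrullDim_eq_one K[X] (Polynomial.not_isField K)]
end GS
end FilePG3

section FilePG4
set_option linter.all false
open Polynomial

section GS
variable {K S ι : Type*} [Field K] [CommRing S] [IsDomain S] [Algebra K S] {𝒮 : ℕ → Submodule K S} [GradedAlgebra 𝒮]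
  [Fintype ι] {g : ι → S} {a : ι → ℕ} {N : ℕ}

lemma irr_prime : (HomogeneousIdeal.irrelevant 𝒮).toIdeal.IsPrime := by
  change (RingHom.ker (GradedRing.projZeroRingHom 𝒮)).IsPrime
  exact RingHom.ker_isPrime _

lemma GS.mem_irr (h : GS 𝒮 g a N) (i : ι) : g i ∈ (HomogeneousIdeal.irrelevant 𝒮).toIdeal :=
  HomogeneousIdeal.mem_irrelevant_of_mem 𝒮 (h.ha i) (h.hg i)

lemma GS.le_irr (h : GS 𝒮 g a N) {Q : Ideal S} (hQ : Q.IsHomogeneous 𝒮) (hQt : Q ≠ ⊤) : Q ≤ (HomogeneousIdeal.irrelevant 𝒮).toIdeal := by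
  intro x hx
  change x ∈ HomogeneousIdeal.irrelevant 𝒮
  rw [HomogeneousIdeal.mem_irrelevant_iff, GradedRing.proj_apply]
  obtain ⟨c, hc⟩ := h.h0 _ (DirectSum.decompose 𝒮 x 0).2
  by_contra h0
  apply hQt
  have hc0 : c ≠ 0 := by rintro rfl; rw [map_zero] at hc; exact h0 hc
  have h1 : algebraMap K S c ∈ Q := by rw [← hc]; exact hQ 0 hx
  exact Ideal.eq_top_of_isUnit_mem _ h1 ((isUnit_iff_ne_zero.2 hc0).map _)

lemma GS.lt_irr (h : GS 𝒮 g a N) {Q : Ideal S} (hQ : Q.IsHomogeneous 𝒮) (hQt : Q ≠ ⊤) (i : ι) (hi : g i ∉ Q) : Q < (HomogeneousIdeal.irrelevant 𝒮).toIdeal :=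
  lt_of_le_of_ne (h.le_irr hQ hQt) (fun e => hi (e ▸ h.mem_irr i))

lemma GS.irr_le (h : GS 𝒮 g a N) {P : Ideal S} (hP : ∀ i, g i ∈ P) : (HomogeneousIdeal.irrelevant 𝒮).toIdeal ≤ P := by
  rw [HomogeneousIdeal.irrelevant_eq_span, Ideal.span_le]
  intro z hz
  simp only [Set.mem_iUnion] at hz
  obtain ⟨n, hn, hz⟩ := hz
  refine (Submodule.span_le (p := P.restrictScalars K)).2 ?_ (gmon_span h.hg h.gen n z hz)
  rintro _ ⟨e, he, rfl⟩
  have : ∃ i, e i ≠ 0 := by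
    by_contra hcc
    push Not at hcc
    simp [hcc] at he
    exact absurd hn (by rw [← he]; exact lt_irrefl _)
  obtain ⟨i, hi⟩ := this
  exact P.mem_of_dvd ((dvd_pow_self (g i) hi).trans (Finset.dvd_prod_of_mem _ (Finset.mem_univ i))) (hP i)

lemma GS.chain (h : GS 𝒮 g a N) {P Q : Ideal S} [hP : P.IsPrime] [hQ : Q.IsPrime] (h1 : P ≠ ⊥) (h2 : P < Q) (h3 : Q < (HomogeneousIdeal.irrelevant 𝒮).toIdeal) : False := by
  let s : LTSeries (PrimeSpectrum S) :=
    { length := 3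
      toFun := ![⟨⊥, Ideal.isPrime_bot⟩, ⟨P, hP⟩, ⟨Q, hQ⟩, ⟨_, irr_prime (𝒮 := 𝒮)⟩]
      step := by
        intro i
        fin_cases i
        · exact bot_lt_iff_ne_bot.2 h1
        · exact h2
        · exact h3 }
  have h4 := Order.LTSeries.length_le_krullDim s
  change (3 : WithBot ℕ∞) ≤ ringKrullDim S at h4
  rw [h.dim] at h4
  exact absurd h4 (by decide)

lemma minimal_homog {I P : Ideal S} (hI : I.IsHomogeneous 𝒮) (hP : P ∈ I.minimalPrimes) : P.IsHomogeneous 𝒮 := by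
  haveI := hP.1.1
  have h1 : (P.homogeneousCore 𝒮).toIdeal ≤ P := Ideal.toIdeal_homogeneousCore_le 𝒮 P
  have h2 := hP.2 (y := (P.homogeneousCore 𝒮).toIdeal) ⟨Ideal.IsPrime.homogeneousCore hP.1.1, hI.toIdeal_homogeneousCore_eq_self.symm.trans_le (Ideal.homogeneousCore_mono _ hP.1.2)⟩ h1
  have h3 : (P.homogeneousCore 𝒮).toIdeal = P := le_antisymm h1 h2
  rw [← h3]
  exact HomogeneousIdeal.isHomogeneous _

lemma GS.noeth (h : GS 𝒮 g a N) : IsNoetherianRing S := by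
  have : Algebra.FiniteType K S := ⟨by
    classical
    rw [← h.gen]
    refine ⟨Finset.univ.image g, by simp⟩⟩
  exact Algebra.FiniteType.isNoetherianRing K S

lemma span_homog {s : Set S} (hs : ∀ x ∈ s, ∃ n, x ∈ 𝒮 n) : (Ideal.span s).IsHomogeneous 𝒮 :=
  Ideal.homogeneous_span 𝒮 s (fun x hx => hs x hx)

/-- radical criterion -/
lemma GS.radical (h : GS 𝒮 g a N) {I : Ideal S} (hI : I.IsHomogeneous 𝒮)
    (hp : ∀ Q : Ideal S, Q.IsPrime → Q.IsHomogeneous 𝒮 → I ≤ Q → ∀ i, g i ∈ Q) : ∃ E : ℕ, 0 < E ∧ ∀ i, g i ^ E ∈ I := by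
  have h1 : ∀ i, g i ∈ I.radical := by
    intro i
    rw [hI.radical_eq]
    rw [Submodule.mem_sInf]
    intro Q hQ
    exact hp Q hQ.2.2 hQ.1 hQ.2.1 i
  choose n hn using h1
  refine ⟨∑ i, n i + 1, by omega, fun i => Ideal.pow_mem_of_pow_mem _ (hn i) ?_⟩
  have := Finset.single_le_sum (f := n) (fun _ _ => Nat.zero_le _) (Finset.mem_univ i)
  omega

theorem GS.exists_y [Infinite K] (h : GS 𝒮 g a N) {w : S} (hw : w ∈ 𝒮 1) (hw0 : w ≠ 0) :
    ∃ y ∈ 𝒮 N, ∃ E : ℕ, 0 < E ∧ ∀ i, g i ^ E ∈ Ideal.span {w, y} := by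
  classical
  haveI := h.noeth
  have hIw : (Ideal.span {w}).IsHomogeneous 𝒮 := span_homog (by rintro x rfl; exact ⟨1, hw⟩)
  -- no minimal prime contains all `g i`
  have hmin : ∀ P ∈ (Ideal.span {w}).minimalPrimes, ∃ i, g i ∉ P := by
    intro P hP
    by_contra hcon
    push Not at hcon
    haveI := hP.1.1
    have hPh := minimal_homog hIw hP
    obtain ⟨E, hE0, hE⟩ := h.radical hIw (by
      intro Q hQ hQh hIQ i
      obtain ⟨P', hP', hP'Q⟩ := Ideal.exists_minimalPrimes_le hIQ
      have hP'h := minimal_homog hIw hP'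
      haveI := hP'.1.1
      have h1 : (HomogeneousIdeal.irrelevant 𝒮).toIdeal ≤ P := by
        exact h.irr_le hcon
      have h2 : P' ≤ P := (h.le_irr hP'h hP'.1.1.ne_top).trans h1
      have h3 : P ≤ P' := hP.2 hP'.1 h2
      exact hP'Q (h3 (hcon i)))
    have := dim_le_one h.hg h.gen h.hN hw (y := 0) (zero_mem _) (E := E) (fun i => Ideal.span_mono (by simp) (hE i)) 0 (by simp)
    rw [h.dim] at this
    exact absurd this (by decide)
  have hfin : (Ideal.span {w}).minimalPrimes.Finite := Ideal.finite_minimalPrimes_of_isNoetherianRing S _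
  let V : Submodule K S := Submodule.span K (Set.range fun i => g i ^ (N / a i))
  have hV : V ≤ 𝒮 N := by
    refine Submodule.span_le.2 ?_
    rintro _ ⟨i, rfl⟩
    have := SetLike.pow_mem_graded (N / a i) (h.hg i)
    rw [smul_eq_mul, Nat.div_mul_cancel (h.hd i)] at this
    exact this
  let s : Finset (Subspace K V) := hfin.toFinset.image (fun P => (P.restrictScalars K).comap V.subtype)
  have hs : ⊤ ∉ s := by
    intro hc
    obtain ⟨P, hP, hPt⟩ := Finset.mem_image.1 hc
    rw [Set.Finite.mem_toFinset] at hP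
    obtain ⟨i, hi⟩ := hmin P hP
    haveI := hP.1.1
    apply hi
    have h1 : (⟨g i ^ (N / a i), Submodule.subset_span ⟨i, rfl⟩⟩ : V) ∈ (P.restrictScalars K).comap V.subtype := by rw [hPt]; trivial
    exact hP.1.1.mem_of_pow_mem _ h1
  have h1 := Subspace.biUnion_ne_univ_of_top_notMem hs
  obtain ⟨⟨y, hyV⟩, hy⟩ := (Set.ne_univ_iff_exists_notMem _).1 h1
  simp only [Set.mem_iUnion, not_exists] at hy
  have hyP : ∀ P ∈ (Ideal.span {w}).minimalPrimes, y ∉ P := by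
    intro P hP hyP
    exact hy _ (Finset.mem_image.2 ⟨P, hfin.mem_toFinset.2 hP, rfl⟩) hyP
  refine ⟨y, hV hyV, h.radical (span_homog ?_) ?_⟩
  · rintro x (rfl | rfl)
    · exact ⟨1, hw⟩
    · exact ⟨N, hV hyV⟩
  intro Q hQ hQh hIQ i
  by_contra hi
  obtain ⟨P, hP, hPQ⟩ := Ideal.exists_minimalPrimes_le (show Ideal.span {w} ≤ Q from (Ideal.span_mono (by simp)).trans hIQ)
  haveI := hP.1.1
  refine h.chain (P := P) (Q := Q) ?_ (lt_of_le_of_ne hPQ ?_) (h.lt_irr hQh hQ.ne_top i hi)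
  · rintro rfl
    exact hw0 (by simpa using hP.1.2 (Ideal.subset_span rfl))
  · rintro rfl
    exact hyP _ hP (hIQ (Ideal.subset_span (by simp)))
end GS
end FilePG4

section FilePG5
set_option linter.all false
open Polynomial

universe v
section A
variable {K L S ι : Type*} [Field K] [Field L] [Algebra K L] [Algebra K[X] L] [Algebra (RatFunc K) L]
  [IsScalarTower K K[X] L] [IsScalarTower K[X] (RatFunc K) L] [IsScalarTower K (RatFunc K) L]
  [CommRing S] [IsDomain S] [Algebra K S] {𝒮 : ℕ → Submodule K S} [GradedAlgebra 𝒮]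
  [Fintype ι] {g : ι → S} {a : ι → ℕ} {N : ℕ} {ψ : S →ₐ[K] L} {w y : S} {E : ℕ}

lemma integral_A (h : GS 𝒮 g a N) (hw : w ∈ 𝒮 1) (hy : y ∈ 𝒮 N) (ψw : ψ w = 1) (ψy : ψ y = algebraMap K[X] L X)
    (hE : ∀ i, g i ^ E ∈ Ideal.span {w, y}) (s : S) : IsIntegral K[X] (ψ s) := by
  classical
  let M : Submodule K[X] L := Submodule.span K[X] (Set.range fun e : ι → Fin E => ψ (gmon g (fun l => (e l : ℕ))))
  have hM : ∀ s : S, ψ s ∈ M := by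
    intro s
    have h1 : ∀ n, 𝒮 n ≤ (M.restrictScalars K).comap ψ.toLinearMap := by
      intro n
      refine (TT_main h.hg h.gen h.hN hw hy hE n).trans (Submodule.span_le.2 ?_)
      rintro _ ⟨i, j, e, -, rfl⟩
      change ψ _ ∈ M
      have : ψ (w ^ i * y ^ j * gmon g (fun l => e l)) = (X ^ j : K[X]) • ψ (gmon g (fun l => (e l : ℕ))) := by
        rw [Algebra.smul_def]; simp [ψw, ψy]
      rw [this]
      exact Submodule.smul_mem _ _ (Submodule.subset_span ⟨e, rfl⟩)
    rw [← DirectSum.sum_support_decompose 𝒮 s, map_sum]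
    exact Submodule.sum_mem _ fun n _ => h1 n (DirectSum.decompose 𝒮 s n).2
  refine isIntegral_of_smul_mem_submodule (A := L) M ?_ (Submodule.fg_span (Set.finite_range _)) (ψ s) ?_
  · intro hb
    have := hM 1
    rw [hb, map_one] at this
    exact one_ne_zero ((Submodule.mem_bot _).1 this)
  · intro n hn
    induction hn using Submodule.span_induction with
    | mem x hx => obtain ⟨e, rfl⟩ := hx; rw [smul_eq_mul, ← map_mul]; exact hM _
    | zero => simp
    | add x y _ _ hx hy => rw [smul_add]; exact add_mem hx hy
    | smul c x _ hx => rw [smul_comm]; exact M.smul_mem _ hx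

lemma integral_B (h : GS 𝒮 g a N) (hw : w ∈ 𝒮 1) (hy : y ∈ 𝒮 N) (ψw : ψ w = 1) (ψy : ψ y = algebraMap K[X] L X)
    (hE : ∀ i, g i ^ E ∈ Ideal.span {w, y}) (j : ℕ) (s : S) (hs : s ∈ 𝒮 (N * j)) :
    IsIntegral (Oinf K) ((RatFunc.X : RatFunc K) ^ (-(j : ℤ)) • ψ s) := by
  classical
  have hN := h.hN
  have hXX : algebraMap K[X] L X = algebraMap (RatFunc K) L RatFunc.X := by
    rw [IsScalarTower.algebraMap_apply K[X] (RatFunc K) L, RatFunc.algebraMap_X]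
  let dg : (ι → Fin E) → ℕ := fun e => ∑ l, (e l : ℕ) * a l
  let cc : (ι → Fin E) → ℕ := fun e => (dg e + N - 1) / N
  have hcc : ∀ e, dg e ≤ N * cc e := by
    intro e
    have := Nat.div_add_mod (dg e + N - 1) N
    have := Nat.mod_lt (dg e + N - 1) hN
    show dg e ≤ N * ((dg e + N - 1) / N)
    omega
  have hcc2 : ∀ e k, dg e ≤ N * k → cc e ≤ k := by
    intro e k hk
    have : dg e + N - 1 < N * (k + 1) := by rw [mul_add]; omega
    have := Nat.div_lt_of_lt_mul this
    show (dg e + N - 1) / N ≤ k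
    omega
  let M : Submodule (Oinf K) L := Submodule.span (Oinf K) (Set.range fun e : ι → Fin E => (RatFunc.X : RatFunc K) ^ (-(cc e : ℤ)) • ψ (gmon g (fun l => (e l : ℕ))))
  have hM : ∀ (c : ℕ) (u : S), u ∈ 𝒮 (N * c) → (RatFunc.X : RatFunc K) ^ (-(c : ℤ)) • ψ u ∈ M := by
    intro c u hu
    have hu' := TT_main h.hg h.gen h.hN hw hy hE _ hu
    clear hu
    unfold TT at hu'
    induction hu' using Submodule.span_induction with
    | mem x hx =>
      obtain ⟨i, k, e, he, rfl⟩ := hx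
      have h1 : N * k + dg e ≤ N * c := by show N * k + ∑ l, (e l : ℕ) * a l ≤ N * c; omega
      have hk : k ≤ c := by
        have : N * k ≤ N * c := by omega
        exact Nat.le_of_mul_le_mul_left this hN
      have h2 := hcc2 e (c - k) (by rw [Nat.mul_sub]; omega)
      have : (RatFunc.X : RatFunc K) ^ (-(c : ℤ)) • ψ (w ^ i * y ^ k * gmon g (fun l => e l)) =
          (⟨RatFunc.X ^ (-((c : ℤ) - k - cc e)), X_zpow_mem _ (by omega)⟩ : Oinf K) • ((RatFunc.X : RatFunc K) ^ (-(cc e : ℤ)) • ψ (gmon g (fun l => (e l : ℕ)))) := by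
        rw [Subalgebra.smul_def, smul_smul, ← zpow_add₀ RatFunc.X_ne_zero]
        simp only [map_mul, map_pow, ψw, ψy, hXX, one_pow, one_mul]
        rw [← map_pow, ← Algebra.smul_def, smul_smul, ← zpow_natCast (RatFunc.X : RatFunc K) k, ← zpow_add₀ RatFunc.X_ne_zero]
        congr 2
        ring
      rw [this]
      exact Submodule.smul_mem _ _ (Submodule.subset_span ⟨e, rfl⟩)
    | zero => simp
    | add x y _ _ hx hy =>
      rw [map_add, smul_add]
      exact add_mem hx hy
    | smul r x _ hx =>
      rw [map_smul, smul_comm, ← algebraMap_smul (Oinf K) r]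
      exact M.smul_mem _ hx
  refine isIntegral_of_smul_mem_submodule (A := L) M ?_ (Submodule.fg_span (Set.finite_range _)) _ ?_
  · intro hb
    have := hM 0 1 (by rw [mul_zero]; exact SetLike.one_mem_graded 𝒮)
    rw [hb, map_one] at this
    simp at this
  · intro n hn
    induction hn using Submodule.span_induction with
    | mem x hx =>
      obtain ⟨e, rfl⟩ := hx
      have h1 : s * (w ^ (N * cc e - dg e) * gmon g (fun l => e l)) ∈ 𝒮 (N * (j + cc e)) := by
        have h2 := SetLike.mul_mem_graded hs (SetLike.mul_mem_graded (SetLike.pow_mem_graded (N * cc e - dg e) hw) (gmon_mem h.hg (fun l => (e l : ℕ))))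
        have h3 : N * j + ((N * cc e - dg e) • 1 + ∑ i, (e i : ℕ) * a i) = N * (j + cc e) := by
          have := hcc e
          change N * j + ((N * cc e - dg e) • 1 + dg e) = N * (j + cc e)
          rw [mul_add, smul_eq_mul]; omega
        rw [h3] at h2
        exact h2
      have h2 := hM _ _ h1
      convert h2 using 1
      simp only [map_mul, map_pow, ψw, one_pow, one_mul, smul_eq_mul, smul_mul_smul_comm]
      rw [← zpow_add₀ RatFunc.X_ne_zero]
      congr 2
      push_cast; ring
    | zero => simp
    | add x y _ _ hx hy => rw [smul_add]; exact add_mem hx hy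
    | smul c x _ hx => rw [smul_comm]; exact M.smul_mem _ hx

lemma finite_A (h : GS 𝒮 g a N) (hw : w ∈ 𝒮 1) (hy : y ∈ 𝒮 N) (ψw : ψ w = 1) (ψy : ψ y = algebraMap K[X] L X)
    (hE : ∀ i, g i ^ E ∈ Ideal.span {w, y}) (frac : ∀ x : L, ∃ a b : S, ψ b ≠ 0 ∧ x = ψ a / ψ b) :
    FiniteDimensional (RatFunc K) L := by
  have hint := integral_A h hw hy ψw ψy hE
  let T := IntermediateField.adjoin (RatFunc K) (Set.range fun i => ψ (g i))
  haveI : FiniteDimensional (RatFunc K) T := by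
    apply IntermediateField.finiteDimensional_adjoin
    rintro _ ⟨i, rfl⟩
    exact (hint (g i)).tower_top
  have hT : ∀ s, ψ s ∈ T := by
    intro s
    have hs : s ∈ Algebra.adjoin K (Set.range g) := by rw [h.gen]; trivial
    induction hs using Algebra.adjoin_induction with
    | mem x hx => obtain ⟨i, rfl⟩ := hx; exact IntermediateField.subset_adjoin _ _ ⟨i, rfl⟩
    | algebraMap r =>
      rw [AlgHom.commutes, IsScalarTower.algebraMap_apply K (RatFunc K) L]
      exact T.algebraMap_mem _
    | add x y _ _ hx hy => rw [map_add]; exact add_mem hx hy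
    | mul x y _ _ hx hy => rw [map_mul]; exact mul_mem hx hy
  have hTt : T = ⊤ := by
    rw [eq_top_iff]
    rintro x -
    obtain ⟨a, b, -, rfl⟩ := frac x
    exact div_mem (hT a) (hT b)
  rw [hTt] at this
  exact LinearEquiv.finiteDimensional (IntermediateField.topEquiv (F := RatFunc K) (E := L)).toLinearEquiv

theorem CM_A (h : GS 𝒮 g a N) (hw : w ∈ 𝒮 1) (hy : y ∈ 𝒮 N) (ψw : ψ w = 1) (ψy : ψ y = algebraMap K[X] L X)
    (hE : ∀ i, g i ^ E ∈ Ideal.span {w, y}) (frac : ∀ x : L, ∃ a b : S, ψ b ≠ 0 ∧ x = ψ a / ψ b)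
    (inj : ∀ j, ∀ s ∈ 𝒮 j, ψ s = 0 → s = 0) : CM 𝒮 ψ N w y :=
  ⟨h.hN, hw, hy, ψw, ψy, inj, fun j s hs => mem_EL.2 ⟨integral_A h hw hy ψw ψy hE s, integral_B h hw hy ψw ψy hE j s hs⟩, frac⟩
end A

section B
variable {K : Type*} {S : Type v} {ι : Type*} [Field K]
  [CommRing S] [IsDomain S] [Algebra K S] {𝒮 : ℕ → Submodule K S} [GradedAlgebra 𝒮]
  [Fintype ι] {g : ι → S} {a : ι → ℕ} {N : ℕ} {w : S}

lemma exists_psi0 (hw : w ∈ 𝒮 1) (hw0 : w ≠ 0) : ∃ ψ : S →ₐ[K] FractionRing S, ∀ j, ∀ s ∈ 𝒮 j, ψ s = algebraMap S _ s / algebraMap S _ w ^ j := by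
  have hw1 : algebraMap S (FractionRing S) w ≠ 0 := by simpa using hw0
  let f : ∀ i, 𝒮 i →ₗ[K] FractionRing S := fun i =>
    { toFun := fun s => algebraMap S _ (s : S) / algebraMap S _ w ^ i
      map_add' := fun x y => by simp [add_div]
      map_smul' := fun c x => by simp [Algebra.smul_def, mul_div_assoc, ← IsScalarTower.algebraMap_apply] }
  let F : DirectSum ℕ (fun i => 𝒮 i) →ₐ[K] FractionRing S := DirectSum.toAlgebra K (fun i => 𝒮 i) f (by
      show algebraMap S (FractionRing S) (1 : S) / algebraMap S (FractionRing S) w ^ 0 = 1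
      simp) (by
      intro i j x y
      show algebraMap S (FractionRing S) ((x : S) * (y : S)) / algebraMap S (FractionRing S) w ^ (i + j) = (algebraMap S (FractionRing S) (x : S) / algebraMap S (FractionRing S) w ^ i) * (algebraMap S (FractionRing S) (y : S) / algebraMap S (FractionRing S) w ^ j)
      rw [map_mul, pow_add]
      field_simp)
  refine ⟨F.comp (DirectSum.decomposeAlgEquiv 𝒮).toAlgHom, fun j s hs => ?_⟩
  have h1 : (F.comp (DirectSum.decomposeAlgEquiv 𝒮).toAlgHom) s = F (DirectSum.decompose 𝒮 s) := rfl
  rw [h1, DirectSum.decompose_of_mem 𝒮 hs]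
  exact DirectSum.toAddMonoid_of (β := fun i => 𝒮 i) (fun i => (f i).toAddMonoidHom) j ⟨s, hs⟩

lemma exists_psi1 (hw : w ∈ 𝒮 1) (hw0 : w ≠ 0) : ∃ (L : Type v) (_ : Field L) (_ : Algebra K L) (ψ : S →ₐ[K] L),
    ψ w = 1 ∧ (∀ x : L, ∃ a b : S, ψ b ≠ 0 ∧ x = ψ a / ψ b) ∧ (∀ j, ∀ s ∈ 𝒮 j, ψ s = 0 → s = 0) := by
  obtain ⟨ψ, hψ⟩ := exists_psi0 hw hw0
  have hw1 : algebraMap S (FractionRing S) w ≠ 0 := by simpa using hw0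
  refine ⟨FractionRing ψ.range, inferInstance, inferInstance, (IsScalarTower.toAlgHom K ψ.range (FractionRing ψ.range)).comp ψ.rangeRestrict, ?_, ?_, ?_⟩
  · have : ψ.rangeRestrict w = 1 := by
      apply Subtype.ext
      show ψ w = 1
      rw [hψ 1 w hw, pow_one, div_self hw1]
    simp [this]
  · intro x
    obtain ⟨a, b, hb, rfl⟩ := IsFractionRing.div_surjective (A := ψ.range) x
    obtain ⟨a', rfl⟩ := ψ.rangeRestrict_surjective a
    obtain ⟨b', rfl⟩ := ψ.rangeRestrict_surjective b
    refine ⟨a', b', ?_, rfl⟩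
    have := nonZeroDivisors.ne_zero hb
    intro h
    apply this
    exact IsFractionRing.injective ψ.range (FractionRing ψ.range) (by rw [map_zero]; exact h)
  · intro j s hs h
    have h1 : ψ.rangeRestrict s = 0 := IsFractionRing.injective ψ.range (FractionRing ψ.range) (by rw [map_zero]; exact h)
    have h2 : ψ s = 0 := congrArg Subtype.val h1
    rw [hψ j s hs, div_eq_zero_iff] at h2
    rcases h2 with h2 | h2
    · exact (map_eq_zero_iff _ (IsFractionRing.injective S (FractionRing S))).1 h2
    · exact absurd h2 (pow_ne_zero _ hw1)

theorem GS.exists_CM [IsAlgClosed K] (h : GS 𝒮 g a N) (hw : w ∈ 𝒮 1) (hw0 : w ≠ 0) :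
    ∃ (L : Type v) (_ : Field L) (_ : Algebra K L) (_ : Algebra K[X] L) (_ : Algebra (RatFunc K) L)
      (_ : IsScalarTower K K[X] L) (_ : IsScalarTower K[X] (RatFunc K) L) (_ : IsScalarTower K (RatFunc K) L)
      (_ : FiniteDimensional (RatFunc K) L) (ψ : S →ₐ[K] L) (y : S), CM 𝒮 ψ N w y := by
  haveI : Infinite K := IsAlgClosed.instInfinite
  obtain ⟨y, hy, E, -, hE⟩ := h.exists_y hw hw0
  obtain ⟨L, _, _, ψ, ψw, frac, inj⟩ := exists_psi1 hw hw0
  have htr : Transcendental K (ψ y) := by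
    intro halg
    have h1 := IsAlgClosed.degree_eq_one_of_irreducible K (minpoly.irreducible halg.isIntegral)
    obtain ⟨c, hc⟩ := minpoly.mem_range_of_degree_eq_one K (ψ y) h1
    have h2 : y = algebraMap K S c * w ^ N := by
      rw [← sub_eq_zero]
      refine inj N _ (sub_mem hy ?_) ?_
      · rw [← Algebra.smul_def]
        have := SetLike.pow_mem_graded N hw
        rw [smul_eq_mul, mul_one] at this
        exact Submodule.smul_mem _ _ this
      · simp [ψw, ← hc]
    have := dim_le_one h.hg h.gen h.hN hw hy hE c h2
    rw [h.dim] at this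
    exact absurd this (by decide)
  letI : Algebra K[X] L := (Polynomial.aeval (ψ y)).toAlgebra
  have hX : ∀ P : K[X], algebraMap K[X] L P = Polynomial.aeval (ψ y) P := fun P => rfl
  haveI : IsScalarTower K K[X] L := IsScalarTower.of_algebraMap_eq fun r => by rw [hX]; simp
  have hinj : Function.Injective (algebraMap K[X] L) := transcendental_iff_injective.1 htr
  letI : Algebra (RatFunc K) L := (IsFractionRing.lift (A := K[X]) (K := RatFunc K) hinj).toAlgebra
  haveI : IsScalarTower K[X] (RatFunc K) L := IsScalarTower.of_algebraMap_eq fun r => by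
    show _ = IsFractionRing.lift (A := K[X]) (K := RatFunc K) hinj _
    rw [IsFractionRing.lift_algebraMap]
  haveI : IsScalarTower K (RatFunc K) L := IsScalarTower.of_algebraMap_eq fun r => by
    rw [IsScalarTower.algebraMap_apply K K[X] L, IsScalarTower.algebraMap_apply K[X] (RatFunc K) L, ← IsScalarTower.algebraMap_apply K K[X] (RatFunc K)]
  have ψy : ψ y = algebraMap K[X] L X := by rw [hX]; simp
  exact ⟨L, inferInstance, inferInstance, inferInstance, inferInstance, inferInstance, inferInstance, inferInstance,
    finite_A h hw hy ψw ψy hE frac, ψ, y, CM_A h hw hy ψw ψy hE frac inj⟩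
end B
end FilePG5

section FilePG6
set_option linter.all false
open Polynomial

section F
variable {K S ι η : Type*} [Field K] [CommRing S] [IsDomain S] [Algebra K S] {𝒮 : ℕ → Submodule K S} [GradedAlgebra 𝒮]
  [Fintype ι] {g : ι → S} {a : ι → ℕ} {N : ℕ} [Fintype η] {H : η → S} {d : η → ℕ}

lemma GS.gpd_zero (h : GS 𝒮 g a N) {J : Ideal S} {E : ℕ} (hE : ∀ i, g i ^ E ∈ J) : ∃ M, ∀ m, M ≤ m → gradedPieceDim 𝒮 J m = 0 := by
  refine ⟨∑ i, E * a i + 1, fun m hm => ?_⟩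
  have h1 : ∀ x ∈ 𝒮 m, x ∈ J := by
    intro x hx
    refine (Submodule.span_le (p := J.restrictScalars K)).2 ?_ (gmon_span h.hg h.gen m x hx)
    rintro _ ⟨e, he, rfl⟩
    by_cases hc : ∃ i, E ≤ e i
    · obtain ⟨i, hi⟩ := hc
      exact J.mem_of_dvd ((pow_dvd_pow (g i) hi).trans (Finset.dvd_prod_of_mem _ (Finset.mem_univ i))) (hE i)
    · push Not at hc
      have : ∑ i, e i * a i ≤ ∑ i, E * a i := Finset.sum_le_sum fun i _ => Nat.mul_le_mul_right _ (hc i).le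
      omega
  have h2 : Submodule.comap (𝒮 m).subtype (J.restrictScalars K) = ⊤ := by
    rw [eq_top_iff]
    rintro ⟨x, hx⟩ -
    exact h1 x hx
  unfold gradedPieceDim
  rw [h2]
  exact Module.finrank_zero_of_subsingleton

lemma frob_mem (p : ℕ) [Fact p.Prime] [CharP S p] (n : ℕ) {x : S} (hx : x ∈ Ideal.span (Set.range H)) :
    x ^ (p ^ n) ∈ Ideal.span (Set.range fun i => H i ^ (p ^ n)) := by
  obtain ⟨c, rfl⟩ := (Ideal.mem_span_range_iff_exists_fun).1 hx
  rw [sum_pow_char_pow]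
  refine Ideal.sum_mem _ fun i _ => ?_
  rw [mul_pow]
  exact Ideal.mul_mem_left _ _ (Ideal.subset_span ⟨i, rfl⟩)

lemma frobPow_eq (p : ℕ) [Fact p.Prime] [CharP S p] (n : ℕ) :
    (Ideal.span (Set.range H)).frobPow (p ^ n) = Ideal.span (Set.range fun i => H i ^ (p ^ n)) := by
  apply le_antisymm
  · refine Ideal.span_le.2 ?_
    rintro _ ⟨x, hx, rfl⟩
    exact frob_mem p n hx
  · refine Ideal.span_le.2 ?_
    rintro _ ⟨i, rfl⟩
    exact Ideal.subset_span ⟨H i, Ideal.subset_span ⟨i, rfl⟩, rfl⟩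

/-- finite colength implies primary -/
lemma GS.primary (h : GS 𝒮 g a N) {J : Ideal S} (hJ : J.IsHomogeneous 𝒮) (hfin : FiniteDimensional K (S ⧸ J)) : ∃ E : ℕ, ∀ i, g i ^ E ∈ J := by
  have h1 : ∀ i, ∃ n, g i ^ n ∈ J := by
    intro i
    obtain ⟨P, hP, hP0⟩ := IsIntegral.of_finite K (Ideal.Quotient.mk J (g i))
    refine ⟨P.natDegree, ?_⟩
    have h2 : Polynomial.aeval (g i) P ∈ J := by
      rw [← Ideal.Quotient.eq_zero_iff_mem]
      change Polynomial.aeval (Ideal.Quotient.mkₐ K J (g i)) P = 0 at hP0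
      rw [Polynomial.aeval_algHom_apply] at hP0
      exact hP0
    have h3 := hJ (P.natDegree * a i) h2
    convert h3
    rw [Polynomial.aeval_eq_sum_range, DirectSum.decompose_sum, DFinsupp.finset_sum_apply, AddSubmonoidClass.coe_finset_sum]
    rw [Finset.sum_eq_single P.natDegree]
    · rw [Polynomial.coeff_natDegree, hP.leadingCoeff, one_smul, proj_same]
      exact SetLike.pow_mem_graded _ (h.hg i)
    · intro k _ hk
      rw [DirectSum.decompose_smul]
      change ((P.coeff k • (DirectSum.decompose 𝒮 (g i ^ k) (P.natDegree * a i)) : 𝒮 _) : S) = 0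
      rw [Submodule.coe_smul, DirectSum.decompose_of_mem_ne 𝒮 (SetLike.pow_mem_graded k (h.hg i)), smul_zero]
      rw [smul_eq_mul]
      intro hc
      exact hk (Nat.eq_of_mul_eq_mul_right (h.ha i) hc)
    · intro hc; simp at hc
  choose n hn using h1
  refine ⟨∑ i, n i, fun i => Ideal.pow_mem_of_pow_mem _ (hn i) ?_⟩
  exact Finset.single_le_sum (f := n) (fun _ _ => Nat.zero_le _) (Finset.mem_univ i)

/-- graded Nakayama -/
lemma naka (h : GS 𝒮 g a N) {P : Ideal S} [hP : P.IsPrime] (hPh : P.IsHomogeneous 𝒮) (hP0 : P ≠ ⊥) {t : S} (ht : t ∉ P) (i : ℕ) :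
    ∃ n, ∃ x ∈ 𝒮 n, x ∈ P ^ i ∧ ∀ l, t ^ l * x ∉ P ^ (i + 1) := by
  haveI := h.noeth
  by_contra hcon
  push Not at hcon
  have hPi : ∀ i, (P ^ i).IsHomogeneous 𝒮 := by
    intro i
    induction i with
    | zero => rw [pow_zero, Ideal.one_eq_top]; exact Ideal.IsHomogeneous.top _
    | succ k ih => rw [pow_succ]; exact Ideal.IsHomogeneous.mul ih hPh
  have h1 : ∀ x ∈ P ^ i, ∃ l, t ^ l * x ∈ P ^ (i + 1) := by
    intro x hx
    have h2 : ∀ n : ℕ, ∃ l, t ^ l * (DirectSum.decompose 𝒮 x n : S) ∈ P ^ (i + 1) := fun n =>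
      hcon n _ (DirectSum.decompose 𝒮 x n).2 (hPi i n hx)
    choose l hl using h2
    classical
    refine ⟨∑ n ∈ (DirectSum.decompose 𝒮 x).support, l n, ?_⟩
    nth_rw 2 [← DirectSum.sum_support_decompose 𝒮 x]
    rw [Finset.mul_sum]
    refine Ideal.sum_mem _ fun n hn => ?_
    exact Ideal.mem_of_dvd _ (mul_dvd_mul_right (pow_dvd_pow t (Finset.single_le_sum (f := l) (fun _ _ => Nat.zero_le _) hn)) _) (hl n)
  obtain ⟨G, hG⟩ : (P ^ i).FG := IsNoetherian.noetherian _
  have h2 : ∃ l, ∀ x ∈ P ^ i, t ^ l * x ∈ P ^ (i + 1) := by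
    have : ∀ x : G, ∃ l, t ^ l * (x : S) ∈ P ^ (i + 1) := fun x => h1 x (by rw [← hG]; exact Ideal.subset_span x.2)
    choose l hl using this
    refine ⟨∑ x, l x, fun x hx => ?_⟩
    rw [← hG] at hx
    induction hx using Submodule.span_induction with
    | mem x hx =>
      exact Ideal.mem_of_dvd _ (mul_dvd_mul_right (pow_dvd_pow t (Finset.single_le_sum (f := l) (fun _ _ => Nat.zero_le _) (Finset.mem_univ ⟨x, hx⟩))) _) (hl ⟨x, hx⟩)
    | zero => simp
    | add x y _ _ hx hy => rw [mul_add]; exact add_mem hx hy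
    | smul c x _ hx => rw [smul_eq_mul, mul_left_comm]; exact Ideal.mul_mem_left _ _ hx
  obtain ⟨l, hl⟩ := h2
  let φ : Module.End S (P ^ i : Ideal S) := LinearMap.lsmul S (P ^ i : Ideal S) (t ^ l)
  have hφ : LinearMap.range φ ≤ P • ⊤ := by
    rintro _ ⟨x, rfl⟩
    have h3 : t ^ l * (x : S) ∈ Submodule.map (P ^ i).subtype (P • (⊤ : Submodule S (P ^ i : Ideal S))) := by
      rw [Submodule.map_smul'', Submodule.map_top, Submodule.range_subtype, smul_eq_mul, ← pow_succ']
      exact hl x x.2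
    obtain ⟨z, hz, hz2⟩ := h3
    have h4 : φ x = z := Subtype.ext hz2.symm
    rw [h4]
    exact hz
  haveI : Module.Finite S (P ^ i : Ideal S) := Module.Finite.of_fg ⟨G, hG⟩
  obtain ⟨Q, hQm, hQd, hQc, hQ0⟩ := LinearMap.exists_monic_and_natDegree_eq_and_coeff_mem_pow_and_aeval_eq_zero S φ P hφ
  obtain ⟨z, hz, hz0⟩ := Submodule.exists_mem_ne_zero_of_ne_bot (pow_ne_zero i hP0 : P ^ i ≠ ⊥)
  have h4 : ∀ Q : S[X], ((Polynomial.aeval φ Q) ⟨z, hz⟩ : S) = Q.eval (t ^ l) * z := by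
    intro Q
    induction Q using Polynomial.induction_on' with
    | add p q hp hq => rw [map_add, LinearMap.add_apply, Submodule.coe_add, hp, hq, Polynomial.eval_add, add_mul]
    | monomial n r =>
      rw [Polynomial.aeval_monomial, Polynomial.eval_monomial]
      have : ∀ (n : ℕ), (((φ ^ n) ⟨z, hz⟩ : (P ^ i : Ideal S)) : S) = (t ^ l) ^ n * z := by
        intro n
        induction n with
        | zero => simp
        | succ n ih =>
          rw [pow_succ', Module.End.mul_apply]
          change t ^ l * (((φ ^ n) ⟨z, hz⟩ : (P ^ i : Ideal S)) : S) = _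
          rw [ih]; ring
      rw [Module.End.mul_apply, Module.algebraMap_end_apply, Submodule.coe_smul, this, smul_eq_mul, mul_assoc]
  have h5 := h4 Q
  rw [hQ0] at h5
  have h6 : Q.eval (t ^ l) = 0 := by
    have : Q.eval (t ^ l) * z = 0 := by rw [← h5]; rfl
    exact (mul_eq_zero.1 this).resolve_right hz0
  rw [Polynomial.eval_eq_sum_range, Finset.sum_range_succ, Polynomial.coeff_natDegree, hQm.leadingCoeff, one_mul] at h6
  have h7 : (t ^ l) ^ Q.natDegree ∈ P := by
    rw [eq_neg_of_add_eq_zero_right h6]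
    refine neg_mem (Ideal.sum_mem _ fun k hk => Ideal.mul_mem_right _ _ ?_)
    have h8 := hQc k
    refine Ideal.pow_le_self ?_ h8
    rw [Finset.mem_range] at hk
    omega
  exact ht (hP.mem_of_pow_mem _ (hP.mem_of_pow_mem _ h7))

theorem GS.V (h : GS 𝒮 g a N) (hH : ∀ i, H i ∈ 𝒮 (d i)) (i0 : η) (hi0 : H i0 ≠ 0) (hfin : ∀ m, Module.Finite K (𝒮 m))
    (hnp : ¬ ∃ E : ℕ, ∀ i, g i ^ E ∈ Ideal.span (Set.range H)) (q : ℕ) :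
    ∃ M0, ∀ M, M0 ≤ M → q ≤ ∑ c ∈ Finset.range N, gradedPieceDim 𝒮 (Ideal.span (Set.range fun i => H i ^ q)) (M + c) := by
  classical
  have hJh : (Ideal.span (Set.range H)).IsHomogeneous 𝒮 := span_homog (by rintro _ ⟨i, rfl⟩; exact ⟨_, hH i⟩)
  have h1 : ∃ P : Ideal S, P.IsPrime ∧ P.IsHomogeneous 𝒮 ∧ Ideal.span (Set.range H) ≤ P ∧ ∃ i, g i ∉ P := by
    by_contra hc
    push Not at hc
    obtain ⟨E, -, hE⟩ := h.radical hJh hc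
    exact hnp ⟨E, hE⟩
  obtain ⟨P, hP, hPh, hJP, i1, hi1⟩ := h1
  have hP0 : P ≠ ⊥ := by
    rintro rfl
    exact hi0 (by simpa using hJP (Ideal.subset_span ⟨i0, rfl⟩))
  set t : S := g i1 ^ (N / a i1) with ht
  have htN : t ∈ 𝒮 N := by
    have := SetLike.pow_mem_graded (N / a i1) (h.hg i1)
    rwa [smul_eq_mul, Nat.div_mul_cancel (h.hd i1)] at this
  have htP : t ∉ P := fun hc => hi1 (hP.mem_of_pow_mem _ hc)
  choose n x hx hxP hxt using fun i => naka h hPh hP0 htP i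
  refine ⟨∑ i ∈ Finset.range q, n i, fun M hM => ?_⟩
  have hn : ∀ i : Fin q, n i ≤ M := fun i => (Finset.single_le_sum (f := n) (fun _ _ => Nat.zero_le _) (Finset.mem_range.2 i.2)).trans hM
  -- choose c and l
  have h2 : ∀ i : Fin q, ∃ c l : ℕ, c < N ∧ n i + N * l = M + c := by
    intro i
    have hN := h.hN
    have hni := hn i
    refine ⟨(N - (M - n i) % N) % N, ((M - n i) + (N - (M - n i) % N) % N) / N, Nat.mod_lt _ hN, ?_⟩
    have e1 := Nat.div_add_mod (M - n i) N
    have e2 := Nat.mod_lt (M - n i) hN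
    rw [Nat.mul_div_cancel']
    · omega
    · rcases Nat.eq_zero_or_pos ((M - n i) % N) with h0 | h0
      · rw [h0, Nat.sub_zero, Nat.mod_self, add_zero]; exact Nat.dvd_of_mod_eq_zero h0
      · rw [Nat.mod_eq_of_lt (by omega)]
        refine ⟨(M - n i) / N + 1, ?_⟩
        rw [mul_add]; omega
  choose c l hcN hcl using h2
  have hy : ∀ i : Fin q, t ^ l i * x i ∈ 𝒮 (M + c i) := by
    intro i
    rw [← hcl i, add_comm, mul_comm N]
    exact SetLike.mul_mem_graded (by simpa using SetLike.pow_mem_graded (l i) htN) (hx i)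
  have hJq : Ideal.span (Set.range fun i => H i ^ q) ≤ P ^ q := by
    refine Ideal.span_le.2 ?_
    rintro _ ⟨i, rfl⟩
    exact Ideal.pow_mem_pow (hJP (Ideal.subset_span ⟨i, rfl⟩)) q
  set J := Ideal.span (Set.range fun i => H i ^ q) with hJ
  have h3 : ∀ c0, (Finset.univ.filter (fun i : Fin q => c i = c0)).card ≤ gradedPieceDim 𝒮 J (M + c0) := by
    intro c0
    haveI := hfin (M + c0)
    have hy' : ∀ i : {i : Fin q // c i = c0}, t ^ l i.1 * x i.1 ∈ 𝒮 (M + c0) := fun i => by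
      have := hy i.1
      rwa [i.2] at this
    let v : {i : Fin q // c i = c0} → (𝒮 (M + c0)) ⧸ (Submodule.comap (𝒮 (M + c0)).subtype (J.restrictScalars K)) :=
      fun i => Submodule.Quotient.mk ⟨t ^ l i.1 * x i.1, hy' i⟩
    have hv : LinearIndependent K v := by
      rw [Fintype.linearIndependent_iff]
      intro r hr
      by_contra hcon
      push Not at hcon
      obtain ⟨j, hj⟩ := hcon
      obtain ⟨i, hi, himin⟩ := Finset.exists_min_image (Finset.univ.filter (fun i : {i : Fin q // c i = c0} => r i ≠ 0)) (fun i => (i.1 : ℕ)) ⟨j, by simpa using hj⟩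
      simp only [Finset.mem_filter, Finset.mem_univ, true_and] at hi himin
      have h4 : ∑ i : {i : Fin q // c i = c0}, r i • (t ^ l i.1 * x i.1) ∈ J := by
        have h5 : (Submodule.Quotient.mk (∑ i : {i : Fin q // c i = c0}, r i • (⟨t ^ l i.1 * x i.1, hy' i⟩ : 𝒮 (M + c0))) : (𝒮 (M + c0)) ⧸ (Submodule.comap (𝒮 (M + c0)).subtype (J.restrictScalars K))) = 0 := by
          rw [← hr]
          simp only [v, ← Submodule.mkQ_apply, map_sum, map_smul]
        rw [Submodule.Quotient.mk_eq_zero] at h5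
        have h6 : ((∑ i : {i : Fin q // c i = c0}, r i • (⟨t ^ l i.1 * x i.1, hy' i⟩ : 𝒮 (M + c0)) : 𝒮 (M + c0)) : S) ∈ J := h5
        simpa [AddSubmonoidClass.coe_finset_sum] using h6
      have h5 : r i • (t ^ l i.1 * x i.1) ∈ P ^ ((i.1 : ℕ) + 1) := by
        have h6 := Finset.add_sum_erase Finset.univ (fun i : {i : Fin q // c i = c0} => r i • (t ^ l i.1 * x i.1)) (Finset.mem_univ i)
        have h7 : r i • (t ^ l i.1 * x i.1) = (∑ i : {i : Fin q // c i = c0}, r i • (t ^ l i.1 * x i.1)) - ∑ i ∈ Finset.univ.erase i, r i • (t ^ l i.1 * x i.1) := by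
          rw [← h6]; ring
        rw [h7]
        refine sub_mem (Ideal.pow_le_pow_right i.1.2 (hJq h4)) (Ideal.sum_mem _ fun k hk => ?_)
        by_cases hrk : r k = 0
        · rw [hrk, zero_smul]; exact zero_mem _
        · have h8 := himin k hrk
          have h9 : (i.1 : ℕ) ≠ k.1 := fun hcc => (Finset.ne_of_mem_erase hk) (Subtype.ext (Fin.ext hcc.symm))
          rw [Algebra.smul_def]
          exact Ideal.mul_mem_left _ _ (Ideal.mul_mem_left _ _ (Ideal.pow_le_pow_right (by omega) (hxP k.1)))
      apply hxt i.1 (l i.1)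
      have h6 : t ^ l i.1 * x i.1 = algebraMap K S (r i)⁻¹ * (r i • (t ^ l i.1 * x i.1)) := by
        rw [Algebra.smul_def, ← mul_assoc (algebraMap K S (r i)⁻¹), ← map_mul, inv_mul_cancel₀ hi, map_one, one_mul]
      rw [h6]
      exact Ideal.mul_mem_left _ _ h5
    have := hv.fintype_card_le_finrank
    rw [Fintype.card_subtype] at this
    exact this
  calc q = (Finset.univ : Finset (Fin q)).card := by simp
    _ = ∑ c0 ∈ Finset.range N, (Finset.univ.filter (fun i : Fin q => c i = c0)).card :=
      Finset.card_eq_sum_card_fiberwise (fun i _ => by simpa using hcN i)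
    _ ≤ _ := Finset.sum_le_sum fun c0 _ => h3 c0
end F
end FilePG6

section FilePG7
set_option linter.all false
open Polynomial

section D
variable {K L S ι η : Type*} [Field K] [Field L] [Algebra K L] [Algebra K[X] L] [Algebra (RatFunc K) L]
  [IsScalarTower K K[X] L] [IsScalarTower K[X] (RatFunc K) L] [IsScalarTower K (RatFunc K) L]
  [FiniteDimensional (RatFunc K) L]
  [CommRing S] [IsDomain S] [Algebra K S] {𝒮 : ℕ → Submodule K S} [GradedAlgebra 𝒮] {ψ : S →ₐ[K] L} {N : ℕ} {w y : S}
  [Fintype ι] {g : ι → S} {a : ι → ℕ}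

/-- the span of the powers -/
def FP {S η : Type*} [CommRing S] (H : η → S) (q : ℕ) : Ideal S := Ideal.span (Set.range fun i => H i ^ q)

def Prim {S ι η : Type*} [CommRing S] (g : ι → S) (H : η → S) : Prop := ∃ E : ℕ, ∀ i, g i ^ E ∈ Ideal.span (Set.range H)

theorem core [Fintype η] [DecidableEq η] (hc : CM 𝒮 ψ N w y) (h : GS 𝒮 g a N) (p : ℕ) [Fact p.Prime] [CharP S p]
    {H : η → S} {d : η → ℕ} (hH : ∀ i, H i ∈ 𝒮 (d i)) (i0 : η) (hi0 : H i0 ≠ 0) :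
    ∃ C : ℤ, 0 ≤ C ∧ ∀ (n : ℕ) {ν : ℕ} (e : Fin ν → η → L) (b : Fin ν → ℤ)
      (hr : GoodFilt.IsRed (ELn K L (fun i => ((p ^ n * d i / N : ℕ) : ℤ)))
        ((Kq (fun i => ψ (H i)) (p ^ n)).restrictScalars (RatFunc K)) e b), ∃ κ : ℤ,
      (∀ m : ℕ, (∀ i, p ^ n * d i + N ≤ m) →
        |(gradedPieceDim 𝒮 (FP H (p ^ n)) m : ℤ) - ∑ j, max (b j - (m / N : ℕ)) 0 - κ| ≤ C) ∧
      (Prim g H → |κ| ≤ C) ∧ (¬ Prim g H → (p : ℤ) ^ n ≤ N * (κ + C)) := by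
  obtain ⟨C, hC0, hC⟩ := hc.formula' η
  refine ⟨C, hC0, fun n ν e b hr => ?_⟩
  obtain ⟨κ, hκ⟩ := hC H d hH i0 hi0 (p ^ n) e b hr
  have hN := h.hN
  -- a degree beyond which the sum vanishes
  obtain ⟨M1, hM1⟩ : ∃ M1 : ℕ, ∀ m, M1 ≤ m → (∀ i, p ^ n * d i + N ≤ m) ∧ ∑ j, max (b j - (m / N : ℕ)) 0 = 0 := by
    refine ⟨∑ i, (p ^ n * d i) + N + N * ∑ j, (b j).toNat, fun m hm => ⟨fun i => ?_, ?_⟩⟩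
    · have := Finset.single_le_sum (f := fun i => p ^ n * d i) (fun _ _ => Nat.zero_le _) (Finset.mem_univ i)
      have h3 := Nat.zero_le (N * ∑ j, (b j).toNat)
      omega
    · refine Finset.sum_eq_zero fun j _ => max_eq_right ?_
      have h2 : ∑ j, (b j).toNat ≤ m / N := by
        rw [Nat.le_div_iff_mul_le hN, mul_comm]
        omega
      have h3 := Finset.single_le_sum (f := fun j => (b j).toNat) (fun _ _ => Nat.zero_le _) (Finset.mem_univ j)
      omega
  refine ⟨κ, hκ, fun ⟨E, hE⟩ => ?_, fun hnp => ?_⟩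
  · obtain ⟨M2, hM2⟩ := h.gpd_zero (J := FP H (p ^ n)) (E := E * p ^ n) (fun i => by
      rw [pow_mul]; exact frob_mem p n (hE i))
    have h1 := hκ (max M1 M2) (hM1 _ (le_max_left _ _)).1
    rw [(hM1 _ (le_max_left _ _)).2] at h1
    change |((gradedPieceDim 𝒮 (FP H (p ^ n)) (max M1 M2) : ℕ) : ℤ) - 0 - κ| ≤ C at h1
    rw [hM2 _ (le_max_right _ _)] at h1
    simpa using h1
  · obtain ⟨M0, hM0⟩ := h.V hH i0 hi0 hc.finite hnp (p ^ n)
    have h1 := hM0 (max M0 M1) (le_max_left _ _)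
    have h2 : ∀ c ∈ Finset.range N, ((gradedPieceDim 𝒮 (Ideal.span (Set.range fun i => H i ^ p ^ n)) (max M0 M1 + c) : ℕ) : ℤ) ≤ κ + C := by
      intro c _
      have h3 := hM1 (max M0 M1 + c) (by have := le_max_right M0 M1; omega)
      have h4 := hκ _ h3.1
      rw [h3.2] at h4
      have := (abs_le.1 h4).2
      linarith
    have h3 := Finset.sum_le_sum h2
    rw [Finset.sum_const, Finset.card_range, nsmul_eq_mul] at h3
    refine le_trans ?_ h3
    exact_mod_cast h1

lemma exists_redn [Fintype η] (D : η → ℤ) (u : η → L) (q : ℕ) : ∃ (ν : ℕ) (e : Fin ν → η → L) (b : Fin ν → ℤ),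
    GoodFilt.IsRed (ELn K L D) ((Kq u q).restrictScalars (RatFunc K)) e b := by
  obtain ⟨e, b, h⟩ := GoodFilt.exists_isRed (goodELn (K := K) (L := L) D) ((Kq u q).restrictScalars (RatFunc K))
  exact ⟨_, e, b, h⟩

lemma sub_le_div {N m m' : ℕ} (hN : 0 < N) (A : ℤ) (h : ((m' / N : ℕ) : ℤ) - (m / N : ℕ) ≤ A) : (m' : ℤ) - m ≤ N * (A + 1) := by
  have h1 := Nat.div_add_mod m N
  have h2 := Nat.div_add_mod m' N
  have h3 := Nat.mod_lt m' hN
  have h4 : (m : ℤ) = N * (m / N : ℕ) + (m % N : ℕ) := by exact_mod_cast h1.symm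
  have h5 : (m' : ℤ) = N * (m' / N : ℕ) + (m' % N : ℕ) := by exact_mod_cast h2.symm
  have h6 : ((m' % N : ℕ) : ℤ) < N := by exact_mod_cast h3
  have h7 : (0 : ℤ) ≤ (m % N : ℕ) := Int.natCast_nonneg _
  have h8 : (N : ℤ) * (((m' / N : ℕ) : ℤ) - (m / N : ℕ)) ≤ N * A := mul_le_mul_of_nonneg_left h (by positivity)
  nlinarith

/-- consequences for the dimensions -/
theorem core2 [Fintype η] (hc : CM 𝒮 ψ N w y) (h : GS 𝒮 g a N) (p : ℕ) [Fact p.Prime] [CharP S p]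
    {H : η → S} {d : η → ℕ} (hH : ∀ i, H i ∈ 𝒮 (d i)) (i0 : η) (hi0 : H i0 ≠ 0) :
    ∃ C : ℕ, ∀ (n : ℕ) (m : ℕ), (∀ i, p ^ n * d i + N ≤ m) →
      (Prim g H → ∀ m', m ≤ m' → C < gradedPieceDim 𝒮 (FP H (p ^ n)) m' → m' ≤ m + N * (gradedPieceDim 𝒮 (FP H (p ^ n)) m + C)) ∧
      (¬ Prim g H → p ^ n ≤ N * (gradedPieceDim 𝒮 (FP H (p ^ n)) m + C)) := by
  classical
  obtain ⟨C, hC0, hC⟩ := core hc h p hH i0 hi0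
  lift C to ℕ using hC0
  refine ⟨2 * C + 1, fun n m hm => ?_⟩
  obtain ⟨ν, e, b, hr⟩ := exists_redn (K := K) (fun i => ((p ^ n * d i / N : ℕ) : ℤ)) (fun i => ψ (H i)) (p ^ n)
  obtain ⟨κ, h1, h2, h3⟩ := hC n e b hr
  refine ⟨fun hp m' hm' hG => ?_, fun hp => ?_⟩
  · have h2 := abs_le.1 (h2 hp)
    have h4 := abs_le.1 (h1 m hm)
    have h5 := abs_le.1 (h1 m' (fun i => (hm i).trans hm'))
    have h6 : 0 < ∑ j, max (b j - (m' / N : ℕ)) 0 := by omega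
    obtain ⟨j, -, hj⟩ : ∃ j ∈ Finset.univ, 0 < max (b j - (m' / N : ℕ)) 0 := by
      by_contra hcon
      push Not at hcon
      exact absurd (Finset.sum_nonpos hcon) (not_le.2 h6)
    have h7 : ((m' / N : ℕ) : ℤ) < b j := by
      rcases lt_max_iff.1 hj with hh | hh
      · omega
      · omega
    have h8 := Finset.single_le_sum (f := fun j => max (b j - (m / N : ℕ)) 0) (fun _ _ => le_max_right _ _) (Finset.mem_univ j)
    have h9 : b j - (m / N : ℕ) ≤ max (b j - (m / N : ℕ)) 0 := le_max_left _ _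
    have h10 := sub_le_div (m := m) (m' := m') h.hN (gradedPieceDim 𝒮 (FP H (p ^ n)) m + 2 * C) (by omega)
    push_cast at h10
    have : (m' : ℤ) ≤ m + N * (gradedPieceDim 𝒮 (FP H (p ^ n)) m + (2 * C + 1)) := by linarith
    exact_mod_cast this
  · have h3 := h3 hp
    have h4 := abs_le.1 (h1 m hm)
    have h5 : 0 ≤ ∑ j, max (b j - (m / N : ℕ)) 0 := Finset.sum_nonneg fun _ _ => le_max_right _ _
    have h6 : κ + C ≤ gradedPieceDim 𝒮 (FP H (p ^ n)) m + (2 * C + 1) := by omega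
    have h7 := h3.trans (mul_le_mul_of_nonneg_left h6 (by positivity : (0 : ℤ) ≤ N))
    exact_mod_cast h7
end D
end FilePG7

section FilePG8
set_option linter.all false
open Polynomial

section D
open Filter Topology
variable {K L S ι η : Type*} [Field K] [Field L] [Algebra K L] [Algebra K[X] L] [Algebra (RatFunc K) L]
  [IsScalarTower K K[X] L] [IsScalarTower K[X] (RatFunc K) L] [IsScalarTower K (RatFunc K) L]
  [FiniteDimensional (RatFunc K) L]
  [CommRing S] [IsDomain S] [Algebra K S] {𝒮 : ℕ → Submodule K S} [GradedAlgebra 𝒮] {ψ : S →ₐ[K] L} {N : ℕ} {w y : S}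
  [Fintype ι] {g : ι → S} {a : ι → ℕ}

/-- the density function of a family -/
def Dens {K S η : Type*} [Field K] [CommRing S] [Algebra K S] (𝒮 : ℕ → Submodule K S) (H : η → S) (p : ℕ) (f : ℝ → ℝ) : Prop :=
  ∀ x : ℝ, 0 ≤ x → Tendsto (fun n : ℕ => (gradedPieceDim 𝒮 (FP H (p ^ n)) ⌊x * (p : ℝ) ^ n⌋₊ : ℝ) / (p : ℝ) ^ n) atTop (𝓝 (f x))

lemma qtend (p : ℕ) [hp : Fact p.Prime] : Tendsto (fun n : ℕ => (p : ℝ) ^ n) atTop atTop :=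
  tendsto_pow_atTop_atTop_of_one_lt (by exact_mod_cast hp.out.one_lt)

lemma qdiv (p : ℕ) [hp : Fact p.Prime] (C : ℝ) : Tendsto (fun n : ℕ => C / (p : ℝ) ^ n) atTop (𝓝 0) :=
  (qtend p).const_div_atTop C

lemma qpos (p : ℕ) [hp : Fact p.Prime] (n : ℕ) : (0 : ℝ) < (p : ℝ) ^ n := by
  have : (0 : ℝ) < p := by exact_mod_cast hp.out.pos
  positivity

lemma Dens.nonneg {H : η → S} {p : ℕ} {f : ℝ → ℝ} (hf : Dens 𝒮 H p f) {x : ℝ} (hx : 0 ≤ x) : 0 ≤ f x :=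
  ge_of_tendsto' (hf x hx) fun n => by positivity

lemma div_floor {N : ℕ} (hN : 0 < N) {t : ℝ} (ht : 0 ≤ t) : |((⌊t⌋₊ / N : ℕ) : ℝ) - t / N| ≤ 1 := by
  rw [← Nat.floor_div_natCast]
  have h1 := Nat.floor_le (show 0 ≤ t / N by positivity)
  have h2 := Nat.lt_floor_add_one (t / N)
  rw [abs_le]; constructor <;> linarith

lemma abs_div_sub_mul {A B q : ℝ} (hq : 0 < q) : |A / q - B| * q = |A - B * q| := by
  conv_lhs => rw [← abs_of_pos hq]
  rw [← abs_mul, sub_mul, abs_of_pos hq, div_mul_cancel₀ _ hq.ne']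

/-- D1 -/
theorem Dens.small [Fintype η] (hc : CM 𝒮 ψ N w y) (p : ℕ) [Fact p.Prime] {f : ℝ → ℝ}
    {H : η → S} {d : η → ℕ} (hH : ∀ i, H i ∈ 𝒮 (d i)) (hf : Dens 𝒮 H p f) {x : ℝ} (hx : 0 ≤ x) (hd : ∀ i, x < d i) :
    f x = Module.finrank (RatFunc K) L * x / N := by
  obtain ⟨C, hC⟩ := hc.dim_bound
  set e := Module.finrank (RatFunc K) L
  have hG : ∀ n : ℕ, gradedPieceDim 𝒮 (FP H (p ^ n)) ⌊x * (p : ℝ) ^ n⌋₊ = Module.finrank K (𝒮 ⌊x * (p : ℝ) ^ n⌋₊) := by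
    intro n
    rw [FP, gpd_subtype (fun i => H i ^ p ^ n) (fun i => p ^ n * d i) (fun i => by simpa using SetLike.pow_mem_graded (p ^ n) (hH i)) _ (fun _ => False)]
    · haveI := hc.finite ⌊x * (p : ℝ) ^ n⌋₊
      have h1 := gpd_eq 𝒮 (Ideal.span (Set.range (fun i : {i : η // False} => H i ^ p ^ n))) ⌊x * (p : ℝ) ^ n⌋₊
      rw [← h1]
      have h2 : Submodule.comap (𝒮 ⌊x * (p : ℝ) ^ n⌋₊).subtype ((Ideal.span (Set.range (fun i : {i : η // False} => H i ^ p ^ n))).restrictScalars K) = ⊥ := by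
        rw [eq_bot_iff]
        rintro ⟨z, hz⟩ hz2
        have : IsEmpty {i : η // False} := ⟨fun i => i.2⟩
        rw [Set.range_eq_empty] at hz2
        have : z = 0 := by simpa using hz2
        exact Subtype.ext this
      rw [h2, finrank_bot, add_zero]
    · intro i _
      rw [Nat.floor_lt (by have := qpos p n; positivity)]
      push_cast
      rw [mul_comm]
      exact mul_lt_mul_of_pos_left (hd i) (qpos p n)
  refine tendsto_nhds_unique (hf x hx) ?_
  rw [← tendsto_sub_nhds_zero_iff]
  refine squeeze_zero_norm (a := fun n => ((C : ℝ) + e) / (p : ℝ) ^ n) (fun n => ?_) (qdiv p _)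
  have hq := qpos p n
  rw [hG, Real.norm_eq_abs, le_div_iff₀ hq, abs_div_sub_mul hq]
  have h1 := hC ⌊x * (p : ℝ) ^ n⌋₊
  have h2 := div_floor hc.hN (show 0 ≤ x * (p : ℝ) ^ n by positivity)
  have h3 : |(Module.finrank K (𝒮 ⌊x * (p : ℝ) ^ n⌋₊) : ℝ) - e * (⌊x * (p : ℝ) ^ n⌋₊ / N : ℕ)| ≤ C := by exact_mod_cast h1
  have h4 : (Module.finrank K (𝒮 ⌊x * (p : ℝ) ^ n⌋₊) : ℝ) - e * x / N * (p : ℝ) ^ n =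
    ((Module.finrank K (𝒮 ⌊x * (p : ℝ) ^ n⌋₊) : ℝ) - e * (⌊x * (p : ℝ) ^ n⌋₊ / N : ℕ)) + e * (((⌊x * (p : ℝ) ^ n⌋₊ / N : ℕ) : ℝ) - x * (p : ℝ) ^ n / N) := by ring
  rw [h4]
  refine (abs_add_le _ _).trans (add_le_add h3 ?_)
  rw [abs_mul, Nat.abs_cast]
  exact mul_le_of_le_one_right (by positivity) h2

/-- restricting to the generators of smaller degree -/
lemma FP_sub_eq [Fintype η] (p : ℕ) [Fact p.Prime] {H : η → S} {d : η → ℕ} (hH : ∀ i, H i ∈ 𝒮 (d i)) (P : η → Prop)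
    {x : ℝ} (hx : 0 ≤ x) (hP : ∀ i, ¬ P i → x < d i) (n : ℕ) :
    gradedPieceDim 𝒮 (FP H (p ^ n)) ⌊x * (p : ℝ) ^ n⌋₊ = gradedPieceDim 𝒮 (FP (fun i : {i // P i} => H i) (p ^ n)) ⌊x * (p : ℝ) ^ n⌋₊ := by
  rw [FP, FP]
  refine gpd_subtype (fun i => H i ^ p ^ n) (fun i => p ^ n * d i) (fun i => by simpa using SetLike.pow_mem_graded (p ^ n) (hH i)) _ P ?_
  intro i hi
  rw [Nat.floor_lt (by have := qpos p n; positivity)]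
  push_cast
  rw [mul_comm]
  exact mul_lt_mul_of_pos_left (hP i hi) (qpos p n)

lemma FP_sub_le (hc : CM 𝒮 ψ N w y) {H : η → S} (P : η → Prop) (q m : ℕ) :
    gradedPieceDim 𝒮 (FP H q) m ≤ gradedPieceDim 𝒮 (FP (fun i : {i // P i} => H i) q) m := by
  haveI := hc.finite m
  refine gpd_anti (Ideal.span_mono ?_) m
  rintro _ ⟨i, rfl⟩
  exact ⟨i, rfl⟩

lemma ev_deg [Fintype η] (p : ℕ) [Fact p.Prime] {d : η → ℕ} {x : ℝ} (P : η → Prop) (hd : ∀ i, P i → (d i : ℝ) < x) (N : ℕ) :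
    ∀ᶠ n : ℕ in atTop, ∀ i, P i → p ^ n * d i + N ≤ ⌊x * (p : ℝ) ^ n⌋₊ := by
  rw [eventually_all]
  intro i
  by_cases hi : P i
  · have h1 : 0 < x - d i := sub_pos.2 (hd i hi)
    filter_upwards [(qtend p).eventually_ge_atTop (N / (x - d i))] with n hn _
    rw [div_le_iff₀ h1] at hn
    refine Nat.le_floor ?_
    push_cast
    linarith
  · exact Eventually.of_forall fun n hc => absurd hc hi

lemma Dens.ev_large {H : η → S} {p : ℕ} [Fact p.Prime] {f : ℝ → ℝ} (hf : Dens 𝒮 H p f) {x : ℝ} (hx : 0 ≤ x) (h : f x ≠ 0) (C : ℕ) :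
    ∀ᶠ n : ℕ in atTop, C < gradedPieceDim 𝒮 (FP H (p ^ n)) ⌊x * (p : ℝ) ^ n⌋₊ := by
  have h1 : 0 < f x := lt_of_le_of_ne (hf.nonneg hx) h.symm
  have h2 := (hf x hx).sub (qdiv p C)
  rw [sub_zero] at h2
  filter_upwards [h2.eventually (lt_mem_nhds h1)] with n hn
  have h3 := qpos p n
  rw [← sub_div, lt_div_iff₀ h3, zero_mul] at hn
  have : (C : ℝ) < gradedPieceDim 𝒮 (FP H (p ^ n)) ⌊x * (p : ℝ) ^ n⌋₊ := by linarith
  exact_mod_cast this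

lemma lim_le {p : ℕ} [Fact p.Prime] {G : ℕ → ℕ} {l c : ℝ} {N C : ℕ} (hG : Tendsto (fun n => (G n : ℝ) / (p : ℝ) ^ n) atTop (𝓝 l))
    (h : ∀ᶠ n in atTop, c * (p : ℝ) ^ n ≤ N * (G n + C) + 1) : c ≤ N * l := by
  have h1 : Tendsto (fun n => (N : ℝ) * ((G n : ℝ) / (p : ℝ) ^ n + C / (p : ℝ) ^ n) + 1 / (p : ℝ) ^ n) atTop (𝓝 (N * (l + 0) + 0)) :=
    ((hG.add (qdiv p C)).const_mul _).add (qdiv p 1)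
  rw [add_zero, add_zero] at h1
  refine ge_of_tendsto h1 ?_
  filter_upwards [h] with n hn
  have h3 := qpos p n
  rw [← add_div, ← mul_div_assoc, ← add_div, le_div_iff₀ h3]
  exact hn

lemma floor_diff {a x q : ℝ} {m : ℕ} (ha : 0 ≤ a) (hx : 0 ≤ x) (hq : 0 ≤ q) (h : ⌊x * q⌋₊ ≤ ⌊a * q⌋₊ + m) : (x - a) * q ≤ m + 1 := by
  have h1 := Nat.floor_le (show 0 ≤ a * q by positivity)
  have h2 := Nat.lt_floor_add_one (x * q)
  have h3 : (⌊x * q⌋₊ : ℝ) ≤ ⌊a * q⌋₊ + m := by exact_mod_cast h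
  linarith

/-- D2 -/
theorem Dens.step [Fintype η] (hc : CM 𝒮 ψ N w y) (h : GS 𝒮 g a N) (p : ℕ) [Fact p.Prime] [CharP S p] {f : ℝ → ℝ}
    {H : η → S} {d : η → ℕ} (hH : ∀ i, H i ∈ 𝒮 (d i)) (hH0 : ∀ i, H i ≠ 0) (hf : Dens 𝒮 H p f)
    {u x : ℝ} (hu : 0 ≤ u) (hux : u < x) (hd : ∀ i, u ≠ d i) (hx : f x ≠ 0) :
    min u (min (x - u) 1) ≤ N * f u := by
  classical
  have hN := h.hN
  have hx0 : 0 ≤ x := hu.trans hux.le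
  by_cases hP : ∃ i0, (d i0 : ℝ) < u
  · obtain ⟨i0, hi0⟩ := hP
    let P : η → Prop := fun i => (d i : ℝ) < u
    refine (min_le_right _ _).trans ?_
    obtain ⟨C, hC⟩ := core2 (η := {i // P i}) hc h p (H := fun i => H i) (d := fun i => d i) (fun i => hH i) ⟨i0, hi0⟩ (hH0 i0)
    refine lim_le (C := C) (hf u hu) ?_
    filter_upwards [ev_deg p P (fun i hi => hi) N, hf.ev_large hx0 hx C] with n hn1 hn2
    have h1 := hC n _ (fun i => hn1 i.1 i.2)
    have h2 := FP_sub_eq p hH P hu (fun i hi => lt_of_le_of_ne (not_lt.1 hi) (hd i)) n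
    rw [← h2] at h1
    have hq := qpos p n
    by_cases hpr : Prim g (fun i : {i // P i} => H i)
    · have h3 := h1.1 hpr ⌊x * (p : ℝ) ^ n⌋₊ (Nat.floor_mono (by gcongr)) (hn2.trans_le (FP_sub_le hc P _ _))
      have h4 := floor_diff hu hx0 hq.le h3
      push_cast at h4
      refine le_trans ?_ h4
      exact mul_le_mul_of_nonneg_right (min_le_left _ _) hq.le
    · have h3 := h1.2 hpr
      have h4 : ((p : ℝ) ^ n) ≤ N * (gradedPieceDim 𝒮 (FP H (p ^ n)) ⌊u * (p : ℝ) ^ n⌋₊ + C) := by exact_mod_cast h3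
      have h5 : min (x - u) 1 * (p : ℝ) ^ n ≤ 1 * (p : ℝ) ^ n := mul_le_mul_of_nonneg_right (min_le_right _ _) hq.le
      linarith
  · push Not at hP
    rw [hf.small hc p hH hu (fun i => lt_of_le_of_ne (hP i) (hd i)), mul_div_cancel₀ _ (by positivity)]
    refine (min_le_left _ _).trans ?_
    have : (1 : ℝ) ≤ Module.finrank (RatFunc K) L := by exact_mod_cast (Module.finrank_pos : 0 < Module.finrank (RatFunc K) L)
    nlinarith

/-- D2' -/
theorem Dens.step' [Fintype η] (hc : CM 𝒮 ψ N w y) (h : GS 𝒮 g a N) (p : ℕ) [Fact p.Prime] [CharP S p] {f : ℝ → ℝ}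
    {H : η → S} {d : η → ℕ} (hH : ∀ i, H i ∈ 𝒮 (d i)) (i0 : η) (hH0 : H i0 ≠ 0) (hpr : Prim g H) (hf : Dens 𝒮 H p f)
    {u x : ℝ} (hu : 0 ≤ u) (hux : u < x) (hd : ∀ i, d i < u) (hx : f x ≠ 0) :
    x - u ≤ N * f u := by
  have hx0 : 0 ≤ x := hu.trans hux.le
  obtain ⟨C, hC⟩ := core2 hc h p hH i0 hH0
  refine lim_le (C := C) (hf u hu) ?_
  filter_upwards [ev_deg p (fun _ => True) (fun i _ => hd i) N, hf.ev_large hx0 hx C] with n hn1 hn2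
  have h1 := hC n _ (fun i => hn1 i trivial)
  have hq := qpos p n
  have h3 := h1.1 hpr ⌊x * (p : ℝ) ^ n⌋₊ (Nat.floor_mono (by gcongr)) hn2
  have h4 := floor_diff hu hx0 hq.le h3
  push_cast at h4
  exact h4
end D
end FilePG8

section FilePG9
set_option linter.all false
open Polynomial

section D
open Filter Topology
variable {K L S ι η : Type*} [Field K] [Field L] [Algebra K L] [Algebra K[X] L] [Algebra (RatFunc K) L]
  [IsScalarTower K K[X] L] [IsScalarTower K[X] (RatFunc K) L] [IsScalarTower K (RatFunc K) L]
  [FiniteDimensional (RatFunc K) L]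
  [CommRing S] [IsDomain S] [Algebra K S] {𝒮 : ℕ → Submodule K S} [GradedAlgebra 𝒮] {ψ : S →ₐ[K] L} {w y : S}
  [Fintype ι] {g : ι → S} {a : ι → ℕ}

theorem Dens.approx [Fintype η] [DecidableEq η] (hc : CM 𝒮 ψ 1 w y) (h : GS 𝒮 g a 1) (p : ℕ) [Fact p.Prime] [CharP S p] {f : ℝ → ℝ}
    {H : η → S} {d : η → ℕ} (hH : ∀ i, H i ∈ 𝒮 (d i)) (hH0 : ∀ i, H i ≠ 0) (hf : Dens 𝒮 H p f)
    {α : ℝ} (hα0 : 0 ≤ α) (hα1 : ∀ x, α < x → f x = 0) (hα2 : ∀ δ > 0, ∃ x, 0 ≤ x ∧ α - δ < x ∧ x ≤ α ∧ f x ≠ 0)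
    (hd : ∀ i, α ≠ d i) (P : η → Prop) [DecidablePred P] (hPα : ∀ i, P i ↔ (d i : ℝ) < α) (i0 : η) (hi0 : P i0) {δ : ℝ} (hδ : 0 < δ) :
    ∀ᶠ n : ℕ in atTop, ∀ (ν : ℕ) (e : Fin ν → {i // P i} → L) (b : Fin ν → ℤ)
      (hr : GoodFilt.IsRed (ELn K L (fun i : {i // P i} => ((p ^ n * d i / 1 : ℕ) : ℤ)))
        ((Kq (fun i : {i // P i} => ψ (H i)) (p ^ n)).restrictScalars (RatFunc K)) e b),
      ∃ hν : 0 < ν, |(b ⟨ν - 1, by omega⟩ : ℝ) / (p : ℝ) ^ n - α| ≤ δ := by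
  have hH' : ∀ i : {i // P i}, H i ∈ 𝒮 (d i) := fun i => hH i
  obtain ⟨C, hC0, hC⟩ := core (η := {i // P i}) hc h p (H := fun i => H i) (d := fun i => d i) hH' ⟨i0, hi0⟩ (hH0 i0)
  obtain ⟨C', hC'⟩ := core2 (η := {i // P i}) hc h p (H := fun i => H i) (d := fun i => d i) hH' ⟨i0, hi0⟩ (hH0 i0)
  lift C to ℕ using hC0
  -- the upper test point
  have e1 : ∀ᶠ x in 𝓝 α, ∀ i, ¬ P i → x < (d i : ℝ) := by
    rw [eventually_all]
    intro i
    by_cases hi : P i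
    · exact Eventually.of_forall fun x hc => absurd hi hc
    · have : α < d i := lt_of_le_of_ne (not_lt.1 (by rwa [hPα] at hi)) (hd i)
      filter_upwards [gt_mem_nhds this] with x hx _ using hx
  have e2 : ∀ᶠ x in 𝓝 α, ∀ i, P i → (d i : ℝ) < x := by
    rw [eventually_all]
    intro i
    by_cases hi : P i
    · filter_upwards [lt_mem_nhds ((hPα i).1 hi)] with x hx _ using hx
    · exact Eventually.of_forall fun x hc => absurd hc hi
  obtain ⟨δ1, hδ1, hball⟩ := Metric.eventually_nhds_iff.1 (e1.and e2)
  set r := min (δ / 2) (δ1 / 2) with hr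
  have hr0 : 0 < r := lt_min (by linarith) (by linarith)
  have hr1 : r ≤ δ / 2 := min_le_left _ _
  have hr2 : r ≤ δ1 / 2 := min_le_right _ _
  have hx1 := hball (y := α + r) (by rw [Real.dist_eq, add_sub_cancel_left, abs_of_pos hr0]; linarith)
  obtain ⟨x', hx'0, hx'1, hx'2, hx'3⟩ := hα2 r hr0
  have hx' := hball (y := x') (by rw [Real.dist_eq, abs_lt]; constructor <;> linarith)
  have hf1 : f (α + r) = 0 := hα1 _ (by linarith)
  have hx10 : 0 ≤ α + r := by linarith
  have hprim : Prim g (fun i : {i // P i} => H i) := by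
    by_contra hnp
    have : (1 : ℝ) ≤ (1 : ℕ) * f (α + r) := by
      refine lim_le (C := C') (hf (α + r) hx10) ?_
      filter_upwards [ev_deg p P hx1.2 1] with n hn
      have h3 := (hC' n _ (fun i => hn i.1 i.2)).2 hnp
      rw [← FP_sub_eq p hH P hx10 hx1.1 n] at h3
      have h4 : ((p : ℝ) ^ n) ≤ (1 : ℕ) * (gradedPieceDim 𝒮 (FP H (p ^ n)) ⌊(α + r) * (p : ℝ) ^ n⌋₊ + C') := by exact_mod_cast h3
      linarith
    rw [hf1] at this
    norm_num at this
  have hlim : Tendsto (fun n : ℕ => (gradedPieceDim 𝒮 (FP H (p ^ n)) ⌊(α + r) * (p : ℝ) ^ n⌋₊ : ℝ) / (p : ℝ) ^ n + (2 * C : ℝ) / (p : ℝ) ^ n) atTop (𝓝 0) := by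
    have := (hf (α + r) hx10).add (qdiv p (2 * C : ℝ))
    rwa [hf1, add_zero] at this
  filter_upwards [ev_deg p P hx1.2 1, ev_deg p P hx'.2 1, hf.ev_large hx'0 hx'3 (2 * C), hlim.eventually (gt_mem_nhds hr0), (qdiv p 1).eventually (gt_mem_nhds hr0)]
    with n hn1 hn2 hn3 hn4 hn5 ν e b hred
  obtain ⟨κ, k1, k2, -⟩ := hC n e b hred
  have hκ := abs_le.1 (k2 hprim)
  have hq := qpos p n
  have h1 := abs_le.1 (k1 _ (fun i => hn1 i.1 i.2))
  rw [← FP_sub_eq p hH P hx10 hx1.1 n] at h1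
  have h2 := abs_le.1 (k1 _ (fun i => hn2 i.1 i.2))
  have h3 := hn3.trans_le (FP_sub_le hc P (p ^ n) ⌊x' * (p : ℝ) ^ n⌋₊)
  simp only [Nat.div_one] at h1 h2
  obtain ⟨j, -, hj⟩ : ∃ j ∈ Finset.univ, 0 < max (b j - (⌊x' * (p : ℝ) ^ n⌋₊ : ℕ)) 0 := by
    by_contra hcon
    push Not at hcon
    have := Finset.sum_nonpos hcon
    omega
  have h7 : (⌊x' * (p : ℝ) ^ n⌋₊ : ℤ) < b j := by
    rcases lt_max_iff.1 hj with hh | hh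
    · omega
    · omega
  have hν : 0 < ν := lt_of_le_of_lt (Nat.zero_le _) j.2
  refine ⟨hν, ?_⟩
  have hjl : b j ≤ b ⟨ν - 1, by omega⟩ := hred.mono (by rw [Fin.le_def]; have := j.2; simp only; omega)
  set B := b ⟨ν - 1, by omega⟩ with hB
  have h8 := Finset.single_le_sum (f := fun j => max (b j - (⌊(α + r) * (p : ℝ) ^ n⌋₊ : ℕ)) 0) (fun _ _ => le_max_right _ _) (Finset.mem_univ (⟨ν - 1, by omega⟩ : Fin ν))
  have h9 : B - (⌊(α + r) * (p : ℝ) ^ n⌋₊ : ℕ) ≤ max (B - (⌊(α + r) * (p : ℝ) ^ n⌋₊ : ℕ)) 0 := le_max_left _ _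
  have h10 : B - (⌊(α + r) * (p : ℝ) ^ n⌋₊ : ℕ) ≤ gradedPieceDim 𝒮 (FP H (p ^ n)) ⌊(α + r) * (p : ℝ) ^ n⌋₊ + 2 * C := by
    have h9' := h9.trans h8
    omega
  have h11 : (B : ℝ) - (⌊(α + r) * (p : ℝ) ^ n⌋₊ : ℕ) ≤ gradedPieceDim 𝒮 (FP H (p ^ n)) ⌊(α + r) * (p : ℝ) ^ n⌋₊ + 2 * C := by exact_mod_cast h10
  have h12 : ((⌊x' * (p : ℝ) ^ n⌋₊ : ℕ) : ℝ) < B := by exact_mod_cast (h7.trans_le hjl)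
  have h13 := Nat.floor_le (show 0 ≤ (α + r) * (p : ℝ) ^ n by positivity)
  have h14 := Nat.lt_floor_add_one (x' * (p : ℝ) ^ n)
  rw [← add_div, div_lt_iff₀ hq] at hn4
  rw [div_lt_iff₀ hq] at hn5
  rw [abs_le, le_sub_iff_add_le, le_div_iff₀ hq, sub_le_iff_le_add, div_le_iff₀ hq]
  constructor
  · have : (-δ + α) * (p : ℝ) ^ n ≤ (x' - r) * (p : ℝ) ^ n := mul_le_mul_of_nonneg_right (by linarith) hq.le
    linarith
  · have : (α + r + r) * (p : ℝ) ^ n ≤ (δ + α) * (p : ℝ) ^ n := mul_le_mul_of_nonneg_right (by linarith) hq.le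
    linarith

/-- D3 -/
theorem Dens.cluster [Fintype η] [IsAlgClosed K] [Algebra.IsSeparable (RatFunc K) L] (pb : PowerBasis (RatFunc K) L) (hθ : pb.gen ∈ EL K L (1 : ℕ))
    (hc : CM 𝒮 ψ 1 w y) (h : GS 𝒮 g a 1) (p : ℕ) [Fact p.Prime] [CharP K p] [CharP S p] {f : ℝ → ℝ}
    {H : η → S} {d : η → ℕ} (hH : ∀ i, H i ∈ 𝒮 (d i)) (hH0 : ∀ i, H i ≠ 0) (hf : Dens 𝒮 H p f)
    {α : ℝ} (hα0 : 0 ≤ α) (hα1 : ∀ x, α < x → f x = 0) (hα2 : ∀ δ > 0, ∃ x, 0 ≤ x ∧ α - δ < x ∧ x ≤ α ∧ f x ≠ 0)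
    (hd : ∀ i, α ≠ d i) (i0 : η) (hi0 : (d i0 : ℝ) < α) {M : ℕ} (hM : Fintype.card η * Module.finrank (RatFunc K) L ≤ M) {e0 : ℕ} (he0 : Module.finrank (RatFunc K) L ≤ e0) :
    ∃ (z : ℤ) (r : ℕ), 1 ≤ r ∧ r ≤ M ∧ |r * α - z| ≤ (M ^ 2 * (6 * e0 ^ 2) + 1 : ℕ) / (p : ℝ) := by
  classical
  let P : η → Prop := fun i => (d i : ℝ) < α
  have hp : p.Prime := Fact.out
  have hp0 : (0 : ℝ) < p := by exact_mod_cast hp.pos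
  obtain ⟨τ, c, hτ⟩ := exists_red (K := K) (L := L)
  set sc : ℤ := |∑ a, c a| with hsc
  have hδ : (0 : ℝ) < 1 / (2 * p * (M + 1)) := by positivity
  have h1 := hf.approx hc h p hH hH0 hα0 hα1 hα2 hd P (fun i => Iff.rfl) i0 hi0 hδ
  have h2 := (qdiv p (M * sc : ℝ)).eventually (gt_mem_nhds (show (0 : ℝ) < 1 / (2 * p) by positivity))
  obtain ⟨n, ⟨hn1, hn2⟩, hn3⟩ := ((h1.and h2).and (eventually_ge_atTop 1)).exists
  obtain ⟨k, rfl⟩ : ∃ k, n = k + 1 := ⟨n - 1, by omega⟩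
  obtain ⟨ν, e, b, hr⟩ := exists_redn (K := K) (fun i : {i // P i} => ((p ^ (k + 1) * d i / 1 : ℕ) : ℤ)) (fun i : {i // P i} => ψ (H i)) (p ^ (k + 1))
  obtain ⟨hν, hb⟩ := hn1 ν e b hr
  have hr' : GoodFilt.IsRed (ELn K L (fun i : {i // P i} => (p ^ (k + 1) : ℕ) * (d i : ℤ)))
      ((Kq (fun i : {i // P i} => ψ (H i)) (p ^ (k + 1))).restrictScalars (RatFunc K)) e b := by
    simpa [Nat.div_one] using hr
  have hψ0 : (fun i : {i // P i} => ψ (H i)) ⟨i0, hi0⟩ ≠ 0 := fun hz => hH0 i0 (hc.inj _ _ (hH i0) hz)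
  obtain ⟨c1, -, c3⟩ := cluster_main pb 1 hθ p (fun i : {i // P i} => ψ (H i)) (fun i : {i // P i} => (d i : ℤ)) ⟨i0, hi0⟩ hψ0 k hr' τ c hτ
  obtain ⟨z, r, hr1, hr2, hr3⟩ := c3 hν
  have hνM : ν ≤ M := by
    rw [c1]
    refine le_trans (Nat.mul_le_mul_right _ ?_) hM
    have := Fintype.card_subtype_le P
    omega
  refine ⟨z, r, hr1, hr2.trans hνM, ?_⟩
  set B := b ⟨ν - 1, by omega⟩
  have hq := qpos p (k + 1)
  have hdim : pb.dim ≤ e0 := by rw [← pb.finrank]; exact he0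
  have d1 : (4 * 1 * pb.dim ^ 2 : ℕ) + 2 * (1 * pb.dim * (pb.dim - 1) : ℕ) ≤ 6 * e0 ^ 2 := by
    have d2 : pb.dim ^ 2 ≤ e0 ^ 2 := Nat.pow_le_pow_left hdim 2
    have d3 : pb.dim * (pb.dim - 1) ≤ pb.dim ^ 2 := by rw [sq]; exact Nat.mul_le_mul_left _ (Nat.sub_le _ _)
    rw [one_mul]
    omega
  have d4 : (r : ℝ) * B - (p : ℝ) ^ (k + 1) * z ≤ (M : ℝ) ^ 2 * ((p : ℝ) ^ k * (6 * e0 ^ 2 : ℕ)) + M * sc ∧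
     -((M : ℝ) ^ 2 * ((p : ℝ) ^ k * (6 * e0 ^ 2 : ℕ)) + M * sc) ≤ (r : ℝ) * B - (p : ℝ) ^ (k + 1) * z := by
    have e1 : |(r : ℤ) * B - (p ^ (k + 1) : ℕ) * z| ≤ (M : ℤ) ^ 2 * ((p : ℤ) ^ k * (6 * e0 ^ 2 : ℕ)) + M * sc := by
      refine hr3.trans ?_
      have : (((4 * 1 * pb.dim ^ 2 : ℕ) : ℤ) + 2 * (1 * pb.dim * (pb.dim - 1) : ℕ)) ≤ (6 * e0 ^ 2 : ℕ) := by exact_mod_cast d1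
      have hsc0 : 0 ≤ sc := abs_nonneg _
      gcongr
    have e2 := abs_le.1 e1
    constructor
    · exact_mod_cast e2.2
    · exact_mod_cast e2.1
  have d5 : |(r : ℝ) * (B / (p : ℝ) ^ (k + 1)) - z| ≤ (M ^ 2 * (6 * e0 ^ 2) : ℕ) / (p : ℝ) + 1 / (2 * p) := by
    have e1 : (r : ℝ) * (B / (p : ℝ) ^ (k + 1)) - z = ((r : ℝ) * B - (p : ℝ) ^ (k + 1) * z) / (p : ℝ) ^ (k + 1) := by
      field_simp
    rw [e1, abs_div, abs_of_pos hq, div_le_iff₀ hq]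
    rw [div_lt_iff₀ hq] at hn2
    have e2 : ((M ^ 2 * (6 * e0 ^ 2) : ℕ) / (p : ℝ) + 1 / (2 * p)) * (p : ℝ) ^ (k + 1) = (M : ℝ) ^ 2 * ((p : ℝ) ^ k * (6 * e0 ^ 2 : ℕ)) + 1 / (2 * p) * (p : ℝ) ^ (k + 1) := by
      push_cast
      field_simp
      ring
    rw [e2, abs_le]
    constructor <;> linarith [d4.1, d4.2]
  have d6 : |(r : ℝ) * (α - B / (p : ℝ) ^ (k + 1))| ≤ 1 / (2 * p) := by
    rw [abs_mul, Nat.abs_cast, abs_sub_comm]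
    calc (r : ℝ) * |(B : ℝ) / (p : ℝ) ^ (k + 1) - α| ≤ (M + 1 : ℝ) * (1 / (2 * p * (M + 1))) := by
          have : (r : ℝ) ≤ M := by exact_mod_cast hr2.trans hνM
          gcongr
          linarith
      _ = 1 / (2 * p) := by field_simp
  have d7 : r * α - z = (r : ℝ) * (α - B / (p : ℝ) ^ (k + 1)) + ((r : ℝ) * (B / (p : ℝ) ^ (k + 1)) - z) := by ring
  rw [d7]
  refine (abs_add_le _ _).trans ((add_le_add d6 d5).trans (le_of_eq ?_))
  push_cast
  field_simp
  ring
end D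
end FilePG9

section FilePG10
set_option linter.all false
open Polynomial

section D
open Filter Topology IntermediateField
variable {K L S ι η : Type*} [Field K] [Field L] [Algebra K L] [Algebra K[X] L] [Algebra (RatFunc K) L]
  [IsScalarTower K K[X] L] [IsScalarTower K[X] (RatFunc K) L] [IsScalarTower K (RatFunc K) L]
  [FiniteDimensional (RatFunc K) L]
  [CommRing S] [IsDomain S] [Algebra K S] {𝒮 : ℕ → Submodule K S} [GradedAlgebra 𝒮] {ψ : S →ₐ[K] L} {w y : S}
  [Fintype ι] {g : ι → S} {a : ι → ℕ}

lemma sep_of_lt {F E : Type*} [Field F] [Field E] [Algebra F E] [FiniteDimensional F E] (p : ℕ) [Fact p.Prime] [CharP F p]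
    (h : Module.finrank F E < p) : Algebra.IsSeparable F E := by
  refine ⟨fun x => ?_⟩
  have hint : IsIntegral F x := IsIntegral.of_finite F x
  have h1 := minpoly.natDegree_le (A := F) x
  have h2 := minpoly.natDegree_pos hint
  rw [IsSeparable, Polynomial.separable_iff_derivative_ne_zero (minpoly.irreducible hint)]
  intro h3
  have h4 := congrArg (fun P => Polynomial.coeff P ((minpoly F x).natDegree - 1)) h3
  simp only [Polynomial.coeff_derivative, Polynomial.coeff_zero] at h4
  have h5 : (minpoly F x).natDegree - 1 + 1 = (minpoly F x).natDegree := by omega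
  rw [h5, Polynomial.coeff_natDegree, (minpoly.monic hint).leadingCoeff, one_mul] at h4
  have h6 : (((minpoly F x).natDegree : ℕ) : F) = 0 := by
    rw [← h5]; push_cast; exact h4
  rw [CharP.cast_eq_zero_iff F p] at h6
  have := Nat.le_of_dvd h2 h6
  omega

theorem exists_pb [Infinite K] [Algebra.IsSeparable (RatFunc K) L] (hc : CM 𝒮 ψ 1 w y) (h : GS 𝒮 g a 1) :
    ∃ pb : PowerBasis (RatFunc K) L, pb.gen ∈ EL K L (1 : ℕ) := by
  haveI : Finite (IntermediateField (RatFunc K) L) :=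
    Field.finite_intermediateField_of_exists_primitive_element _ _ (Field.exists_primitive_element _ _)
  have ha : ∀ i, a i = 1 := fun i => Nat.dvd_one.1 (h.hd i)
  let T : IntermediateField (RatFunc K) L → Submodule K (𝒮 1) := fun F =>
    { carrier := {x | ψ x ∈ F}
      add_mem' := fun {x y} hx hy => by
        simp only [Set.mem_setOf_eq] at *
        rw [Submodule.coe_add, map_add]; exact add_mem hx hy
      zero_mem' := by simp
      smul_mem' := fun c x hx => by
        simp only [Set.mem_setOf_eq] at *
        rw [Submodule.coe_smul, map_smul, ← IsScalarTower.algebraMap_smul (RatFunc K) c]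
        exact F.smul_mem hx }
  have hT : ∀ F, T F = ⊤ → F = ⊤ := by
    intro F hF
    have h1 : ∀ i, ψ (g i) ∈ F := fun i => by
      have : (⟨g i, by rw [← ha i]; exact h.hg i⟩ : 𝒮 1) ∈ T F := by rw [hF]; trivial
      exact this
    have h2 : ∀ s : S, ψ s ∈ F := by
      intro s
      have h3 : s ∈ Algebra.adjoin K (Set.range g) := by rw [h.gen]; trivial
      induction h3 using Algebra.adjoin_induction with
      | mem x hx => obtain ⟨i, rfl⟩ := hx; exact h1 i
      | algebraMap r => rw [AlgHom.commutes, IsScalarTower.algebraMap_apply K (RatFunc K) L]; exact F.algebraMap_mem _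
      | add x y _ _ hx hy => rw [map_add]; exact add_mem hx hy
      | mul x y _ _ hx hy => rw [map_mul]; exact mul_mem hx hy
    rw [eq_top_iff]
    intro x _
    obtain ⟨u, v, -, rfl⟩ := hc.frac x
    exact div_mem (h2 u) (h2 v)
  obtain ⟨x, hx⟩ : ∃ x : 𝒮 1, ∀ F, ψ x ∈ F → F = ⊤ := by
    by_contra hcon
    push Not at hcon
    have hfin : (Set.range T).Finite := Set.finite_range T
    have h1 := Subspace.biUnion_ne_univ_of_top_notMem (k := K) (E := 𝒮 1) (s := (hfin.subset (Set.diff_subset : Set.range T \ {⊤} ⊆ Set.range T)).toFinset) (by simp)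
    apply h1
    rw [Set.eq_univ_iff_forall]
    intro x
    obtain ⟨F, hF1, hF2⟩ := hcon x
    simp only [Set.mem_iUnion]
    refine ⟨T F, ?_, hF1⟩
    simp only [Set.Finite.mem_toFinset, Set.mem_diff, Set.mem_range, exists_apply_eq_apply, Set.mem_singleton_iff, true_and]
    exact fun hc => hF2 (hT F hc)
  have h1 : (RatFunc K)⟮ψ x⟯ = ⊤ := hx _ (IntermediateField.mem_adjoin_simple_self _ _)
  refine ⟨(IntermediateField.adjoin.powerBasis (Algebra.IsSeparable.isIntegral (RatFunc K) (ψ x))).map ((IntermediateField.equivOfEq h1).trans IntermediateField.topEquiv), ?_⟩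
  have h2 := hc.mem 1 x (by simpa using x.2)
  simpa using h2

/-- D3, final form -/
theorem Dens.rational [Fintype η] [IsAlgClosed K]
    (hc : CM 𝒮 ψ 1 w y) (h : GS 𝒮 g a 1) (p : ℕ) [Fact p.Prime] [CharP K p] [CharP S p] {f : ℝ → ℝ}
    {H : η → S} {d : η → ℕ} (hH : ∀ i, H i ∈ 𝒮 (d i)) (hH0 : ∀ i, H i ≠ 0) (hf : Dens 𝒮 H p f)
    (hd1 : ∀ i, 0 < d i) (hfin : Prim g H) {e0 : ℕ} (he1 : f (1 / 2) * 2 ≤ e0) (he2 : e0 < p)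
    {α : ℝ} (hα0 : 0 ≤ α) (hα1 : ∀ x, α < x → f x = 0) (hα2 : ∀ δ > 0, ∃ x, 0 ≤ x ∧ α - δ < x ∧ x ≤ α ∧ f x ≠ 0) {M : ℕ} (hM : Fintype.card η * e0 ≤ M) :
    (∃ (z : ℤ) (r : ℕ), 1 ≤ r ∧ r ≤ M ∧ |r * α - z| ≤ (M ^ 2 * (6 * e0 ^ 2) + 1 : ℕ) / (p : ℝ)) ∨ ∃ i, α = d i := by
  rw [or_iff_not_imp_right]
  intro hd
  push Not at hd
  have he0 : Module.finrank (RatFunc K) L ≤ e0 := by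
    rw [hf.small hc p hH (by norm_num) (fun i => by have : (1 : ℝ) ≤ d i := by exact_mod_cast hd1 i
                                                    linarith)] at he1
    have : (Module.finrank (RatFunc K) L : ℝ) ≤ e0 := by
      push_cast at he1
      linarith
    exact_mod_cast this
  haveI : CharP (RatFunc K) p := charP_of_injective_algebraMap (algebraMap K (RatFunc K)).injective p
  haveI := sep_of_lt (F := RatFunc K) (E := L) p (lt_of_le_of_lt he0 he2)
  haveI : Infinite K := IsAlgClosed.instInfinite
  obtain ⟨pb, hpb⟩ := exists_pb hc h
  by_cases hi : ∃ i0, (d i0 : ℝ) < α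
  · obtain ⟨i0, hi0⟩ := hi
    exact hf.cluster pb hpb hc h p hH hH0 hα0 hα1 hα2 hd i0 hi0 ((Nat.mul_le_mul_left _ he0).trans hM) he0
  · exfalso
    push Not at hi
    have e1 : ∀ᶠ x in 𝓝 α, ∀ i, x < (d i : ℝ) := by
      rw [eventually_all]
      intro i
      exact gt_mem_nhds (lt_of_le_of_ne (hi i) (hd i))
    obtain ⟨δ1, hδ1, hball⟩ := Metric.eventually_nhds_iff.1 e1
    have h1 := hball (y := α + δ1 / 2) (by rw [Real.dist_eq, add_sub_cancel_left, abs_of_pos (by linarith)]; linarith)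
    have h2 := hf.small hc p hH (by linarith) h1
    rw [hα1 _ (by linarith)] at h2
    have h3 : (0 : ℝ) < Module.finrank (RatFunc K) L := by exact_mod_cast (Module.finrank_pos : 0 < Module.finrank (RatFunc K) L)
    have h4 : (0 : ℝ) < Module.finrank (RatFunc K) L * (α + δ1 / 2) / (1 : ℕ) := by positivity
    linarith
end D
end FilePG10

section FilePG11
set_option linter.all false
open Polynomial

section D
open Filter Topology
variable {K S ι η : Type*} [Field K] 
  [CommRing S] [IsDomain S] [Algebra K S] {𝒮 : ℕ → Submodule K S} [GradedAlgebra 𝒮] {N : ℕ} {w : S}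
  [Fintype ι] {g : ι → S} {a : ι → ℕ}

lemma FP_nz (H : η → S) {q : ℕ} (hq : 0 < q) : FP (fun i : {i // H i ≠ 0} => H i) q = FP H q := by
  apply le_antisymm
  · refine Ideal.span_mono ?_
    rintro _ ⟨i, rfl⟩
    exact ⟨i, rfl⟩
  · refine Ideal.span_le.2 ?_
    rintro _ ⟨i, rfl⟩
    by_cases hi : H i = 0
    · simp only [hi, zero_pow hq.ne']; exact zero_mem _
    · exact Ideal.subset_span ⟨⟨i, hi⟩, rfl⟩

lemma Dens.nz {H : η → S} {p : ℕ} [hp : Fact p.Prime] {f : ℝ → ℝ} (hf : Dens 𝒮 H p f) : Dens 𝒮 (fun i : {i // H i ≠ 0} => H i) p f := by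
  intro x hx
  have := hf x hx
  simpa only [FP_nz H (Nat.pow_pos hp.out.pos)] using this

lemma span_nz (H : η → S) : Ideal.span (Set.range fun i : {i // H i ≠ 0} => H i) = Ideal.span (Set.range H) := by
  have := FP_nz H one_pos
  simpa [FP] using this

lemma GS.prim_nz [Fintype η] (h : GS 𝒮 g a N) {H : η → S} {d : η → ℕ} (hH : ∀ i, H i ∈ 𝒮 (d i))
    (hfin : FiniteDimensional K (S ⧸ Ideal.span (Set.range H))) : Prim g (fun i : {i // H i ≠ 0} => H i) := by
  rw [Prim, span_nz]
  exact h.primary (span_homog (by rintro _ ⟨i, rfl⟩; exact ⟨_, hH i⟩)) hfin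

lemma GS.exists_nz [Fintype η] (h : GS 𝒮 g a N) {H : η → S} (hpr : Prim g (fun i : {i // H i ≠ 0} => H i)) : ∃ i, H i ≠ 0 := by
  by_contra hcon
  push Not at hcon
  haveI : IsEmpty {i // H i ≠ 0} := ⟨fun i => i.2 (hcon i.1)⟩
  obtain ⟨E, hE⟩ := hpr
  have h1 : ∀ i, g i = 0 := by
    intro i
    have := hE i
    rw [Set.range_eq_empty, Ideal.span_empty, Ideal.mem_bot] at this
    exact eq_zero_of_pow_eq_zero this
  have h2 : Function.Surjective (algebraMap K S) := by
    intro s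
    have h3 : s ∈ Algebra.adjoin K (Set.range g) := by rw [h.gen]; trivial
    have h4 : Algebra.adjoin K (Set.range g) ≤ ⊥ := Algebra.adjoin_le (by rintro _ ⟨i, rfl⟩; rw [h1 i]; exact zero_mem _)
    exact Algebra.mem_bot.1 (h4 h3)
  have h3 := ringKrullDim_le_of_surjective _ h2
  rw [h.dim, ringKrullDim_eq_zero_of_field] at h3
  norm_num at h3

variable [Fintype η] [IsAlgClosed K] {H : η → S} {d : η → ℕ} {p : ℕ} [Fact p.Prime] [CharP S p] {f : ℝ → ℝ}

theorem pack1 (h : GS 𝒮 g a N) (hw : w ∈ 𝒮 1) (hw0 : w ≠ 0) (hH : ∀ i, H i ∈ 𝒮 (d i)) (hfin : FiniteDimensional K (S ⧸ Ideal.span (Set.range H)))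
    (hf : Dens 𝒮 H p f) :
    (∀ u x : ℝ, 0 ≤ u → u < x → (∀ i, u ≠ d i) → f x ≠ 0 → min u (min (x - u) 1) ≤ N * f u) ∧
    (∀ u x : ℝ, 0 ≤ u → u < x → (∀ i, (d i : ℝ) < u) → f x ≠ 0 → x - u ≤ N * f u) ∧
    (∀ x : ℝ, 0 ≤ x → (∀ i, H i ≠ 0 → x < d i) → x ≤ N * f x) := by
  classical
  obtain ⟨L, _, _, _, _, _, _, _, _, ψ, y, hc⟩ := h.exists_CM hw hw0
  have hH' : ∀ i : {i // H i ≠ 0}, H i ∈ 𝒮 (d i) := fun i => hH i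
  have hpr := h.prim_nz hH hfin
  obtain ⟨i0, hi0⟩ := h.exists_nz hpr
  refine ⟨fun u x hu hux hd hx => ?_, fun u x hu hux hd hx => ?_, fun x hx hd => ?_⟩
  · exact hf.nz.step hc h p hH' (fun i => i.2) hu hux (fun i => hd i) hx
  · exact hf.nz.step' hc h p hH' ⟨i0, hi0⟩ hi0 hpr hu hux (fun i => hd i) hx
  · have hN := h.hN
    rw [hf.nz.small hc p hH' hx (fun i => hd i i.2), mul_div_cancel₀ _ (by positivity)]
    have : (1 : ℝ) ≤ Module.finrank (RatFunc K) L := by exact_mod_cast (Module.finrank_pos : 0 < Module.finrank (RatFunc K) L)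
    nlinarith

theorem pack2 (h : GS 𝒮 g a 1) (hw : w ∈ 𝒮 1) (hw0 : w ≠ 0) [CharP K p] (hH : ∀ i, H i ∈ 𝒮 (d i)) (hfin : FiniteDimensional K (S ⧸ Ideal.span (Set.range H)))
    (hf : Dens 𝒮 H p f) (hd1 : ∀ i, H i ≠ 0 → 0 < d i) {e0 : ℕ} (he1 : f (1 / 2) * 2 ≤ e0) (he2 : e0 < p)
    {α : ℝ} (hα0 : 0 ≤ α) (hα1 : ∀ x, α < x → f x = 0) (hα2 : ∀ δ > 0, ∃ x, 0 ≤ x ∧ α - δ < x ∧ x ≤ α ∧ f x ≠ 0) {M : ℕ} (hM : Fintype.card η * e0 ≤ M) :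
    (∃ (z : ℤ) (r : ℕ), 1 ≤ r ∧ r ≤ M ∧ |r * α - z| ≤ (M ^ 2 * (6 * e0 ^ 2) + 1 : ℕ) / (p : ℝ)) ∨ ∃ i, α = d i := by
  classical
  obtain ⟨L, _, _, _, _, _, _, _, _, ψ, y, hc⟩ := h.exists_CM hw hw0
  have hH' : ∀ i : {i // H i ≠ 0}, H i ∈ 𝒮 (d i) := fun i => hH i
  have hpr := h.prim_nz hH hfin
  rcases hf.nz.rational hc h p hH' (fun i => i.2) (fun i => hd1 i i.2) hpr he1 he2 hα0 hα1 hα2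
    ((Nat.mul_le_mul_right _ (Fintype.card_subtype_le _)).trans hM) with h1 | ⟨i, h1⟩
  · exact Or.inl h1
  · exact Or.inr ⟨i.1, h1⟩
end D
end FilePG11

section FilePH1
set_option linter.all false
open TensorProduct

lemma redGrading_eq (A RA Ω : Type*) [CommRing A] [CommRing RA] [Algebra A RA]
    [CommRing Ω] [Algebra A Ω] (𝒜A : ℕ → Submodule A RA) :
    redGrading A RA Ω 𝒜A = fun i => (𝒜A i).baseChange Ω := by
  funext i
  rw [Submodule.baseChange_eq_span]
  rfl

@[reducible] noncomputable def redGraded (A RA Ω : Type*) [CommRing A] [CommRing RA] [Algebra A RA]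
    [CommRing Ω] [Algebra A Ω] (𝒜A : ℕ → Submodule A RA) [GradedAlgebra 𝒜A] :
    GradedAlgebra (redGrading A RA Ω 𝒜A) := by
  rw [redGrading_eq]
  infer_instance

section
variable {A RA Ω k : Type*} [CommRing A] [CommRing RA] [Algebra A RA] [Module.Flat A RA]
    [Field Ω] [Algebra A Ω] [Field k] [Algebra A k] {𝒜A : ℕ → Submodule A RA} [GradedAlgebra 𝒜A]

lemma van {M : Type*} [AddCommGroup M] [Module A M] {ι : Type*} [Fintype ι] {m : ι → M} {n : ι → RA}
    (h : ∑ i, m i ⊗ₜ[A] n i = 0) : TensorProduct.VanishesTrivially A m n :=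
  TensorProduct.vanishesTrivially_of_sum_tmul_eq_zero_of_rTensor_injective A
    (Module.Flat.rTensor_preserves_injective_linearMap _ (Submodule.subtype_injective _)) h

lemma scal (hk : Function.Injective (algebraMap A k)) [Nontrivial (Ω ⊗[A] RA)] {b : RA} {c : k}
    (hb : (1:k) ⊗ₜ[A] b = c ⊗ₜ[A] (1:RA)) : ∃ c' : Ω, (1:Ω) ⊗ₜ[A] b = algebraMap Ω (Ω ⊗[A] RA) c' := by
  have h1 : ∑ i : Fin 2, (![1, -c] : Fin 2 → k) i ⊗ₜ[A] (![b, 1] : Fin 2 → RA) i = 0 := by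
    simp [Fin.sum_univ_two, hb, TensorProduct.neg_tmul]
  obtain ⟨l, a, y, h1, h2⟩ := van h1
  have e0 := h1 0
  have e1 := h1 1
  simp only [Matrix.cons_val_zero, Matrix.cons_val_one] at e0 e1
  have h2' : ∀ j, algebraMap A k (a 0 j) = c * algebraMap A k (a 1 j) := by
    intro j
    have := h2 j
    simp only [Fin.sum_univ_two, Matrix.cons_val_zero, Matrix.cons_val_one, Algebra.smul_def] at this
    linear_combination this
  have hne : ∃ j, algebraMap A Ω (a 1 j) ≠ 0 := by
    by_contra hcon
    push Not at hcon
    have : (1 : Ω ⊗[A] RA) = 0 := by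
      rw [Algebra.TensorProduct.one_def, e1, TensorProduct.tmul_sum]
      refine Finset.sum_eq_zero fun j _ => ?_
      rw [← TensorProduct.smul_tmul, Algebra.smul_def, hcon j, zero_mul, TensorProduct.zero_tmul]
    exact one_ne_zero this
  obtain ⟨j, hj⟩ := hne
  have h3 : a 1 j • b = a 0 j • (1:RA) := by
    rw [e0, e1, Finset.smul_sum, Finset.smul_sum]
    refine Finset.sum_congr rfl fun i _ => ?_
    rw [smul_smul, smul_smul]
    congr 1
    apply hk
    rw [map_mul, map_mul, h2', h2']; ring
  refine ⟨(algebraMap A Ω (a 1 j))⁻¹ * algebraMap A Ω (a 0 j), ?_⟩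
  have h4 : (algebraMap A Ω (a 1 j)) ⊗ₜ[A] b = (algebraMap A Ω (a 0 j)) ⊗ₜ[A] (1:RA) := by
    rw [Algebra.algebraMap_eq_smul_one, Algebra.algebraMap_eq_smul_one, TensorProduct.smul_tmul, TensorProduct.smul_tmul, h3]
  rw [Algebra.TensorProduct.algebraMap_apply, Algebra.algebraMap_self, RingHom.id_apply, ← smul_eq_mul, ← TensorProduct.smul_tmul', ← h4, TensorProduct.smul_tmul', smul_eq_mul, inv_mul_cancel₀ hj]

lemma deg1_ne [IsNoetherianRing RA] [IsDomain RA] [Nontrivial (Ω ⊗[A] RA)] {x0 : RA} (hx0 : x0 ∈ 𝒜A 1) (hx00 : x0 ≠ 0) :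
    ∃ x ∈ 𝒜A 1, (1:Ω) ⊗ₜ[A] x ≠ 0 := by
  by_contra hcon
  push Not at hcon
  set P : Ideal RA := (RingHom.ker (algebraMap A Ω)).map (algebraMap A RA) with hP
  set J : Ideal RA := Ideal.span (𝒜A 1 : Set RA) with hJ
  have hJP : J ≤ P • J := by
    rw [hJ, Ideal.span_le]
    intro x hx
    have h1 : ∑ i : Fin 1, (fun _ => 1 : Fin 1 → Ω) i ⊗ₜ[A] (fun _ => x : Fin 1 → RA) i = 0 := by
      simpa using hcon x hx
    obtain ⟨l, a, y, h1, h2⟩ := van h1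
    have e0 : x = ∑ j, a 0 j • y j := h1 0
    have e1 : x = ∑ j, a 0 j • (DirectSum.decompose 𝒜A (y j) 1 : RA) := by
      have : (DirectSum.decompose 𝒜A x 1 : RA) = x := DirectSum.decompose_of_mem_same _ hx
      calc x = _ := this.symm
        _ = (DirectSum.decompose 𝒜A (∑ j, a 0 j • y j) 1 : RA) := by rw [← e0]
        _ = _ := ?_
      simp [DirectSum.decompose_sum, DirectSum.decompose_smul, DFinsupp.finset_sum_apply]
      rfl
    rw [SetLike.mem_coe, e1]
    refine Submodule.sum_mem _ fun j _ => ?_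
    rw [Algebra.smul_def (a 0 j), ← smul_eq_mul]
    refine Submodule.smul_mem_smul (Ideal.mem_map_of_mem _ ?_) (Ideal.subset_span (SetLike.coe_mem _))
    have := h2 j
    simpa [Algebra.smul_def] using this
  obtain ⟨r, hr, hrJ⟩ := Submodule.exists_sub_one_mem_and_smul_eq_zero_of_fg_of_le_smul P J (IsNoetherian.noetherian J) hJP
  have h3 := hrJ x0 (Ideal.subset_span hx0)
  have hr0 : r = 0 := by simpa [hx00] using h3
  rw [hr0] at hr
  have h1P : (1:RA) ∈ P := by simpa using P.neg_mem hr
  have hle : P ≤ RingHom.ker (Algebra.TensorProduct.includeRight : RA →ₐ[A] Ω ⊗[A] RA).toRingHom := by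
    rw [hP, Ideal.map_le_iff_le_comap]
    intro x hx
    rw [Ideal.mem_comap, RingHom.mem_ker]
    have hx' : algebraMap A Ω x = 0 := hx
    simp only [AlgHom.toRingHom_eq_coe, RingHom.coe_coe, AlgHom.commutes]
    rw [Algebra.TensorProduct.algebraMap_apply, hx', TensorProduct.zero_tmul]
  have := hle h1P
  rw [RingHom.mem_ker, map_one] at this
  exact one_ne_zero this

/-- denominators -/
lemma exists_retr [IsDomain A] [FaithfulSMul A k] : ∃ ρ : k →ₗ[A] FractionRing A, ρ 1 = 1 := by
  letI := FractionRing.liftAlgebra A k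
  obtain ⟨ρ, hρ⟩ := LinearMap.exists_leftInverse_of_injective (Algebra.linearMap (FractionRing A) k)
    (LinearMap.ker_eq_bot.2 (algebraMap (FractionRing A) k).injective)
  refine ⟨ρ.restrictScalars A, ?_⟩
  have := congrArg (fun φ => φ 1) hρ
  simpa using this

lemma clear_den [IsDomain A] [FaithfulSMul A k] (B : Subalgebra A RA) {x : RA}
    (hx : (1:k) ⊗ₜ[A] x ∈ Submodule.span k ((fun u => (1:k) ⊗ₜ[A] u) '' (B : Set RA))) : ∃ a : A, a ≠ 0 ∧ a • x ∈ B := by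
  obtain ⟨ρ, hρ⟩ := exists_retr (A := A) (k := k)
  have key : ∀ y ∈ Submodule.span k ((fun u => (1:k) ⊗ₜ[A] u) '' (B : Set RA)), ∀ c : k, ∃ a : A, a ≠ 0 ∧ ∃ b ∈ B,
      a • (LinearMap.rTensor RA ρ (c • y)) = (1 : FractionRing A) ⊗ₜ[A] b := by
    intro y hy
    induction hy using Submodule.span_induction with
    | mem y hy =>
      intro c
      obtain ⟨u, hu, rfl⟩ := hy
      obtain ⟨⟨a1, a2⟩, ha⟩ := IsLocalization.surj (nonZeroDivisors A) (ρ c)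
      refine ⟨a2, nonZeroDivisors.ne_zero a2.2, a1 • u, B.smul_mem hu a1, ?_⟩
      dsimp only
      rw [TensorProduct.smul_tmul', smul_eq_mul, mul_one, LinearMap.rTensor_tmul, TensorProduct.smul_tmul',
        ← TensorProduct.smul_tmul, Algebra.smul_def, mul_comm, ha, Algebra.smul_def, mul_one]
    | zero => exact fun c => ⟨1, one_ne_zero, 0, B.zero_mem, by simp⟩
    | add y z _ _ h1 h2 =>
      intro c
      obtain ⟨a1, ha1, b1, hb1, e1⟩ := h1 c
      obtain ⟨a2, ha2, b2, hb2, e2⟩ := h2 c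
      refine ⟨a1 * a2, mul_ne_zero ha1 ha2, a2 • b1 + a1 • b2, B.add_mem (B.smul_mem hb1 _) (B.smul_mem hb2 _), ?_⟩
      rw [smul_add, map_add, smul_add, TensorProduct.tmul_add, TensorProduct.tmul_smul, TensorProduct.tmul_smul, ← e1, ← e2,
        smul_smul, smul_smul, mul_comm a2]
    | smul r y _ h =>
      intro c
      rw [smul_smul]
      exact h _
  obtain ⟨a, ha, b, hb, e⟩ := key _ hx 1
  refine ⟨a, ha, ?_⟩
  rw [one_smul, LinearMap.rTensor_tmul, hρ, ← TensorProduct.tmul_smul] at e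
  have hinj := Algebra.TensorProduct.includeRight_injective (R := A) (A := FractionRing A) (B := RA) (IsFractionRing.injective A (FractionRing A))
  have : a • x = b := hinj e
  rwa [this]
end
end FilePH1

section FilePH2
set_option linter.all false
open TensorProduct

section
variable {A RA Ω : Type*} [CommRing A] [CommRing RA] [Algebra A RA]
    [Field Ω] [Algebra A Ω] {𝒜A : ℕ → Submodule A RA} [GradedAlgebra 𝒜A]
    {ι : Type*} [Fintype ι] {g : ι → RA} {a : ι → ℕ} {N : ℕ}

lemma mem_red {n : ℕ} {x : RA} (hx : x ∈ 𝒜A n) : (1:Ω) ⊗ₜ[A] x ∈ redGrading A RA Ω 𝒜A n :=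
  Submodule.subset_span ⟨x, hx, rfl⟩

lemma red_zero (hb : ∀ b ∈ 𝒜A 0, ∃ c : Ω, (1:Ω) ⊗ₜ[A] b = algebraMap Ω (Ω ⊗[A] RA) c)
    {x : Ω ⊗[A] RA} (hx : x ∈ redGrading A RA Ω 𝒜A 0) : ∃ c : Ω, x = algebraMap Ω (Ω ⊗[A] RA) c := by
  have : redGrading A RA Ω 𝒜A 0 ≤ LinearMap.range (Algebra.linearMap Ω (Ω ⊗[A] RA)) := by
    refine Submodule.span_le.2 ?_
    rintro _ ⟨b, hb', rfl⟩
    obtain ⟨c, hc⟩ := hb b hb'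
    exact ⟨c, hc.symm⟩
  obtain ⟨c, hc⟩ := this hx
  exact ⟨c, hc.symm⟩

lemma incl_adjoin {B : Set RA} {T : Subalgebra Ω (Ω ⊗[A] RA)} (hB : ∀ b ∈ B, (1:Ω) ⊗ₜ[A] b ∈ T) {x : RA}
    (hx : x ∈ Algebra.adjoin A B) : (1:Ω) ⊗ₜ[A] x ∈ T := by
  have : Algebra.adjoin A B ≤ (T.restrictScalars A).comap (Algebra.TensorProduct.includeRight : RA →ₐ[A] Ω ⊗[A] RA) :=
    Algebra.adjoin_le hB
  exact this hx

lemma GS_of (hb : ∀ b ∈ 𝒜A 0, ∃ c : Ω, (1:Ω) ⊗ₜ[A] b = algebraMap Ω (Ω ⊗[A] RA) c)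
    (hg : ∀ i, g i ∈ 𝒜A (a i)) (gen : Algebra.adjoin A (Set.range g) = ⊤) (hN : 0 < N)
    (hd : ∀ i, 0 < a i → a i ∣ N) (hdim : ringKrullDim (Ω ⊗[A] RA) = 2) :
    GS (redGrading A RA Ω 𝒜A) (fun i : {i // 0 < a i} => (1:Ω) ⊗ₜ[A] g i) (fun i => a i) N where
  h0 := fun x hx => red_zero hb hx
  hg := fun i => mem_red (hg i)
  ha := fun i => i.2
  hN := hN
  hd := fun i => hd i i.2
  dim := hdim
  gen := by
    set T := Algebra.adjoin Ω (Set.range (fun i : {i // 0 < a i} => (1:Ω) ⊗ₜ[A] g i)) with hT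
    have h1 : ∀ x : RA, (1:Ω) ⊗ₜ[A] x ∈ T := by
      intro x
      refine incl_adjoin (B := Set.range g) ?_ (gen ▸ Algebra.mem_top)
      rintro _ ⟨i, rfl⟩
      rcases Nat.eq_zero_or_pos (a i) with h | h
      · obtain ⟨c, hc⟩ := hb (g i) (h ▸ hg i)
        rw [hc]; exact T.algebraMap_mem c
      · exact Algebra.subset_adjoin ⟨⟨i, h⟩, rfl⟩
    rw [eq_top_iff]
    intro z _
    induction z using TensorProduct.induction_on with
    | zero => exact T.zero_mem
    | tmul c x =>
      have := T.smul_mem (h1 x) c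
      rwa [TensorProduct.smul_tmul', smul_eq_mul, mul_one] at this
    | add x y hx hy => exact T.add_mem (hx trivial) (hy trivial)

lemma good_mem {x : RA} {c : A} (hc : algebraMap A Ω c ≠ 0) (hx : c • x ∈ Algebra.adjoin A (𝒜A 1 : Set RA)) :
    (1:Ω) ⊗ₜ[A] x ∈ Algebra.adjoin Ω (redGrading A RA Ω 𝒜A 1 : Set (Ω ⊗[A] RA)) := by
  have h1 := incl_adjoin (Ω := Ω) (T := Algebra.adjoin Ω (redGrading A RA Ω 𝒜A 1 : Set (Ω ⊗[A] RA)))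
    (fun b hb => Algebra.subset_adjoin (mem_red hb)) hx
  have h2 := Subalgebra.smul_mem _ h1 (algebraMap A Ω c)⁻¹
  rwa [← TensorProduct.smul_tmul, TensorProduct.smul_tmul', Algebra.smul_def c, mul_one, smul_eq_mul, inv_mul_cancel₀ hc] at h2
end

section
variable {K S ι : Type*} [Field K] [IsAlgClosed K] [CommRing S] [IsDomain S] [Algebra K S] {𝒮 : ℕ → Submodule K S} [GradedAlgebra 𝒮]
  [Fintype ι] {g : ι → S} {a : ι → ℕ} {N : ℕ} {w : S}

lemma GS.one (h : GS 𝒮 g a N) (hw : w ∈ 𝒮 1) (hw0 : w ≠ 0) (hg : ∀ i, g i ∈ Algebra.adjoin K (𝒮 1 : Set S)) :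
    ∃ (m : ℕ) (g' : Fin m → S), GS 𝒮 g' (fun _ => 1) 1 := by
  obtain ⟨L, _, _, _, _, _, _, _, _, ψ, y, hc⟩ := h.exists_CM hw hw0
  haveI := hc.finite 1
  have hfg : (𝒮 1).FG := Module.Finite.iff_fg.1 this
  obtain ⟨m, g', hg'⟩ := Submodule.fg_iff_exists_fin_generating_family.1 hfg
  refine ⟨m, g', h.h0, fun i => hg' ▸ Submodule.subset_span ⟨i, rfl⟩, fun _ => one_pos, one_pos, fun _ => one_dvd _, ?_, h.dim⟩
  rw [eq_top_iff, ← h.gen]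
  refine Algebra.adjoin_le ?_
  rintro _ ⟨i, rfl⟩
  have : Algebra.adjoin K (𝒮 1 : Set S) ≤ Algebra.adjoin K (Set.range g') := by
    refine Algebra.adjoin_le ?_
    rw [← hg']
    exact Algebra.span_le_adjoin K _
  exact this (hg i)
end
end FilePH2

section FilePH3
set_option linter.all false
open TensorProduct

section
variable {A RA : Type*} [CommRing A] [CommRing RA] [Algebra A RA] {𝒜A : ℕ → Submodule A RA} [GradedAlgebra 𝒜A]

lemma hom_fam (F : Finset RA) : ∃ (n : ℕ) (g : Fin n → RA) (a : Fin n → ℕ), (∀ i, g i ∈ 𝒜A (a i)) ∧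
    (∀ i, ∃ f ∈ F, ∃ m, g i = (DirectSum.decompose 𝒜A f m : RA)) ∧ 
    (∀ f ∈ F, ∀ (T : AddSubmonoid RA), (∀ i, g i ∈ T) → f ∈ T) := by
  classical
  let ι₀ := Σ (x : F), (DirectSum.decompose 𝒜A x.1).support
  let x (i : ι₀) : RA := ((DirectSum.decompose 𝒜A) i.1 i.2).1
  let e := (Fintype.equivFin ι₀).symm
  refine ⟨Fintype.card ι₀, fun i => x (e i), fun i => (e i).2.1, fun i => SetLike.coe_mem _, fun i => ⟨(e i).1, (e i).1.2, (e i).2, rfl⟩, ?_⟩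
  intro f hf T hT
  rw [← DirectSum.sum_support_decompose 𝒜A f]
  refine sum_mem fun n hn => ?_
  have := hT (e.symm ⟨⟨f, hf⟩, ⟨n, hn⟩⟩)
  simpa [x] using this

lemma hom_gens [hft : Algebra.FiniteType A RA] : ∃ (n : ℕ) (g : Fin n → RA) (a : Fin n → ℕ), (∀ i, g i ∈ 𝒜A (a i)) ∧
    Algebra.adjoin A (Set.range g) = ⊤ := by
  obtain ⟨F, hF⟩ := hft.out
  obtain ⟨n, g, a, h1, -, h3⟩ := hom_fam (𝒜A := 𝒜A) F
  refine ⟨n, g, a, h1, ?_⟩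
  rw [eq_top_iff, ← hF]
  refine Algebra.adjoin_le fun f hf => h3 f hf (Algebra.adjoin A (Set.range g)).toSubmodule.toAddSubmonoid fun i => ?_
  exact Algebra.subset_adjoin ⟨i, rfl⟩

lemma hom_ideal [IsNoetherianRing RA] {IA : Ideal RA} (hI : IA.IsHomogeneous 𝒜A) : ∃ (n : ℕ) (g : Fin n → RA) (a : Fin n → ℕ), (∀ i, g i ∈ 𝒜A (a i)) ∧
    IA = Ideal.span (Set.range g) := by
  obtain ⟨F, hF⟩ := (IsNoetherian.noetherian IA : IA.FG)
  obtain ⟨n, g, a, h1, h2, h3⟩ := hom_fam (𝒜A := 𝒜A) F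
  refine ⟨n, g, a, h1, le_antisymm ?_ ?_⟩
  · rw [← hF]
    refine Submodule.span_le.2 fun f hf => h3 f hf (Ideal.span (Set.range g)).toAddSubmonoid fun i => ?_
    exact Ideal.subset_span ⟨i, rfl⟩
  · refine Ideal.span_le.2 ?_
    rintro _ ⟨i, rfl⟩
    obtain ⟨f, hf, m, hm⟩ := h2 i
    rw [hm]
    exact hI m (hF ▸ Submodule.subset_span hf)
end

section
variable {k R A RA : Type*} [Field k] [CommRing R] [IsDomain R] [Algebra k R] {𝒜 : ℕ → Submodule k R}
  [CommRing A] [IsDomain A] [Algebra A k] [FaithfulSMul A k] [CommRing RA] [Algebra A RA] [Module.Flat A RA] {𝒜A : ℕ → Submodule A RA}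
  (e : (k ⊗[A] RA) ≃ₐ[k] R)
  (h𝒜e : ∀ n, 𝒜 n = Submodule.span k
        (⇑((e : k ⊗[A] RA →+* R).comp
            (Algebra.TensorProduct.includeRight : RA →ₐ[A] k ⊗[A] RA).toRingHom) ''
          (𝒜A n : Set RA)))

include e in
omit [IsDomain A] in
lemma RA_dom : IsDomain RA := by
  have hinj := Algebra.TensorProduct.includeRight_injective (R := A) (A := k) (B := RA) (FaithfulSMul.algebraMap_injective A k)
  have h2 : Function.Injective ((e : k ⊗[A] RA →+* R).comp
            (Algebra.TensorProduct.includeRight : RA →ₐ[A] k ⊗[A] RA).toRingHom) := e.injective.comp hinj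
  exact h2.isDomain _

include h𝒜e in
lemma e_mem {n : ℕ} {x : RA} (hx : x ∈ 𝒜A n) : e ((1:k) ⊗ₜ[A] x) ∈ 𝒜 n := by
  rw [h𝒜e n]
  exact Submodule.subset_span ⟨x, hx, rfl⟩

include h𝒜e in
lemma scal_k (h0 : 𝒜 0 = Submodule.span k {1}) {b : RA} (hb : b ∈ 𝒜A 0) : ∃ c : k, (1:k) ⊗ₜ[A] b = c ⊗ₜ[A] (1:RA) := by
  have h1 := e_mem e h𝒜e hb
  rw [h0, Submodule.mem_span_singleton] at h1
  obtain ⟨c, hc⟩ := h1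
  refine ⟨c, e.injective ?_⟩
  rw [← hc]
  have : c ⊗ₜ[A] (1:RA) = c • (1 : k ⊗[A] RA) := by
    rw [Algebra.TensorProduct.one_def, TensorProduct.smul_tmul', smul_eq_mul, mul_one]
  rw [this, map_smul, map_one]

variable [GradedAlgebra 𝒜]
include h𝒜e in
lemma exists_x0 (h0 : 𝒜 0 = Submodule.span k {1}) (hstd : ∀ n, 𝒜 (n + 1) = 𝒜 1 * 𝒜 n) (hdim : ringKrullDim R = 2) :
    ∃ x ∈ 𝒜A 1, x ≠ 0 := by
  by_contra hcon
  push Not at hcon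
  have h1 : 𝒜 1 = ⊥ := by
    rw [h𝒜e 1, Submodule.span_eq_bot]
    rintro _ ⟨x, hx, rfl⟩
    rw [hcon x hx, map_zero]
  have h2 : Function.Surjective (algebraMap k R) := by
    intro r
    classical
    have : ∀ n, ∀ x ∈ 𝒜 n, x ∈ LinearMap.range (Algebra.linearMap k R) := by
      intro n x hx
      rcases n with _ | n
      · rw [h0, Submodule.mem_span_singleton] at hx
        obtain ⟨c, rfl⟩ := hx
        exact ⟨c, by simp [Algebra.smul_def]⟩
      · rw [hstd, h1, Submodule.bot_mul, Submodule.mem_bot] at hx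
        rw [hx]; exact zero_mem _
    have h3 : r ∈ LinearMap.range (Algebra.linearMap k R) := by
      rw [← DirectSum.sum_support_decompose 𝒜 r]
      exact sum_mem fun n _ => this n _ (SetLike.coe_mem _)
    obtain ⟨c, hc⟩ := h3
    exact ⟨c, hc⟩
  have h3 := ringKrullDim_le_of_surjective _ h2
  rw [hdim, ringKrullDim_eq_zero_of_field] at h3
  norm_num at h3

include h𝒜e in
lemma exists_good (h0 : 𝒜 0 = Submodule.span k {1}) (hstd : ∀ n, 𝒜 (n + 1) = 𝒜 1 * 𝒜 n) {n : ℕ} {x : RA} (hx : x ∈ 𝒜A n) :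
    ∃ a : A, a ≠ 0 ∧ a • x ∈ Algebra.adjoin A (𝒜A 1 : Set RA) := by
  refine clear_den (k := k) _ ?_
  set B := Algebra.adjoin A (𝒜A 1 : Set RA) with hB
  set W := Submodule.span k ((fun u => (1:k) ⊗ₜ[A] u) '' (B : Set RA)) with hW
  have h1 : ∀ n, 𝒜 n ≤ W.map (e : k ⊗[A] RA →ₗ[k] R) := by
    intro n
    induction n with
    | zero =>
      rw [h0, Submodule.span_singleton_le_iff_mem]
      exact ⟨1, Submodule.subset_span ⟨1, B.one_mem, rfl⟩, by simp⟩
    | succ n ih =>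
      rw [hstd]
      have hWW : W.map (e : k ⊗[A] RA →ₗ[k] R) * W.map (e : k ⊗[A] RA →ₗ[k] R) ≤ W.map (e : k ⊗[A] RA →ₗ[k] R) := by
        rw [hW, Submodule.map_span, Submodule.span_mul_span]
        refine Submodule.span_mono ?_
        rintro _ ⟨_, ⟨_, ⟨u, hu, rfl⟩, rfl⟩, _, ⟨_, ⟨v, hv, rfl⟩, rfl⟩, rfl⟩
        refine ⟨_, ⟨u * v, B.mul_mem hu hv, rfl⟩, ?_⟩
        have : (1:k) ⊗ₜ[A] (u * v) = (1:k) ⊗ₜ[A] u * (1:k) ⊗ₜ[A] v := by simp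
        simp only [this]
        exact map_mul e _ _
      refine le_trans (mul_le_mul' ?_ ih) hWW
      rw [h𝒜e 1, Submodule.span_le]
      rintro _ ⟨x, hx, rfl⟩
      exact ⟨_, Submodule.subset_span ⟨x, Algebra.subset_adjoin hx, rfl⟩, rfl⟩
  obtain ⟨y, hy, hye⟩ := h1 n (e_mem e h𝒜e hx)
  have : y = (1:k) ⊗ₜ[A] x := e.injective hye
  rwa [← this]
end
end FilePH3

section FilePH4
set_option linter.all false
open TensorProduct

lemma jac_avoid {A : Type*} [CommRing A] [IsDomain A] [IsJacobsonRing A] {b : A} (hb : b ≠ 0) : ∃ s : MaximalSpectrum A, b ∉ s.asIdeal := by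
  by_contra hcon
  push Not at hcon
  have h1 : b ∈ (⊥ : Ideal A).jacobson := by
    rw [Ideal.jacobson, Ideal.mem_sInf]
    intro I hI
    exact hcon ⟨I, hI.2⟩
  rw [(isJacobsonRing_iff_prime_eq.1 inferInstance ⊥ Ideal.isPrime_bot)] at h1
  exact hb h1

lemma exists_large {A : Type*} [CommRing A] [IsDomain A] [CharZero A] [IsJacobsonRing A] (Ω : MaximalSpectrum A → Type*) [∀ s, Field (Ω s)] [∀ s, Algebra A (Ω s)]
    (hker : ∀ s, RingHom.ker (algebraMap A (Ω s)) = s.asIdeal)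
    (hps : ∀ s, (ringChar (Ω s)).Prime) {a : A} (ha : a ≠ 0) (N : ℕ) : ∃ s, N < ringChar (Ω s) ∧ algebraMap A (Ω s) a ≠ 0 := by
  obtain ⟨s, hs⟩ := jac_avoid (mul_ne_zero ha (by exact_mod_cast N.factorial_ne_zero : ((N.factorial : ℕ) : A) ≠ 0))
  rw [← hker, RingHom.mem_ker, map_mul, map_natCast] at hs
  refine ⟨s, ?_, fun h => hs (by rw [h, zero_mul])⟩
  by_contra hle
  apply hs
  rw [(CharP.cast_eq_zero_iff (Ω s) (ringChar (Ω s)) _).2 ((hps s).dvd_factorial.2 (not_lt.1 hle)), mul_zero]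

lemma jac_int : IsJacobsonRing ℤ := by
  rw [isJacobsonRing_iff_prime_eq]
  intro P hP
  by_cases h : P = ⊥
  · subst h
    rw [eq_bot_iff]
    intro n hn
    by_contra hn0
    obtain ⟨p, hp1, hp2⟩ := Nat.exists_infinite_primes (n.natAbs + 1)
    rw [Ideal.jacobson, Ideal.mem_sInf] at hn
    have hpr : Prime (p : ℤ) := Nat.prime_iff_prime_int.1 hp2
    haveI h2 : (Ideal.span {(p : ℤ)}).IsPrime := (Ideal.span_singleton_prime hpr.ne_zero).2 hpr
    have h3 : (Ideal.span {(p : ℤ)}).IsMaximal := h2.isMaximal (by simp [hp2.ne_zero])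
    have := hn ⟨bot_le, h3⟩
    rw [Ideal.mem_span_singleton, Int.natCast_dvd] at this
    have := Nat.le_of_dvd (Int.natAbs_pos.2 hn0) this
    omega
  · haveI := hP.isMaximal h
    exact Ideal.jacobson_eq_self_of_isMaximal

lemma jac_sub {k : Type*} [Field k] (A : Subalgebra ℤ k) (hA : A.FG) : IsJacobsonRing A ∧ IsNoetherianRing A := by
  haveI : Algebra.FiniteType ℤ A := A.fg_iff_finiteType.1 hA
  haveI := jac_int
  exact ⟨isJacobsonRing_of_finiteType (A := ℤ), Algebra.FiniteType.isNoetherianRing ℤ A⟩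
end FilePH4

section FilePI1
set_option linter.all false

section
variable {Sg η : Type*} [Fintype η] (p : Sg → ℕ) (f : Sg → ℝ → ℝ) (F : ℝ → ℝ) (d : η → ℕ) (N : ℕ) (good : Sg → Prop)

theorem final_analysis (hN : 0 < N)
    (hF : ∀ x : ℝ, 0 ≤ x → ∀ ε : ℝ, 0 < ε → ∃ N : ℕ, ∀ s : Sg, N < p s → |f s x - F x| < ε)
    (hnn : ∀ s x, 0 ≤ x → 0 ≤ f s x)
    (hA : ∀ s, ∀ u x : ℝ, 0 ≤ u → u < x → (∀ i, u ≠ d i) → f s x ≠ 0 → min u (min (x - u) 1) ≤ N * f s u)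
    (hB : ∀ s, ∀ u x : ℝ, 0 ≤ u → u < x → (∀ i, (d i : ℝ) < u) → f s x ≠ 0 → x - u ≤ N * f s u)
    (hC : ∀ s, (∀ x, 0 ≤ x → f s x = 0) ∨ 1 / 2 ≤ N * f s (1 / 2))
    (hlarge : ∀ n : ℕ, ∃ s, n < p s ∧ good s)
    (hR : ∀ s, good s → (∀ x, 0 ≤ x → f s x = 0) ∨ ∀ e0 : ℕ, f s (1 / 2) * 2 ≤ e0 → e0 < p s → ∀ α : ℝ, 0 ≤ α → (∀ x, α < x → f s x = 0) →
      (∀ δ > 0, ∃ x, 0 ≤ x ∧ α - δ < x ∧ x ≤ α ∧ f s x ≠ 0) → ∀ M : ℕ, Fintype.card η * e0 ≤ M →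
      (∃ (z : ℤ) (r : ℕ), 1 ≤ r ∧ r ≤ M ∧ |r * α - z| ≤ (M ^ 2 * (6 * e0 ^ 2) + 1 : ℕ) / (p s : ℝ)) ∨ ∃ i, α = d i) :
    ∃ αinf : ℚ, (αinf : ℝ) = sSup {x : ℝ | 0 ≤ x ∧ F x ≠ 0} ∧
      (∀ ε : ℝ, 0 < ε → ∃ N : ℕ, ∀ s, N < p s → |sSup {x : ℝ | 0 ≤ x ∧ f s x ≠ 0} - (αinf : ℝ)| < ε) := by
  have hNr : (0:ℝ) < N := by exact_mod_cast hN
  by_cases hT : ∀ n, ∃ s, n < p s ∧ ∀ x, 0 ≤ x → f s x = 0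
  · have hF0 : ∀ x, 0 ≤ x → F x = 0 := by
      intro x hx
      by_contra hne
      obtain ⟨n, hn⟩ := hF x hx |F x| (abs_pos.2 hne)
      obtain ⟨s, hs, hs0⟩ := hT n
      have := hn s hs
      rw [hs0 x hx, zero_sub, abs_neg] at this
      exact lt_irrefl _ this
    refine ⟨0, ?_, fun ε hε => ?_⟩
    · have : {x : ℝ | 0 ≤ x ∧ F x ≠ 0} = ∅ := by
        ext x; simp only [Set.mem_setOf_eq, Set.mem_empty_iff_false, iff_false]
        exact fun h => h.2 (hF0 x h.1)
      rw [this, Real.sSup_empty]; simp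
    · obtain ⟨n, hn⟩ := hF (1/2) (by norm_num) (1 / (4 * N)) (by positivity)
      refine ⟨n, fun s hs => ?_⟩
      have h1 := hn s hs
      rw [hF0 _ (by norm_num), sub_zero, abs_lt, lt_div_iff₀ (by positivity)] at h1
      rcases hC s with h | h
      · have : {x : ℝ | 0 ≤ x ∧ f s x ≠ 0} = ∅ := by
          ext x; simp only [Set.mem_setOf_eq, Set.mem_empty_iff_false, iff_false]
          exact fun h' => h'.2 (h x h'.1)
        rw [this, Real.sSup_empty]; simpa using hε
      · exfalso; nlinarith [h1.2]
  push Not at hT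
  obtain ⟨n0, hn0⟩ := hT
  have hhalf : ∀ s, n0 < p s → 1 / 2 ≤ N * f s (1 / 2) := by
    intro s hs
    rcases hC s with h | h
    · obtain ⟨x, hx, hx'⟩ := hn0 s hs
      exact absurd (h x hx) hx'
    · exact h
  have hFhalf : F (1/2) ≠ 0 := by
    intro h0
    obtain ⟨n, hn⟩ := hF (1/2) (by norm_num) (1 / (4 * N)) (by positivity)
    obtain ⟨s, hs, -⟩ := hlarge (max n n0)
    have h1 := hn s (lt_of_le_of_lt (le_max_left _ _) hs)
    have h2 := hhalf s (lt_of_le_of_lt (le_max_right _ _) hs)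
    rw [h0, sub_zero, abs_lt, lt_div_iff₀ (by positivity)] at h1
    nlinarith [h1.2]
  have hne : ∀ x, 0 ≤ x → F x ≠ 0 → ∃ n : ℕ, ∀ s, n < p s → f s x ≠ 0 := by
    intro x hx hFx
    obtain ⟨n, hn⟩ := hF x hx |F x| (abs_pos.2 hFx)
    refine ⟨n, fun s hs h0 => ?_⟩
    have := hn s hs
    rw [h0, zero_sub, abs_neg] at this
    exact lt_irrefl _ this
  -- boundedness
  set u0 : ℝ := ∑ i, (d i : ℝ) + 1 with hu0
  have hu0d : ∀ i, (d i : ℝ) < u0 := by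
    intro i
    have : (d i : ℝ) ≤ ∑ i, (d i : ℝ) := Finset.single_le_sum (f := fun i => (d i : ℝ)) (fun j _ => Nat.cast_nonneg _) (Finset.mem_univ i)
    linarith
  have hu00 : 0 ≤ u0 := by positivity
  obtain ⟨n1, hn1⟩ := hF u0 hu00 1 one_pos
  set Bd : ℝ := u0 + N * (|F u0| + 1) with hBd
  have hbs : ∀ s, n1 < p s → ∀ x, f s x ≠ 0 → x ≤ Bd := by
    intro s hs x hx
    by_contra hlt
    push Not at hlt
    have hpos : 0 ≤ N * (|F u0| + 1) := by positivity
    have h1 := hB s u0 x hu00 (by linarith) hu0d hx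
    have h2 := (abs_lt.1 (hn1 s hs)).2
    have h3 := le_abs_self (F u0)
    nlinarith
  have hZs : ∀ s, n1 < p s → BddAbove {x : ℝ | 0 ≤ x ∧ f s x ≠ 0} := fun s hs => ⟨Bd, fun x hx => hbs s hs x hx.2⟩
  have hZF : BddAbove {x : ℝ | 0 ≤ x ∧ F x ≠ 0} := by
    refine ⟨Bd, fun x hx => ?_⟩
    obtain ⟨n, hn⟩ := hne x hx.1 hx.2
    obtain ⟨s, hs, -⟩ := hlarge (max n n1)
    exact hbs s (lt_of_le_of_lt (le_max_right _ _) hs) x (hn s (lt_of_le_of_lt (le_max_left _ _) hs))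
  set α := sSup {x : ℝ | 0 ≤ x ∧ F x ≠ 0} with hα
  have hFne : {x : ℝ | 0 ≤ x ∧ F x ≠ 0}.Nonempty := ⟨1/2, by norm_num, hFhalf⟩
  have hαge : 1/2 ≤ α := le_csSup hZF ⟨by norm_num, hFhalf⟩
  have hlim : ∀ ε : ℝ, 0 < ε → ∃ n : ℕ, ∀ s, n < p s → |sSup {x : ℝ | 0 ≤ x ∧ f s x ≠ 0} - α| < ε := by
    intro ε hε
    obtain ⟨u, ⟨hu1, hu2⟩, hud⟩ := ((Set.Ioo_infinite (show α < α + ε / 4 by linarith)).diff (Set.finite_range (fun i => (d i : ℝ)))).nonempty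
    have hFu : F u = 0 := by
      by_contra h
      have := le_csSup hZF (show u ∈ {x : ℝ | 0 ≤ x ∧ F x ≠ 0} from ⟨by linarith, h⟩)
      linarith
    have hupos : 0 < u := by linarith
    set δ := min u (min (ε / 4) 1) with hδ
    have hδ0 : 0 < δ := lt_min hupos (lt_min (by linarith) one_pos)
    obtain ⟨n2, hn2⟩ := hF u hupos.le (δ / N) (by positivity)
    obtain ⟨x, hx, hxα⟩ := exists_lt_of_lt_csSup hFne (show α - ε < α by linarith)
    obtain ⟨n3, hn3⟩ := hne x hx.1 hx.2
    refine ⟨n1 + n2 + n3, fun s hs => ?_⟩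
    have hf1 : x ≤ sSup {x : ℝ | 0 ≤ x ∧ f s x ≠ 0} := le_csSup (hZs s (by omega)) ⟨hx.1, hn3 s (by omega)⟩
    have hf2 : sSup {x : ℝ | 0 ≤ x ∧ f s x ≠ 0} ≤ α + ε / 2 := by
      refine csSup_le ⟨x, hx.1, hn3 s (by omega)⟩ fun y hy => ?_
      by_contra hlt
      push Not at hlt
      have h1 := hA s u y hupos.le (by linarith) (fun i h => hud ⟨i, h.symm⟩) hy.2
      have h2 := (abs_lt.1 (hn2 s (by omega))).2
      rw [hFu, sub_zero, lt_div_iff₀ hNr] at h2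
      have h3 : δ ≤ min u (min (y - u) 1) := by
        rw [hδ]
        exact min_le_min le_rfl (min_le_min (by linarith) le_rfl)
      nlinarith
    rw [abs_lt]
    constructor <;> linarith
  -- rationality
  set e0 : ℕ := ⌈2 * (F (1/2) + 1)⌉₊ with he0
  set M : ℕ := Fintype.card η * e0 with hM
  set D : ℕ := M.factorial with hD
  have hD0 : (0:ℝ) < D := by exact_mod_cast M.factorial_pos
  have hround : ∀ ε : ℝ, 0 < ε → |D * α - round ((D:ℝ) * α)| ≤ D * ε := by
    intro ε hε
    obtain ⟨n2, hn2⟩ := hlim (ε / 2) (by linarith)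
    obtain ⟨n3, hn3⟩ := hF (1/2) (by norm_num) 1 one_pos
    obtain ⟨n4, hn4⟩ := exists_nat_gt (((M ^ 2 * (6 * e0 ^ 2) + 1 : ℕ) : ℝ) / (ε / 2))
    obtain ⟨s, hs, hgs⟩ := hlarge (n0 + n1 + n2 + n3 + n4 + e0)
    set αs := sSup {x : ℝ | 0 ≤ x ∧ f s x ≠ 0} with hαs
    have hh := hhalf s (by omega)
    have hnes : f s (1/2) ≠ 0 := by
      intro h0; rw [h0] at hh; norm_num at hh
    have hbd := hZs s (by omega)
    have hαs0 : 0 ≤ αs := le_trans (by norm_num) (le_csSup hbd (show (1/2:ℝ) ∈ _ from ⟨by norm_num, hnes⟩))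
    have hdist := hn2 s (by omega)
    have hs0 : f s (1 / 2) * 2 ≤ e0 := by
      have h1 := (abs_lt.1 (hn3 s (by omega))).2
      have h2 := Nat.le_ceil (2 * (F (1/2) + 1))
      linarith
    have hs1 : ∀ x, αs < x → f s x = 0 := by
      intro x hx
      by_contra hne'
      have := le_csSup hbd (show x ∈ _ from ⟨by linarith, hne'⟩)
      linarith
    have hs2 : ∀ δ > 0, ∃ x, 0 ≤ x ∧ αs - δ < x ∧ x ≤ αs ∧ f s x ≠ 0 := by
      intro δ hδ
      obtain ⟨x, hx, hx2⟩ := exists_lt_of_lt_csSup (show {x : ℝ | 0 ≤ x ∧ f s x ≠ 0}.Nonempty from ⟨1/2, by norm_num, hnes⟩) (show αs - δ < αs by linarith)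
      exact ⟨x, hx.1, hx2, le_csSup hbd hx, hx.2⟩
    have hz : ∃ z : ℤ, |D * αs - z| ≤ D * (ε / 2) := by
      rcases hR s hgs with h | h
      · exact absurd (h _ (by norm_num)) hnes
      rcases h e0 hs0 (by omega) αs hαs0 hs1 hs2 M le_rfl with ⟨z, r, hr1, hrM, hzr⟩ | ⟨i, hi⟩
      · obtain ⟨t, ht⟩ := Nat.dvd_factorial hr1 hrM
        refine ⟨t * z, ?_⟩
        have hp : (0:ℝ) < p s := by exact_mod_cast (by omega : 0 < p s)
        have h1 : ((M ^ 2 * (6 * e0 ^ 2) + 1 : ℕ) : ℝ) / p s ≤ ε / 2 := by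
          rw [div_lt_iff₀ (by linarith)] at hn4
          rw [div_le_iff₀ hp]
          have : (n4 : ℝ) ≤ p s := by exact_mod_cast (by omega : n4 ≤ p s)
          nlinarith
        have hDt : (D : ℝ) = r * t := by rw [hD, ht]; push_cast; ring
        have htD : (t : ℝ) ≤ D := by
          rw [hDt]
          have : (1:ℝ) ≤ r := by exact_mod_cast hr1
          have : (0:ℝ) ≤ t := Nat.cast_nonneg _
          nlinarith
        have h2 : (D:ℝ) * αs - ((t * z : ℤ) : ℝ) = t * (r * αs - z) := by rw [hDt]; push_cast; ring
        rw [h2, abs_mul, Nat.abs_cast]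
        exact mul_le_mul htD (hzr.trans h1) (abs_nonneg _) hD0.le
      · refine ⟨D * d i, ?_⟩
        rw [hi]
        push_cast
        rw [sub_self, abs_zero]
        positivity
    obtain ⟨z, hz⟩ := hz
    refine (round_le _ z).trans ?_
    have h3 : (D:ℝ) * α - z = (D * αs - z) - D * (αs - α) := by ring
    rw [h3]
    refine (abs_sub _ _).trans ?_
    rw [abs_mul, Nat.abs_cast]
    nlinarith
  have hzero : D * α - round ((D:ℝ) * α) = 0 := by
    by_contra h
    have h1 := abs_pos.2 h
    have h2 := hround (|D * α - round ((D:ℝ) * α)| / (2 * D)) (by positivity)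
    have h3 : (D:ℝ) * (|D * α - round ((D:ℝ) * α)| / (2 * D)) = |D * α - round ((D:ℝ) * α)| / 2 := by field_simp
    linarith
  have hq : ((round ((D:ℝ) * α) / D : ℚ) : ℝ) = α := by
    push_cast
    rw [div_eq_iff hD0.ne']
    linarith
  exact ⟨_, hq, by rw [hq]; exact hlim⟩
end
end FilePI1

section FilePI2
set_option linter.all false
open Filter Topology TensorProduct

section
variable {K S η : Type*} [Field K] [CommRing S] [Algebra K S] {𝒮 : ℕ → Submodule K S} 

lemma gpd_top (m : ℕ) : gradedPieceDim 𝒮 (⊤ : Ideal S) m = 0 := by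
  unfold gradedPieceDim
  have h : Submodule.comap (𝒮 m).subtype ((⊤ : Ideal S).restrictScalars K) = ⊤ := by
    ext; simp
  rw [h]
  haveI : Subsingleton ((𝒮 m) ⧸ (⊤ : Submodule K (𝒮 m))) := Submodule.Quotient.subsingleton_iff.2 rfl
  exact Module.finrank_zero_of_subsingleton

lemma dens_top {H : η → S} {p : ℕ} {f : ℝ → ℝ} (hf : Dens 𝒮 H p f) {i : η} (hu : IsUnit (H i)) {x : ℝ} (hx : 0 ≤ x) : f x = 0 := by
  have h1 := hf x hx
  have h2 : ∀ n : ℕ, FP H (p ^ n) = ⊤ := by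
    intro n
    refine Ideal.eq_top_of_isUnit_mem _ (Ideal.subset_span ⟨i, rfl⟩) (hu.pow _)
  simp only [h2, gpd_top, Nat.cast_zero, zero_div] at h1
  exact tendsto_nhds_unique h1 tendsto_const_nhds
end

section
variable {A RA Ω η : Type*} [CommRing A] [CommRing RA] [Algebra A RA]
    [Field Ω] [Algebra A Ω] {𝒜A : ℕ → Submodule A RA}

lemma redIdeal_span (x : η → RA) : redIdeal A RA Ω (Ideal.span (Set.range x)) = Ideal.span (Set.range fun i => (1:Ω) ⊗ₜ[A] x i) := by
  unfold redIdeal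
  rw [Ideal.map_span, ← Set.range_comp]
  rfl

lemma dens_red (x : η → RA) [IsDomain (Ω ⊗[A] RA)] [Fintype η] (p : ℕ) [Fact p.Prime] [CharP (Ω ⊗[A] RA) p] {f : ℝ → ℝ}
    (hf : ∀ y : ℝ, 0 ≤ y →
      Tendsto (fun n : ℕ =>
          (gradedPieceDim (redGrading A RA Ω 𝒜A)
              ((redIdeal A RA Ω (Ideal.span (Set.range x))).frobPow (p ^ n))
              ⌊y * (p : ℝ) ^ n⌋₊ : ℝ) / (p : ℝ) ^ n)
        atTop (𝓝 (f y))) : Dens (redGrading A RA Ω 𝒜A) (fun i => (1:Ω) ⊗ₜ[A] x i) p f := by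
  intro y hy
  have := hf y hy
  simp only [redIdeal_span, frobPow_eq] at this
  exact this
end

section
variable {A RA Ω η : Type*} [CommRing A] [CommRing RA] [Algebra A RA]
    [Field Ω] [IsAlgClosed Ω] [Algebra A Ω] {𝒜A : ℕ → Submodule A RA} [GradedAlgebra 𝒜A] [IsDomain (Ω ⊗[A] RA)]
    {ι : Type*} [Fintype ι] {g : ι → RA} {a : ι → ℕ} {N : ℕ} [Fintype η] {h : η → RA} {d : η → ℕ}

theorem per_s (p : ℕ) (hp : p.Prime) (hcp : CharP Ω p)
    (hb : ∀ b ∈ 𝒜A 0, ∃ c : Ω, (1:Ω) ⊗ₜ[A] b = algebraMap Ω (Ω ⊗[A] RA) c)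
    (hw : ∃ x ∈ 𝒜A 1, (1:Ω) ⊗ₜ[A] x ≠ 0)
    (hg : ∀ i, g i ∈ 𝒜A (a i)) (gen : Algebra.adjoin A (Set.range g) = ⊤) (hN : 0 < N)
    (hd : ∀ i, 0 < a i → a i ∣ N) (hdim : ringKrullDim (Ω ⊗[A] RA) = 2)
    (hh : ∀ i, h i ∈ 𝒜A (d i)) (hcolen : FiniteDimensional Ω ((Ω ⊗[A] RA) ⧸ redIdeal A RA Ω (Ideal.span (Set.range h)))) {f : ℝ → ℝ}
    (hf : ∀ y : ℝ, 0 ≤ y →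
      Tendsto (fun n : ℕ =>
          (gradedPieceDim (redGrading A RA Ω 𝒜A)
              ((redIdeal A RA Ω (Ideal.span (Set.range h))).frobPow (p ^ n))
              ⌊y * (p : ℝ) ^ n⌋₊ : ℝ) / (p : ℝ) ^ n)
        atTop (𝓝 (f y))) :
    (∀ x, 0 ≤ x → 0 ≤ f x) ∧
    (∀ u x : ℝ, 0 ≤ u → u < x → (∀ i, u ≠ d i) → f x ≠ 0 → min u (min (x - u) 1) ≤ N * f u) ∧
    (∀ u x : ℝ, 0 ≤ u → u < x → (∀ i, (d i : ℝ) < u) → f x ≠ 0 → x - u ≤ N * f u) ∧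
    ((∀ x, 0 ≤ x → f x = 0) ∨ 1 / 2 ≤ N * f (1 / 2)) ∧
    ((∀ i, ∃ c : A, algebraMap A Ω c ≠ 0 ∧ c • g i ∈ Algebra.adjoin A (𝒜A 1 : Set RA)) →
      (∀ x, 0 ≤ x → f x = 0) ∨ ∀ e0 : ℕ, f (1 / 2) * 2 ≤ e0 → e0 < p → ∀ α : ℝ, 0 ≤ α → (∀ x, α < x → f x = 0) →
      (∀ δ > 0, ∃ x, 0 ≤ x ∧ α - δ < x ∧ x ≤ α ∧ f x ≠ 0) → ∀ M : ℕ, Fintype.card η * e0 ≤ M →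
      (∃ (z : ℤ) (r : ℕ), 1 ≤ r ∧ r ≤ M ∧ |r * α - z| ≤ (M ^ 2 * (6 * e0 ^ 2) + 1 : ℕ) / (p : ℝ)) ∨ ∃ i, α = d i) := by
  haveI : Fact p.Prime := ⟨hp⟩
  haveI : CharP (Ω ⊗[A] RA) p := charP_of_injective_algebraMap (algebraMap Ω (Ω ⊗[A] RA)).injective p
  letI := redGraded A RA Ω 𝒜A
  have hD := dens_red h p hf
  have hGS := GS_of hb hg gen hN hd hdim
  have hH : ∀ i, (1:Ω) ⊗ₜ[A] h i ∈ redGrading A RA Ω 𝒜A (d i) := fun i => mem_red (hh i)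
  obtain ⟨x, hx, hx0⟩ := hw
  have hw := mem_red (Ω := Ω) hx
  rw [redIdeal_span] at hcolen
  obtain ⟨h1, h2, h3⟩ := pack1 hGS hw hx0 hH hcolen hD
  have hcase : (∀ x, 0 ≤ x → f x = 0) ∨ ∀ i, (1:Ω) ⊗ₜ[A] h i ≠ 0 → 0 < d i := by
    by_cases hall : ∀ i, (1:Ω) ⊗ₜ[A] h i ≠ 0 → 0 < d i
    · exact Or.inr hall
    · left
      push Not at hall
      obtain ⟨i, hi, hdi⟩ := hall
      have hi0 : d i = 0 := by omega
      obtain ⟨c, hc⟩ := hb (h i) (hi0 ▸ hh i)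
      have hc0 : c ≠ 0 := by
        rintro rfl
        rw [map_zero] at hc
        exact hi hc
      intro x hx
      refine dens_top hD (i := i) ?_ hx
      rw [hc]
      exact (IsUnit.mk0 c hc0).map _
  refine ⟨fun x hx => hD.nonneg hx, h1, h2, ?_, fun hgood => ?_⟩
  · rcases hcase with h | h
    · exact Or.inl h
    · refine Or.inr (h3 _ (by norm_num) fun i hi => ?_)
      have : (1:ℝ) ≤ d i := by exact_mod_cast h i hi
      linarith
  · rcases hcase with h | h
    · exact Or.inl h
    · right
      obtain ⟨m, g', hg'⟩ := hGS.one hw hx0 (fun i => by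
        obtain ⟨c, hc, hc'⟩ := hgood i
        exact good_mem hc hc')
      intro e0 he1 he2 α hα0 hα1 hα2 M hM
      exact pack2 hg' hw hx0 hH hcolen hD h he1 he2 hα0 hα1 hα2 hM
end
end FilePI2

/-- **Theorem (Statement 9).** Let `(R, I)` be a standard graded pair over an algebraically
closed field `k` of characteristic `0`, with `R` a two-dimensional domain, with a suitable
spread `(A, R_A, I_A)` and reductions `(R_s, I_s)` mod `p_s`; let `f s` be the Hilbert–Kunz
density function of the reduction `(R_s, I_s)` and let `F = f^∞_{R,I}` be the pointwise
limit of the `f s` as `p_s → ∞`.  Then `lim_{p_s → ∞} α(R_s, I_s)` exists, is a rational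
number, and equals `α^∞(R, I) = sup {x ≥ 0 | F x ≠ 0}`. -/
theorem alpha_limit_exists_rational_eq_alphaInfty
    (k : Type*) [Field k] [CharZero k] [IsAlgClosed k]
    (R : Type*) [CommRing R] [IsDomain R] [Algebra k R]
    (𝒜 : ℕ → Submodule k R) [GradedAlgebra 𝒜]
    (h0 : 𝒜 0 = Submodule.span k {1})
    (hstd : ∀ n, 𝒜 (n + 1) = 𝒜 1 * 𝒜 n)
    (hfg : FiniteDimensional k (𝒜 1))
    (hdim : ringKrullDim R = 2)
    (I : Ideal R) (hIhom : Ideal.IsHomogeneous 𝒜 I)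
    (hcolen : FiniteDimensional k (R ⧸ I))
    -- the spread `(A, R_A, I_A)`:
    (A : Subalgebra ℤ k) (hA : A.FG)
    (RA : Type*) [CommRing RA] [Algebra A RA]
    (hflat : Module.Flat A RA) (hft : Algebra.FiniteType A RA)
    (𝒜A : ℕ → Submodule A RA) [GradedAlgebra 𝒜A]
    (IA : Ideal RA) (hIA : Ideal.IsHomogeneous 𝒜A IA)
    -- base change to `k` recovers `(R, 𝒜, I)`:
    (e : (k ⊗[A] RA) ≃ₐ[k] R)
    (hIe : I = Ideal.map ((e : k ⊗[A] RA →+* R).comp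
        (Algebra.TensorProduct.includeRight : RA →ₐ[A] k ⊗[A] RA).toRingHom) IA)
    (h𝒜e : ∀ n, 𝒜 n = Submodule.span k
        (⇑((e : k ⊗[A] RA →+* R).comp
            (Algebra.TensorProduct.includeRight : RA →ₐ[A] k ⊗[A] RA).toRingHom) ''
          (𝒜A n : Set RA)))
    -- reductions mod `p_s`:
    (hfin : ∀ s : MaximalSpectrum A, Finite (A ⧸ s.asIdeal))
    (Ω : MaximalSpectrum A → Type*) [∀ s, Field (Ω s)] [∀ s, Algebra A (Ω s)]
    [∀ s, IsAlgClosed (Ω s)]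
    (hker : ∀ s, RingHom.ker (algebraMap A (Ω s)) = s.asIdeal)
    (hps : ∀ s, (ringChar (Ω s)).Prime)
    (hdomS : ∀ s, IsDomain (Ω s ⊗[A] RA))
    (hdimS : ∀ s, ringKrullDim (Ω s ⊗[A] RA) = 2)
    (hcolenS : ∀ s, FiniteDimensional (Ω s) ((Ω s ⊗[A] RA) ⧸ redIdeal ↥A RA (Ω s) IA))
    -- `f s` is the Hilbert–Kunz density function of the reduction `(R_s, I_s)` mod `p_s`:
    (f : MaximalSpectrum A → ℝ → ℝ)
    (hf : ∀ s, ∀ x : ℝ, 0 ≤ x →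
      Tendsto (fun n : ℕ =>
          (gradedPieceDim (redGrading ↥A RA (Ω s) 𝒜A)
              ((redIdeal ↥A RA (Ω s) IA).frobPow ((ringChar (Ω s)) ^ n))
              ⌊x * (ringChar (Ω s) : ℝ) ^ n⌋₊ : ℝ) / (ringChar (Ω s) : ℝ) ^ n)
        atTop (𝓝 (f s x)))
    -- `F = f^∞_{R,I}` is the pointwise limit of the `f s` as `p_s → ∞`:
    (F : ℝ → ℝ)
    (hF : ∀ x : ℝ, 0 ≤ x → ∀ ε : ℝ, 0 < ε → ∃ N : ℕ,
      ∀ s : MaximalSpectrum A, N < ringChar (Ω s) → |f s x - F x| < ε) :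
    -- `lim_{p_s→∞} α(R_s, I_s)` exists, is rational and equals `α^∞(R,I)`:
    ∃ αinf : ℚ,
      (αinf : ℝ) = sSup {x : ℝ | 0 ≤ x ∧ F x ≠ 0} ∧
      (∀ ε : ℝ, 0 < ε → ∃ N : ℕ, ∀ s : MaximalSpectrum A, N < ringChar (Ω s) →
        |sSup {x : ℝ | 0 ≤ x ∧ f s x ≠ 0} - (αinf : ℝ)| < ε) := by
  haveI hdom : IsDomain RA := RA_dom e
  obtain ⟨hjac, hnoeA⟩ := jac_sub A hA
  haveI : IsNoetherianRing RA := Algebra.FiniteType.isNoetherianRing A RA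
  obtain ⟨x0, hx0, hx00⟩ := exists_x0 e h𝒜e h0 hstd hdim
  obtain ⟨n, g, a, hg, gen⟩ := hom_gens (A := A) (𝒜A := 𝒜A)
  obtain ⟨m, h, d, hh, rfl⟩ := hom_ideal hIA
  choose c hc0 hc using fun i => exists_good e h𝒜e h0 hstd (hg i)
  set N : ℕ := ∏ i, (if 0 < a i then a i else 1) with hNdef
  have hN : 0 < N := Finset.prod_pos fun i _ => by split_ifs <;> omega
  have hd : ∀ i, 0 < a i → a i ∣ N := by
    intro i hi
    have := Finset.dvd_prod_of_mem (fun i => if 0 < a i then a i else 1) (Finset.mem_univ i)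
    simpa [hi] using this
  have key := fun s => per_s (Ω := Ω s) (𝒜A := 𝒜A) (g := g) (a := a) (N := N) (h := h) (d := d) (f := f s) (ringChar (Ω s)) (hps s) inferInstance
    (fun b hb => by
      obtain ⟨c, hc⟩ := scal_k e h𝒜e h0 hb
      exact scal (FaithfulSMul.algebraMap_injective A k) hc)
    (deg1_ne hx0 hx00) hg gen hN hd (hdimS s) hh (hcolenS s) (hf s)
  refine final_analysis (fun s => ringChar (Ω s)) f F d N (fun s => algebraMap A (Ω s) (∏ i, c i) ≠ 0) hN hF
    (fun s => (key s).1) (fun s => (key s).2.1) (fun s => (key s).2.2.1) (fun s => (key s).2.2.2.1) ?_ ?_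
  · intro n
    exact exists_large Ω hker hps (Finset.prod_ne_zero_iff.2 fun i _ => hc0 i) n
  · intro s hs
    refine (key s).2.2.2.2 fun i => ⟨c i, ?_, hc i⟩
    rw [map_prod, Finset.prod_ne_zero_iff] at hs
    exact hs i (Finset.mem_univ i)
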